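/- Let W be a complex vector space of complex dimension m ≥ 3. A map Z : 𝒦(W) → 𝒦(W*) is a continuous, translation invariant and SL(W,ℂ)-contravariant Minkowski valuation if and only if there exists a convex body N ∈ 𝒦(ℂ) such that Z = Π_N, where Π_N K ∈ 𝒦(W*) has support function h(Π_N K, u) = V(K,…,K, N·u) for all u ∈ W (2m−1 copies of K and one copy of N·u = {cu : c ∈ N}). Moreover, N is unique up to translations. -/

import Mathlib

open scoped Pointwise
open MeasureTheory Module

noncomputable section

section CommonDefs

variable {V V' A : Type*}
variable [NormedAddCommGroup V] [NormedSpace ℝ V]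
variable [NormedAddCommGroup V'] [NormedSpace ℝ V']
variable [NormedAddCommGroup A] [NormedSpace ℝ A]

/-- The supremum of a (pairing) functional over a convex body; used to express the
support function `h(K, ξ) = sup_{x ∈ K} ⟨ξ, x⟩` for the various pairings `p = ⟨ξ, ·⟩`. -/
def hSupp (K : ConvexBody V) (p : V → ℝ) : ℝ := sSup (p '' (K : Set V))

/-- The translate `x + K` of a convex body. -/
def ConvexBody.translate (K : ConvexBody V) (x : V) : ConvexBody V :=
  ⟨(fun y => x + y) '' (K : Set V), K.convex.translate x,
    K.isCompact.image (continuous_const.add continuous_id),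
    K.nonempty.image _⟩

/-- The image of a convex body under a continuous linear map. -/
def ConvexBody.mapCLM (f : V →L[ℝ] V') (K : ConvexBody V) : ConvexBody V' :=
  ⟨f '' (K : Set V), K.convex.linear_image (f : V →ₗ[ℝ] V'),
    K.isCompact.image f.continuous, K.nonempty.image _⟩

/-- The reflection `-K` of a convex body about the origin. -/
def ConvexBody.neg (K : ConvexBody V) : ConvexBody V :=
  K.mapCLM (-(ContinuousLinearMap.id ℝ V))

/-- The union of two convex bodies (a convex body provided it is convex). -/
def ConvexBody.union (K L : ConvexBody V) (h : Convex ℝ ((K : Set V) ∪ (L : Set V))) :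
    ConvexBody V :=
  ⟨(K : Set V) ∪ (L : Set V), h, K.isCompact.union L.isCompact,
    K.nonempty.mono Set.subset_union_left⟩

/-- The intersection of two convex bodies (a convex body provided it is nonempty). -/
def ConvexBody.inter (K L : ConvexBody V) (h : ((K : Set V) ∩ (L : Set V)).Nonempty) :
    ConvexBody V :=
  ⟨(K : Set V) ∩ (L : Set V), K.convex.inter L.convex,
    K.isCompact.inter_right L.isClosed, h⟩

/-- A Minkowski valuation: `Z(K ∪ L) + Z(K ∩ L) = Z(K) + Z(L)` (Minkowski addition)
whenever `K, L, K ∪ L` are convex bodies. -/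
def IsMinkowskiValuation (Z : ConvexBody V → ConvexBody A) : Prop :=
  ∀ (K L : ConvexBody V) (hU : Convex ℝ ((K : Set V) ∪ (L : Set V)))
    (hI : ((K : Set V) ∩ (L : Set V)).Nonempty),
    Z (K.union L hU) + Z (K.inter L hI) = Z K + Z L

/-- A real-valued valuation: `φ(K ∪ L) + φ(K ∩ L) = φ(K) + φ(L)`
whenever `K, L, K ∪ L` are convex bodies. -/
def IsValuation (φ : ConvexBody V → ℝ) : Prop :=
  ∀ (K L : ConvexBody V) (hU : Convex ℝ ((K : Set V) ∪ (L : Set V)))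
    (hI : ((K : Set V) ∩ (L : Set V)).Nonempty),
    φ (K.union L hU) + φ (K.inter L hI) = φ K + φ L

/-- Translation invariance of a map defined on convex bodies. -/
def IsTranslationInvariant {α : Type*} (Z : ConvexBody V → α) : Prop :=
  ∀ (K : ConvexBody V) (x : V), Z (K.translate x) = Z K

/-- The mixed volume (w.r.t. the Lebesgue (Haar) measure `μ`) of an `n`-tuple of convex
bodies, given by the polarization formula
`V(K₁, …, Kₙ) = (1/n!) ∑_{S ⊆ {1,…,n}} (-1)^{n - |S|} vol(∑_{i ∈ S} K_i)`. -/
def mixedVol [MeasurableSpace V] (μ : Measure V) {n : ℕ} (K : Fin n → ConvexBody V) : ℝ :=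
  (n.factorial : ℝ)⁻¹ *
    ∑ S : Finset (Fin n), (-1 : ℝ) ^ (n - S.card) * (μ (∑ i ∈ S, (K i : Set V))).toReal

/-- The extension `V(K, …, K, f)` (with `n - 1` copies of `K`) of the mixed volume to
continuous positively `1`-homogeneous functions `f` on the dual space, defined via
Aleksandrov's variational formula: `V(K,…,K,f)` is `1/n` times the right derivative at
`t = 0` of the volume of the Wulff shape (aka Aleksandrov body) of `h_K + t f`.
For `f = h_L` the Wulff shape is `K + t L`, so this indeed extends `L ↦ V(K, …, K, L)`. -/
def mixedVolFn [MeasurableSpace V] (μ : Measure V) (K : ConvexBody V)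
    (f : (V →L[ℝ] ℝ) → ℝ) : ℝ :=
  (Module.finrank ℝ V : ℝ)⁻¹ *
    derivWithin (fun t : ℝ =>
        (μ {x : V | ∀ ξ : V →L[ℝ] ℝ, ξ x ≤ hSupp K ξ + t * f ξ}).toReal)
      (Set.Ici 0) 0

/-- The dimension of a convex body: the dimension of (the direction of) its affine hull. -/
def bodyDim (K : ConvexBody V) : ℕ := Module.finrank ℝ (vectorSpan ℝ (K : Set V))

/-- A convex body contained in a subspace `E`, viewed as a convex body of `E`. -/
def bodyIn (E : Submodule ℝ V) (K : ConvexBody V) (h : (K : Set V) ⊆ (E : Set V)) :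
    ConvexBody ↥E :=
  ⟨Subtype.val ⁻¹' (K : Set V),
    K.convex.linear_preimage (E.subtype),
    by
      rw [Topology.IsEmbedding.subtypeVal.isCompact_iff,
        Set.image_preimage_eq_of_subset (by rw [Subtype.range_coe]; exact h)]
      exact K.isCompact,
    by obtain ⟨x, hx⟩ := K.nonempty; exact ⟨⟨x, h hx⟩, hx⟩⟩

/-- The properties of the components of McMullen's decomposition of (the support function
of) a Minkowski valuation: each `fᵢ(·, u)` is a continuous, translation invariant
valuation, homogeneous of degree `i`, and each `fᵢ(K, ·)` is continuous and positively
`1`-homogeneous. -/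
def McMullenProps (f : ℕ → ConvexBody V → V → ℝ) : Prop :=
  (∀ (i : ℕ) (u : V), Continuous fun K : ConvexBody V => f i K u) ∧
  (∀ (i : ℕ) (u : V), IsValuation fun K : ConvexBody V => f i K u) ∧
  (∀ (i : ℕ) (u : V), IsTranslationInvariant fun K : ConvexBody V => f i K u) ∧
  (∀ (i : ℕ) (K : ConvexBody V) (u : V) (t : ℝ), 0 < t → f i (t • K) u = t ^ i * f i K u) ∧
  (∀ (i : ℕ) (K : ConvexBody V), Continuous fun u : V => f i K u) ∧
  (∀ (i : ℕ) (K : ConvexBody V) (u : V) (t : ℝ), 0 < t → f i K (t • u) = t * f i K u)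

end CommonDefs

/-- The surface area measure `S(M, ·)` on `S¹ ⊆ ℂ` of a planar convex body `M`,
characterized (uniquely) by the property that it is a finite measure concentrated on the
unit circle with `∫_{S¹} h(L, α) dσ(α) = 2 V(M, L)` for every planar convex body `L`. -/
def IsSurfaceAreaMeasure (M : ConvexBody ℂ) (σ : Measure ℂ) : Prop :=
  IsFiniteMeasure σ ∧ σ (Metric.sphere (0 : ℂ) 1)ᶜ = 0 ∧
    ∀ L : ConvexBody ℂ,
      (∫ α, hSupp L (fun c => (c * (starRingEnd ℂ) α).re) ∂σ) = 2 * mixedVol volume ![M, L]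

section ComplexDefs

variable {W : Type*} [NormedAddCommGroup W] [NormedSpace ℂ W] [FiniteDimensional ℂ W]

/-- The determinant pairing `det(u, v)` on a 2-dimensional complex vector space,
with respect to a fixed basis `b`. -/
def cdet (b : Basis (Fin 2) ℂ W) (u v : W) : ℂ :=
  b.coord 0 u * b.coord 1 v - b.coord 1 u * b.coord 0 v

/-- `det(·, w) : W → ℂ` as a continuous real-linear map. -/
def cdetCLM (b : Basis (Fin 2) ℂ W) (w : W) : W →L[ℝ] ℂ :=
  LinearMap.toContinuousLinearMap
    (((b.coord 1 w) • (b.coord 0 : W →ₗ[ℂ] ℂ)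
      - (b.coord 0 w) • (b.coord 1 : W →ₗ[ℂ] ℂ)).restrictScalars ℝ)

/-- `det(K, w) = {det(k, w) : k ∈ K} ⊆ ℂ`. -/
def detBody (b : Basis (Fin 2) ℂ W) (K : ConvexBody W) (w : W) : ConvexBody ℂ :=
  K.mapCLM (cdetCLM b w)

/-- `N · w = {c • w : c ∈ N} ⊆ W` for a planar convex body `N ⊆ ℂ`. -/
def dotBody (N : ConvexBody ℂ) (w : W) : ConvexBody W :=
  N.mapCLM (LinearMap.toContinuousLinearMap ((LinearMap.toSpanSingleton ℂ W w).restrictScalars ℝ))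

/-- A complex-linear endomorphism, as a continuous real-linear map. -/
def cReal (g : W →ₗ[ℂ] W) : W →L[ℝ] W :=
  LinearMap.toContinuousLinearMap (g.restrictScalars ℝ)

/-- Precomposition `ξ ↦ ξ ∘ g` on the complex dual `W* = W →L[ℂ] ℂ`,
as a continuous real-linear map. The adjoint of `g` is `precompDual g`, and
`g^{-*} = precompDual g⁻¹`. -/
def precompDual (g : W →L[ℂ] W) : (W →L[ℂ] ℂ) →L[ℝ] (W →L[ℂ] ℂ) :=
  LinearMap.toContinuousLinearMap
    { toFun := fun ξ => ξ.comp g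
      map_add' := fun ξ η => ContinuousLinearMap.add_comp ξ η g
      map_smul' := fun r ξ => ContinuousLinearMap.smul_comp r ξ g }

/-- `Z : 𝒦(W) → 𝒦(W*)` is `SL(W,ℂ)`-contravariant: `Z(gK) = g^{-*} Z(K)` for every
`g ∈ SL(W,ℂ)`. -/
def IsSLContravariant (Z : ConvexBody W → ConvexBody (W →L[ℂ] ℂ)) : Prop :=
  ∀ g : W ≃L[ℂ] W, LinearMap.det ((g : W →L[ℂ] W) : W →ₗ[ℂ] W) = 1 →
    ∀ K : ConvexBody W,
      Z (K.mapCLM (cReal (g : W →ₗ[ℂ] W))) =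
        (Z K).mapCLM (precompDual (g.symm : W →L[ℂ] W))

/-- `Z : 𝒦(W) → 𝒦(W)` is `SL(W,ℂ)`-covariant: `Z(gK) = g Z(K)` for every
`g ∈ SL(W,ℂ)`. -/
def IsSLCovariant (Z : ConvexBody W → ConvexBody W) : Prop :=
  ∀ g : W ≃L[ℂ] W, LinearMap.det ((g : W →L[ℂ] W) : W →ₗ[ℂ] W) = 1 →
    ∀ K : ConvexBody W,
      Z (K.mapCLM (cReal (g : W →ₗ[ℂ] W))) = (Z K).mapCLM (cReal (g : W →ₗ[ℂ] W))

end ComplexDefs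

section

section Basics

variable {V V' V'' : Type*}
variable [NormedAddCommGroup V] [NormedSpace ℝ V]
variable [NormedAddCommGroup V'] [NormedSpace ℝ V']
variable [NormedAddCommGroup V''] [NormedSpace ℝ V'']

namespace ConvexBody

@[simp] theorem coe_translate (K : ConvexBody V) (x : V) :
    (K.translate x : Set V) = (fun y => x + y) '' (K : Set V) := rfl

@[simp] theorem coe_mapCLM (f : V →L[ℝ] V') (K : ConvexBody V) :
    (K.mapCLM f : Set V') = f '' (K : Set V) := rfl

@[simp] theorem coe_union (K L : ConvexBody V) (h) :
    (K.union L h : Set V) = (K : Set V) ∪ (L : Set V) := rfl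

@[simp] theorem coe_inter (K L : ConvexBody V) (h) :
    (K.inter L h : Set V) = (K : Set V) ∩ (L : Set V) := rfl

theorem mem_coe {K : ConvexBody V} {x : V} : x ∈ (K : Set V) ↔ x ∈ K := Iff.rfl

/-- The convex body with one point. -/
def point (x : V) : ConvexBody V := ⟨{x}, convex_singleton x, isCompact_singleton, ⟨x, rfl⟩⟩

@[simp] theorem coe_point (x : V) : (point x : Set V) = {x} := rfl

theorem translate_eq_add (K : ConvexBody V) (x : V) : K.translate x = K + point x := by
  apply ConvexBody.ext
  simp [Set.add_singleton, add_comm]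

theorem point_zero : point (0 : V) = 0 := ConvexBody.ext rfl

theorem mapCLM_point (f : V →L[ℝ] V') (x : V) : (point x).mapCLM f = point (f x) :=
  ConvexBody.ext (by simp)

theorem mapCLM_add (f : V →L[ℝ] V') (K L : ConvexBody V) :
    (K + L).mapCLM f = K.mapCLM f + L.mapCLM f := by
  apply ConvexBody.ext
  simp only [coe_mapCLM, coe_add]
  exact Set.image_add f

theorem mapCLM_mapCLM (g : V' →L[ℝ] V'') (f : V →L[ℝ] V') (K : ConvexBody V) :
    (K.mapCLM f).mapCLM g = K.mapCLM (g.comp f) :=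
  ConvexBody.ext (by simp only [coe_mapCLM, Set.image_image]; rfl)

theorem smul_eq_mapCLM (t : ℝ) (K : ConvexBody V) :
    t • K = K.mapCLM (t • ContinuousLinearMap.id ℝ V) := by
  apply ConvexBody.ext
  ext x
  simp [Set.mem_smul_set]

theorem mapCLM_smul (f : V →L[ℝ] V') (t : ℝ) (K : ConvexBody V) :
    (t • K).mapCLM f = t • K.mapCLM f := by
  rw [smul_eq_mapCLM, smul_eq_mapCLM, mapCLM_mapCLM, mapCLM_mapCLM]
  congr 1
  ext x
  simp

theorem mapCLM_zero (K : ConvexBody V) : K.mapCLM (0 : V →L[ℝ] V') = 0 := by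
  apply ConvexBody.ext
  ext x
  simp only [coe_mapCLM, zero_apply, Set.mem_image, coe_zero, Set.mem_zero]
  obtain ⟨y, hy⟩ := K.nonempty
  exact ⟨fun ⟨_, _, h⟩ => h.symm, fun h => ⟨y, hy, h.symm⟩⟩

theorem mapCLM_translate (f : V →L[ℝ] V') (K : ConvexBody V) (x : V) :
    (K.translate x).mapCLM f = (K.mapCLM f).translate (f x) := by
  rw [translate_eq_add, translate_eq_add, mapCLM_add, mapCLM_point]

theorem add_smul_body (s t : ℝ) (hs : 0 ≤ s) (ht : 0 ≤ t) (K : ConvexBody V) :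
    (s + t) • K = s • K + t • K := by
  apply ConvexBody.ext
  rw [coe_smul, coe_add, coe_smul, coe_smul]
  exact K.convex.add_smul hs ht

/-- If a union of two convex bodies is convex, every segment joining them meets the intersection. -/
theorem exists_mem_segment_inter {K L : ConvexBody V}
    (hU : Convex ℝ ((K : Set V) ∪ (L : Set V))) {x y : V} (hx : x ∈ K) (hy : y ∈ L) :
    ∃ z ∈ segment ℝ x y, z ∈ K ∧ z ∈ L := by
  have hc : IsPreconnected (segment ℝ x y) := (convex_segment x y).isPreconnected
  have hsub : segment ℝ x y ⊆ (K : Set V) ∪ L := hU.segment_subset (Or.inl hx) (Or.inr hy)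
  rw [isPreconnected_closed_iff] at hc
  exact hc K L K.isClosed L.isClosed hsub ⟨x, left_mem_segment ℝ x y, hx⟩
    ⟨y, right_mem_segment ℝ x y, hy⟩

theorem exists_dist_le (K L : ConvexBody V) {x : V} (hx : x ∈ K) :
    ∃ y ∈ L, dist x y ≤ dist K L := by
  obtain ⟨y, hy, h⟩ := L.isCompact.exists_infDist_eq_dist L.nonempty x
  refine ⟨y, hy, ?_⟩
  rw [← h, ← hausdorffDist_coe]
  exact Metric.infDist_le_hausdorffDist_of_mem hx hausdorffEDist_ne_top

theorem dist_le {K L : ConvexBody V} {r : ℝ} (hr : 0 ≤ r)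
    (h₁ : ∀ x ∈ K, ∃ y ∈ L, dist x y ≤ r) (h₂ : ∀ y ∈ L, ∃ x ∈ K, dist y x ≤ r) :
    dist K L ≤ r := by
  rw [← hausdorffDist_coe]
  exact Metric.hausdorffDist_le_of_mem_dist hr h₁ h₂

theorem dist_add_add_le (K L K' L' : ConvexBody V) :
    dist (K + L) (K' + L') ≤ dist K K' + dist L L' := by
  have key : ∀ K L K' L' : ConvexBody V, ∀ x ∈ K + L, ∃ y ∈ K' + L',
      dist x y ≤ dist K K' + dist L L' := by
    intro K L K' L' x hx
    obtain ⟨a, ha, b, hb, rfl⟩ := Set.mem_add.1 (show x ∈ (K : Set V) + L from hx)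
    obtain ⟨a', ha', h1⟩ := exists_dist_le K K' ha
    obtain ⟨b', hb', h2⟩ := exists_dist_le L L' hb
    exact ⟨a' + b', Set.add_mem_add ha' hb', (_root_.dist_add_add_le _ _ _ _).trans (add_le_add h1 h2)⟩
  refine dist_le (by positivity) (key K L K' L') ?_
  rw [dist_comm K, dist_comm L]
  exact key K' L' K L

theorem exists_norm_le (K : ConvexBody V) : ∃ C : ℝ, 0 < C ∧ ∀ x ∈ K, ‖x‖ ≤ C := by
  obtain ⟨C, hC⟩ := K.isBounded.exists_norm_le
  exact ⟨max C 1, by positivity, fun x hx => (hC x hx).trans (le_max_left _ _)⟩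

theorem dist_mapCLM_le (f g : V →L[ℝ] V') (K L : ConvexBody V) (C : ℝ)
    (hC : ∀ x ∈ K, ‖x‖ ≤ C) :
    dist (K.mapCLM f) (L.mapCLM g) ≤ ‖f - g‖ * C + ‖g‖ * dist K L := by
  have hC0 : 0 ≤ C := by
    obtain ⟨x, hx⟩ := K.nonempty
    exact (norm_nonneg x).trans (hC x hx)
  have key : ∀ x ∈ K, ∀ y : V, dist x y ≤ dist K L →
      dist (f x) (g y) ≤ ‖f - g‖ * C + ‖g‖ * dist K L := by
    intro x hx y hxy
    have : f x - g y = (f - g) x + g (x - y) := by simp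
    rw [dist_eq_norm, this]
    rw [dist_eq_norm] at hxy
    refine (norm_add_le _ _).trans (add_le_add ?_ ?_)
    · exact ((f - g).le_opNorm x).trans (by gcongr; exact hC x hx)
    · exact (g.le_opNorm _).trans (by gcongr)
  refine dist_le (by positivity) ?_ ?_
  · rintro _ ⟨x, hx, rfl⟩
    obtain ⟨y, hy, h⟩ := exists_dist_le K L hx
    exact ⟨g y, ⟨y, hy, rfl⟩, key x hx y h⟩
  · rintro _ ⟨y, hy, rfl⟩
    obtain ⟨x, hx, h⟩ := exists_dist_le L K hy
    refine ⟨f x, ⟨x, hx, rfl⟩, ?_⟩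
    rw [dist_comm]
    exact key x hx y (by rwa [dist_comm, dist_comm K])

theorem continuous_mapCLM_uncurry :
    Continuous fun p : (V →L[ℝ] V') × ConvexBody V => p.2.mapCLM p.1 := by
  rw [continuous_iff_continuousAt]
  rintro ⟨f, K⟩
  obtain ⟨C, hC0, hC⟩ := K.exists_norm_le
  unfold ContinuousAt
  rw [tendsto_iff_dist_tendsto_zero]
  have h : Filter.Tendsto (fun p : (V →L[ℝ] V') × ConvexBody V =>
      ‖f - p.1‖ * C + ‖p.1‖ * dist K p.2) (nhds (f, K)) (nhds (‖f - f‖ * C + ‖f‖ * dist K K)) := by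
    apply Continuous.tendsto'
    · fun_prop
    · rfl
  simp only [sub_self, norm_zero, zero_mul, dist_self, mul_zero, add_zero] at h
  refine squeeze_zero (fun _ => dist_nonneg) (fun p => ?_) h
  rw [dist_comm]
  exact dist_mapCLM_le f p.1 K p.2 C hC

end ConvexBody

open ConvexBody

@[fun_prop]
theorem Continuous.mapCLM {X : Type*} [TopologicalSpace X] {f : X → V →L[ℝ] V'}
    {K : X → ConvexBody V} (hf : Continuous f) (hK : Continuous K) :
    Continuous fun x => (K x).mapCLM (f x) :=
  continuous_mapCLM_uncurry.comp (hf.prodMk hK)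

instance : ContinuousAdd (ConvexBody V) := by
  refine ⟨?_⟩
  rw [continuous_iff_continuousAt]
  rintro ⟨K, L⟩
  unfold ContinuousAt
  rw [tendsto_iff_dist_tendsto_zero]
  have h : Filter.Tendsto (fun p : ConvexBody V × ConvexBody V =>
      dist p.1 K + dist p.2 L) (nhds (K, L)) (nhds (dist K K + dist L L)) := by
    apply Continuous.tendsto'
    · fun_prop
    · rfl
  simp only [dist_self, add_zero] at h
  exact squeeze_zero (fun _ => dist_nonneg) (fun p => dist_add_add_le _ _ _ _) h

instance : ContinuousSMul ℝ (ConvexBody V) := by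
  refine ⟨?_⟩
  simp_rw [smul_eq_mapCLM]
  fun_prop

/-- A continuous, translation invariant real-valued valuation. -/
structure CTV (φ : ConvexBody V → ℝ) : Prop where
  cont : Continuous φ
  val : IsValuation φ
  ti : IsTranslationInvariant φ

theorem IsValuation.eq {φ : ConvexBody V → ℝ} (hφ : IsValuation φ) {U I K L : ConvexBody V}
    (hU : (U : Set V) = (K : Set V) ∪ L) (hI : (I : Set V) = (K : Set V) ∩ L) :
    φ U + φ I = φ K + φ L := by
  have h1 : Convex ℝ ((K : Set V) ∪ L) := hU ▸ U.convex
  have h2 : ((K : Set V) ∩ L).Nonempty := hI ▸ I.nonempty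
  rw [← hφ K L h1 h2]
  congr 2 <;> exact ConvexBody.ext (by assumption)

theorem IsValuation.addRight {φ : ConvexBody V → ℝ} (hφ : IsValuation φ) (Q : ConvexBody V) :
    IsValuation fun K => φ (K + Q) := by
  intro K L hU hI
  apply hφ.eq
  · simp [Set.union_add]
  · apply Set.Subset.antisymm
    · simp only [coe_add, coe_inter]
      exact Set.inter_add_subset
    · rintro z ⟨hz1, hz2⟩
      obtain ⟨k, hk, p, hp, rfl⟩ := Set.mem_add.1 hz1
      obtain ⟨l, hl, q, hq, h⟩ := Set.mem_add.1 hz2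
      obtain ⟨c, ⟨a, b, ha, hb, hab, rfl⟩, hcK, hcL⟩ := exists_mem_segment_inter hU hk hl
      refine Set.mem_add.2 ⟨_, ⟨hcK, hcL⟩, a • p + b • q, Q.convex hp hq ha hb hab, ?_⟩
      calc a • k + b • l + (a • p + b • q) = a • (k + p) + b • (l + q) := by module
        _ = k + p := by rw [h, ← add_smul, hab, one_smul]

theorem IsValuation.map {φ : ConvexBody V' → ℝ} (hφ : IsValuation φ) (f : V →L[ℝ] V') :
    IsValuation fun K => φ (K.mapCLM f) := by
  intro K L hU hI
  apply hφ.eq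
  · simp [Set.image_union]
  · apply Set.Subset.antisymm
    · simp only [coe_mapCLM, coe_inter]
      exact Set.image_inter_subset _ _ _
    · rintro z ⟨⟨k, hk, rfl⟩, ⟨l, hl, h⟩⟩
      obtain ⟨c, ⟨a, b, ha, hb, hab, rfl⟩, hcK, hcL⟩ := exists_mem_segment_inter hU hk hl
      refine ⟨_, ⟨hcK, hcL⟩, ?_⟩
      simp only [map_add, map_smul, h]
      rw [← add_smul, hab, one_smul]

namespace CTV

theorem add_point {φ : ConvexBody V → ℝ} (hφ : CTV φ) (K : ConvexBody V) (x : V) :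
    φ (K + point x) = φ K := by
  rw [← translate_eq_add]; exact hφ.ti K x

theorem zero : CTV (fun _ : ConvexBody V => (0 : ℝ)) :=
  ⟨continuous_const, fun _ _ _ _ => by simp, fun _ _ => rfl⟩

theorem add {φ ψ : ConvexBody V → ℝ} (hφ : CTV φ) (hψ : CTV ψ) : CTV fun K => φ K + ψ K :=
  ⟨hφ.cont.add hψ.cont, fun K L hU hI => by linarith [hφ.val K L hU hI, hψ.val K L hU hI],
    fun K x => by simp only [hφ.ti K x, hψ.ti K x]⟩

theorem const_mul {φ : ConvexBody V → ℝ} (hφ : CTV φ) (c : ℝ) : CTV fun K => c * φ K :=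
  ⟨continuous_const.mul hφ.cont, fun K L hU hI => by
      have := hφ.val K L hU hI
      rw [← mul_add, ← mul_add, this],
    fun K x => by simp only [hφ.ti K x]⟩

theorem neg {φ : ConvexBody V → ℝ} (hφ : CTV φ) : CTV fun K => -φ K := by
  simpa using hφ.const_mul (-1)

theorem sub {φ ψ : ConvexBody V → ℝ} (hφ : CTV φ) (hψ : CTV ψ) : CTV fun K => φ K - ψ K := by
  simpa [sub_eq_add_neg] using hφ.add hψ.neg

theorem sum {ι : Type*} {φ : ι → ConvexBody V → ℝ} (s : Finset ι) (h : ∀ i ∈ s, CTV (φ i)) :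
    CTV fun K => ∑ i ∈ s, φ i K := by
  classical
  induction s using Finset.induction_on with
  | empty => simpa using CTV.zero
  | insert a s ha ih =>
    simp only [Finset.sum_insert ha]
    exact (h a (by simp)).add (ih fun i hi => h i (by simp [hi]))

theorem addRight {φ : ConvexBody V → ℝ} (hφ : CTV φ) (Q : ConvexBody V) :
    CTV fun K => φ (K + Q) :=
  ⟨hφ.cont.comp (by fun_prop), hφ.val.addRight Q, fun K x => by
    simp only [translate_eq_add]
    rw [add_right_comm, hφ.add_point]⟩

theorem map {φ : ConvexBody V' → ℝ} (hφ : CTV φ) (f : V →L[ℝ] V') :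
    CTV fun K => φ (K.mapCLM f) :=
  ⟨hφ.cont.comp (by fun_prop), hφ.val.map f, fun K x => by
    simp only [mapCLM_translate]
    exact hφ.ti _ _⟩

theorem smul {φ : ConvexBody V → ℝ} (hφ : CTV φ) (t : ℝ) : CTV fun K => φ (t • K) := by
  simp_rw [smul_eq_mapCLM]
  exact hφ.map _

end CTV

end Basics

end

section

section Polytopes

variable {V V' : Type*}
variable [NormedAddCommGroup V] [NormedSpace ℝ V]
variable [NormedAddCommGroup V'] [NormedSpace ℝ V']

namespace ConvexBody

open Classical in
/-- The convex hull of a finite nonempty set (junk value `0` otherwise). -/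
def hull (s : Set V) : ConvexBody V :=
  if h : s.Finite ∧ s.Nonempty then
    ⟨convexHull ℝ s, convex_convexHull ℝ s, h.1.isCompact_convexHull ℝ, h.2.convexHull⟩
  else 0

theorem coe_hull {s : Set V} (hs : s.Finite) (hn : s.Nonempty) :
    (hull s : Set V) = convexHull ℝ s := by
  rw [hull, dif_pos ⟨hs, hn⟩]; rfl

theorem hull_singleton (x : V) : hull {x} = point x :=
  ConvexBody.ext (by rw [coe_hull (Set.finite_singleton x) ⟨x, rfl⟩]; simp)

theorem hull_add {s t : Set V} (hs : s.Finite) (hn : s.Nonempty) (ht : t.Finite)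
    (hm : t.Nonempty) : hull s + hull t = hull (s + t) := by
  apply ConvexBody.ext
  rw [coe_add, coe_hull hs hn, coe_hull ht hm, coe_hull (hs.add ht) (hn.add hm), convexHull_add]

theorem mapCLM_hull (f : V →L[ℝ] V') {s : Set V} (hs : s.Finite) (hn : s.Nonempty) :
    (hull s).mapCLM f = hull (f '' s) := by
  apply ConvexBody.ext
  rw [coe_mapCLM, coe_hull hs hn, coe_hull (hs.image f) (hn.image f)]
  exact (f : V →ₗ[ℝ] V').image_convexHull s

theorem hull_add_point {s : Set V} (hs : s.Finite) (hn : s.Nonempty) (x : V) :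
    hull s + point x = hull ((fun y => y + x) '' s) := by
  rw [← hull_singleton, hull_add hs hn (Set.finite_singleton x) ⟨x, rfl⟩, Set.add_singleton]

theorem smul_hull (t : ℝ) {s : Set V} (hs : s.Finite) (hn : s.Nonempty) :
    t • hull s = hull (t • s) := by
  apply ConvexBody.ext
  rw [coe_smul, coe_hull hs hn, coe_hull (hs.smul_set) (hn.smul_set), convexHull_smul]

theorem hull_insert_of_mem {s : Set V} (hs : s.Finite) {x : V} (hx : x ∈ convexHull ℝ s) :
    hull (insert x s) = hull s := by
  have hn : s.Nonempty := convexHull_nonempty_iff.1 ⟨x, hx⟩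
  apply ConvexBody.ext
  rw [coe_hull (hs.insert x) (Set.insert_nonempty x s), coe_hull hs hn]
  apply Set.Subset.antisymm
  · exact convexHull_min (Set.insert_subset hx (subset_convexHull ℝ s)) (convex_convexHull ℝ s)
  · exact convexHull_mono (Set.subset_insert x s)

theorem exists_hull_dist_le (K : ConvexBody V) {ε : ℝ} (hε : 0 < ε) :
    ∃ s : Set V, s.Finite ∧ s.Nonempty ∧ dist (hull s) K ≤ ε := by
  obtain ⟨t, htK, hfin, hcov⟩ := K.isCompact.finite_cover_balls hε
  have hn : t.Nonempty := by
    obtain ⟨x, hx⟩ := K.nonempty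
    obtain ⟨i, hi, -⟩ := Set.mem_iUnion₂.1 (hcov hx)
    exact ⟨i, hi⟩
  refine ⟨t, hfin, hn, dist_le hε.le ?_ ?_⟩
  · intro x hx
    rw [← mem_coe, coe_hull hfin hn] at hx
    exact ⟨x, convexHull_min htK K.convex hx, by simpa using hε.le⟩
  · intro y hy
    obtain ⟨i, hi, h⟩ := Set.mem_iUnion₂.1 (hcov hy)
    refine ⟨i, ?_, (Metric.mem_ball.1 h).le⟩
    rw [← mem_coe, coe_hull hfin hn]
    exact subset_convexHull ℝ t hi

theorem eq_zero_of_hull {φ : ConvexBody V → ℝ} (hφ : Continuous φ)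
    (h : ∀ s : Set V, s.Finite → s.Nonempty → φ (hull s) = 0) (K : ConvexBody V) : φ K = 0 := by
  have hcl : IsClosed {K : ConvexBody V | φ K = 0} := isClosed_eq hφ continuous_const
  have : K ∈ closure {K : ConvexBody V | φ K = 0} := by
    rw [Metric.mem_closure_iff]
    intro ε hε
    obtain ⟨s, hs, hn, hd⟩ := K.exists_hull_dist_le (half_pos hε)
    exact ⟨hull s, h s hs hn, by rw [dist_comm]; linarith⟩
  rwa [hcl.closure_eq] at this

theorem exists_smul_add_smul {F : Set V} (hF : Convex ℝ F) {x y : V} (hx : x ∈ F) (hy : y ∈ F)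
    {a b : ℝ} (ha : 0 ≤ a) (hb : 0 ≤ b) : ∃ w ∈ F, a • x + b • y = (a + b) • w := by
  have : a • x + b • y ∈ (a + b) • F := by
    rw [hF.add_smul ha hb]
    exact Set.add_mem_add (Set.smul_mem_smul_set hx) (Set.smul_mem_smul_set hy)
  obtain ⟨w, hw, h⟩ := this
  exact ⟨w, hw, h.symm⟩

end ConvexBody

open ConvexBody

theorem mem_convexJoin_smul {F G : Set V} {x : V} :
    x ∈ convexJoin ℝ F G ↔ ∃ f ∈ F, ∃ g ∈ G, ∃ a b : ℝ, 0 ≤ a ∧ 0 ≤ b ∧ a + b = 1 ∧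
      x = a • f + b • g := by
  rw [mem_convexJoin]
  constructor
  · rintro ⟨f, hf, g, hg, a, b, ha, hb, hab, rfl⟩
    exact ⟨f, hf, g, hg, a, b, ha, hb, hab, rfl⟩
  · rintro ⟨f, hf, g, hg, a, b, ha, hb, hab, rfl⟩
    exact ⟨f, hf, g, hg, a, b, ha, hb, hab, rfl⟩

theorem add_subset_union_convexJoin {F G K : Set V} (hF : Convex ℝ F) (hG : Convex ℝ G)
    (hK : K = convexJoin ℝ F G) : K + K = (K + F) ∪ (K + G) := by
  have hFK : ∀ x ∈ F, G.Nonempty → x ∈ K := by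
    rintro x hx ⟨g, hg⟩
    rw [hK, mem_convexJoin]
    exact ⟨x, hx, g, hg, left_mem_segment ℝ x g⟩
  have hGK : ∀ x ∈ G, F.Nonempty → x ∈ K := by
    rintro x hx ⟨g, hg⟩
    rw [hK, mem_convexJoin]
    exact ⟨g, hg, x, hx, right_mem_segment ℝ g x⟩
  have key : ∀ F G : Set V, Convex ℝ F → Convex ℝ G → ∀ x ∈ F, ∀ y ∈ F, ∀ x' ∈ G, ∀ y' ∈ G,
      ∀ a b c d : ℝ, 0 ≤ a → 0 ≤ b → 0 ≤ c → 0 ≤ d → a + b = 1 → c + d = 1 → 1 ≤ a + c →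
      a • x + b • x' + (c • y + d • y') ∈ convexJoin ℝ F G + F := by
    intro F G hF hG x hx y hy x' hx' y' hy' a b c d ha hb hc hd hab hcd h
    obtain ⟨w, hw, h1⟩ := exists_smul_add_smul hF hx hy ha hc
    obtain ⟨w', hw', h2⟩ := exists_smul_add_smul hG hx' hy' hb hd
    refine Set.mem_add.2 ⟨(a + c - 1) • w + (b + d) • w', mem_convexJoin_smul.2
      ⟨w, hw, w', hw', _, _, by linarith, by linarith, by linarith, rfl⟩, w, hw, ?_⟩
    calc (a + c - 1) • w + (b + d) • w' + w = (a + c) • w + (b + d) • w' := by module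
      _ = a • x + b • x' + (c • y + d • y') := by rw [← h1, ← h2]; abel
  apply Set.Subset.antisymm
  · intro z hz
    obtain ⟨k, hk, l, hl, rfl⟩ := Set.mem_add.1 hz
    rw [hK] at hk hl
    obtain ⟨x, hx, x', hx', a, b, ha, hb, hab, rfl⟩ := mem_convexJoin_smul.1 hk
    obtain ⟨y, hy, y', hy', c, d, hc, hd, hcd, rfl⟩ := mem_convexJoin_smul.1 hl
    rcases le_total 1 (a + c) with h | h
    · left
      rw [hK]
      exact key F G hF hG x hx y hy x' hx' y' hy' a b c d ha hb hc hd hab hcd h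
    · right
      rw [hK, convexJoin_comm, add_comm (a • x), add_comm (c • y)]
      exact key G F hG hF x' hx' y' hy' x hx y hy b a d c hb ha hd hc (by linarith) (by linarith)
        (by linarith)
  · apply Set.union_subset
    · rintro z hz
      obtain ⟨k, hk, l, hl, rfl⟩ := Set.mem_add.1 hz
      have hk' := hk
      rw [hK] at hk'
      obtain ⟨x, hx, x', hx', -⟩ := mem_convexJoin.1 hk'
      exact Set.add_mem_add hk (hFK l hl ⟨x', hx'⟩)
    · rintro z hz
      obtain ⟨k, hk, l, hl, rfl⟩ := Set.mem_add.1 hz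
      have hk' := hk
      rw [hK] at hk'
      obtain ⟨x, hx, x', hx', -⟩ := mem_convexJoin.1 hk'
      exact Set.add_mem_add hk (hGK l hl ⟨x, hx⟩)

theorem inter_add_convexJoin {F G K : Set V} (hF : Convex ℝ F) (hG : Convex ℝ G)
    (hK : K = convexJoin ℝ F G) : F + G = (K + F) ∩ (K + G) := by
  apply Set.Subset.antisymm
  · rintro z hz
    obtain ⟨f, hf, g, hg, rfl⟩ := Set.mem_add.1 hz
    have h1 : f ∈ K := by
      rw [hK]; exact mem_convexJoin.2 ⟨f, hf, g, hg, left_mem_segment ℝ f g⟩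
    have h2 : g ∈ K := by
      rw [hK]; exact mem_convexJoin.2 ⟨f, hf, g, hg, right_mem_segment ℝ f g⟩
    exact ⟨Set.mem_add.2 ⟨g, h2, f, hf, add_comm g f⟩, Set.add_mem_add h1 hg⟩
  · rintro z ⟨hz1, hz2⟩
    obtain ⟨k, hk, x₀, hx₀, rfl⟩ := Set.mem_add.1 hz1
    obtain ⟨l, hl, y₀, hy₀, h⟩ := Set.mem_add.1 hz2
    rw [hK] at hk hl
    obtain ⟨x, hx, x', hx', a, b, ha, hb, hab, rfl⟩ := mem_convexJoin_smul.1 hk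
    obtain ⟨y, hy, y', hy', c, d, hc, hd, hcd, rfl⟩ := mem_convexJoin_smul.1 hl
    obtain ⟨p, hp, h1⟩ := exists_smul_add_smul hF hx hx₀ ha zero_le_one
    obtain ⟨q, hq, h2⟩ := exists_smul_add_smul hG hy' hy₀ hd zero_le_one
    rcases eq_or_lt_of_le (add_nonneg ha hd) with h0 | h0
    · have ha0 : a = 0 := by linarith
      have hb1 : b = 1 := by linarith
      subst ha0 hb1
      refine Set.mem_add.2 ⟨x₀, hx₀, x', hx', ?_⟩
      module
    · set t : ℝ := d / (a + d) with ht
      have ht0 : 0 ≤ t := by positivity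
      have ht1 : 0 ≤ 1 - t := by
        rw [ht, one_sub_div h0.ne']
        have : a + d - d = a := by ring
        rw [this]; positivity
      have hta : t * (a + d) = d := by rw [ht]; field_simp
      obtain ⟨f, hf, h3⟩ := exists_smul_add_smul hF hp hy
        (mul_nonneg ht0 (by linarith : 0 ≤ a + 1)) (mul_nonneg ht1 hc)
      obtain ⟨g, hg, h4⟩ := exists_smul_add_smul hG hx' hq
        (mul_nonneg ht0 hb) (mul_nonneg ht1 (by linarith : 0 ≤ d + 1))
      have e1 : t * (a + 1) + (1 - t) * c = 1 := by
        have : c = 1 - d := by linarith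
        subst this; linarith
      have e2 : t * b + (1 - t) * (d + 1) = 1 := by
        have : b = 1 - a := by linarith
        subst this; linarith
      rw [e1, one_smul] at h3
      rw [e2, one_smul] at h4
      refine Set.mem_add.2 ⟨f, hf, g, hg, ?_⟩
      have z1 : a • x + b • x' + x₀ = (a + 1) • p + b • x' := by
        rw [← h1]; module
      have z2 : a • x + b • x' + x₀ = c • y + (d + 1) • q := by
        rw [← h, ← h2]; module
      calc f + g = t • ((a + 1) • p + b • x') + (1 - t) • (c • y + (d + 1) • q) := by
            rw [← h3, ← h4]; module
        _ = t • (a • x + b • x' + x₀) + (1 - t) • (a • x + b • x' + x₀) := by rw [← z1, ← z2]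
        _ = _ := by module

/-- The basic cutting identity for the sum of a convex body with two bodies it is the join of. -/
theorem IsValuation.join {φ : ConvexBody V → ℝ} (hφ : IsValuation φ) {K F G : ConvexBody V}
    (hK : (K : Set V) = convexJoin ℝ (F : Set V) G) :
    φ (K + K) + φ (F + G) = φ (K + F) + φ (K + G) := by
  apply hφ.eq
  · simpa using add_subset_union_convexJoin F.convex G.convex hK
  · simpa using inter_add_convexJoin F.convex G.convex hK

theorem IsValuation.hull_union {φ : ConvexBody V → ℝ} (hφ : IsValuation φ) {s t : Set V}
    (hs : s.Finite) (hsn : s.Nonempty) (ht : t.Finite) (htn : t.Nonempty) :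
    φ (hull (s ∪ t) + hull (s ∪ t)) + φ (hull s + hull t)
      = φ (hull (s ∪ t) + hull s) + φ (hull (s ∪ t) + hull t) := by
  apply hφ.join
  rw [coe_hull (hs.union ht) (hsn.mono Set.subset_union_left), coe_hull hs hsn, coe_hull ht htn,
    convexHull_union hsn htn]

theorem mem_convexHull_insert_smul {S : Set V} (hS : S.Nonempty) {p x : V} :
    x ∈ convexHull ℝ (insert p S) ↔ ∃ a b : ℝ, 0 ≤ a ∧ 0 ≤ b ∧ a + b = 1 ∧
      ∃ c ∈ convexHull ℝ S, x = a • p + b • c := by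
  rw [convexHull_insert hS, mem_convexJoin_smul]
  constructor
  · rintro ⟨f, hf, g, hg, a, b, ha, hb, hab, rfl⟩
    exact ⟨a, b, ha, hb, hab, g, hg, by rw [Set.mem_singleton_iff.1 hf]⟩
  · rintro ⟨a, b, ha, hb, hab, g, hg, rfl⟩
    exact ⟨p, rfl, g, hg, a, b, ha, hb, hab, rfl⟩

/-- Cutting a polytope through a point of an edge. -/
theorem IsValuation.hull_split {φ : ConvexBody V → ℝ} (hφ : IsValuation φ) {S : Set V}
    (hS : S.Finite) {p q s : V} (hs : s ∈ convexHull ℝ S) (hpq : s ∈ segment ℝ p q) :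
    φ (hull (insert p (insert q S))) + φ (hull S)
      = φ (hull (insert p S)) + φ (hull (insert q S)) := by
  have hn : S.Nonempty := convexHull_nonempty_iff.1 ⟨s, hs⟩
  have hin : ∀ x, (insert x S).Nonempty := fun x => Set.insert_nonempty x S
  obtain ⟨σ', σ, hσ', hσ, hσσ, hsd⟩ := hpq
  have hC := convex_convexHull ℝ S
  apply hφ.eq
  · rw [coe_hull ((hS.insert q).insert p) (Set.insert_nonempty _ _), coe_hull (hS.insert p) (hin p),
      coe_hull (hS.insert q) (hin q)]
    apply Set.Subset.antisymm
    · have key : ∀ (p q : V) (σ σ' α β γ : ℝ), 0 ≤ σ → 0 ≤ σ' → σ' + σ = 1 →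
          σ' • p + σ • q = s → 0 ≤ α → 0 ≤ β → 0 ≤ γ → α + β + γ = 1 → ∀ c ∈ convexHull ℝ S,
          β * σ' ≤ α * σ → α • p + β • q + γ • c ∈ convexHull ℝ (insert p S) := by
        intro p q σ σ' α β γ hσ hσ' hσσ hsd hα hβ hγ hsum c hc h
        rw [mem_convexHull_insert_smul hn]
        rcases eq_or_lt_of_le hσ with h0 | h0
        · have h1 : σ' = 1 := by linarith
          subst h1
          rw [← h0] at hsd h
          have hβ0 : β = 0 := by linarith
          subst hβ0
          exact ⟨α, γ, hα, hγ, by linarith, c, hc, by module⟩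
        · obtain ⟨w, hw, h1⟩ := exists_smul_add_smul hC hs hc (div_nonneg hβ h0.le) hγ
          refine ⟨α - β * σ' / σ, β / σ + γ, ?_, by positivity, ?_, w, hw, ?_⟩
          · rw [sub_nonneg, div_le_iff₀ h0]; exact h
          · have : σ' = 1 - σ := by linarith
            subst this
            field_simp
            linear_combination σ * hsum
          · rw [← h1, ← hsd]
            match_scalars <;> field_simp <;> ring
      intro x hx
      obtain ⟨a, b, ha, hb, hab, y, hy, rfl⟩ := (mem_convexHull_insert_smul (hin q)).1 hx
      obtain ⟨c, d, hc, hd, hcd, z, hz, rfl⟩ := (mem_convexHull_insert_smul hn).1 hy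
      have e : a • p + b • (c • q + d • z) = a • p + (b * c) • q + (b * d) • z := by module
      have hsum : a + b * c + b * d = 1 := by rw [add_assoc, ← mul_add, hcd, mul_one, hab]
      rw [e]
      rcases le_total (b * c * σ') (a * σ) with h | h
      · left
        exact key p q σ σ' a (b * c) (b * d) hσ hσ' hσσ hsd ha (by positivity) (by positivity)
          hsum z hz h
      · right
        rw [add_comm (a • p)]
        exact key q p σ' σ (b * c) a (b * d) hσ' hσ (by linarith) (by rw [← hsd, add_comm])
          (by positivity) ha (by positivity) (by linarith) z hz h
    · apply Set.union_subset <;> apply convexHull_mono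
      · exact Set.insert_subset_insert (Set.subset_insert q S)
      · exact Set.subset_insert p _
  · rw [coe_hull hS hn, coe_hull (hS.insert p) (hin p), coe_hull (hS.insert q) (hin q)]
    apply Set.Subset.antisymm
    · exact Set.subset_inter (convexHull_mono (Set.subset_insert p S))
        (convexHull_mono (Set.subset_insert q S))
    · rintro z ⟨hz1, hz2⟩
      obtain ⟨α, a, hα, ha, hαa, c, hc, rfl⟩ := (mem_convexHull_insert_smul hn).1 hz1
      obtain ⟨β, b, hβ, hb, hβb, d, hd, h⟩ := (mem_convexHull_insert_smul hn).1 hz2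
      rcases eq_or_lt_of_le (add_nonneg (mul_nonneg hα hσ) (mul_nonneg hβ hσ')) with h0 | h0
      · have h1 : α * σ = 0 := le_antisymm (by nlinarith [mul_nonneg hβ hσ']) (mul_nonneg hα hσ)
        have h2 : β * σ' = 0 := le_antisymm (by nlinarith [mul_nonneg hα hσ]) (mul_nonneg hβ hσ')
        rcases mul_eq_zero.1 h1 with h3 | h3
        · subst h3
          have : a = 1 := by linarith
          subst this
          simpa using hc
        · subst h3
          have : σ' = 1 := by linarith
          subst this
          have hps : p = s := by rw [← hsd]; module
          rw [hps]
          exact hC hs hc hα ha hαa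
      · set t : ℝ := β * σ' / (α * σ + β * σ') with ht
        have htr : 1 - t = α * σ / (α * σ + β * σ') := by rw [ht]; field_simp; ring
        have ht0 : 0 ≤ t := by positivity
        have ht1 : 0 ≤ 1 - t := by rw [htr]; positivity
        have hbal : t * α * σ = (1 - t) * β * σ' := by rw [htr, ht]; field_simp
        have hP : t * α = (t * α + (1 - t) * β) * σ' := by
          have : σ = 1 - σ' := by linarith
          subst this; linarith
        have hQ : (1 - t) * β = (t * α + (1 - t) * β) * σ := by
          have : σ' = 1 - σ := by linarith
          subst this; linarith
        obtain ⟨w, hw, h1⟩ := exists_smul_add_smul hC hc hd (mul_nonneg ht0 ha) (mul_nonneg ht1 hb)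
        have hz : α • p + a • c = (t * α + (1 - t) * β) • s + (t * a + (1 - t) * b) • w := by
          calc α • p + a • c = t • (α • p + a • c) + (1 - t) • (α • p + a • c) := by module
            _ = t • (α • p + a • c) + (1 - t) • (β • q + b • d) := by rw [← h]
            _ = (t * α) • p + ((1 - t) * β) • q + ((t * a) • c + ((1 - t) * b) • d) := by module
            _ = _ := by
              rw [h1, ← hsd, smul_add, smul_smul, smul_smul, ← hP, ← hQ]
        rw [hz]
        refine hC hs hw (by positivity) (by positivity) ?_
        have : a = 1 - α := by linarith
        subst this
        have : b = 1 - β := by linarith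
        subst this
        ring

end Polytopes

end

section

section AffInd

variable {V V' : Type*}
variable [NormedAddCommGroup V] [NormedSpace ℝ V]
variable [NormedAddCommGroup V'] [NormedSpace ℝ V']

open ConvexBody

theorem hull_eq_zero_of_affineIndependent {φ : ConvexBody V → ℝ} (hv : IsValuation φ)
    (h : ∀ s : Finset V, s.Nonempty → AffineIndependent ℝ ((↑) : s → V) → φ (hull s) = 0) :
    ∀ (n : ℕ) (s : Finset V), s.Nonempty → s.card ≤ n → φ (hull s) = 0 := by
  classical
  intro n
  induction n with
  | zero => intro s hs hc; exact absurd hc (Nat.not_le.2 hs.card_pos)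
  | succ n ih =>
    have inner : ∀ (k : ℕ) (s : Finset V) (α : V → ℝ), s.Nonempty → s.card ≤ n + 1 →
        ∑ e ∈ s, α e • e = 0 → ∑ e ∈ s, α e = 0 → (∃ x ∈ s, α x ≠ 0) →
        (s.filter fun x => 0 < α x).card ≤ k → φ (hull s) = 0 := by
      intro k
      induction k with
      | zero =>
        intro s α hn hc h0 h1 h2 hk
        obtain ⟨p, hp, hpos⟩ := Finset.exists_pos_of_sum_zero_of_exists_nonzero α h1 h2
        have : p ∈ s.filter fun x => 0 < α x := Finset.mem_filter.2 ⟨hp, hpos⟩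
        rw [Finset.card_eq_zero.1 (Nat.le_zero.1 hk)] at this
        simp at this
      | succ k ihk =>
        intro s α hn hc h0 h1 h2 hk
        obtain ⟨p, hp, hpos⟩ := Finset.exists_pos_of_sum_zero_of_exists_nonzero α h1 h2
        by_cases hq : ∃ q ∈ s, q ≠ p ∧ 0 < α q
        · obtain ⟨q, hq, hqp, hqpos⟩ := hq
          set T : Finset V := (s.erase p).erase q with hT
          have hqs : q ∈ s.erase p := Finset.mem_erase.2 ⟨hqp, hq⟩
          have hsT : s = insert p (insert q T) := by
            rw [hT, Finset.insert_erase hqs, Finset.insert_erase hp]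
          have hqT : q ∉ T := Finset.notMem_erase q _
          have hpT : p ∉ insert q T := by
            rw [hT, Finset.insert_erase hqs]; exact Finset.notMem_erase p s
          have hpT' : p ∉ T := fun hh => hpT (Finset.mem_insert_of_mem hh)
          have hcT : T.card + 2 = s.card := by
            rw [hsT, Finset.card_insert_of_notMem hpT, Finset.card_insert_of_notMem hqT]
          have hS : 0 < α p + α q := by linarith
          set z : V := (α p / (α p + α q)) • p + (α q / (α p + α q)) • q with hz
          have hzseg : z ∈ segment ℝ p q :=
            ⟨_, _, by positivity, by positivity, by field_simp, rfl⟩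
          have hzS : (α p + α q) • z = α p • p + α q • q := by
            rw [hz]; match_scalars <;> field_simp
          rw [hsT, Finset.sum_insert hpT, Finset.sum_insert hqT] at h0 h1
          have piece : ∀ r, (r = p ∨ r = q) → r ∉ T → φ (hull ↑(insert r (insert z T))) = 0 := by
            intro r hr hrT
            by_cases hcard : (insert r (insert z T)).card ≤ n
            · exact ih _ (Finset.insert_nonempty _ _) hcard
            have hzT : z ∉ T := by
              intro hh
              rw [Finset.insert_eq_of_mem hh] at hcard
              have := Finset.card_insert_le r T
              omega
            have hrz : r ≠ z := by
              rintro hh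
              rw [← hh, Finset.insert_eq_of_mem (Finset.mem_insert_self r T)] at hcard
              have := Finset.card_insert_le r T
              omega
            have hrzT : r ∉ insert z T := by simp [hrz, hrT]
            set β : V → ℝ := fun x => if x = r then 0 else if x = z then α p + α q else α x with hβ
            have hβr : β r = 0 := by simp [hβ]
            have hβz : β z = α p + α q := by simp [hβ, hrz.symm]
            have hβT : ∀ x ∈ T, β x = α x := by
              intro x hx
              have h1 : x ≠ r := fun hh => hrT (hh ▸ hx)
              have h2 : x ≠ z := fun hh => hzT (hh ▸ hx)
              simp [hβ, h1, h2]
            refine ihk (insert r (insert z T)) β (Finset.insert_nonempty _ _) ?_ ?_ ?_ ?_ ?_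
            · rw [Finset.card_insert_of_notMem hrzT, Finset.card_insert_of_notMem hzT]; omega
            · rw [Finset.sum_insert hrzT, Finset.sum_insert hzT, hβr, hβz, hzS,
                Finset.sum_congr rfl fun x hx => by rw [hβT x hx], ← h0]
              module
            · rw [Finset.sum_insert hrzT, Finset.sum_insert hzT, hβr, hβz,
                Finset.sum_congr rfl hβT]
              linear_combination h1
            · exact ⟨z, by simp, by rw [hβz]; exact hS.ne'⟩
            · have e1 : (insert r (insert z T)).filter (fun x => 0 < β x)
                  = insert z (T.filter fun x => 0 < α x) := by
                rw [Finset.filter_insert, if_neg (by rw [hβr]; exact lt_irrefl _),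
                  Finset.filter_insert, if_pos (by rw [hβz]; exact hS)]
                congr 1
                exact Finset.filter_congr fun x hx => by rw [hβT x hx]
              have e2 : s.filter (fun x => 0 < α x)
                  = insert p (insert q (T.filter fun x => 0 < α x)) := by
                rw [hsT, Finset.filter_insert, if_pos hpos, Finset.filter_insert, if_pos hqpos]
              rw [e2, Finset.card_insert_of_notMem (by
                intro hh
                rcases Finset.mem_insert.1 hh with h | h
                · exact hqp h.symm
                · exact hpT' (Finset.mem_of_mem_filter _ h)),
                Finset.card_insert_of_notMem fun hh => hqT (Finset.mem_of_mem_filter _ hh)] at hk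
              rw [e1]
              have := Finset.card_insert_le z (T.filter fun x => 0 < α x)
              omega
          have hA := piece p (Or.inl rfl) hpT'
          have hB := piece q (Or.inr rfl) hqT
          have hC : φ (hull ↑(insert z T)) = 0 := by
            refine ih _ (Finset.insert_nonempty _ _) ?_
            have := Finset.card_insert_le z T
            omega
          have hsp := hv.hull_split (S := (↑(insert z T) : Set V)) (Finset.finite_toSet _)
            (p := p) (q := q) (s := z) (subset_convexHull ℝ _ (by simp)) hzseg
          have hfull : hull (insert p (insert q (↑(insert z T) : Set V))) = hull (↑s : Set V) := by
            have : insert p (insert q (↑(insert z T) : Set V)) = insert z (↑s : Set V) := by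
              rw [hsT]; push_cast
              rw [Set.insert_comm q z, Set.insert_comm p z]
            rw [this]
            apply hull_insert_of_mem (Finset.finite_toSet s)
            exact (convex_convexHull ℝ _).segment_subset (subset_convexHull ℝ _ hp)
              (subset_convexHull ℝ _ hq) hzseg
          rw [hfull] at hsp
          push_cast at hsp hA hB hC
          linarith
        · push Not at hq
          have hsum := Finset.add_sum_erase s α hp
          have hsum' := Finset.add_sum_erase s (fun e => α e • e) hp
          have hpos' : 0 < ∑ e ∈ s.erase p, -α e := by
            rw [Finset.sum_neg_distrib]; linarith
          have hmem : p ∈ convexHull ℝ (↑(s.erase p) : Set V) := by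
            have := Finset.centerMass_mem_convexHull (R := ℝ) (s.erase p) (w := fun e => -α e)
              (z := id) (s := (↑(s.erase p) : Set V))
              (fun e he => by
                have := hq e (Finset.mem_of_mem_erase he) (Finset.ne_of_mem_erase he)
                linarith) hpos' (fun e he => he)
            convert this using 1
            rw [Finset.centerMass, Finset.sum_neg_distrib]
            simp only [neg_smul, Finset.sum_neg_distrib, id]
            have e1 : -∑ e ∈ s.erase p, α e = α p := by linarith
            have e2 : -∑ e ∈ s.erase p, α e • e = α p • p := by
              rw [h0] at hsum'
              exact (eq_neg_of_add_eq_zero_left hsum').symm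
            rw [e1, e2, smul_smul, inv_mul_cancel₀ hpos.ne', one_smul]
          have hn' : (s.erase p).Nonempty := by
            have := convexHull_nonempty_iff.1 ⟨p, hmem⟩
            exact_mod_cast this
          have h3 := ih (s.erase p) hn' (by rw [Finset.card_erase_of_mem hp]; omega)
          rw [← hull_insert_of_mem (Finset.finite_toSet _) hmem, ← Finset.coe_insert,
            Finset.insert_erase hp] at h3
          exact h3
    intro s hs hc
    by_cases hai : AffineIndependent ℝ ((↑) : s → V)
    · exact h s hs hai
    · obtain ⟨f, hf0, hf1, hf2⟩ := exists_nontrivial_relation_sum_zero_of_not_affine_ind hai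
      exact inner _ s f hs hc hf0 hf1 hf2 le_rfl

theorem eq_zero_of_affineIndependent {φ : ConvexBody V → ℝ} (hc : Continuous φ)
    (hv : IsValuation φ)
    (h : ∀ s : Finset V, s.Nonempty → AffineIndependent ℝ ((↑) : s → V) → φ (hull s) = 0)
    (K : ConvexBody V) : φ K = 0 := by
  refine eq_zero_of_hull hc (fun s hs hn => ?_) K
  have := hull_eq_zero_of_affineIndependent hv h _ hs.toFinset (by simpa using hn) le_rfl
  simpa using this

end AffInd

section BodyRing

variable {V : Type*} [NormedAddCommGroup V] [NormedSpace ℝ V]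

open ConvexBody

/-- The linear extension of a function on convex bodies to formal linear combinations. -/
def formalEval (φ : ConvexBody V → ℝ) : AddMonoidAlgebra ℝ (ConvexBody V) →ₗ[ℝ] ℝ :=
  (Finsupp.linearCombination ℝ φ).comp (AddMonoidAlgebra.coeffLinearEquiv ℝ).toLinearMap

theorem formalEval_single (φ : ConvexBody V → ℝ) (K : ConvexBody V) (r : ℝ) :
    formalEval φ (AddMonoidAlgebra.single K r) = r * φ K := by
  simp [formalEval, AddMonoidAlgebra.coeffLinearEquiv]

/-- The largest ideal on which the linear extension of `φ` vanishes. -/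
def bodyIdeal (φ : ConvexBody V → ℝ) : Ideal (AddMonoidAlgebra ℝ (ConvexBody V)) where
  carrier := {x | ∀ y, formalEval φ (x * y) = 0}
  add_mem' := fun {a b} ha hb y => by rw [add_mul, map_add, ha y, hb y, add_zero]
  zero_mem' := fun y => by simp
  smul_mem' := fun c x hx y => by
    rw [smul_eq_mul, mul_right_comm, mul_comm, ← mul_assoc, mul_assoc, mul_comm]
    rw [show c * y * x = x * (c * y) by ring]
    exact hx _

/-- The ring generated by classes of convex bodies under Minkowski addition, modulo the
relations seen by `φ`. -/
abbrev BodyRing (φ : ConvexBody V → ℝ) : Type _ :=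
  AddMonoidAlgebra ℝ (ConvexBody V) ⧸ bodyIdeal φ

variable (φ : ConvexBody V → ℝ)

/-- The class of a convex body. -/
def bodyClass (K : ConvexBody V) : BodyRing φ :=
  Ideal.Quotient.mk _ (AddMonoidAlgebra.single K (1 : ℝ))

/-- Evaluation of `φ` on the ring of classes. -/
def bodyEval : BodyRing φ →ₗ[ℝ] ℝ :=
  ((bodyIdeal φ).restrictScalars ℝ).liftQ (formalEval φ) (by
    intro x hx
    have := hx 1
    rwa [mul_one] at this)

theorem bodyEval_bodyClass (K : ConvexBody V) : bodyEval φ (bodyClass φ K) = φ K := by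
  have : bodyEval φ (bodyClass φ K) = formalEval φ (AddMonoidAlgebra.single K 1) := rfl
  rw [this, formalEval_single, one_mul]

theorem bodyClass_add (K L : ConvexBody V) :
    bodyClass φ (K + L) = bodyClass φ K * bodyClass φ L := by
  simp only [bodyClass]
  rw [← map_mul, AddMonoidAlgebra.single_mul_single, one_mul]

theorem bodyRing_ext {x : BodyRing φ} (h : ∀ Q, bodyEval φ (x * bodyClass φ Q) = 0) : x = 0 := by
  obtain ⟨a, rfl⟩ := Ideal.Quotient.mk_surjective x
  rw [Ideal.Quotient.eq_zero_iff_mem]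
  intro y
  induction y using AddMonoidAlgebra.induction_linear with
  | zero => simp
  | add f g hf hg => rw [mul_add, map_add, hf, hg, add_zero]
  | single Q r =>
    have h1 : formalEval φ (a * AddMonoidAlgebra.single Q 1) = 0 := h Q
    have h2 : AddMonoidAlgebra.single Q r = r • (AddMonoidAlgebra.single Q (1 : ℝ)) := by simp
    rw [h2, mul_smul_comm, map_smul, h1, smul_zero]

theorem bodyClass_nsmul (n : ℕ) (K : ConvexBody V) :
    bodyClass φ (n • K) = bodyClass φ K ^ n := by
  induction n with
  | zero =>
    rw [zero_smul, pow_zero]; rfl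
  | succ n ih => rw [succ_nsmul, bodyClass_add, ih, pow_succ]

variable {φ}

theorem CTV.bodyClass_point (hφ : CTV φ) (x : V) : bodyClass φ (point x) = 1 := by
  rw [← sub_eq_zero]
  refine bodyRing_ext φ fun Q => ?_
  rw [sub_mul, one_mul, ← bodyClass_add, map_sub, bodyEval_bodyClass, bodyEval_bodyClass,
    add_comm, hφ.add_point, sub_self]

theorem IsValuation.bodyClass_eq (hφ : IsValuation φ) {K F G : ConvexBody V}
    (hK : (K : Set V) = convexJoin ℝ (F : Set V) G) :
    (bodyClass φ K - bodyClass φ F) * (bodyClass φ K - bodyClass φ G) = 0 := by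
  refine bodyRing_ext φ fun Q => ?_
  have h := (hφ.addRight Q).join hK
  have e : (bodyClass φ K - bodyClass φ F) * (bodyClass φ K - bodyClass φ G) * bodyClass φ Q
      = bodyClass φ (K + K + Q) + bodyClass φ (F + G + Q) - bodyClass φ (K + F + Q)
        - bodyClass φ (K + G + Q) := by
    simp only [bodyClass_add]; ring
  rw [e]
  simp only [map_add, map_sub, bodyEval_bodyClass]
  linarith

theorem IsValuation.bodyClass_hull (hφ : IsValuation φ) {s t : Set V}
    (hs : s.Finite) (hsn : s.Nonempty) (ht : t.Finite) (htn : t.Nonempty) :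
    (bodyClass φ (hull (s ∪ t)) - bodyClass φ (hull s))
      * (bodyClass φ (hull (s ∪ t)) - bodyClass φ (hull t)) = 0 := by
  apply hφ.bodyClass_eq
  rw [coe_hull (hs.union ht) (hsn.mono Set.subset_union_left), coe_hull hs hsn, coe_hull ht htn,
    convexHull_union hsn htn]

theorem CTV.hull_pow_eq_zero (hφ : CTV φ) : ∀ (n : ℕ) (s : Finset V), s.Nonempty → s.card ≤ n →
    (bodyClass φ (hull s) - 1) ^ n = 0 := by
  classical
  intro n
  induction n with
  | zero => intro s hs hc; exact absurd hc (Nat.not_le.2 hs.card_pos)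
  | succ n ih =>
    intro s hs hc
    obtain ⟨v, hv⟩ := hs
    rcases (s.erase v).eq_empty_or_nonempty with h | h
    · have : (s : Set V) = {v} := by
        rw [← Finset.insert_erase hv, h]; simp
      rw [this, hull_singleton, hφ.bodyClass_point, sub_self, zero_pow (Nat.succ_ne_zero n)]
    · have h1 := hφ.val.bodyClass_hull (Set.finite_singleton v) (Set.singleton_nonempty v)
        (Finset.finite_toSet (s.erase v)) h
      rw [hull_singleton, hφ.bodyClass_point, Set.singleton_union, ← Finset.coe_insert,
        Finset.insert_erase hv] at h1
      set x := bodyClass φ (hull s) - 1 with hx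
      set y := bodyClass φ (hull (s.erase v)) - 1 with hy
      have h2 : x * x = x * y := by
        have : bodyClass φ (hull s) - bodyClass φ (hull (s.erase v)) = x - y := by
          rw [hx, hy]; ring
        rw [this] at h1
        linear_combination h1
      have h3 : ∀ k, x ^ (k + 1) = x * y ^ k := by
        intro k
        induction k with
        | zero => simp
        | succ k ihk =>
          calc x ^ (k + 1 + 1) = x ^ (k + 1) * x := pow_succ _ _
            _ = (x * x) * y ^ k := by rw [ihk]; ring
            _ = x * y ^ (k + 1) := by rw [h2]; ring
      have h4 := ih (s.erase v) h (by rw [Finset.card_erase_of_mem hv]; omega)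
      rw [h3, hy, h4, mul_zero]

end BodyRing

end

section

section McMullen

variable {V V' : Type*}
variable [NormedAddCommGroup V] [NormedSpace ℝ V]
variable [NormedAddCommGroup V'] [NormedSpace ℝ V']

open ConvexBody

theorem ConvexBody.zero_smul_body (K : ConvexBody V) : (0 : ℝ) • K = 0 := by
  rw [smul_eq_mapCLM, zero_smul, mapCLM_zero]

theorem ConvexBody.natCast_smul (n : ℕ) (K : ConvexBody V) : (n : ℝ) • K = n • K := by
  induction n with
  | zero => rw [Nat.cast_zero, zero_smul_body, zero_smul]
  | succ n ih =>
    rw [Nat.cast_succ, add_smul_body _ _ n.cast_nonneg zero_le_one, ih, one_smul, succ_nsmul]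

/-- The polynomial whose value at a natural number `k` is the binomial coefficient `k.choose j`. -/
def binomPoly (j : ℕ) : Polynomial ℝ := Polynomial.C ((j.factorial : ℝ)⁻¹) * descPochhammer ℝ j

theorem binomPoly_eval (j k : ℕ) : (binomPoly j).eval (k : ℝ) = k.choose j := by
  rw [binomPoly, Polynomial.eval_mul, Polynomial.eval_C, descPochhammer_eval_eq_descFactorial,
    Nat.descFactorial_eq_factorial_mul_choose]
  push_cast
  have : (j.factorial : ℝ) ≠ 0 := by positivity
  field_simp

theorem binomPoly_natDegree (j : ℕ) : (binomPoly j).natDegree ≤ j :=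
  (Polynomial.natDegree_C_mul_le _ _).trans (descPochhammer_natDegree ℝ j).le

theorem bodyRing_smul {φ : ConvexBody V → ℝ} (r : ℝ) (x : BodyRing φ) :
    r • x = algebraMap ℝ (BodyRing φ) r * x := by
  exact Algebra.smul_def r x

/-- The iterated difference of `k ↦ φ (k • K)` at `0`. -/
def bodyDiff (φ : ConvexBody V → ℝ) (j : ℕ) (K : ConvexBody V) : ℝ :=
  ∑ l ∈ Finset.range (j + 1), ((-1) ^ (j - l) * (j.choose l : ℝ)) * φ ((l : ℝ) • K)

theorem bodyEval_pow_sub_one (φ : ConvexBody V → ℝ) (j : ℕ) (K : ConvexBody V) :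
    bodyEval φ ((bodyClass φ K - 1) ^ j) = bodyDiff φ j K := by
  rw [sub_eq_add_neg, add_pow, map_sum]
  refine Finset.sum_congr rfl fun l _ => ?_
  have : bodyClass φ K ^ l * (-1) ^ (j - l) * ((j.choose l : ℕ) : BodyRing φ)
      = ((-1 : ℝ) ^ (j - l) * (j.choose l : ℝ)) • bodyClass φ (l • K) := by
    rw [bodyRing_smul, bodyClass_nsmul]
    simp only [map_mul, map_pow, map_neg, map_one, map_natCast]
    ring
  rw [this, map_smul, bodyEval_bodyClass, natCast_smul, smul_eq_mul]

theorem CTV.bodyDiff {φ : ConvexBody V → ℝ} (hφ : CTV φ) (j : ℕ) : CTV (bodyDiff φ j) := by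
  unfold _root_.bodyDiff
  exact CTV.sum _ fun l _ => (hφ.smul _).const_mul _

theorem card_le_of_affineIndependent [FiniteDimensional ℝ V] (s : Finset V)
    (h : AffineIndependent ℝ ((↑) : s → V)) : s.card ≤ finrank ℝ V + 1 := by
  have := h.card_le_finrank_succ
  rw [Fintype.card_coe] at this
  exact this.trans (Nat.succ_le_succ (Submodule.finrank_le _))

theorem CTV.natCast_smul_eq [FiniteDimensional ℝ V] {φ : ConvexBody V → ℝ} (hφ : CTV φ) (k : ℕ)
    (K : ConvexBody V) :
    φ ((k : ℝ) • K) = ∑ j ∈ Finset.range (finrank ℝ V + 1),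
      (k.choose j : ℝ) * _root_.bodyDiff φ j K := by
  have h := (hφ.smul (k : ℝ)).sub (CTV.sum (Finset.range (finrank ℝ V + 1))
    fun j _ => (hφ.bodyDiff j).const_mul (k.choose j : ℝ))
  have := eq_zero_of_affineIndependent h.cont h.val ?_ K
  · linarith
  intro s hs hai
  have hN := hφ.hull_pow_eq_zero (finrank ℝ V + 1) s hs (card_le_of_affineIndependent s hai)
  set x := bodyClass φ (hull (s : Set V)) - 1 with hx
  have h1 : bodyClass φ (hull (s : Set V)) = x + 1 := by rw [hx]; ring
  have h2 : φ ((k : ℝ) • hull (s : Set V)) = bodyEval φ ((x + 1) ^ k) := by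
    rw [natCast_smul, ← bodyEval_bodyClass φ, bodyClass_nsmul, h1]
  have h3 : ∀ m, (x + 1) ^ k = ∑ j ∈ Finset.range (k + 1 + m), (k.choose j : BodyRing φ) * x ^ j := by
    intro m
    induction m with
    | zero =>
      rw [add_pow]
      refine Finset.sum_congr rfl fun j _ => ?_
      ring
    | succ m ih =>
      rw [ih, ← add_assoc, Finset.sum_range_succ _ (k + 1 + m),
        Nat.choose_eq_zero_of_lt (by omega : k < k + 1 + m)]
      simp
  have h4 : ∀ m, ∑ j ∈ Finset.range (finrank ℝ V + 1 + m), (k.choose j : BodyRing φ) * x ^ j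
      = ∑ j ∈ Finset.range (finrank ℝ V + 1), (k.choose j : BodyRing φ) * x ^ j := by
    intro m
    induction m with
    | zero => simp
    | succ m ih =>
      rw [← add_assoc, Finset.sum_range_succ, ih, pow_add, hN]
      simp
  have h5 : (x + 1) ^ k
      = ∑ j ∈ Finset.range (finrank ℝ V + 1), (k.choose j : BodyRing φ) * x ^ j := by
    rw [h3 (finrank ℝ V), ← h4 k]
    congr 2
    omega
  rw [h2, h5, map_sum, sub_eq_zero]
  refine Finset.sum_congr rfl fun j _ => ?_
  have : (k.choose j : BodyRing φ) * x ^ j = (k.choose j : ℝ) • x ^ j := by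
    rw [bodyRing_smul, map_natCast]
  rw [this, map_smul, bodyEval_pow_sub_one, smul_eq_mul]

/-- The polynomial `t ↦ φ (t • K)`. -/
def bodyPoly (φ : ConvexBody V → ℝ) (K : ConvexBody V) : Polynomial ℝ :=
  ∑ j ∈ Finset.range (finrank ℝ V + 1), Polynomial.C (bodyDiff φ j K) * binomPoly j

theorem eqOn_nonneg_of_natCast {f g : ℝ → ℝ} (hf : Continuous f) (hg : Continuous g)
    (h : ∀ p q : ℕ, 0 < q → f (p / q) = g (p / q)) {t : ℝ} (ht : 0 ≤ t) : f t = g t := by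
  have h1 : Filter.Tendsto (fun x : ℕ => (⌊t * (x : ℝ)⌋₊ : ℝ) / (x : ℝ)) Filter.atTop (nhds t) :=
    (tendsto_nat_floor_mul_div_atTop ht).comp tendsto_natCast_atTop_atTop
  have h2 := (hf.tendsto t).comp h1
  have h3 := (hg.tendsto t).comp h1
  refine tendsto_nhds_unique h2 (h3.congr' ?_)
  filter_upwards [Filter.eventually_gt_atTop 0] with q hq
  exact (h _ q hq).symm

theorem CTV.bodyPoly_natCast [FiniteDimensional ℝ V] {φ : ConvexBody V → ℝ} (hφ : CTV φ)
    (K : ConvexBody V) (k : ℕ) : (bodyPoly φ K).eval (k : ℝ) = φ ((k : ℝ) • K) := by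
  rw [hφ.natCast_smul_eq, bodyPoly, Polynomial.eval_finsetSum]
  refine Finset.sum_congr rfl fun j _ => ?_
  rw [Polynomial.eval_mul, Polynomial.eval_C, binomPoly_eval, mul_comm]

theorem polynomial_eq_of_natCast {p q : Polynomial ℝ}
    (h : ∀ k : ℕ, p.eval (k : ℝ) = q.eval (k : ℝ)) : p = q := by
  apply Polynomial.eq_of_infinite_eval_eq
  apply Set.Infinite.mono (s := Set.range fun k : ℕ => (k : ℝ))
  · rintro _ ⟨k, rfl⟩
    exact h k
  · exact Set.infinite_range_of_injective Nat.cast_injective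

theorem CTV.bodyPoly_eval [FiniteDimensional ℝ V] {φ : ConvexBody V → ℝ} (hφ : CTV φ)
    (K : ConvexBody V) {t : ℝ} (ht : 0 ≤ t) : (bodyPoly φ K).eval t = φ (t • K) := by
  have hc : Continuous fun t : ℝ => φ (t • K) := hφ.cont.comp (by fun_prop)
  refine eqOn_nonneg_of_natCast (bodyPoly φ K).continuous hc (fun p q hq => ?_) ht
  have hq' : (q : ℝ) ≠ 0 := by positivity
  have h1 : (bodyPoly φ ((q : ℝ)⁻¹ • K)).comp (Polynomial.C (q : ℝ) * Polynomial.X)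
      = bodyPoly φ K := by
    apply polynomial_eq_of_natCast
    intro k
    rw [Polynomial.eval_comp, hφ.bodyPoly_natCast]
    simp only [Polynomial.eval_mul, Polynomial.eval_C, Polynomial.eval_X]
    rw [← Nat.cast_mul, hφ.bodyPoly_natCast, smul_smul]
    congr 2
    push_cast
    field_simp
  rw [← h1, Polynomial.eval_comp]
  simp only [Polynomial.eval_mul, Polynomial.eval_C, Polynomial.eval_X]
  rw [mul_div_cancel₀ _ hq', hφ.bodyPoly_natCast, smul_smul]
  rfl

/-- The homogeneous component of degree `i` of `φ`. -/
def bodyComp (φ : ConvexBody V → ℝ) (i : ℕ) (K : ConvexBody V) : ℝ :=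
  ∑ j ∈ Finset.range (finrank ℝ V + 1), (binomPoly j).coeff i * bodyDiff φ j K

theorem bodyPoly_coeff (φ : ConvexBody V → ℝ) (i : ℕ) (K : ConvexBody V) :
    (bodyPoly φ K).coeff i = bodyComp φ i K := by
  simp [bodyPoly, bodyComp, mul_comm]

theorem CTV.bodyComp {φ : ConvexBody V → ℝ} (hφ : CTV φ) (i : ℕ) : CTV (bodyComp φ i) := by
  unfold _root_.bodyComp
  exact CTV.sum _ fun j _ => (hφ.bodyDiff j).const_mul _

theorem CTV.smul_eq_sum [FiniteDimensional ℝ V] {φ : ConvexBody V → ℝ} (hφ : CTV φ)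
    (K : ConvexBody V) {t : ℝ} (ht : 0 ≤ t) :
    φ (t • K) = ∑ i ∈ Finset.range (finrank ℝ V + 1), _root_.bodyComp φ i K * t ^ i := by
  rw [← hφ.bodyPoly_eval K ht, Polynomial.eval_eq_sum_range' (n := finrank ℝ V + 1)]
  · simp_rw [bodyPoly_coeff]
  · refine Nat.lt_succ_of_le (Polynomial.natDegree_sum_le_of_forall_le _ _ fun j hj => ?_)
    refine (Polynomial.natDegree_C_mul_le _ _).trans ((binomPoly_natDegree j).trans ?_)
    have := Finset.mem_range.1 hj
    omega

/-- Homogeneity of degree `i` under nonnegative dilations. -/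
def IsHomog (i : ℕ) (φ : ConvexBody V → ℝ) : Prop :=
  ∀ (K : ConvexBody V) (t : ℝ), 0 ≤ t → φ (t • K) = t ^ i * φ K

theorem CTV.bodyComp_homog [FiniteDimensional ℝ V] {φ : ConvexBody V → ℝ} (hφ : CTV φ) (i : ℕ) :
    IsHomog i (_root_.bodyComp φ i) := by
  intro K t ht
  have h : bodyPoly φ (t • K) = (bodyPoly φ K).comp (Polynomial.C t * Polynomial.X) := by
    apply polynomial_eq_of_natCast
    intro k
    rw [hφ.bodyPoly_natCast, Polynomial.eval_comp, smul_smul]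
    simp only [Polynomial.eval_mul, Polynomial.eval_C, Polynomial.eval_X]
    rw [hφ.bodyPoly_eval _ (by positivity), mul_comm]
  rw [← bodyPoly_coeff, ← bodyPoly_coeff, h, Polynomial.comp_C_mul_X_coeff, mul_comm]

theorem bodyComp_congr {φ : ConvexBody V → ℝ} {ψ : ConvexBody V → ℝ} {K L : ConvexBody V}
    (h : ∀ t : ℝ, φ (t • K) = ψ (t • L)) (i : ℕ) : bodyComp φ i K = bodyComp ψ i L := by
  simp [bodyComp, bodyDiff, h]

end McMullen

end

section

section Lam

variable {V V' : Type*}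
variable [NormedAddCommGroup V] [NormedSpace ℝ V]
variable [NormedAddCommGroup V'] [NormedSpace ℝ V']

open ConvexBody

/-- The segment from `0` to `v`. -/
def ConvexBody.seg (v : V) : ConvexBody V := hull {0, v}

theorem ConvexBody.coe_seg (v : V) : (seg v : Set V) = segment ℝ 0 v := by
  rw [seg, coe_hull (by simp) (by simp), convexHull_pair]

theorem ConvexBody.mem_seg {v x : V} : x ∈ seg v ↔ ∃ t : ℝ, 0 ≤ t ∧ t ≤ 1 ∧ x = t • v := by
  rw [← mem_coe, coe_seg, segment_eq_image]
  constructor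
  · rintro ⟨t, ht, rfl⟩
    exact ⟨t, ht.1, ht.2, by simp⟩
  · rintro ⟨t, h0, h1, rfl⟩
    exact ⟨t, ⟨h0, h1⟩, by simp⟩

theorem ConvexBody.mapCLM_seg (f : V →L[ℝ] V') (v : V) : (seg v).mapCLM f = seg (f v) := by
  rw [seg, mapCLM_hull f (by simp) (by simp), Set.image_pair, map_zero, seg]

theorem ConvexBody.smul_seg (t : ℝ) (v : V) : t • seg v = seg (t • v) := by
  rw [smul_eq_mapCLM, mapCLM_seg]; rfl

theorem ConvexBody.seg_zero : seg (0 : V) = 0 := by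
  rw [seg, Set.pair_eq_singleton, hull_singleton, point_zero]

theorem ConvexBody.seg_add_seg_smul {s t : ℝ} (hs : 0 ≤ s) (ht : 0 ≤ t) (v : V) :
    seg (s • v) + seg (t • v) = seg ((s + t) • v) := by
  rw [← smul_seg, ← smul_seg, ← smul_seg, add_smul_body s t hs ht]

theorem ConvexBody.seg_neg (v : V) : seg (-v) + point v = seg v := by
  rw [seg, hull_add_point (by simp) (by simp), Set.image_pair, seg, Set.pair_comm]
  simp

@[fun_prop]
theorem Continuous.seg {X : Type*} [TopologicalSpace X] {f : X → V} (hf : Continuous f) :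
    Continuous fun x => ConvexBody.seg (f x) := by
  have h : ∀ v : V, ConvexBody.seg v
      = (ConvexBody.seg (1 : ℝ)).mapCLM ((ContinuousLinearMap.id ℝ ℝ).smulRight v) := by
    intro v
    rw [mapCLM_seg]; simp
  simp_rw [h]
  refine Continuous.mapCLM ?_ continuous_const
  exact (ContinuousLinearMap.smulRightL ℝ ℝ V (ContinuousLinearMap.id ℝ ℝ)).continuous.comp hf

/-- The difference operator of a functional in the direction of a segment. -/
def lam (v : V) (φ : ConvexBody V → ℝ) (K : ConvexBody V) : ℝ := φ (K + seg v) - φ K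

theorem lam_comm (v w : V) (φ : ConvexBody V → ℝ) : lam v (lam w φ) = lam w (lam v φ) := by
  ext K
  simp only [lam, add_right_comm K (seg v) (seg w)]
  ring

theorem lam_map (f : V →L[ℝ] V') (v : V) (φ : ConvexBody V' → ℝ) (K : ConvexBody V) :
    lam v (fun K => φ (K.mapCLM f)) K = lam (f v) φ (K.mapCLM f) := by
  simp only [lam, mapCLM_add, mapCLM_seg]

theorem lam_zero (φ : ConvexBody V → ℝ) (K : ConvexBody V) : lam 0 φ K = 0 := by
  simp [lam, seg_zero]

namespace CTV

variable {φ : ConvexBody V → ℝ}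

theorem lam (hφ : CTV φ) (v : V) : CTV (lam v φ) := (hφ.addRight _).sub hφ

theorem lam_neg (hφ : CTV φ) (v : V) : _root_.lam (-v) φ = _root_.lam v φ := by
  ext K
  rw [_root_.lam, _root_.lam, ← seg_neg v, ← add_assoc, hφ.add_point]

theorem bodyClass_seg_sq (hφ : CTV φ) (v : V) : (bodyClass φ (seg v) - 1) ^ 2 = 0 := by
  have := hφ.val.bodyClass_hull (s := {0}) (t := {v}) (by simp) (by simp) (by simp) (by simp)
  rw [hull_singleton, hull_singleton, hφ.bodyClass_point, hφ.bodyClass_point] at this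
  rw [sq]
  exact this

theorem lam_natCast (hφ : CTV φ) (k : ℕ) (v : V) (K : ConvexBody V) :
    _root_.lam ((k : ℝ) • v) φ K = k * _root_.lam v φ K := by
  set x := bodyClass φ (seg v) - 1 with hx
  have hx2 : x ^ 2 = 0 := hφ.bodyClass_seg_sq v
  have h1 : ∀ k : ℕ, (1 + x) ^ k = 1 + k * x := by
    intro k
    induction k with
    | zero => simp
    | succ k ih =>
      rw [pow_succ, ih]
      push_cast
      linear_combination (k : BodyRing φ) * hx2
  have h2 : bodyClass φ (seg v) = 1 + x := by rw [hx]; ring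
  have h3 : bodyClass φ (K + seg ((k : ℝ) • v)) - bodyClass φ K
      = (k : ℝ) • (bodyClass φ (K + seg v) - bodyClass φ K) := by
    rw [← smul_seg, natCast_smul, bodyClass_add, bodyClass_nsmul, bodyClass_add, h2, h1,
      bodyRing_smul, map_natCast]
    ring
  have h4 := congrArg (bodyEval φ) h3
  rw [map_smul, map_sub, map_sub] at h4
  simpa [bodyEval_bodyClass, _root_.lam] using h4

theorem continuous_lam (hφ : CTV φ) (K : ConvexBody V) : Continuous fun v => _root_.lam v φ K := by
  have := hφ.cont
  unfold _root_.lam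
  fun_prop

theorem lam_smul_of_nonneg (hφ : CTV φ) {t : ℝ} (ht : 0 ≤ t) (v : V) (K : ConvexBody V) :
    _root_.lam (t • v) φ K = t * _root_.lam v φ K := by
  refine eqOn_nonneg_of_natCast (f := fun t => _root_.lam (t • v) φ K)
    (g := fun t => t * _root_.lam v φ K)
    ((hφ.continuous_lam K).comp (by fun_prop)) (by fun_prop) ?_ ht
  intro p q hq
  have hq' : (q : ℝ) ≠ 0 := by positivity
  have h1 := hφ.lam_natCast p ((q : ℝ)⁻¹ • v) K
  have h2 := hφ.lam_natCast q ((q : ℝ)⁻¹ • v) K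
  rw [smul_smul] at h1 h2
  rw [mul_inv_cancel₀ hq', one_smul] at h2
  simp only [div_eq_mul_inv]
  rw [h1, h2]
  field_simp

theorem lam_smul (hφ : CTV φ) (t : ℝ) (v : V) (K : ConvexBody V) :
    _root_.lam (t • v) φ K = |t| * _root_.lam v φ K := by
  rcases le_total 0 t with ht | ht
  · rw [abs_of_nonneg ht, hφ.lam_smul_of_nonneg ht]
  · rw [abs_of_nonpos ht, ← hφ.lam_smul_of_nonneg (neg_nonneg.2 ht), neg_smul, hφ.lam_neg]

theorem lam_add_seg (hφ : CTV φ) (s : ℝ) (v : V) (K : ConvexBody V) :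
    _root_.lam v φ (K + seg (s • v)) = _root_.lam v φ K := by
  have key : ∀ s : ℝ, 0 ≤ s → ∀ v, _root_.lam v φ (K + seg (s • v)) = _root_.lam v φ K := by
    intro s hs v
    have h1 := hφ.lam_smul_of_nonneg hs v K
    have h2 := hφ.lam_smul_of_nonneg (add_nonneg hs zero_le_one) v K
    unfold _root_.lam at *
    rw [← seg_add_seg_smul hs zero_le_one, one_smul, ← add_assoc] at h2
    linarith
  rcases le_total 0 s with hs | hs
  · exact key s hs v
  · have := key (-s) (by linarith) (-v)
    rw [hφ.lam_neg] at this
    simpa using this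

theorem lam_homog (hφ : CTV φ) {i : ℕ} (h : IsHomog (i + 1) φ) (v : V) :
    IsHomog i (_root_.lam v φ) := by
  intro K t ht
  have hc1 : Continuous fun t : ℝ => _root_.lam v φ (t • K) :=
    (hφ.lam v).cont.comp (by fun_prop)
  have hc2 : Continuous fun t : ℝ => t ^ i * _root_.lam v φ K := by fun_prop
  have hpos : ∀ t ∈ Set.Ioi (0 : ℝ), _root_.lam v φ (t • K) = t ^ i * _root_.lam v φ K := by
    intro t ht
    have ht : 0 < t := ht
    have h1 : t • K + seg v = t • (K + seg (t⁻¹ • v)) := by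
      rw [smul_add, smul_seg, smul_smul, mul_inv_cancel₀ ht.ne', one_smul]
    have h2 := hφ.lam_smul_of_nonneg (inv_nonneg.2 ht.le) v K
    unfold _root_.lam at *
    rw [h1, h _ t ht.le, h _ t ht.le, ← mul_sub, h2, pow_succ]
    field_simp
  have := Set.EqOn.closure (s := Set.Ioi (0 : ℝ)) hpos hc1 hc2
  exact this (by rw [closure_Ioi]; exact ht)

end CTV

theorem lam_eq_half {φ : ConvexBody V → ℝ} (hφ : IsValuation φ) {v : V} {ℓ : V →L[ℝ] ℝ}
    (hv : ℓ v = 1) (K : ConvexBody V) {T : ℝ} (hT : ∀ x ∈ K, |ℓ x| ≤ T) (X : ConvexBody V)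
    (hX : ∀ y, y ∈ X ↔ ∃ k ∈ K, ∃ σ : ℝ, |σ| ≤ T ∧ y = k + σ • v) (Y : ConvexBody V)
    (hY : ∀ y, y ∈ Y ↔ y ∈ X ∧ ℓ y ≤ 0) :
    lam v φ Y = lam v φ (K.mapCLM (ContinuousLinearMap.id ℝ V - ℓ.smulRight v)) := by
  set B := K.mapCLM (ContinuousLinearMap.id ℝ V - ℓ.smulRight v) with hB
  have hBm : ∀ y, y ∈ B ↔ ∃ k ∈ K, y = k - ℓ k • v := by
    intro y
    rw [← mem_coe, hB, coe_mapCLM]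
    constructor
    · rintro ⟨k, hk, rfl⟩; exact ⟨k, hk, by simp⟩
    · rintro ⟨k, hk, rfl⟩; exact ⟨k, hk, by simp⟩
  have hBX : ∀ y ∈ B, y ∈ X ∧ ℓ y = 0 := by
    intro y hy
    obtain ⟨k, hk, rfl⟩ := (hBm y).1 hy
    refine ⟨(hX _).2 ⟨k, hk, -ℓ k, by rw [abs_neg]; exact hT k hk, ?_⟩, by simp [hv]⟩
    rw [neg_smul, sub_eq_add_neg]
  have hadd : ∀ (A : ConvexBody V) y, y ∈ A + seg v ↔ ∃ a ∈ A, ∃ τ : ℝ, 0 ≤ τ ∧ τ ≤ 1 ∧ y = a + τ • v := by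
    intro A y
    rw [← mem_coe, coe_add, Set.mem_add]
    constructor
    · rintro ⟨a, ha, s, hs, rfl⟩
      obtain ⟨τ, h0, h1, rfl⟩ := mem_seg.1 hs
      exact ⟨a, ha, τ, h0, h1, rfl⟩
    · rintro ⟨a, ha, τ, h0, h1, rfl⟩
      exact ⟨a, ha, _, mem_seg.2 ⟨τ, h0, h1, rfl⟩, rfl⟩
  have h := hφ.eq (U := Y + seg v) (I := B) (K := Y) (L := B + seg v) ?_ ?_
  · unfold lam; linarith
  · ext y
    rw [Set.mem_union]
    simp only [mem_coe]
    rw [hadd, hadd]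
    constructor
    · rintro ⟨a, ha, τ, h0, h1, rfl⟩
      obtain ⟨haX, hal⟩ := (hY a).1 ha
      obtain ⟨k, hk, σ, hσ, rfl⟩ := (hX a).1 haX
      have h2 := abs_le.1 hσ
      have h3 := abs_le.1 (hT k hk)
      simp only [map_add, map_smul, hv, smul_eq_mul, mul_one] at hal
      rcases le_total (ℓ k + σ + τ) 0 with h4 | h4
      · left
        rw [hY, hX]
        refine ⟨⟨k, hk, σ + τ, abs_le.2 ⟨by linarith, by linarith⟩, by module⟩, ?_⟩
        simpa [hv] using h4
      · right
        exact ⟨k - ℓ k • v, (hBm _).2 ⟨k, hk, rfl⟩, ℓ k + σ + τ, h4, by linarith, by module⟩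
    · rintro (hy | ⟨a, ha, τ, h0, h1, rfl⟩)
      · exact ⟨y, hy, 0, le_rfl, zero_le_one, by simp⟩
      · obtain ⟨h2, h3⟩ := hBX a ha
        exact ⟨a, (hY a).2 ⟨h2, h3.le⟩, τ, h0, h1, rfl⟩
  · ext y
    rw [Set.mem_inter_iff]
    simp only [mem_coe]
    rw [hadd]
    constructor
    · intro hy
      obtain ⟨h2, h3⟩ := hBX y hy
      exact ⟨(hY y).2 ⟨h2, h3.le⟩, y, hy, 0, le_rfl, zero_le_one, by simp⟩
    · rintro ⟨hy, a, ha, τ, h0, h1, rfl⟩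
      obtain ⟨h2, h3⟩ := hBX a ha
      have h4 := ((hY _).1 hy).2
      simp only [map_add, map_smul, hv, h3, smul_eq_mul, mul_one, zero_add] at h4
      have : τ = 0 := le_antisymm h4 h0
      simpa [this] using ha

theorem CTV.lam_proj {φ : ConvexBody V → ℝ} (hφ : CTV φ) {v : V} {ℓ : V →L[ℝ] ℝ}
    (hv : ℓ v = 1) (K : ConvexBody V) :
    _root_.lam v φ K
      = _root_.lam v φ (K.mapCLM (ContinuousLinearMap.id ℝ V - ℓ.smulRight v)) := by
  obtain ⟨C, hC0, hC⟩ := K.exists_norm_le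
  set T := ‖ℓ‖ * C with hTd
  have hT : ∀ x ∈ K, |ℓ x| ≤ T := by
    intro x hx
    exact (ℓ.le_opNorm x).trans (by rw [hTd]; gcongr; exact hC x hx)
  have hT0 : 0 ≤ T := by positivity
  set X := K + seg (T • v) + seg ((-T) • v) with hXd
  have hX : ∀ y, y ∈ X ↔ ∃ k ∈ K, ∃ σ : ℝ, |σ| ≤ T ∧ y = k + σ • v := by
    intro y
    rw [← mem_coe, hXd, coe_add, coe_add, Set.mem_add]
    constructor
    · rintro ⟨_, ⟨k, hk, s, hs, rfl⟩, r, hr, rfl⟩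
      obtain ⟨a, ha0, ha1, rfl⟩ := mem_seg.1 hs
      obtain ⟨b, hb0, hb1, rfl⟩ := mem_seg.1 hr
      refine ⟨k, hk, a * T - b * T, abs_le.2 ⟨by nlinarith, by nlinarith⟩, by module⟩
    · rintro ⟨k, hk, σ, hσ, rfl⟩
      have h2 := abs_le.1 hσ
      rcases hT0.eq_or_lt with h | h
      · have : σ = 0 := by linarith
        refine ⟨k + 0, ⟨k, hk, 0, mem_seg.2 ⟨0, by simp⟩, rfl⟩, 0, mem_seg.2 ⟨0, by simp⟩, ?_⟩
        simp [this]
      · rcases le_total 0 σ with hs | hs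
        · refine ⟨_, ⟨k, hk, _, mem_seg.2 ⟨σ / T, by positivity, (div_le_one h).2 h2.2, rfl⟩, rfl⟩,
            0, mem_seg.2 ⟨0, by simp⟩, ?_⟩
          simp [smul_smul, div_mul_cancel₀ σ h.ne']
        · refine ⟨k + 0, ⟨k, hk, 0, mem_seg.2 ⟨0, by simp⟩, rfl⟩, _,
            mem_seg.2 ⟨-σ / T, div_nonneg (by linarith) h.le, (div_le_one h).2 (by linarith), rfl⟩, ?_⟩
          rw [smul_smul, show -σ / T * -T = σ by field_simp, add_zero]
  have hBX : ∀ y, (∃ k ∈ K, y = k - ℓ k • v) → y ∈ X ∧ ℓ y = 0 := by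
    rintro y ⟨k, hk, rfl⟩
    refine ⟨(hX _).2 ⟨k, hk, -ℓ k, by rw [abs_neg]; exact hT k hk, ?_⟩, by simp [hv]⟩
    rw [neg_smul, sub_eq_add_neg]
  obtain ⟨k₀, hk₀⟩ := K.nonempty
  have hy₀ := hBX _ ⟨k₀, hk₀, rfl⟩
  let Y : ConvexBody V := ⟨(X : Set V) ∩ {y | ℓ y ≤ 0},
    X.convex.inter (convex_halfSpace_le ℓ.isLinear 0),
    X.isCompact.inter_right (isClosed_le ℓ.continuous continuous_const), ⟨_, hy₀.1, hy₀.2.le⟩⟩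
  let Y' : ConvexBody V := ⟨(X : Set V) ∩ {y | 0 ≤ ℓ y},
    X.convex.inter (convex_halfSpace_ge ℓ.isLinear 0),
    X.isCompact.inter_right (isClosed_le continuous_const ℓ.continuous), ⟨_, hy₀.1, hy₀.2.ge⟩⟩
  have h1 := lam_eq_half hφ.val hv K hT X hX Y (fun y => Iff.rfl)
  have h2 := lam_eq_half hφ.val (v := -v) (ℓ := -ℓ) (by simpa using hv) K
    (T := T) (by simpa using hT) X (by
      intro y
      rw [hX]
      constructor
      · rintro ⟨k, hk, σ, hσ, rfl⟩
        exact ⟨k, hk, -σ, by rwa [abs_neg], by simp⟩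
      · rintro ⟨k, hk, σ, hσ, rfl⟩
        exact ⟨k, hk, -σ, by rwa [abs_neg], by simp⟩) Y' (fun y => by
      change _ ∧ _ ↔ _ ∧ -ℓ y ≤ 0
      simp)
  have hpi : (-ℓ).smulRight (-v) = ℓ.smulRight v := by ext; simp
  rw [hφ.lam_neg, hpi] at h2
  set B := K.mapCLM (ContinuousLinearMap.id ℝ V - ℓ.smulRight v) with hB
  have h3 := (hφ.lam v).val.eq (U := X) (I := B) (K := Y) (L := Y') ?_ ?_
  · have h4 : _root_.lam v φ X = _root_.lam v φ K := by
      rw [hXd, hφ.lam_add_seg, hφ.lam_add_seg]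
    linarith
  · ext y
    change y ∈ X ↔ (y ∈ X ∧ ℓ y ≤ 0) ∨ (y ∈ X ∧ 0 ≤ ℓ y)
    have := le_total (ℓ y) 0
    tauto
  · ext y
    change y ∈ (B : Set V) ↔ (y ∈ X ∧ ℓ y ≤ 0) ∧ (y ∈ X ∧ 0 ≤ ℓ y)
    rw [hB, coe_mapCLM]
    constructor
    · rintro ⟨k, hk, rfl⟩
      have := hBX _ ⟨k, hk, rfl⟩
      simp only [sub_apply, ContinuousLinearMap.id_apply,
        ContinuousLinearMap.smulRight_apply]
      exact ⟨⟨this.1, this.2.le⟩, this.1, this.2.ge⟩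
    · rintro ⟨⟨h5, h6⟩, -, h7⟩
      obtain ⟨k, hk, σ, hσ, rfl⟩ := (hX y).1 h5
      refine ⟨k, hk, ?_⟩
      have h8 : ℓ k + σ = 0 := by
        have := le_antisymm h6 h7
        simpa [hv] using this
      have : σ = -ℓ k := by linarith
      simp [this, sub_eq_add_neg]

/-- `lam v φ K` depends only on the image of `K` under a map whose kernel is spanned by `v`. -/
theorem CTV.lam_congr {φ : ConvexBody V → ℝ} (hφ : CTV φ) {v : V} {f : V →L[ℝ] V'}
    (hf : ∀ x, f x = 0 → ∃ c : ℝ, x = c • v) {K L : ConvexBody V}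
    (hKL : K.mapCLM f = L.mapCLM f) : _root_.lam v φ K = _root_.lam v φ L := by
  rcases eq_or_ne v 0 with rfl | hv
  · rw [lam_zero, lam_zero]
  obtain ⟨ℓ, hℓ⟩ := SeparatingDual.exists_eq_one (R := ℝ) hv
  rw [hφ.lam_proj hℓ K, hφ.lam_proj hℓ L]
  congr 1
  have key : ∀ K L : ConvexBody V, K.mapCLM f = L.mapCLM f →
      ∀ x ∈ K.mapCLM (ContinuousLinearMap.id ℝ V - ℓ.smulRight v),
        x ∈ L.mapCLM (ContinuousLinearMap.id ℝ V - ℓ.smulRight v) := by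
    intro K L h x hx
    obtain ⟨k, hk, rfl⟩ := hx
    have h1 : f k ∈ K.mapCLM f := ⟨k, hk, rfl⟩
    rw [h] at h1
    obtain ⟨l, hl, hlk⟩ := h1
    refine ⟨l, hl, ?_⟩
    obtain ⟨c, hc⟩ := hf (l - k) (by rw [map_sub, hlk, sub_self])
    have : l = k + c • v := by rw [← hc]; abel
    rw [this]
    simp [hℓ, add_smul]
  apply ConvexBody.ext
  ext x
  exact ⟨key K L hKL x, key L K hKL.symm x⟩

end Lam

end

section

section SegmentFree

variable {V V' : Type*}
variable [NormedAddCommGroup V] [NormedSpace ℝ V]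
variable [NormedAddCommGroup V'] [NormedSpace ℝ V']

open ConvexBody

theorem ConvexBody.continuous_hull_range {ι : Type*} [Fintype ι] [Nonempty ι] :
    Continuous fun w : ι → V => hull (Set.range w) := by
  classical
  let F : (ι → V) → ((ι → ℝ) →L[ℝ] V) := fun w =>
    ∑ i, (ContinuousLinearMap.proj (R := ℝ) (φ := fun _ : ι => ℝ) i).smulRight (w i)
  have hF : Continuous F := by
    refine continuous_finsetSum _ fun i _ => ?_
    exact (ContinuousLinearMap.smulRightL ℝ (ι → ℝ) V (ContinuousLinearMap.proj i)).continuous.comp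
      (continuous_apply i)
  have h : ∀ w : ι → V, hull (Set.range w)
      = (hull (Set.range fun i : ι => (Pi.single i 1 : ι → ℝ))).mapCLM (F w) := by
    intro w
    rw [mapCLM_hull _ (Set.finite_range _) (Set.range_nonempty _), ← Set.range_comp]
    congr 2
    ext i
    simp [F, Pi.single_apply]
  simp_rw [h]
  exact Continuous.mapCLM hF continuous_const

theorem Continuous.hull_image {X α : Type*} [TopologicalSpace X] {s : Set α} (hs : s.Finite)
    (hn : s.Nonempty) {g : X → α → V} (hg : ∀ a, Continuous fun x => g x a) :
    Continuous fun x => hull (g x '' s) := by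
  have := hs.fintype
  have := hn.to_subtype
  have h : ∀ x, g x '' s = Set.range (fun a : s => g x a) := by
    intro x; ext y; simp
  simp_rw [h]
  exact continuous_hull_range.comp (continuous_pi fun a => hg a)

theorem sum_alternating_choose_mul_pow (i : ℕ) :
    ∑ l ∈ Finset.range (i + 1), ((-1 : ℝ) ^ (i - l) * (i.choose l : ℝ)) * (l : ℝ) ^ i
      = i.factorial := by
  have h1 := congrFun (fwdDiff_iter_eq_factorial (R := ℝ) (n := i)) 0
  rw [fwdDiff_iter_eq_sum_shift] at h1
  simp only [nsmul_eq_mul, mul_one, zero_add, zsmul_eq_mul] at h1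
  push_cast at h1
  simpa using h1

theorem IsHomog.bodyDiff {φ : ConvexBody V → ℝ} {i : ℕ} (h : IsHomog i φ) (K : ConvexBody V) :
    bodyDiff φ i K = i.factorial * φ K := by
  rw [← sum_alternating_choose_mul_pow, Finset.sum_mul, _root_.bodyDiff]
  refine Finset.sum_congr rfl fun l _ => ?_
  rw [h K l (by positivity)]
  ring

theorem CTV.bodyClass_hull_add {φ : ConvexBody V → ℝ} (hφ : CTV φ) {s : Set V} (hs : s.Finite)
    (hn : s.Nonempty) (x : V) :
    bodyClass φ (hull ((fun y => y + x) '' s)) = bodyClass φ (hull s) := by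
  rw [← hull_add_point hs hn, bodyClass_add, hφ.bodyClass_point, mul_one]

/-- Continuous translation invariant valuations that do not see segment summands. -/
structure SegFree (φ : ConvexBody V → ℝ) : Prop extends CTV φ where
  lam_eq_zero : ∀ v K, lam v φ K = 0

namespace SegFree

variable {φ : ConvexBody V → ℝ}

theorem bodyClass_seg (hφ : SegFree φ) (v : V) : bodyClass φ (seg v) = 1 := by
  rw [← sub_eq_zero]
  refine bodyRing_ext _ fun Q => ?_
  rw [sub_mul, one_mul, map_sub, mul_comm, ← bodyClass_add, bodyEval_bodyClass, bodyEval_bodyClass]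
  exact hφ.lam_eq_zero v Q

theorem bodyClass_pair (hφ : SegFree φ) (p q : V) : bodyClass φ (hull {p, q}) = 1 := by
  have := hφ.toCTV.bodyClass_hull_add (s := {0, q - p}) (by simp) (by simp) p
  rw [Set.image_pair] at this
  simp only [zero_add, sub_add_cancel] at this
  rw [this]
  exact hφ.bodyClass_seg _

theorem hull_edge (hφ : SegFree φ) {s : Set V} (hs : s.Finite) (hn : s.Nonempty) (p q : V) :
    (bodyClass φ (hull (s ∪ {p, q})) - 1) * (bodyClass φ (hull (s ∪ {p, q})) - 1)
      = (bodyClass φ (hull (s ∪ {p, q})) - 1) * (bodyClass φ (hull s) - 1) := by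
  have := hφ.val.bodyClass_hull (s := s) (t := {p, q}) hs hn (by simp) (by simp)
  rw [hφ.bodyClass_pair] at this
  linear_combination this

theorem hull_edge_pow (hφ : SegFree φ) {s : Set V} (hs : s.Finite) (hn : s.Nonempty) (p q : V)
    (k : ℕ) :
    (bodyClass φ (hull (s ∪ {p, q})) - 1) ^ (k + 1)
      = (bodyClass φ (hull (s ∪ {p, q})) - 1) * (bodyClass φ (hull s) - 1) ^ k := by
  induction k with
  | zero => simp
  | succ k ih =>
    rw [pow_succ, ih, mul_right_comm, hφ.hull_edge hs hn, pow_succ]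
    ring

theorem hull_pow_eq_zero (hφ : SegFree φ) : ∀ (k : ℕ) (s : Finset V), s.Nonempty →
    s.card ≤ 2 * k → (bodyClass φ (hull (s : Set V)) - 1) ^ k = 0 := by
  classical
  intro k
  induction k with
  | zero =>
    intro s hs hc
    have := hs.card_pos
    omega
  | succ k ih =>
    intro s hs hc
    by_cases h2 : s.card ≤ 2
    · have : bodyClass φ (hull (s : Set V)) = 1 := by
        obtain ⟨p, hp⟩ := hs
        have : ∃ q, s = {p, q} := by
          have h3 : (s.erase p).card ≤ 1 := by rw [Finset.card_erase_of_mem hp]; omega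
          rw [Finset.card_le_one_iff_subset_singleton] at h3
          have : Nonempty V := ⟨p⟩
          obtain ⟨q, hq⟩ := h3
          by_cases hqs : q ∈ s
          · refine ⟨q, ?_⟩
            ext x
            simp only [Finset.mem_insert, Finset.mem_singleton]
            constructor
            · intro hx
              by_cases hxp : x = p
              · exact Or.inl hxp
              · exact Or.inr (Finset.mem_singleton.1 (hq (Finset.mem_erase.2 ⟨hxp, hx⟩)))
            · rintro (rfl | rfl) <;> assumption
          · refine ⟨p, ?_⟩
            ext x
            simp only [Finset.mem_insert, Finset.mem_singleton, or_self]
            constructor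
            · intro hx
              by_contra hxp
              have := Finset.mem_singleton.1 (hq (Finset.mem_erase.2 ⟨hxp, hx⟩))
              exact hqs (this ▸ hx)
            · rintro rfl; exact hp
        obtain ⟨q, rfl⟩ := this
        rw [Finset.coe_pair]
        exact hφ.bodyClass_pair p q
      rw [this]; simp
    · obtain ⟨p, hp⟩ := hs
      have h3 : (s.erase p).card = s.card - 1 := Finset.card_erase_of_mem hp
      obtain ⟨q, hq⟩ : (s.erase p).Nonempty := Finset.card_pos.1 (by omega)
      have h4 : ((s.erase p).erase q).card = s.card - 1 - 1 := by
        rw [Finset.card_erase_of_mem hq, h3]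
      set r := (s.erase p).erase q with hr
      have hrn : r.Nonempty := Finset.card_pos.1 (by omega)
      have h5 : (s : Set V) = (r : Set V) ∪ {p, q} := by
        ext x
        have hq' := Finset.mem_erase.1 hq
        simp only [hr, Finset.coe_erase, Set.mem_union, Set.mem_insert_iff, Set.mem_singleton_iff,
          Set.mem_sdiff, Finset.mem_coe]
        constructor
        · tauto
        · rintro (h | rfl | rfl)
          · exact h.1.1
          · exact hp
          · exact hq'.2
      rw [h5, hφ.hull_edge_pow (Finset.finite_toSet r) hrn, ih r hrn (by omega), mul_zero]

theorem hull_eq_zero (hφ : SegFree φ) {i : ℕ} (hi : IsHomog i φ) (s : Finset V)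
    (hs : s.Nonempty) (hc : s.card ≤ 2 * i) : φ (hull (s : Set V)) = 0 := by
  have h1 := hi.bodyDiff (hull (s : Set V))
  rw [← bodyEval_pow_sub_one, hφ.hull_pow_eq_zero i s hs hc, map_zero] at h1
  have : (i.factorial : ℝ) ≠ 0 := by positivity
  exact (mul_eq_zero.1 h1.symm).resolve_left this

theorem eq_zero_of_lt [FiniteDimensional ℝ V] (hφ : SegFree φ) {i : ℕ} (hi : IsHomog i φ)
    (h : finrank ℝ V + 1 ≤ 2 * i) (K : ConvexBody V) : φ K = 0 :=
  eq_zero_of_affineIndependent hφ.cont hφ.val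
    (fun s hs ha => hφ.hull_eq_zero hi s hs ((card_le_of_affineIndependent s ha).trans h)) K

end SegFree

end SegmentFree

end

section

section Exceptional

variable {V : Type*}
variable [NormedAddCommGroup V] [NormedSpace ℝ V]

open ConvexBody

/-- The entries of a list of pairs. -/
def pairSet {α : Type*} (P : List (α × α)) : Set α := {x | ∃ e ∈ P, x = e.1 ∨ x = e.2}

theorem pairSet_nil {α : Type*} : pairSet ([] : List (α × α)) = ∅ := by
  ext; simp [pairSet]

theorem pairSet_cons {α : Type*} (e : α × α) (P : List (α × α)) :
    pairSet (e :: P) = {e.1, e.2} ∪ pairSet P := by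
  ext x; simp [pairSet]

theorem finite_pairSet {α : Type*} (P : List (α × α)) : (pairSet P).Finite := by
  induction P with
  | nil => simp [pairSet_nil]
  | cons e P ih => rw [pairSet_cons]; exact (Set.toFinite _).union ih

theorem pairSet_map {α β : Type*} (f : α → β) (P : List (α × α)) :
    pairSet (P.map (Prod.map f f)) = f '' pairSet P := by
  induction P with
  | nil => simp [pairSet_nil]
  | cons e P ih =>
    rw [List.map_cons, pairSet_cons, ih, pairSet_cons, Set.image_union, Set.image_pair]; rfl

/-- The class of the triangle with vertices `0, a, b`, minus one. -/
def triClass (φ : ConvexBody V → ℝ) (e : V × V) : BodyRing φ :=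
  bodyClass φ (hull {0, e.1, e.2}) - 1

namespace SegFree

variable {φ : ConvexBody V → ℝ}

theorem triClass_eq (hφ : SegFree φ) (o : V) (e : V × V) :
    triClass φ (e.1 - o, e.2 - o) = bodyClass φ (hull {o, e.1, e.2}) - 1 := by
  have := hφ.toCTV.bodyClass_hull_add (s := {0, e.1 - o, e.2 - o}) (by simp) (by simp) o
  rw [Set.image_insert_eq, Set.image_pair] at this
  simp only [zero_add, sub_add_cancel] at this
  rw [this, triClass]

theorem triClass_rotate (hφ : SegFree φ) (a b : V) :
    triClass φ (-a, b - a) = triClass φ (a, b) := by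
  have h1 := hφ.triClass_eq a (0, b)
  have h2 := hφ.triClass_eq 0 (a, b)
  simp only [zero_sub, sub_zero] at h1 h2
  rw [h1, h2, Set.insert_comm]

theorem triClass_nsmul (hφ : SegFree φ) (n : ℕ) (a b : V) :
    triClass φ ((n : ℝ) • a, (n : ℝ) • b) = n * triClass φ (a, b) := by
  have h1 : (hull {0, (n : ℝ) • a, (n : ℝ) • b} : ConvexBody V) = n • hull {0, a, b} := by
    rw [← natCast_smul, smul_hull _ (by simp) (by simp), Set.smul_set_insert, Set.smul_set_insert,
      Set.smul_set_singleton, smul_zero]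
  have h2 : triClass φ (a, b) ^ 2 = 0 := by
    have := hφ.hull_edge (s := {0}) (by simp) (by simp) a b
    rw [Set.singleton_union, hull_singleton, hφ.bodyClass_point, sub_self, mul_zero] at this
    rw [sq, triClass]; exact this
  have h3 : bodyClass φ (hull {0, a, b}) = 1 + triClass φ (a, b) := by rw [triClass]; ring
  have h4 : ∀ k : ℕ, (1 + triClass φ (a, b)) ^ k = 1 + k * triClass φ (a, b) := by
    intro k
    induction k with
    | zero => simp
    | succ k ih =>
      rw [pow_succ, ih]
      push_cast
      linear_combination (k : BodyRing φ) * h2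
  rw [triClass, h1, bodyClass_nsmul, h3, h4]
  ring

theorem hull_mul_prod (hφ : SegFree φ) (o : V) (P : List (V × V)) :
    ∀ {s : Set V}, s.Finite → o ∈ s →
      (bodyClass φ (hull (s ∪ pairSet P)) - 1)
          * (P.map fun e => triClass φ (e.1 - o, e.2 - o)).prod
        = (bodyClass φ (hull s) - 1) * (P.map fun e => triClass φ (e.1 - o, e.2 - o)).prod := by
  induction P with
  | nil => intro s _ _; simp [pairSet_nil]
  | cons e P ih =>
    intro s hs ho
    rw [List.map_cons, List.prod_cons, pairSet_cons, ← Set.union_assoc]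
    have h1 := ih (s := s ∪ {e.1, e.2}) (hs.union (Set.toFinite _)) (Or.inl ho)
    have h2 := hφ.val.bodyClass_hull (s := s) (t := {o, e.1, e.2}) hs ⟨o, ho⟩ (by simp) (by simp)
    have h3 : s ∪ {o, e.1, e.2} = s ∪ {e.1, e.2} := by
      rw [Set.union_insert, Set.insert_eq_of_mem (Set.mem_union_left _ ho)]
    have h4 := hφ.hull_edge hs ⟨o, ho⟩ e.1 e.2
    rw [h3] at h2
    rw [hφ.triClass_eq o e]
    linear_combination (bodyClass φ (hull {o, e.1, e.2}) - 1) * h1 +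
      (-h2 + h4) * (P.map fun e => triClass φ (e.1 - o, e.2 - o)).prod

theorem hull_pow_eq_prod (hφ : SegFree φ) (o : V) (P : List (V × V)) :
    (bodyClass φ (hull ({o} ∪ pairSet P)) - 1) ^ P.length
      = (P.map fun e => triClass φ (e.1 - o, e.2 - o)).prod := by
  induction P with
  | nil => simp
  | cons e P ih =>
    rw [List.length_cons, pairSet_cons, Set.union_comm {e.1, e.2}, ← Set.union_assoc,
      hφ.hull_edge_pow ((Set.finite_singleton o).union (finite_pairSet P)) (by simp), ih,
      Set.union_assoc, Set.union_comm (pairSet P), ← Set.union_assoc,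
      hφ.hull_mul_prod o P (by simp) (by simp), List.map_cons, List.prod_cons,
      hφ.triClass_eq o e, Set.singleton_union]

theorem factorial_mul_eq (hφ : SegFree φ) {m : ℕ} (hm : IsHomog m φ) (o : V) (P : List (V × V))
    (hP : P.length = m) :
    m.factorial * φ (hull ({o} ∪ pairSet P))
      = bodyEval φ (P.map fun e => triClass φ (e.1 - o, e.2 - o)).prod := by
  rw [← hφ.hull_pow_eq_prod, hP, bodyEval_pow_sub_one, hm.bodyDiff]

theorem prod_shift (hφ : SegFree φ) {m : ℕ} (hm : IsHomog m φ) (v c a b : V) (P : List (V × V))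
    (hP : P.length + 2 = m) :
    bodyEval φ (triClass φ (v, c) * (triClass φ (a, b) * (P.map (triClass φ)).prod))
      = bodyEval φ (triClass φ (v, c) * (triClass φ (a - v, b - v) *
          (P.map fun e => triClass φ (e.1 - v, e.2 - v)).prod)) := by
  have h1 := hφ.factorial_mul_eq hm 0 ((v, c) :: (a, b) :: P) (by simpa using hP)
  have h2 := hφ.factorial_mul_eq hm v ((0, c) :: (a, b) :: P) (by simpa using hP)
  simp only [List.map_cons, List.prod_cons, sub_zero, zero_sub, Prod.mk.eta] at h1 h2
  rw [hφ.triClass_rotate] at h2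
  have h3 : {0} ∪ pairSet ((v, c) :: (a, b) :: P) = {v} ∪ pairSet ((0, c) :: (a, b) :: P) := by
    simp only [pairSet_cons]
    ext x
    simp only [Set.mem_union, Set.mem_insert_iff, Set.mem_singleton_iff]
    tauto
  rw [h3] at h1
  rw [← h2, h1]

theorem tri_shift (hφ : SegFree φ) {m : ℕ} (hm : IsHomog m φ) (v c a b : V) (P : List (V × V))
    (hP : P.length + 2 = m) :
    bodyEval φ (triClass φ (v, c) * (triClass φ (a, b) * (P.map (triClass φ)).prod))
      = bodyEval φ (triClass φ (v, c) * (triClass φ (a - v, b - v) * (P.map (triClass φ)).prod)) := by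
  let g : ℝ → V × ℝ → V := fun t x => x.1 - (x.2 * t) • v
  let s : Set (V × ℝ) := {(0, 0), (v, 0), (c, 0), (a - v, 0), (b - v, 0)}
    ∪ (fun x => (x, 1)) '' pairSet P
  have hs : s.Finite := (Set.toFinite _).union ((finite_pairSet P).image _)
  have hE : ∀ t : ℝ, bodyEval φ (triClass φ (v, c) * (triClass φ (a - v, b - v) *
      (P.map fun e => triClass φ (e.1 - t • v, e.2 - t • v)).prod))
      = m.factorial * φ (hull (g t '' s)) := by
    intro t
    have h1 := hφ.factorial_mul_eq hm 0 ((v, c) :: (a - v, b - v) ::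
      P.map (Prod.map (fun x => x - t • v) (fun x => x - t • v))) (by simpa using hP)
    simp only [List.map_cons, List.prod_cons, sub_zero, List.map_map, Prod.mk.eta] at h1
    have h2 : {0} ∪ pairSet ((v, c) :: (a - v, b - v) ::
      P.map (Prod.map (fun x => x - t • v) (fun x => x - t • v))) = g t '' s := by
      rw [pairSet_cons, pairSet_cons, pairSet_map, Set.image_union, Set.image_image]
      simp only [Set.image_insert_eq, Set.image_singleton, g, zero_mul, zero_smul, sub_zero,
        one_mul]
      ext x
      simp only [Set.mem_union, Set.mem_insert_iff, Set.mem_singleton_iff]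
      tauto
    rw [h2] at h1
    rw [h1]
    rfl
  have hcont : Continuous fun t => (m.factorial : ℝ) * φ (hull (g t '' s)) := by
    refine continuous_const.mul (hφ.cont.comp (Continuous.hull_image hs (by simp [s]) ?_))
    intro x
    fun_prop
  have hstep : ∀ n : ℕ, 0 < n →
      bodyEval φ (triClass φ (v, c) * (triClass φ (a, b) * (P.map (triClass φ)).prod))
        = m.factorial * φ (hull (g (1 / (n : ℝ)) '' s)) := by
    intro n hn
    have hn0 : (n : ℝ) ≠ 0 := by positivity
    have h1 := hφ.prod_shift hm v c a b (P.map fun e => ((n : ℝ) • e.1, (n : ℝ) • e.2))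
      (by simpa using hP)
    have hprod : ∀ Q : List (V × V),
        (Q.map fun e => triClass φ ((n : ℝ) • e.1, (n : ℝ) • e.2)).prod
          = ((n : ℝ) ^ Q.length) • (Q.map (triClass φ)).prod := by
      intro Q
      induction Q with
      | nil => simp
      | cons e Q ih =>
        rw [List.map_cons, List.prod_cons, ih, hφ.triClass_nsmul, List.map_cons, List.prod_cons,
          List.length_cons, pow_succ, bodyRing_smul, bodyRing_smul, map_mul, map_natCast]
        ring
    have e1 : (P.map fun e => ((n : ℝ) • e.1, (n : ℝ) • e.2)).map (triClass φ)
        = P.map fun e => triClass φ ((n : ℝ) • e.1, (n : ℝ) • e.2) := by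
      rw [List.map_map]; rfl
    have e2 : ((P.map fun e => ((n : ℝ) • e.1, (n : ℝ) • e.2)).map
          fun e => triClass φ (e.1 - v, e.2 - v))
        = (P.map fun e => (e.1 - (1 / (n : ℝ)) • v, e.2 - (1 / (n : ℝ)) • v)).map
            fun e => triClass φ ((n : ℝ) • e.1, (n : ℝ) • e.2) := by
      rw [List.map_map, List.map_map]
      refine List.map_congr_left fun e _ => ?_
      simp only [Function.comp, smul_sub, smul_smul, mul_one_div_cancel hn0, one_smul]
    rw [e1, e2, hprod, hprod, List.length_map] at h1
    simp only [mul_smul_comm, map_smul] at h1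
    have h2 := smul_right_injective ℝ (pow_ne_zero P.length hn0) h1
    rw [h2, ← hE, List.map_map]
    rfl
  have hlim : Filter.Tendsto (fun n : ℕ => (m.factorial : ℝ) * φ (hull (g (1 / (n : ℝ)) '' s)))
      Filter.atTop (nhds (m.factorial * φ (hull (g 0 '' s)))) :=
    (hcont.tendsto 0).comp tendsto_one_div_atTop_nhds_zero_nat
  have hconst : Filter.Tendsto (fun n : ℕ => (m.factorial : ℝ) * φ (hull (g (1 / (n : ℝ)) '' s)))
      Filter.atTop (nhds (bodyEval φ (triClass φ (v, c) * (triClass φ (a, b) *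
        (P.map (triClass φ)).prod)))) := by
    refine tendsto_const_nhds.congr' ?_
    filter_upwards [Filter.eventually_gt_atTop 0] with n hn
    exact hstep n hn
  rw [tendsto_nhds_unique hconst hlim, ← hE 0]
  simp

theorem hull_move (hφ : SegFree φ) {m : ℕ} (hm : IsHomog m φ) (v c a b : V) (P : List (V × V))
    (hP : P.length + 2 = m) :
    φ (hull ({0} ∪ pairSet ((v, c) :: (a, b) :: P)))
      = φ (hull ({0} ∪ pairSet ((v, c) :: (a + v, b) :: P))) := by
  have h1 := hφ.factorial_mul_eq hm 0 ((v, c) :: (a, b) :: P) (by simpa using hP)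
  have h2 := hφ.factorial_mul_eq hm 0 ((v, c) :: (a + v, b) :: P) (by simpa using hP)
  simp only [List.map_cons, List.prod_cons, sub_zero, Prod.mk.eta] at h1 h2
  rw [← hφ.triClass_rotate a b, hφ.tri_shift hm v c _ _ P hP, ← hφ.triClass_rotate (-a - v)] at h1
  have e1 : -(-a - v) = a + v := by abel
  have e2 : b - a - v - (-a - v) = b := by abel
  rw [e1, e2, ← h2] at h1
  have : (m.factorial : ℝ) ≠ 0 := by positivity
  exact mul_left_cancel₀ this h1

theorem exists_pairs {α : Type*} : ∀ (k : ℕ) (l : List α), l.length = 2 * k →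
    ∃ P : List (α × α), P.length = k ∧ pairSet P = {x | x ∈ l} := by
  intro k
  induction k with
  | zero =>
    intro l hl
    refine ⟨[], rfl, ?_⟩
    have : l = [] := List.length_eq_zero_iff.1 (by simpa using hl)
    rw [this, pairSet_nil]
    simp
  | succ k ih =>
    intro l hl
    match l, hl with
    | [], hl => simp at hl
    | [x], hl => simp at hl; omega
    | x :: y :: l, hl =>
      obtain ⟨P, hP, h⟩ := ih l (by simp at hl; omega)
      refine ⟨(x, y) :: P, by simp [hP], ?_⟩
      rw [pairSet_cons, h]
      ext z
      simp [or_assoc]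

/-- The value of a functional at the convex hull of `0` and the entries of a list. -/
def listVal (φ : ConvexBody V → ℝ) (l : List V) : ℝ := φ (hull ({0} ∪ {x | x ∈ l}))

theorem listVal_perm {l l' : List V} (h : l.Perm l') : listVal φ l = listVal φ l' := by
  unfold listVal
  congr 4
  ext x
  exact h.mem_iff

theorem listVal_move (hφ : SegFree φ) {m : ℕ} (hm : IsHomog m φ) (hm2 : 2 ≤ m) (v a : V)
    (l : List V) (hl : l.length + 2 = 2 * m) :
    listVal φ (v :: a :: l) = listVal φ (v :: (a + v) :: l) := by
  match l, hl with
  | [], hl => simp at hl; omega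
  | [x], hl => simp at hl; omega
  | c :: b :: l, hl =>
    obtain ⟨P, hP, h⟩ := exists_pairs (m - 2) l (by simp at hl; omega)
    have := hφ.hull_move hm v c a b P (by omega)
    unfold listVal
    simp only [pairSet_cons, h] at this
    convert this using 4 <;>
    · ext x
      simp only [Set.mem_union, Set.mem_insert_iff, Set.mem_singleton_iff, Set.mem_ofPred_eq,
        List.mem_cons]
      tauto

theorem listVal_move_map (hφ : SegFree φ) {m : ℕ} (hm : IsHomog m φ) (hm2 : 2 ≤ m) (v : V) :
    ∀ (l l' : List V), l.length + l'.length + 1 = 2 * m →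
      listVal φ (v :: (l ++ l')) = listVal φ (v :: (l.map (· + v) ++ l')) := by
  intro l
  induction l with
  | nil => intro l' _; rfl
  | cons a l ih =>
    intro l' hl
    rw [List.cons_append, hφ.listVal_move hm hm2 v a (l ++ l') (by simp at hl ⊢; omega)]
    have h1 : (v :: (a + v) :: (l ++ l')).Perm (v :: (l ++ (a + v) :: l')) :=
      List.Perm.cons _ (List.perm_middle.symm)
    have h2 : (v :: (l.map (· + v) ++ (a + v) :: l')).Perm
        (v :: ((a :: l).map (· + v) ++ l')) := List.Perm.cons _ List.perm_middle
    rw [listVal_perm h1, ih ((a + v) :: l') (by simp at hl ⊢; omega), listVal_perm h2]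

theorem listVal_short (hφ : SegFree φ) {m : ℕ} (hm : IsHomog m φ) (l : List V)
    (hl : l.length + 1 ≤ 2 * m) : listVal φ l = 0 := by
  classical
  have := hφ.hull_eq_zero hm (insert 0 l.toFinset) (by simp)
    ((Finset.card_insert_le _ _).trans ((Nat.succ_le_succ l.toFinset_card_le).trans hl))
  rw [listVal]
  convert this using 3
  ext x; simp

theorem listVal_half (hφ : SegFree φ) {m : ℕ} (hm : IsHomog m φ) (hm2 : 2 ≤ m) (v : V)
    (l : List V) (hl : l.length + 1 = 2 * m) :
    listVal φ (v :: l) = 2 * listVal φ ((1 / 2 : ℝ) • v :: l) := by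
  set h : V := (1 / 2 : ℝ) • v with hh
  have hv : v = h + h := by rw [hh]; module
  have hfin : {x | x ∈ l}.Finite := l.finite_toSet
  have h1 := hφ.val.hull_split (S := insert h {x | x ∈ l}) (p := 0) (q := v) (s := h)
    (hfin.insert h) (subset_convexHull ℝ _ (Set.mem_insert _ _))
    (by rw [segment_eq_image]; exact ⟨1 / 2, by norm_num, by simp [hh]⟩)
  have e1 : φ (hull (insert 0 (insert v (insert h {x | x ∈ l})))) = listVal φ (v :: l) := by
    rw [listVal, show insert 0 (insert v (insert h {x | x ∈ l})) = insert h ({0} ∪ {x | x ∈ v :: l})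
      from by
        ext x
        simp only [Set.mem_union, Set.mem_insert_iff, Set.mem_singleton_iff, Set.mem_ofPred_eq,
          List.mem_cons]
        tauto]
    rw [hull_insert_of_mem]
    · exact (Set.finite_singleton _).union (v :: l).finite_toSet
    · have : h ∈ segment ℝ 0 v := by
        rw [segment_eq_image]; exact ⟨1 / 2, by norm_num, by simp [hh]⟩
      exact (convex_convexHull ℝ _).segment_subset
        (subset_convexHull ℝ _ (by simp)) (subset_convexHull ℝ _ (by simp)) this
  have e2 : φ (hull (insert h {x | x ∈ l})) = 0 := by
    have := hφ.listVal_short hm (l.map (· + -h)) (by simpa using hl.le)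
    rw [← this, listVal, ← hφ.add_point (hull (insert h {x | x ∈ l})) (-h),
      hull_add_point (hfin.insert h) (by simp)]
    congr 2
    ext x
    simp only [Set.image_insert_eq, add_neg_cancel, Set.mem_insert_iff, Set.mem_image,
      Set.mem_ofPred_eq, Set.singleton_union, List.mem_map]
  have e3 : φ (hull (insert 0 (insert h {x | x ∈ l}))) = listVal φ (h :: l) := by
    rw [listVal]
    congr 2
    ext x; simp
  have e4 : φ (hull (insert v (insert h {x | x ∈ l}))) = listVal φ (h :: l) := by
    have h2 := hφ.listVal_move_map hm hm2 h (l.map (· + -h)) [] (by simpa using hl)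
    have h3 : (l.map (· + -h)).map (· + h) = l := by
      rw [List.map_map]
      simp
    rw [List.append_nil, List.append_nil, h3] at h2
    rw [← h2, listVal, ← hφ.add_point (hull (insert v (insert h {x | x ∈ l}))) (-h),
      hull_add_point ((hfin.insert h).insert v) (by simp)]
    congr 2
    rw [Set.image_insert_eq, Set.image_insert_eq]
    ext x
    have : v + -h = h := by rw [hv]; abel
    simp only [this, add_neg_cancel, Set.mem_insert_iff, Set.mem_image, Set.mem_ofPred_eq,
      Set.singleton_union, List.mem_cons, List.mem_map]
    tauto
  rw [e1, e2, e3, e4] at h1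
  linarith

theorem listVal_half_map (hφ : SegFree φ) {m : ℕ} (hm : IsHomog m φ) (hm2 : 2 ≤ m) :
    ∀ (l l' : List V), l.length + l'.length = 2 * m →
      listVal φ (l ++ l') = 2 ^ l.length * listVal φ (l.map ((1 / 2 : ℝ) • ·) ++ l') := by
  intro l
  induction l with
  | nil => intro l' _; simp
  | cons a l ih =>
    intro l' hl
    rw [List.cons_append, hφ.listVal_half hm hm2 a (l ++ l') (by simp at hl ⊢; omega)]
    have h1 : ((1 / 2 : ℝ) • a :: (l ++ l')).Perm (l ++ (1 / 2 : ℝ) • a :: l') :=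
      List.perm_middle.symm
    have h2 : (l.map ((1 / 2 : ℝ) • ·) ++ (1 / 2 : ℝ) • a :: l').Perm
        ((a :: l).map ((1 / 2 : ℝ) • ·) ++ l') := List.perm_middle
    rw [listVal_perm h1, ih ((1 / 2 : ℝ) • a :: l') (by simp at hl ⊢; omega), listVal_perm h2,
      List.length_cons, pow_succ]
    ring

theorem listVal_eq_zero (hφ : SegFree φ) {m : ℕ} (hm : IsHomog m φ) (hm2 : 2 ≤ m) (l : List V)
    (hl : l.length = 2 * m) : listVal φ l = 0 := by
  have h1 := hφ.listVal_half_map hm hm2 l [] (by simpa using hl)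
  rw [List.append_nil, List.append_nil] at h1
  have h2 : listVal φ (l.map ((1 / 2 : ℝ) • ·)) = (1 / 2) ^ m * listVal φ l := by
    rw [listVal, listVal, ← hm _ _ (by norm_num), smul_hull]
    · congr 2
      ext x
      simp [Set.mem_smul_set, eq_comm]
    · exact (Set.finite_singleton _).union l.finite_toSet
    · simp
  rw [h2, hl] at h1
  have h3 : (2 : ℝ) ^ (2 * m) * (1 / 2) ^ m = 2 ^ m := by
    rw [two_mul, pow_add, mul_assoc, ← mul_pow]; norm_num
  have h4 : (1 : ℝ) < 2 ^ m := one_lt_pow₀ (by norm_num) (by omega)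
  rw [← mul_assoc, h3] at h1
  have : (2 ^ m - 1) * listVal φ l = 0 := by linarith
  exact (mul_eq_zero.1 this).resolve_left (by linarith)

theorem eq_zero_of_eq [FiniteDimensional ℝ V] (hφ : SegFree φ) {m : ℕ} (hm : IsHomog m φ)
    (hm2 : 2 ≤ m) (h : finrank ℝ V = 2 * m) (K : ConvexBody V) : φ K = 0 := by
  classical
  refine eq_zero_of_affineIndependent hφ.cont hφ.val (fun s hs ha => ?_) K
  have hc := card_le_of_affineIndependent s ha
  rw [h] at hc
  rcases hc.lt_or_eq with hc | hc
  · exact hφ.hull_eq_zero hm s hs (by omega)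
  · obtain ⟨p, hp⟩ := hs
    have h1 : (s.erase p).card = 2 * m := by rw [Finset.card_erase_of_mem hp]; omega
    have h2 := hφ.listVal_eq_zero hm hm2 ((s.erase p).toList.map (· + -p)) (by simpa using h1)
    rw [← h2, listVal, ← hφ.add_point (hull (s : Set V)) (-p),
      hull_add_point (Finset.finite_toSet s) ⟨p, hp⟩]
    congr 2
    conv_lhs => rw [← Finset.insert_erase hp]
    rw [Finset.coe_insert, Set.image_insert_eq, Set.singleton_union]
    congr 1
    · simp
    · ext x
      simp only [Set.mem_image, Set.mem_ofPred_eq, List.mem_map, Finset.mem_toList,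
        Finset.mem_coe]

end SegFree

end Exceptional

end

section

section TypeYGeneral

variable {V V' : Type*}
variable [NormedAddCommGroup V] [NormedSpace ℝ V]

open ConvexBody

theorem eq_at_zero_of_pos {f g : ℝ → ℝ} (hf : Continuous f) (hg : Continuous g)
    (h : ∀ t, 0 < t → f t = g t) : f 0 = g 0 := by
  have h1 : Filter.Tendsto f (nhdsWithin 0 (Set.Ioi 0)) (nhds (f 0)) :=
    hf.continuousAt.tendsto.mono_left nhdsWithin_le_nhds
  have h2 : Filter.Tendsto g (nhdsWithin 0 (Set.Ioi 0)) (nhds (g 0)) :=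
    hg.continuousAt.tendsto.mono_left nhdsWithin_le_nhds
  refine tendsto_nhds_unique (h1.congr' ?_) h2
  filter_upwards [self_mem_nhdsWithin] with t ht using h t ht

theorem CTV.isHomog_of_pos {φ : ConvexBody V → ℝ} (hφ : CTV φ) {i : ℕ}
    (h : ∀ K t, 0 < t → φ (t • K) = t ^ i * φ K) : IsHomog i φ := by
  intro K t ht
  rcases ht.eq_or_lt with rfl | ht
  · exact eq_at_zero_of_pos (f := fun t => φ (t • K)) (g := fun t => t ^ i * φ K)
      (hφ.cont.comp (by fun_prop)) (by fun_prop) (fun t ht => h K t ht)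
  · exact h K t ht

theorem IsHomog.eq_zero_body {φ : ConvexBody V → ℝ} (h : IsHomog 0 φ) (K : ConvexBody V) :
    φ K = φ 0 := by
  have := h K 0 le_rfl
  rw [zero_smul_body] at this
  simpa using this.symm

theorem IsHomog.apply_zero {φ : ConvexBody V → ℝ} {i : ℕ} (h : IsHomog (i + 1) φ) :
    φ 0 = 0 := by
  have := h 0 0 le_rfl
  rw [zero_smul_body] at this
  simpa using this

/-- Even, one-homogeneous valuations on the line-free classes vanish on planes. -/
theorem SegFree.eq_zero_of_even [FiniteDimensional ℝ V] (h2 : finrank ℝ V = 2)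
    {φ : ConvexBody V → ℝ} (hφ : SegFree φ) (hh : IsHomog 1 φ)
    (he : ∀ K : ConvexBody V, φ (K.mapCLM (-(ContinuousLinearMap.id ℝ V))) = φ K)
    (K : ConvexBody V) : φ K = 0 := by
  classical
  have htri : ∀ a b : V, φ (hull {0, a, b}) = 0 := by
    intro a b
    have hpair : φ (hull {a, b}) = 0 := by
      have := hφ.hull_eq_zero hh {a, b} (by simp) Finset.card_le_two
      simpa using this
    have h1 := hφ.val.hull_split (S := {a, b}) (by simp) (p := 0) (q := a + b)
      (s := (1 / 2 : ℝ) • a + (1 / 2 : ℝ) • b)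
      (by
        rw [convexHull_pair]
        exact ⟨1 / 2, 1 / 2, by norm_num, by norm_num, by norm_num, rfl⟩)
      ⟨1 / 2, 1 / 2, by norm_num, by norm_num, by norm_num, by simp⟩
    have h3 : hull {0, a + b, a, b} = 0 + seg a + seg b := by
      rw [zero_add, seg, seg, hull_add (by simp) (by simp) (by simp) (by simp)]
      congr 1
      ext x
      simp only [Set.mem_add, Set.mem_insert_iff, Set.mem_singleton_iff]
      constructor
      · rintro (rfl | rfl | rfl | rfl)
        · exact ⟨0, by simp, 0, by simp, by simp⟩
        · exact ⟨a, by simp, b, by simp, rfl⟩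
        · exact ⟨x, by simp, 0, by simp, by simp⟩
        · exact ⟨0, by simp, x, by simp, by simp⟩
      · rintro ⟨x, rfl | rfl, y, rfl | rfl, rfl⟩ <;> simp
    have h4 : φ (hull {0, a + b, a, b}) = 0 := by
      have h5 := hφ.lam_eq_zero b (0 + seg a)
      have h6 := hφ.lam_eq_zero a 0
      unfold lam at h5 h6
      rw [h3]
      linarith [hh.apply_zero]
    have h5 : φ (hull {a + b, a, b}) = φ (hull {0, a, b}) := by
      rw [← he (hull {0, a, b}), mapCLM_hull _ (by simp) (by simp),
        ← hφ.add_point (hull (_ '' _)) (a + b),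
        hull_add_point ((Set.toFinite _).image _) ((Set.insert_nonempty _ _).image _)]
      congr 2
      ext x
      simp [Set.image_insert_eq]
      tauto
    rw [h4, hpair, h5] at h1
    linarith
  refine eq_zero_of_affineIndependent hφ.cont hφ.val (fun s hs ha => ?_) K
  have hc := card_le_of_affineIndependent s ha
  rcases hc.lt_or_eq with hc | hc
  · exact hφ.hull_eq_zero hh s hs (by omega)
  · rw [h2] at hc
    obtain ⟨p, q, r, -, -, -, rfl⟩ := Finset.card_eq_three.1 hc
    rw [← hφ.add_point _ (-p), hull_add_point (by simp) (by simp), ← htri (q - p) (r - p)]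
    congr 2
    simp [Set.image_insert_eq, sub_eq_add_neg]

end TypeYGeneral

section TypeY

open ConvexBody

universe u

variable {V : Type u} [NormedAddCommGroup V] [NormedSpace ℂ V] [FiniteDimensional ℂ V]

@[simp] theorem cReal_apply (g : V →ₗ[ℂ] V) (x : V) : cReal g x = g x := rfl

/-- A family of valuations on which complex linear maps act through the determinant. -/
structure TypeY (y : ℂ → ConvexBody V → ℝ) : Prop where
  ctv : ∀ c, CTV (y c)
  smul : ∀ (t : ℝ), 0 < t → ∀ c K, y (t * c) K = t * y c K
  equiv : ∀ B : V →ₗ[ℂ] V, LinearMap.det B ≠ 0 → ∀ c K,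
    y c (K.mapCLM (cReal B)) = y (c * LinearMap.det B) K

namespace TypeY

variable {y : ℂ → ConvexBody V → ℝ}

theorem isHomog (hy : TypeY y) (c : ℂ) : IsHomog (finrank ℂ V) (y c) := by
  refine (hy.ctv c).isHomog_of_pos fun K t ht => ?_
  have h1 : t • K = K.mapCLM (cReal ((t : ℂ) • LinearMap.id)) := by
    rw [smul_eq_mapCLM]
    rfl
  have h2 : LinearMap.det ((t : ℂ) • (LinearMap.id : V →ₗ[ℂ] V))
      = ((t ^ finrank ℂ V : ℝ) : ℂ) := by
    rw [LinearMap.det_smul]; simp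
  rw [h1, hy.equiv _ (by rw [h2]; exact_mod_cast (pow_pos ht _).ne'), h2, mul_comm,
    hy.smul _ (pow_pos ht _)]

theorem zero (hy : TypeY y) (K : ConvexBody V) : y 0 K = 0 := by
  have := hy.smul 2 (by norm_num) 0 K
  rw [mul_zero] at this
  linarith

theorem lam_equiv (hy : TypeY y) (B : V →ₗ[ℂ] V) (hB : LinearMap.det B ≠ 0) (c : ℂ) (v : V)
    (K : ConvexBody V) :
    lam (B v) (y c) (K.mapCLM (cReal B)) = lam v (y (c * LinearMap.det B)) K := by
  have h1 := lam_map (cReal B) v (y c) K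
  rw [cReal_apply] at h1
  rw [← h1, funext (hy.equiv B hB c)]

theorem lam_proj (hy : TypeY y) {v : V} {ℓ : V →ₗ[ℂ] ℂ} (hv : ℓ v = 1) (c : ℂ)
    (K : ConvexBody V) :
    lam v (y c) K = lam v (y c) (K.mapCLM (cReal (LinearMap.id - ℓ.smulRight v))) := by
  have hcont : Continuous fun b : ℝ => cReal (LinearMap.id + ((b : ℂ) - 1) • ℓ.smulRight v) := by
    have : (fun b : ℝ => cReal (LinearMap.id + ((b : ℂ) - 1) • ℓ.smulRight v))
        = fun b : ℝ => cReal (LinearMap.id - ℓ.smulRight v) + b • cReal (ℓ.smulRight v) := by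
      ext b x
      simp [sub_smul]
      abel
    rw [this]
    fun_prop
  have h := eq_at_zero_of_pos
    (f := fun b : ℝ => lam v (y c)
      (K.mapCLM (cReal (LinearMap.id + ((b : ℂ) - 1) • ℓ.smulRight v))))
    (g := fun b => lam v (y c) K)
    (((hy.ctv c).lam v).cont.comp (by fun_prop)) (by fun_prop) ?_
  · rw [← h]
    congr 3
    ext x
    simp [sub_eq_add_neg]
  · intro b hb
    set B : V →ₗ[ℂ] V := LinearMap.id + ((b : ℂ) - 1) • ℓ.smulRight v with hB
    have hdet : LinearMap.det B = b := by
      have : B = LinearMap.transvection (((b : ℂ) - 1) • ℓ) v := by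
        ext x
        simp [hB, LinearMap.transvection.apply, smul_smul]
      rw [this, LinearMap.transvection.det]
      simp [hv]
    have hb0 : (b : ℂ) ≠ 0 := by exact_mod_cast hb.ne'
    have h1 := hy.lam_equiv B (by rw [hdet]; exact hb0) c v K
    have h2 : B v = b • v := by
      simp [hB, hv, sub_smul]
    rw [h2, (hy.ctv c).lam_smul, abs_of_pos hb, hdet, mul_comm c] at h1
    have h3 : lam v (y (b * c)) K = b * lam v (y c) K := by
      unfold lam
      rw [hy.smul b hb, hy.smul b hb]; ring
    rw [h3] at h1
    exact mul_left_cancel₀ hb.ne' h1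

/-- The family induced on a complex hyperplane. -/
theorem ker (hy : TypeY y) {v : V} {ℓ : V →ₗ[ℂ] ℂ} (hv : ℓ v = 1) :
    TypeY fun c (A : ConvexBody (LinearMap.ker ℓ)) =>
      lam v (y c) (A.mapCLM (LinearMap.toContinuousLinearMap
        ((LinearMap.ker ℓ).subtype.restrictScalars ℝ))) where
  ctv c := ((hy.ctv c).lam v).map _
  smul t ht c K := by
    unfold lam
    rw [hy.smul t ht, hy.smul t ht]; ring
  equiv B hB c K := by
    obtain ⟨prj, hprj⟩ : ∃ prj : V →ₗ[ℂ] LinearMap.ker ℓ, ∀ x, (prj x : V) = x - ℓ x • v :=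
      ⟨(LinearMap.id - ℓ.smulRight v).codRestrict _ (by intro x; simp [hv]), fun _ => rfl⟩
    let e : (LinearMap.ker ℓ × ℂ) ≃ₗ[ℂ] V :=
      LinearEquiv.ofLinearMap
        ((LinearMap.ker ℓ).subtype.coprod (LinearMap.toSpanSingleton ℂ V v))
        (prj.prod ℓ) (by ext x; simp [hprj]) (by
          ext x
          · simp [hprj]
          · simp
          · simp [hprj, hv]
          · simp [hv])
    let Bh : V →ₗ[ℂ] V := (e : (LinearMap.ker ℓ × ℂ) →ₗ[ℂ] V) ∘ₗ
      (B.prodMap LinearMap.id) ∘ₗ (e.symm : V →ₗ[ℂ] (LinearMap.ker ℓ × ℂ))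
    have hdet : LinearMap.det Bh = LinearMap.det B := by
      rw [LinearMap.det_conj, LinearMap.det_prodMap]
      simp
    have hBv : Bh v = v := by
      have : prj v = 0 := Subtype.ext (by simp [hprj, hv])
      simp [Bh, e, this, hv]
    have hBi : ∀ x : LinearMap.ker ℓ, Bh x = B x := by
      intro x
      have : prj x = x := Subtype.ext (by simp [hprj])
      simp [Bh, e, this]
    have h1 := hy.lam_equiv Bh (by rwa [hdet]) c v
      (K.mapCLM (LinearMap.toContinuousLinearMap
        ((LinearMap.ker ℓ).subtype.restrictScalars ℝ)))
    rw [hBv, hdet] at h1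
    rw [← h1, mapCLM_mapCLM, mapCLM_mapCLM]
    congr 2
    ext x
    exact (hBi x).symm

end TypeY

end TypeY

end

section

section TypeYPlane

set_option linter.unusedSectionVars false

open ConvexBody

universe u

variable {V : Type u} [NormedAddCommGroup V] [NormedSpace ℂ V] [FiniteDimensional ℂ V]

theorem dotBody_dotBody (A : ConvexBody ℂ) (a : ℂ) (w : V) :
    dotBody (dotBody A a) w = dotBody A (a • w) := by
  rw [dotBody, dotBody, mapCLM_mapCLM, dotBody]
  congr 1
  ext
  simp [mul_smul]

theorem dotBody_seg (a : ℂ) (w : V) : dotBody (seg a) w = seg (a • w) := by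
  rw [dotBody, mapCLM_seg]; rfl

theorem mapCLM_dotBody (g : V →ₗ[ℂ] V) (A : ConvexBody ℂ) (w : V) :
    (dotBody A w).mapCLM (cReal g) = dotBody A (g w) := by
  rw [dotBody, mapCLM_mapCLM, dotBody]
  congr 1
  ext
  simp

@[simp] theorem cdetCLM_apply (b : Basis (Fin 2) ℂ V) (w x : V) :
    cdetCLM b w x = b.coord 1 w * b.coord 0 x - b.coord 0 w * b.coord 1 x := rfl

/-- The planar valuation obtained from a family by adding a segment. -/
def planeVal (y : ℂ → ConvexBody V → ℝ) (b : Basis (Fin 2) ℂ V) (c : ℂ) (A : ConvexBody ℂ) : ℝ :=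
  lam (b 1) (y c) (dotBody A (b 0))

namespace TypeY

variable {y : ℂ → ConvexBody V → ℝ} (b : Basis (Fin 2) ℂ V)

theorem planeVal_ctv (hy : TypeY y) (c : ℂ) : CTV (planeVal y b c) :=
  ((hy.ctv c).lam _).map _

theorem isHomog_two (hy : TypeY y) (b : Basis (Fin 2) ℂ V) (c : ℂ) : IsHomog 2 (y c) := by
  have := hy.isHomog c
  rwa [finrank_eq_card_basis b, Fintype.card_fin] at this

theorem planeVal_homog (hy : TypeY y) (c : ℂ) : IsHomog 1 (planeVal y b c) := by
  intro K t ht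
  rw [planeVal, dotBody, mapCLM_smul, (hy.ctv c).lam_homog (hy.isHomog_two b c) _ _ t ht]
  rfl

theorem det_toLin (M : Matrix (Fin 2) (Fin 2) ℂ) :
    LinearMap.det (Matrix.toLin b b M) = M 0 0 * M 1 1 - M 0 1 * M 1 0 := by
  rw [LinearMap.det_toLin, Matrix.det_fin_two]

theorem planeVal_dotBody (hy : TypeY y) (c : ℂ) {a : ℂ} (ha : a ≠ 0) (A : ConvexBody ℂ) :
    planeVal y b c (dotBody A a) = planeVal y b (c * a) A := by
  set B := Matrix.toLin b b !![a, 0; 0, 1] with hB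
  have hd : LinearMap.det B = a := by rw [hB, det_toLin]; simp
  have h0 : B (b 0) = a • b 0 := by rw [hB, Matrix.toLin_self]; simp
  have h1 : B (b 1) = b 1 := by rw [hB, Matrix.toLin_self]; simp
  have := hy.lam_equiv B (by rwa [hd]) c (b 1) (dotBody A (b 0))
  rw [h1, hd, mapCLM_dotBody, h0, ← dotBody_dotBody] at this
  exact this

theorem planeVal_neg (hy : TypeY y) (c : ℂ) (A : ConvexBody ℂ) :
    planeVal y b (-c) A = planeVal y b c A := by
  set B : V →ₗ[ℂ] V := (-1 : ℂ) • LinearMap.id with hB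
  have hd : LinearMap.det B = 1 := by
    rw [hB, LinearMap.det_smul, finrank_eq_card_basis b]; simp
  have h := hy.lam_equiv B (by simp [hd]) c (b 1) (dotBody A (b 0))
  have h0 : ∀ x, B x = (-1 : ℂ) • x := fun x => rfl
  rw [hd, mapCLM_dotBody, h0, h0, ← dotBody_dotBody, neg_one_smul, (hy.ctv c).lam_neg,
    mul_one] at h
  have h2 := hy.planeVal_dotBody b c (a := -1) (by simp) A
  rw [mul_neg_one] at h2
  rw [← h2]
  exact h

theorem lam_eq_planeVal (hy : TypeY y) (w : V) (c : ℂ) (K : ConvexBody V) :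
    lam w (y c) K = planeVal y b c (detBody b K w) := by
  rcases eq_or_ne w 0 with rfl | hw
  · have : detBody b K 0 = 0 := by
      rw [detBody, ← mapCLM_zero K]
      congr 1
      ext x
      simp
    rw [lam_zero, this, (hy.planeVal_homog b c).apply_zero]
  · obtain ⟨s, t, hst⟩ : ∃ s t : ℂ, s * b.coord 1 w - t * b.coord 0 w = 1 := by
      by_cases h : b.coord 1 w = 0
      · have h0 : b.coord 0 w ≠ 0 := by
          intro h0
          apply hw
          apply b.ext_elem
          intro i
          fin_cases i
          · simpa using h0
          · simpa using h
        exact ⟨0, -(b.coord 0 w)⁻¹, by rw [h]; field_simp; simp⟩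
      · exact ⟨(b.coord 1 w)⁻¹, 0, by field_simp; simp⟩
    set x := s • b 0 + t • b 1 with hx
    set B := Matrix.toLin b b !![s, b.coord 0 w; t, b.coord 1 w] with hB
    have hd : LinearMap.det B = 1 := by
      rw [hB, det_toLin]
      simp only [Matrix.of_apply, Matrix.cons_val', Matrix.cons_val_zero, Matrix.cons_val_one,
        Matrix.cons_val_fin_one]
      rw [← hst]; ring
    have h0 : B (b 0) = x := by rw [hB, Matrix.toLin_self]; simp [hx]
    have h1 : B (b 1) = w := by
      rw [hB, Matrix.toLin_self]
      have := b.sum_repr w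
      rw [Fin.sum_univ_two] at this
      simpa using this
    obtain ⟨ℓ, hℓ⟩ : ∃ ℓ : V →ₗ[ℂ] ℂ, ∀ k, ℓ k = s * b.coord 1 k - t * b.coord 0 k :=
      ⟨s • b.coord 1 - t • b.coord 0, fun k => by simp⟩
    rw [hy.lam_proj (ℓ := ℓ) (v := w) (by rw [hℓ, hst]) c K]
    have h2 : K.mapCLM (cReal (LinearMap.id - ℓ.smulRight w))
        = (dotBody (detBody b K w) (b 0)).mapCLM (cReal B) := by
      rw [mapCLM_dotBody, h0, detBody, dotBody, mapCLM_mapCLM]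
      congr 1
      ext k
      apply b.ext_elem
      intro i
      have h3 := hℓ k
      simp only [Basis.coord_apply] at h3 hst
      fin_cases i
      · simp [hx, h3]
        linear_combination (-(b.repr k 0)) * hst
      · simp [hx, h3]
        linear_combination (-(b.repr k 1)) * hst
    have h4 := hy.lam_equiv B (by simp [hd]) c (b 1) (dotBody (detBody b K w) (b 0))
    rw [h1, ← h2, hd, mul_one] at h4
    exact h4

/-- The value of the planar valuation on a segment. -/
def eta (y : ℂ → ConvexBody V → ℝ) (b : Basis (Fin 2) ℂ V) (c : ℂ) : ℝ := planeVal y b c (seg 1)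

theorem planeVal_zero (hy : TypeY y) (A : ConvexBody ℂ) : planeVal y b 0 A = 0 := by
  simp [planeVal, lam, hy.zero]

theorem eta_smul (hy : TypeY y) {t : ℝ} (ht : 0 < t) (c : ℂ) :
    eta y b (t * c) = t * eta y b c := by
  simp only [eta, planeVal, lam, hy.smul t ht]; ring

theorem eta_neg (hy : TypeY y) (c : ℂ) : eta y b (-c) = eta y b c :=
  hy.planeVal_neg b c _

theorem planeVal_seg (hy : TypeY y) (c w : ℂ) : planeVal y b c (seg w) = eta y b (c * w) := by
  rcases eq_or_ne w 0 with rfl | hw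
  · rw [seg_zero, mul_zero, eta, hy.planeVal_zero, (hy.planeVal_homog b c).apply_zero]
  · rw [eta, ← hy.planeVal_dotBody b c hw, dotBody_seg, smul_eq_mul, one_mul]

theorem planeVal_add_seg (hy : TypeY y) (c w : ℂ) (A : ConvexBody ℂ) :
    planeVal y b c (A + seg w) = planeVal y b c A + eta y b (c * w) := by
  have h1 : IsHomog 0 (lam w (planeVal y b c)) :=
    (hy.planeVal_ctv b c).lam_homog (hy.planeVal_homog b c) w
  have h2 := h1.eq_zero_body A
  unfold lam at h2
  rw [zero_add, hy.planeVal_seg, (hy.planeVal_homog b c).apply_zero] at h2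
  linarith

theorem add_seg_seg (hy : TypeY y) (c : ℂ) (a a' : V) (K : ConvexBody V) :
    y c (K + seg a + seg a') = y c K + planeVal y b c (detBody b K a)
      + planeVal y b c (detBody b K a')
      + eta y b (c * cdetCLM b a' a) := by
  have h1 := hy.lam_eq_planeVal b a c K
  have h2 := hy.lam_eq_planeVal b a' c (K + seg a)
  rw [detBody, mapCLM_add, mapCLM_seg, hy.planeVal_add_seg] at h2
  unfold lam at h1 h2
  unfold detBody at h1 ⊢
  linarith

end TypeY

end TypeYPlane

end

section

section TypeYZero

set_option linter.unusedSectionVars false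

open ConvexBody

universe u

variable {V : Type u} [NormedAddCommGroup V] [NormedSpace ℂ V] [FiniteDimensional ℂ V]

theorem hull_pairs_neg (p q : V) :
    hull {p, -p, q, -q} = 0 + seg (p - q) + seg (p + q) + point (-p) := by
  rw [zero_add, seg, seg, hull_add (by simp) (by simp) (by simp) (by simp),
    hull_add_point (Set.Finite.add (by simp) (by simp)) (Set.Nonempty.add (by simp) (by simp))]
  congr 1
  ext x
  simp only [Set.mem_image, Set.mem_add, Set.mem_insert_iff, Set.mem_singleton_iff]
  constructor
  · rintro (rfl | rfl | rfl | rfl)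
    · exact ⟨x - q + (x + q), ⟨x - q, by simp, x + q, by simp, rfl⟩, by abel⟩
    · exact ⟨0, ⟨0, by simp, 0, by simp, by simp⟩, by simp⟩
    · exact ⟨p + x, ⟨0, by simp, p + x, by simp, by simp⟩, by abel⟩
    · exact ⟨p - q, ⟨p - q, by simp, 0, by simp, by simp⟩, by abel⟩
  · rintro ⟨_, ⟨x, rfl | rfl, y, rfl | rfl, rfl⟩, rfl⟩
    · simp
    · simp
    · right; right; right; abel
    · left; abel

namespace TypeY

variable {y : ℂ → ConvexBody V → ℝ} (b : Basis (Fin 2) ℂ V)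

/-- The square with vertices the fourth roots of unity. -/
def square : ConvexBody ℂ := hull {1, -1, Complex.I, -Complex.I}

/-- The sum of the two side lengths of the square. -/
def rho (y : ℂ → ConvexBody V → ℝ) (b : Basis (Fin 2) ℂ V) (c : ℂ) : ℝ :=
  eta y b (c * (1 - Complex.I)) + eta y b (c * (1 + Complex.I))

theorem planeVal_square (hy : TypeY y) (c w : ℂ) :
    planeVal y b c (dotBody square w) = rho y b (c * w) := by
  have h : ∀ c, planeVal y b c square = rho y b c := by
    intro c
    rw [square, hull_pairs_neg, (hy.planeVal_ctv b c).add_point, hy.planeVal_add_seg,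
      hy.planeVal_add_seg, (hy.planeVal_homog b c).apply_zero, zero_add, rho]
  rcases eq_or_ne w 0 with rfl | hw
  · have : dotBody square (0 : ℂ) = 0 := by
      rw [dotBody, ← mapCLM_zero square]
      congr 1
      ext
      simp
    rw [this, (hy.planeVal_homog b c).apply_zero, rho]
    simp [eta, hy.planeVal_zero]
  · rw [hy.planeVal_dotBody b c hw, h]

/-- The orbit of a vector under the fourth roots of unity. -/
def quad (x : V) : Set V := {x, -x, Complex.I • x, -(Complex.I • x)}

theorem quad_finite (x : V) : (quad x).Finite := by simp [quad]

theorem quad_nonempty (x : V) : (quad x).Nonempty := ⟨x, by simp [quad]⟩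

theorem quad_neg (x : V) : quad (-x) = quad x := by
  ext y
  simp only [quad, smul_neg, neg_neg, Set.mem_insert_iff, Set.mem_singleton_iff]
  tauto

theorem quad_I (x : V) : quad (Complex.I • x) = quad x := by
  ext y
  simp only [quad, smul_smul, Complex.I_mul_I, neg_one_smul, neg_neg, Set.mem_insert_iff,
    Set.mem_singleton_iff]
  tauto

theorem quad_zero : quad (0 : V) = {0} := by simp [quad]

theorem image_quad (w x : V) : (cdetCLM b w) '' quad x = quad (cdetCLM b w x) := by
  simp only [quad, Set.image_insert_eq, Set.image_singleton, map_neg]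
  have : cdetCLM b w (Complex.I • x) = Complex.I • cdetCLM b w x := by simp; ring
  rw [this]

theorem hull_quad_zero_union (z : ℂ) : hull ({0} ∪ quad z) = hull (quad z) := by
  apply hull_insert_of_mem (quad_finite z)
  have := (convex_convexHull ℝ (quad z))
    (subset_convexHull ℝ _ (show z ∈ _ by simp [quad]))
    (subset_convexHull ℝ _ (show -z ∈ _ by simp [quad]))
    (show (0 : ℝ) ≤ 1 / 2 by norm_num) (show (0 : ℝ) ≤ 1 / 2 by norm_num) (by norm_num)
  simpa using this

theorem dotBody_square (z : ℂ) : dotBody square z = hull (quad z) := by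
  rw [dotBody, square, mapCLM_hull _ (by simp) (by simp)]
  simp [Set.image_insert_eq, quad]

/-- The vertices of the 16-cell. -/
def cell (b : Basis (Fin 2) ℂ V) : Set V := quad (b 0) ∪ quad (b 1)

theorem cell_finite : (cell b).Finite := (quad_finite _).union (quad_finite _)

theorem cell_nonempty : (cell b).Nonempty := (quad_nonempty _).inl

theorem cell_eq : cell b = {b 0, -b 0, b 1, -b 1} ∪
    {Complex.I • b 0, -(Complex.I • b 0), Complex.I • b 1, -(Complex.I • b 1)} := by
  ext x
  simp only [cell, quad, Set.mem_union, Set.mem_insert_iff, Set.mem_singleton_iff]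
  tauto

theorem detBody_cell (w : V) : detBody b (hull (cell b)) w
    = hull (quad (b.coord 1 w) ∪ quad (b.coord 0 w)) := by
  rw [detBody, mapCLM_hull _ (cell_finite b) (cell_nonempty b), cell, Set.image_union,
    image_quad, image_quad]
  have h0 : cdetCLM b w (b 0) = b.coord 1 w := by simp
  have h1 : cdetCLM b w (b 1) = -b.coord 0 w := by simp
  rw [h0, h1, quad_neg]

theorem planeVal_cell (hy : TypeY y) (c : ℂ) {w : V} {z : ℂ}
    (h : quad (b.coord 1 w) ∪ quad (b.coord 0 w) = quad z ∨
      quad (b.coord 1 w) ∪ quad (b.coord 0 w) = {0} ∪ quad z) :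
    planeVal y b c (detBody b (hull (cell b)) w) = rho y b (c * z) := by
  rw [← hy.planeVal_square, detBody_cell, dotBody_square]
  rcases h with h | h
  · rw [h]
  · rw [h, hull_quad_zero_union]

theorem detBody_seg_seg (w a a' : V) : detBody b (0 + seg a + seg a') w
    = 0 + seg (cdetCLM b w a) + seg (cdetCLM b w a') := by
  rw [detBody, mapCLM_add, mapCLM_add, mapCLM_seg, mapCLM_seg, ← point_zero, mapCLM_point,
    map_zero, point_zero]

theorem planeVal_seg_seg (hy : TypeY y) (c : ℂ) (w a a' : V) :
    planeVal y b c (detBody b (0 + seg a + seg a') w)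
      = eta y b (c * cdetCLM b w a) + eta y b (c * cdetCLM b w a') := by
  rw [detBody_seg_seg, hy.planeVal_add_seg, hy.planeVal_add_seg,
    (hy.planeVal_homog b c).apply_zero, zero_add]

theorem seg_seg (hy : TypeY y) (c : ℂ) (a a' : V) : y c (0 + seg a + seg a') =
    eta y b (c * cdetCLM b a' a) := by
  have h0 : ∀ w, detBody b (0 : ConvexBody V) w = 0 := fun w => by
    rw [detBody, ← point_zero, mapCLM_point, map_zero, point_zero]
  rw [hy.add_seg_seg b, h0, h0, (hy.planeVal_homog b c).apply_zero,
    (hy.isHomog_two b c).apply_zero]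
  simp

theorem four_seg (hy : TypeY y) (c : ℂ) (p q r s : V) :
    y c ((0 + seg p + seg q) + (0 + seg r + seg s)) =
      eta y b (c * cdetCLM b q p) + eta y b (c * cdetCLM b r p) + eta y b (c * cdetCLM b r q)
      + eta y b (c * cdetCLM b s p) + eta y b (c * cdetCLM b s q)
      + eta y b (c * cdetCLM b s r) := by
  rw [zero_add (seg r), ← add_assoc, ← zero_add (seg r), zero_add (seg r), hy.add_seg_seg b,
    hy.planeVal_seg_seg, hy.planeVal_seg_seg, hy.seg_seg b]
  simp only [cdetCLM_apply]
  ring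

theorem eta_two_mul (hy : TypeY y) (c : ℂ) : eta y b (c * 2) = 2 * eta y b c := by
  have := hy.eta_smul b (t := 2) (by norm_num) c
  rw [mul_comm]
  exact_mod_cast this

theorem two_cover (hy : TypeY y) (c : ℂ) {p q r s : V}
    (h : cell b = {p, -p, q, -q} ∪ {r, -r, s, -s}) :
    4 * y c (hull (cell b)) + y c ((0 + seg (p - q) + seg (p + q)) +
      (0 + seg (r - s) + seg (r + s))) = y c (hull (cell b) + seg (p - q) + seg (p + q))
      + y c (hull (cell b) + seg (r - s) + seg (r + s)) := by
  have h1 := (hy.ctv c).val.hull_union (s := {p, -p, q, -q}) (t := {r, -r, s, -s}) (by simp)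
    (by simp) (by simp) (by simp)
  have h2 : hull (cell b) + hull (cell b) = (2 : ℝ) • hull (cell b) := by
    rw [show (2 : ℝ) = ((2 : ℕ) : ℝ) by norm_num, natCast_smul, two_nsmul]
  have h3 : ∀ K X Y : ConvexBody V, K + X + Y = K + (0 + X + Y) := fun K X Y => by
    rw [zero_add, add_assoc]
  rw [h3 (hull (cell b)) (seg (p - q)), h3 (hull (cell b)) (seg (r - s))]
  rw [← h, h2, hy.isHomog_two b c _ _ (by norm_num), hull_pairs_neg, hull_pairs_neg] at h1
  generalize 0 + seg (p - q) + seg (p + q) = X at h1 ⊢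
  generalize 0 + seg (r - s) + seg (r + s) = Y at h1 ⊢
  rw [add_add_add_comm, ← add_assoc, (hy.ctv c).add_point, (hy.ctv c).add_point,
    ← add_assoc, (hy.ctv c).add_point, ← add_assoc, (hy.ctv c).add_point] at h1
  linarith

theorem eta_eq_zero (hy : TypeY y) (c : ℂ) : eta y b c = 0 := by
  have hI : Complex.I * Complex.I = -1 := Complex.I_mul_I
  have hq : quad Complex.I = quad (1 : ℂ) := by simpa using quad_I (1 : ℂ)
  have e2 := hy.eta_two_mul b
  have e2n : ∀ c, eta y b (c * (-2)) = 2 * eta y b c := fun c => by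
    rw [mul_neg, hy.eta_neg, e2]
  have e2I : ∀ c, eta y b (c * (2 * Complex.I)) = 2 * eta y b (c * Complex.I) := fun c => by
    rw [← e2]; congr 1; ring
  have e2In : ∀ c, eta y b (c * (-(2 * Complex.I))) = 2 * eta y b (c * Complex.I) := fun c => by
    rw [mul_neg, hy.eta_neg, e2I]
  have e0 : ∀ c, eta y b (c * 0) = 0 := fun c => by rw [mul_zero, eta, hy.planeVal_zero]
  have hrel : ∀ c, eta y b (c * (1 - Complex.I)) + eta y b (c * (1 + Complex.I))
      = eta y b c + 2 * eta y b (c * Complex.I) := by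
    intro c
    have h1 := hy.two_cover b c (cell_eq b)
    have h2 := hy.two_cover b c (p := b 0) (q := Complex.I • b 0) (r := b 1)
      (s := Complex.I • b 1) rfl
    have a1 : cdetCLM b (b 0 + b 1) (b 0 - b 1) = 2 := by simp; norm_num
    have a2 : cdetCLM b (Complex.I • b 0 - Complex.I • b 1) (b 0 - b 1) = 0 := by simp
    have a3 : cdetCLM b (Complex.I • b 0 - Complex.I • b 1) (b 0 + b 1)
        = -(2 * Complex.I) := by simp; ring
    have a4 : cdetCLM b (Complex.I • b 0 + Complex.I • b 1) (b 0 - b 1)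
        = 2 * Complex.I := by simp; ring
    have a5 : cdetCLM b (Complex.I • b 0 + Complex.I • b 1) (b 0 + b 1) = 0 := by simp
    have a6 : cdetCLM b (Complex.I • b 0 + Complex.I • b 1) (Complex.I • b 0 - Complex.I • b 1)
        = -2 := by simp; norm_num
    have b1 : cdetCLM b (b 0 + Complex.I • b 0) (b 0 - Complex.I • b 0) = 0 := by simp
    have b2 : cdetCLM b (b 1 - Complex.I • b 1) (b 0 - Complex.I • b 0)
        = -(2 * Complex.I) := by simp; linear_combination hI
    have b3 : cdetCLM b (b 1 - Complex.I • b 1) (b 0 + Complex.I • b 0) = 2 := by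
      simp; linear_combination -hI
    have b4 : cdetCLM b (b 1 + Complex.I • b 1) (b 0 - Complex.I • b 0) = 2 := by
      simp; linear_combination -hI
    have b5 : cdetCLM b (b 1 + Complex.I • b 1) (b 0 + Complex.I • b 0)
        = 2 * Complex.I := by simp; linear_combination hI
    have b6 : cdetCLM b (b 1 + Complex.I • b 1) (b 1 - Complex.I • b 1) = 0 := by simp
    rw [hy.four_seg b, hy.add_seg_seg b, hy.add_seg_seg b, a1, a2, a3, a4, a5, a6,
      hy.planeVal_cell b c (z := 1), hy.planeVal_cell b c (z := 1),
      hy.planeVal_cell b c (z := 1), hy.planeVal_cell b c (z := 1)] at h1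
    · rw [hy.four_seg b, hy.add_seg_seg b, hy.add_seg_seg b, b1, b2, b3, b4, b5, b6,
        hy.planeVal_cell b c (z := 1 - Complex.I), hy.planeVal_cell b c (z := 1 + Complex.I),
        hy.planeVal_cell b c (z := 1 - Complex.I), hy.planeVal_cell b c (z := 1 + Complex.I)]
        at h2
      · have r1 : rho y b (c * (1 - Complex.I))
            = 2 * eta y b (c * Complex.I) + 2 * eta y b c := by
          rw [rho, ← e2In, ← e2]
          congr 2
          · linear_combination c * hI
          · linear_combination (-c) * hI
        have r2 : rho y b (c * (1 + Complex.I))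
            = 2 * eta y b c + 2 * eta y b (c * Complex.I) := by
          rw [rho, ← e2I, ← e2]
          congr 2
          · linear_combination (-c) * hI
          · linear_combination c * hI
        rw [r1, r2] at h2
        simp only [mul_one, rho] at h1
        simp only [e2, e2n, e2I, e2In, e0] at h1 h2
        linarith
      all_goals right
      all_goals simp [quad_zero, Set.union_comm]
    all_goals left
    all_goals simp [quad_neg, hq]
  have h3 : ∀ c, eta y b (c * Complex.I) = eta y b c := by
    intro c
    have h1 := hrel c
    have h2 := hrel (c * Complex.I)
    have h4 : eta y b (c * Complex.I * (1 - Complex.I)) = eta y b (c * (1 + Complex.I)) := by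
      congr 1; linear_combination (-c) * hI
    have h5 : eta y b (c * Complex.I * (1 + Complex.I)) = eta y b (c * (1 - Complex.I)) := by
      rw [← hy.eta_neg]; congr 1; linear_combination (-c) * hI
    have h6 : eta y b (c * Complex.I * Complex.I) = eta y b c := by
      rw [← hy.eta_neg]; congr 1; linear_combination (-c) * hI
    rw [h4, h5, h6] at h2
    linarith
  have h4 : ∀ c, 2 * eta y b (c * (1 + Complex.I)) = 3 * eta y b c := by
    intro c
    have h1 := hrel c
    have h5 : eta y b (c * (1 - Complex.I)) = eta y b (c * (1 + Complex.I)) := by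
      rw [← h3 (c * (1 - Complex.I))]; congr 1; linear_combination (-c) * hI
    rw [h3, h5] at h1
    linarith
  have h5 := h4 (c * (1 + Complex.I))
  have h6 : eta y b (c * (1 + Complex.I) * (1 + Complex.I)) = 2 * eta y b c := by
    rw [← h3 c, ← e2I]; congr 1; linear_combination c * hI
  linarith [h4 c]

end TypeY

end TypeYZero

end

section

section TypeYGeneral

open ConvexBody

universe u

namespace TypeY

theorem planeVal_eq_zero {V : Type u} [NormedAddCommGroup V] [NormedSpace ℂ V]
    [FiniteDimensional ℂ V] {y : ℂ → ConvexBody V → ℝ} (hy : TypeY y) (b : Basis (Fin 2) ℂ V)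
    (c : ℂ) (A : ConvexBody ℂ) : planeVal y b c A = 0 := by
  have hs : SegFree (planeVal y b c) :=
    { hy.planeVal_ctv b c with
      lam_eq_zero := fun v K => by
        unfold lam
        rw [hy.planeVal_add_seg, hy.eta_eq_zero]; ring }
  refine SegFree.eq_zero_of_even Complex.finrank_real_complex hs (hy.planeVal_homog b c)
    (fun K => ?_) A
  have h : K.mapCLM (-(ContinuousLinearMap.id ℝ ℂ)) = dotBody K (-1) := by
    unfold dotBody
    congr 1
    ext : 1; simp
  rw [h, hy.planeVal_dotBody b c (by simp), mul_neg_one, hy.planeVal_neg]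

/-- Families of type `Y` vanish. -/
theorem eq_zero (q : ℕ) (hq : 2 ≤ q) : ∀ {V : Type u} [NormedAddCommGroup V] [NormedSpace ℂ V]
    [FiniteDimensional ℂ V] {y : ℂ → ConvexBody V → ℝ}, TypeY y → finrank ℂ V = q →
    ∀ c K, y c K = 0 := by
  induction q, hq using Nat.le_induction with
  | base =>
    intro V _ _ _ y hy hV c K
    have b := finBasisOfFinrankEq ℂ V hV
    have hs : SegFree (y c) :=
      { hy.ctv c with
        lam_eq_zero := fun v K => by rw [hy.lam_eq_planeVal b, hy.planeVal_eq_zero b] }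
    exact hs.eq_zero_of_eq (hV ▸ hy.isHomog c) le_rfl (by rw [finrank_real_of_complex, hV]) K
  | succ q hq ih =>
    intro V _ _ _ y hy hV c K
    have hs : SegFree (y c) :=
      { hy.ctv c with
        lam_eq_zero := fun v K => by
          rcases eq_or_ne v 0 with rfl | hv
          · rw [lam_zero]
          obtain ⟨ℓ, hℓ⟩ : ∃ ℓ : V →ₗ[ℂ] ℂ, ℓ v = 1 := by
            obtain ⟨ℓ, hℓ⟩ := SeparatingDual.exists_eq_one (R := ℂ) hv
            exact ⟨ℓ, hℓ⟩
          have hfin : finrank ℂ (LinearMap.ker ℓ) = q := by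
            have := Module.Dual.finrank_ker_add_one_of_ne_zero (f := ℓ) (by rintro rfl; simp at hℓ)
            omega
          have h1 := fun A => ih (hy.ker hℓ) hfin c A
          rw [hy.lam_proj hℓ]
          let prj : V →ₗ[ℂ] LinearMap.ker ℓ :=
            (LinearMap.id - ℓ.smulRight v).codRestrict _ (by intro x; simp [hℓ])
          rw [← h1 (K.mapCLM (LinearMap.toContinuousLinearMap (prj.restrictScalars ℝ))),
            mapCLM_mapCLM]
          rfl }
    exact hs.eq_zero_of_eq (hV ▸ hy.isHomog c) (by omega) (by rw [finrank_real_of_complex, hV]) K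

end TypeY

end TypeYGeneral

end

section

section Shear

set_option linter.unusedSectionVars false

open ConvexBody

variable {V : Type*} [NormedAddCommGroup V] [NormedSpace ℝ V] [FiniteDimensional ℝ V]

/-- The map `x ↦ x + ℓ(x) w`. -/
def shear (ℓ : V →ₗ[ℝ] ℝ) (w : V) : V →L[ℝ] V :=
  LinearMap.toContinuousLinearMap (LinearMap.id + ℓ.smulRight w)

@[simp] theorem shear_apply (ℓ : V →ₗ[ℝ] ℝ) (w x : V) : shear ℓ w x = x + ℓ x • w := rfl

/-- Every function on `s` extends to an affine function. -/
def AffFree (s : Set V) : Prop :=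
  ∀ F : V → ℝ, ∃ ℓ : V →ₗ[ℝ] ℝ, ∃ d : ℝ, ∀ x ∈ s, ℓ x + d = F x

theorem AffFree.mono {s t : Set V} (ht : AffFree t) (h : s ⊆ t) : AffFree s := fun F => by
  obtain ⟨ℓ, d, hℓ⟩ := ht F
  exact ⟨ℓ, d, fun x hx => hℓ x (h hx)⟩

theorem AffFree.replace {s : Set V} (hs : AffFree s) {p q : V} (hp : p ∈ s) (hq : q ∈ s)
    (hpq : p ≠ q) {α β : ℝ} (hα : α ≠ 0) (hαβ : α + β = 1) :
    AffFree (insert (α • p + β • q) (s \ {p})) := fun F => by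
  classical
  obtain ⟨ℓ, d, hℓ⟩ := hs fun x => if x = p then α⁻¹ * (F (α • p + β • q) - β * F q) else F x
  refine ⟨ℓ, d, ?_⟩
  rintro x (rfl | hx)
  · have h1 := hℓ p hp
    have h2 := hℓ q hq
    rw [if_pos rfl] at h1
    rw [if_neg hpq.symm] at h2
    rw [map_add, map_smul, map_smul, smul_eq_mul, smul_eq_mul]
    have h3 : α * (ℓ p + d) = F (α • p + β • q) - β * F q := by
      rw [h1]; field_simp
    linear_combination h3 + β * h2 - d * hαβ
  · rw [hℓ x hx.1, if_neg (by simpa using hx.2)]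

theorem AffineIndependent.affFree {s : Finset V} (hs : AffineIndependent ℝ ((↑) : s → V)) :
    AffFree (s : Set V) := fun F => by
  rcases s.eq_empty_or_nonempty with rfl | ⟨x₀, hx₀⟩
  · exact ⟨0, 0, by simp⟩
  have h := (affineIndependent_iff_linearIndependent_vsub ℝ _ (⟨x₀, hx₀⟩ : s)).1 hs
  let b := Basis.span h
  obtain ⟨g, hg⟩ := LinearMap.exists_extend (b.constr ℝ fun i => F i - F x₀)
  refine ⟨g, F x₀ - g x₀, fun x hx => ?_⟩
  by_cases hxx : x = x₀
  · subst hxx; ring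
  have h1 : g (x - x₀) = F x - F x₀ := by
    have h2 := b.constr_basis ℝ (fun i => F i - F x₀) ⟨⟨x, hx⟩, fun h => hxx (congrArg Subtype.val h)⟩
    rw [← hg] at h2
    simpa [b, Basis.span_apply] using h2
  rw [map_sub] at h1
  linarith

/-- Valuations invariant under all shears along `w`, vanishing on a hyperplane and
homogeneous of a wrong degree with respect to a dilation in direction `w`. -/
structure ShearInv (ψ : ConvexBody V → ℝ) (w : V) (π : V →ₗ[ℝ] ℝ) (N : ℕ) (θ : ℝ) : Prop where
  ctv : CTV ψ
  apply_w : π w = 1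
  ne : θ ≠ N
  shear : ∀ ℓ : V →ₗ[ℝ] ℝ, ℓ w = 0 → ∀ K, ψ (K.mapCLM (shear ℓ w)) = ψ K
  flat : ∀ K : ConvexBody V, (∀ x ∈ K, π x = 0) → ψ K = 0
  scale : ∀ K : ConvexBody V, ψ (K.mapCLM (_root_.shear (((N : ℝ) - 1) • π) w)) = θ * ψ K

namespace ShearInv

variable {ψ : ConvexBody V → ℝ} {w : V} {π : V →ₗ[ℝ] ℝ} {N : ℕ} {θ : ℝ}

theorem hull_eq_zero_of_const (h : ShearInv ψ w π N θ) {κ : V →ₗ[ℝ] ℝ} (hκ : κ w = 1) {d : ℝ}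
    {s : Set V} (hs : s.Finite) (hn : s.Nonempty) (hd : ∀ x ∈ s, κ x = d) : ψ (hull s) = 0 := by
  rw [← h.ctv.add_point _ (-(d • w)), ← h.shear (κ - π) (by simp [hκ, h.apply_w])]
  apply h.flat
  intro x hx
  rw [hull_add_point hs hn, mapCLM_hull _ (hs.image _) (hn.image _), ← mem_coe,
    coe_hull ((hs.image _).image _) ((hn.image _).image _)] at hx
  have hc : Convex ℝ {x : V | π x = 0} := (LinearMap.ker π).convex
  refine convexHull_min ?_ hc hx
  rintro _ ⟨_, ⟨y, hy, rfl⟩, rfl⟩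
  simp [hκ, h.apply_w, hd y hy]

theorem scale' (h : ShearInv ψ w π N θ) {κ : V →ₗ[ℝ] ℝ} (hκ : κ w = 1) (K : ConvexBody V) :
    ψ (K.mapCLM (_root_.shear (((N : ℝ) - 1) • κ) w)) = θ * ψ K := by
  rw [← h.shear (κ - π) (by simp [hκ, h.apply_w]), ← h.shear (κ - π) (by simp [hκ, h.apply_w]) K,
    ← h.scale, mapCLM_mapCLM, mapCLM_mapCLM]
  congr 2
  ext x
  simp [hκ, h.apply_w, sub_smul, add_smul, sub_mul]
  abel_nf

theorem hull_vertical (h : ShearInv ψ w π N θ) {R : Set V} (hR : R.Finite) {q : V} {δ : ℝ}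
    (hδ : δ ≠ 0) (hf : AffFree (insert (q + δ • w) (insert q R))) (hp : q + δ • w ∉ R)
    (hq : q ∉ R) (hw : w ≠ 0) : ψ (hull (insert (q + δ • w) (insert q R))) = 0 := by
  classical
  have hpq : q + δ • w ≠ q := by simp [hδ, hw]
  obtain ⟨κ, d, hκ⟩ := hf fun x => if x = q + δ • w then δ else 0
  have hκq : κ q = -d := by
    have := hκ q (by simp); rw [if_neg hpq.symm] at this; linarith
  have hκR : ∀ x ∈ R, κ x = -d := fun x hx => by
    have := hκ x (by simp [hx])
    rw [if_neg (by rintro rfl; exact hp hx)] at this; linarith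
  have hκw : κ w = 1 := by
    have := hκ (q + δ • w) (by simp)
    rw [if_pos rfl, map_add, map_smul, hκq, smul_eq_mul] at this
    have : δ * (κ w - 1) = 0 := by linarith
    have := (mul_eq_zero.1 this).resolve_left hδ
    linarith
  obtain ⟨ℓ, c, hℓ⟩ := hf fun x => if x ∈ R then 0 else 1
  have hℓq : ℓ q = 1 - c := by
    have := hℓ q (by simp); rw [if_neg hq] at this; linarith
  have hℓR : ∀ x ∈ R, ℓ x = - c := fun x hx => by
    have := hℓ x (by simp [hx])
    rw [if_pos hx] at this; linarith
  have hℓw : ℓ w = 0 := by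
    have := hℓ (q + δ • w) (by simp)
    rw [if_neg hp, map_add, map_smul, hℓq, smul_eq_mul] at this
    have : δ * ℓ w = 0 := by linarith
    exact (mul_eq_zero.1 this).resolve_left hδ
  set g : ℝ → ℝ := fun t => ψ (hull (insert (q + t • w) (insert q R))) with hg
  have hfin : ∀ t : ℝ, (insert (q + t • w) (insert q R)).Finite := fun t =>
    (hR.insert _).insert _
  -- shift of the base point
  have hshift : ∀ (t : ℝ) (X : Set V), X.Finite → X.Nonempty →
      ψ (hull ((fun x => x + (t * (ℓ x + c)) • w) '' X)) = ψ (hull X) := by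
    intro t X hX hXn
    rw [← h.shear (t • ℓ) (by simp [hℓw]) (hull X),
      ← h.ctv.add_point (ConvexBody.mapCLM _ (hull X)) ((t * c) • w), mapCLM_hull _ hX hXn,
      hull_add_point (hX.image _) (hXn.image _), Set.image_image]
    congr 3
    ext x
    simp [mul_add, add_smul, add_assoc]
  have himR : ∀ t : ℝ, (fun x => x + (t * (ℓ x + c)) • w) '' R = R := fun t => by
    conv_rhs => rw [← Set.image_id R]
    exact Set.image_congr fun x hx => by simp [hℓR x hx]
  have hadd : ∀ k : ℕ, g (((k : ℝ) + 1) * δ) = g (k * δ) + g δ := by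
    intro k
    have hkpos : (0 : ℝ) < (k : ℝ) + 1 := by positivity
    have h1 := h.ctv.val.hull_split (S := insert (q + ((k : ℝ) * δ) • w) R)
      (hR.insert _) (p := q + (((k : ℝ) + 1) * δ) • w) (q := q) (s := q + ((k : ℝ) * δ) • w)
      (subset_convexHull ℝ _ (by simp)) (by
        refine ⟨k / (k + 1), 1 / (k + 1), by positivity, by positivity, by field_simp, ?_⟩
        have e1 : (k : ℝ) / (k + 1) * (((k : ℝ) + 1) * δ) = k * δ := by field_simp
        have e2 : (k : ℝ) / (k + 1) + 1 / (k + 1) = 1 := by field_simp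
        rw [smul_add, smul_smul, e1, add_right_comm, ← add_smul, e2, one_smul])
    have h2 : ψ (hull (insert (q + ((k : ℝ) * δ) • w) R)) = 0 := by
      have := hshift (k * δ) (insert q R) (hR.insert _) (by simp)
      rw [Set.image_insert_eq, himR, hℓq, sub_add_cancel, mul_one] at this
      rw [this]
      refine h.hull_eq_zero_of_const hκw (d := -d) (hR.insert _) (by simp) ?_
      rintro x (rfl | hx)
      exacts [hκq, hκR x hx]
    have h3 : ψ (hull (insert (q + (((k : ℝ) + 1) * δ) • w) (insert (q + ((k : ℝ) * δ) • w) R)))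
        = g δ := by
      rw [hg]
      simp only
      rw [← hshift (k * δ) _ (hfin δ) (by simp)]
      congr 2
      rw [Set.image_insert_eq, Set.image_insert_eq, himR, hℓq, map_add, map_smul, hℓw, hℓq]
      congr 1
      · simp only [smul_zero, add_zero, sub_add_cancel, mul_one, add_assoc, ← add_smul]
        congr 2; ring
      · simp
    have h4 : insert (q + (((k : ℝ) + 1) * δ) • w) (insert q (insert (q + ((k : ℝ) * δ) • w) R))
        = insert (q + ((k : ℝ) * δ) • w) (insert (q + (((k : ℝ) + 1) * δ) • w) (insert q R)) := by
      ext; simp; tauto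
    rw [h2, add_zero, h3, h4, hull_insert_of_mem (hfin _)] at h1
    · rw [Set.insert_comm q] at h1
      rw [hg]; simp only
      rw [h1]
      ring
    · refine segment_subset_convexHull (x := q + (((k : ℝ) + 1) * δ) • w) (y := q) (by simp)
        (by simp) ?_
      refine ⟨k / (k + 1), 1 / (k + 1), by positivity, by positivity, by field_simp, ?_⟩
      have e1 : (k : ℝ) / (k + 1) * (((k : ℝ) + 1) * δ) = k * δ := by field_simp
      have e2 : (k : ℝ) / (k + 1) + 1 / (k + 1) = 1 := by field_simp
      rw [smul_add, smul_smul, e1, add_right_comm, ← add_smul, e2, one_smul]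
  have hmul : ∀ k : ℕ, g (k * δ) = k * g δ := by
    intro k
    induction k with
    | zero =>
      rw [hg]
      simp only [Nat.cast_zero, zero_mul, zero_smul, add_zero, Set.insert_idem]
      exact h.hull_eq_zero_of_const hκw (d := -d) (hR.insert _) (by simp) (by
        rintro x (rfl | hx)
        exacts [hκq, hκR x hx])
    | succ k ih => rw [Nat.cast_succ, hadd, ih]; ring
  have hsc : g (N * δ) = θ * g δ := by
    rw [hg]
    simp only
    rw [← h.scale' hκw, ← h.ctv.add_point (ConvexBody.mapCLM _ _) ((((N : ℝ) - 1) * d) • w),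
      mapCLM_hull _ (hfin _) (by simp), hull_add_point ((hfin _).image _) (by simp)]
    congr 2
    rw [Set.image_image, Set.image_insert_eq, Set.image_insert_eq]
    congr 1
    · simp only [shear_apply, map_add, map_smul, LinearMap.smul_apply, hκw, hκq, smul_eq_mul]
      module
    · congr 1
      · simp [hκq]
      · conv_lhs => rw [← Set.image_id R]
        exact Set.image_congr fun x hx => by simp [hκR x hx]
  have : ((N : ℝ) - θ) * g δ = 0 := by rw [sub_mul, ← hmul, hsc, sub_self]
  exact (mul_eq_zero.1 this).resolve_left (sub_ne_zero.2 h.ne.symm)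

end ShearInv

end Shear

end

section

section ShearZero

set_option linter.unusedSectionVars false

open ConvexBody

variable {V : Type*} [NormedAddCommGroup V] [NormedSpace ℝ V] [FiniteDimensional ℝ V]

namespace ShearInv

variable {ψ : ConvexBody V → ℝ} {w : V} {π : V →ₗ[ℝ] ℝ} {N : ℕ} {θ : ℝ}

theorem sum_replace [DecidableEq V] {M : Type*} [AddCommGroup M] {s : Finset V} {p q r : V}
    (hp : p ∈ s) (hq : q ∈ s) (hpq : p ≠ q) (hr : r ∉ s) (f : V → M) (z : M) :
    (∑ x ∈ insert r (s.erase q), if x = r then z else if x = p then 0 else f x)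
      = ∑ x ∈ s, f x + z - f p - f q := by
  have hp' : p ∈ s.erase q := Finset.mem_erase.2 ⟨hpq, hp⟩
  rw [Finset.sum_insert (fun h => hr (Finset.mem_of_mem_erase h)), if_pos rfl,
    ← Finset.add_sum_erase s f hq, ← Finset.add_sum_erase _ f hp', ← Finset.add_sum_erase _ _ hp',
    if_neg (by rintro rfl; exact hr hp), if_pos rfl, Finset.sum_congr rfl (g := f)]
  · abel
  · intro x hx
    rw [if_neg (by rintro rfl; exact hr (Finset.mem_of_mem_erase (Finset.mem_of_mem_erase hx))),
      if_neg (Finset.ne_of_mem_erase hx)]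

theorem hull_relation (h : ShearInv ψ w π N θ) (n : ℕ)
    (ih : ∀ s : Finset V, s.card ≤ n → s.Nonempty → AffFree (s : Set V) → ψ (hull s) = 0)
    (k : ℕ) : ∀ (s : Finset V) (c : V → ℝ), s.card ≤ n + 1 → AffFree (s : Set V) →
      ∑ x ∈ s, c x = 0 → ∑ x ∈ s, c x • x = w → (s.filter fun x => c x ≠ 0).card ≤ k →
      ψ (hull s) = 0 := by
  classical
  have hw : w ≠ 0 := by
    rintro rfl
    have := h.apply_w
    simp at this
  induction k with
  | zero =>
    intro s c _ _ _ h1 h2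
    rw [Nat.le_zero, Finset.card_eq_zero, Finset.filter_eq_empty_iff] at h2
    refine absurd ?_ hw
    rw [← h1]
    exact Finset.sum_eq_zero fun x hx => by rw [not_not.1 (h2 hx), zero_smul]
  | succ k ihk =>
    intro s c hsn hf h0 h1 h2
    by_cases hex : ∃ p ∈ s, ∃ q ∈ s, p ≠ q ∧ 0 < c p * c q
    · obtain ⟨p, hp, q, hq, hpq, hpos⟩ := hex
      have hcp : c p ≠ 0 := by rintro h; simp [h] at hpos
      have hcq : c q ≠ 0 := by rintro h; simp [h] at hpos
      obtain ⟨α, β, hα, hβ, hαβ, hcc, h3, h4⟩ : ∃ α β : ℝ, 0 < α ∧ 0 < β ∧ α + β = 1 ∧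
          c p + c q ≠ 0 ∧ (c p + c q) * α = c p ∧ (c p + c q) * β = c q := by
        have hcc : c p + c q ≠ 0 := by
          intro h5
          have : c q = - c p := by linarith
          rw [this] at hpos
          nlinarith [sq_nonneg (c p)]
        have hs2 : 0 < (c p + c q) ^ 2 := by positivity
        refine ⟨c p / (c p + c q), c q / (c p + c q), ?_, ?_, by field_simp, hcc, by field_simp,
          by field_simp⟩
        · rw [show c p / (c p + c q) = (c p ^ 2 + c p * c q) / (c p + c q) ^ 2 by field_simp]
          positivity
        · rw [show c q / (c p + c q) = (c q ^ 2 + c p * c q) / (c p + c q) ^ 2 by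
            field_simp; ring]
          positivity
      set r := α • p + β • q with hr
      have hrs : r ∉ s := by
        intro hrs
        obtain ⟨ℓ, d, hℓ⟩ := hf fun x => if x = p then 1 else 0
        have e1 := hℓ p hp
        have e2 := hℓ q hq
        have e3 := hℓ r hrs
        rw [if_pos rfl] at e1
        rw [if_neg hpq.symm] at e2
        have e4 : ℓ r + d = α := by
          rw [hr, map_add, map_smul, map_smul, smul_eq_mul, smul_eq_mul]
          linear_combination α * e1 + β * e2 - d * hαβ
        rw [e4] at e3
        split_ifs at e3 <;> linarith
      have hbr : r ∈ segment ℝ p q := ⟨α, β, hα.le, hβ.le, hαβ, rfl⟩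
      -- replacing an endpoint
      have key : ∀ p q : V, p ∈ s → q ∈ s → p ≠ q → c p ≠ 0 → c q ≠ 0 →
          (c p + c q) • r = c p • p + c q • q → c p + c q ≠ 0 →
          AffFree (insert r ((s : Set V) \ {q})) →
          ψ (hull ((insert r (s.erase q) : Finset V) : Set V)) = 0 := by
        intro p q hp hq hpq hcp hcq hrr hcc hfr
        refine ihk _ (fun x => if x = r then c p + c q else if x = p then 0 else c x) ?_ ?_ ?_ ?_ ?_
        · refine (Finset.card_insert_le _ _).trans ?_
          rw [Finset.card_erase_add_one hq]
          exact hsn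
        · rwa [Finset.coe_insert, Finset.coe_erase]
        · rw [sum_replace hp hq hpq hrs, h0]; ring
        · have : ∀ x, (if x = r then c p + c q else if x = p then 0 else c x) • x
              = if x = r then (c p + c q) • r else if x = p then 0 else c x • x := by
            intro x
            split_ifs with hx hx
            · rw [hx]
            · rw [zero_smul]
            · rfl
          simp only [this]
          rw [sum_replace hp hq hpq hrs (fun x => c x • x), h1, hrr]; abel
        · refine le_trans (Finset.card_le_card (t := insert r
            (((s.filter fun x => c x ≠ 0).erase q).erase p)) ?_) ?_
          · intro x hx
            simp only [Finset.mem_filter, Finset.mem_insert, Finset.mem_erase] at hx ⊢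
            obtain ⟨hx1, hx2⟩ := hx
            by_cases hxr : x = r
            · exact Or.inl hxr
            rw [if_neg hxr] at hx2
            by_cases hxp : x = p
            · rw [if_pos hxp] at hx2; exact absurd rfl hx2
            rw [if_neg hxp] at hx2
            have := hx1.resolve_left hxr
            exact Or.inr ⟨hxp, this.1, this.2, hx2⟩
          · refine (Finset.card_insert_le _ _).trans ?_
            rw [Finset.card_erase_add_one]
            · rw [Finset.card_erase_of_mem (by simp [hq, hcq])]
              omega
            · simp [hpq, hp, hcp]
      have hrr : (c p + c q) • r = c p • p + c q • q := by
        rw [hr, smul_add, smul_smul, smul_smul, h3, h4]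
      have k1 := key p q hp hq hpq hcp hcq hrr hcc (by
        rw [hr, add_comm]; exact hf.replace hq hp hpq.symm hβ.ne' (by linarith))
      have k2 := key q p hq hp hpq.symm hcq hcp (by rw [add_comm, hrr, add_comm])
        (by rwa [add_comm]) (hf.replace hp hq hpq hα.ne' hαβ)
      set S₀ : Finset V := insert r ((s.erase p).erase q) with hS₀
      have k3 : ψ (hull (S₀ : Set V)) = 0 := by
        refine ih _ ?_ ⟨r, by simp [hS₀]⟩ ?_
        · refine (Finset.card_insert_le _ _).trans ?_
          rw [Finset.card_erase_add_one (by simp [hq, hpq.symm]), Finset.card_erase_of_mem hp]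
          omega
        · refine (hf.replace hp hq hpq hα.ne' hαβ).mono ?_
          intro x
          simp only [hS₀, Finset.coe_insert, Finset.coe_erase, Set.mem_insert_iff, Set.mem_sdiff]
          tauto
      have hsplit := h.ctv.val.hull_split (S := (S₀ : Set V)) (S₀.finite_toSet) (p := p) (q := q)
        (s := r) (subset_convexHull ℝ _ (by simp [hS₀])) hbr
      have e1 : (insert p (insert q (S₀ : Set V))) = insert r (s : Set V) := by
        ext x
        simp only [hS₀, Finset.coe_insert, Finset.coe_erase, Set.mem_insert_iff, Set.mem_sdiff,
          Set.mem_singleton_iff, Finset.mem_coe]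
        constructor
        · rintro (rfl | rfl | rfl | hx) <;> tauto
        · tauto
      have e2 : insert p (S₀ : Set V) = ((insert r (s.erase q) : Finset V) : Set V) := by
        ext x
        simp only [hS₀, Finset.coe_insert, Finset.coe_erase, Set.mem_insert_iff, Set.mem_sdiff,
          Set.mem_singleton_iff, Finset.mem_coe]
        constructor
        · rintro (rfl | rfl | hx) <;> tauto
        · tauto
      have e3 : insert q (S₀ : Set V) = ((insert r (s.erase p) : Finset V) : Set V) := by
        ext x
        simp only [hS₀, Finset.coe_insert, Finset.coe_erase, Set.mem_insert_iff, Set.mem_sdiff,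
          Set.mem_singleton_iff, Finset.mem_coe]
        constructor
        · rintro (rfl | rfl | hx) <;> tauto
        · tauto
      rw [e1, e2, e3, k1, k2, k3, hull_insert_of_mem s.finite_toSet
        (segment_subset_convexHull (by simpa) (by simpa) hbr)] at hsplit
      linarith
    · push Not at hex
      obtain ⟨p, hp, hcp⟩ : ∃ p ∈ s, c p ≠ 0 := by
        by_contra! hcon
        refine hw ?_
        rw [← h1]
        exact Finset.sum_eq_zero fun x hx => by rw [hcon x hx, zero_smul]
      obtain ⟨q, hq, hqp⟩ : ∃ q ∈ s, c p * c q < 0 := by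
        by_contra! hcon
        have e1 : ∑ x ∈ s, c p * c x = 0 := by rw [← Finset.mul_sum, h0, mul_zero]
        have e2 := (Finset.sum_eq_zero_iff_of_nonneg hcon).1 e1 p hp
        exact hcp (mul_self_eq_zero.1 e2)
      have hpq : p ≠ q := by
        rintro rfl
        nlinarith [sq_nonneg (c p)]
      have hcq : c q ≠ 0 := by rintro h; simp [h] at hqp
      have hothers : ∀ x ∈ (s.erase q).erase p, c x = 0 := by
        intro x hx
        simp only [Finset.mem_erase] at hx
        by_contra hcx
        have e1 := hex x hx.2.2 p hp hx.1
        have e2 := hex x hx.2.2 q hq hx.2.1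
        have e3 : 0 < (c x) ^ 2 := by positivity
        have e4 : (c x * c p) * (c x * c q) < 0 := by
          have : (c x * c p) * (c x * c q) = (c x) ^ 2 * (c p * c q) := by ring
          rw [this]
          exact mul_neg_of_pos_of_neg e3 hqp
        nlinarith [mul_nonneg_of_nonpos_of_nonpos e1 e2]
      have hp' : p ∈ s.erase q := Finset.mem_erase.2 ⟨hpq, hp⟩
      rw [← Finset.add_sum_erase s _ hq, ← Finset.add_sum_erase _ _ hp',
        Finset.sum_eq_zero hothers] at h0
      rw [← Finset.add_sum_erase s _ hq, ← Finset.add_sum_erase _ _ hp',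
        Finset.sum_eq_zero fun x hx => by rw [hothers x hx, zero_smul]] at h1
      have hcqp : c q = - c p := by linarith
      have hpw : p = q + (c p)⁻¹ • w := by
        rw [← h1, hcqp, add_zero, smul_add, smul_smul, smul_smul, mul_neg, inv_mul_cancel₀ hcp]
        module
      have hseq : (s : Set V) = insert (q + (c p)⁻¹ • w)
          (insert q (((s.erase q).erase p : Finset V) : Set V)) := by
        rw [← hpw, Set.insert_comm, ← Finset.coe_insert, Finset.insert_erase hp', ← Finset.coe_insert,
          Finset.insert_erase hq]
      rw [hseq]
      refine h.hull_vertical (Finset.finite_toSet _) (inv_ne_zero hcp) (hseq ▸ hf) ?_ ?_ hw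
      · rw [← hpw]; simp
      · simp

theorem hull_finset (h : ShearInv ψ w π N θ) (n : ℕ) :
    ∀ s : Finset V, s.card ≤ n → s.Nonempty → AffFree (s : Set V) → ψ (hull s) = 0 := by
  classical
  induction n with
  | zero =>
    intro s hs hn
    exact absurd (Finset.card_eq_zero.1 (Nat.le_zero.1 hs)) hn.ne_empty
  | succ n ih =>
    intro s hs hn hf
    obtain ⟨x₀, hx₀⟩ := hn
    by_cases hsp : w ∈ Submodule.span ℝ ((fun x => x - x₀) '' (s : Set V))
    · obtain ⟨c, hc⟩ : ∃ c : V → ℝ, ∑ x ∈ s, c x • (x - x₀) = w := by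
        obtain ⟨c, hc⟩ := (Submodule.mem_span_image_finset_iff_exists_fun ℝ).1 hsp
        refine ⟨fun x => if h : x ∈ s then c ⟨x, h⟩ else 0, ?_⟩
        rw [← hc, ← Finset.sum_coe_sort]
        exact Finset.sum_congr rfl fun x _ => by simp
      refine h.hull_relation n ih s.card s (fun x => c x - if x = x₀ then ∑ x ∈ s, c x else 0) hs hf
        ?_ ?_ (Finset.card_filter_le _ _)
      · rw [Finset.sum_sub_distrib, Finset.sum_ite_eq', if_pos hx₀, sub_self]
      · rw [← hc]
        simp only [sub_smul, smul_sub, ite_smul, zero_smul, Finset.sum_sub_distrib,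
          Finset.sum_ite_eq', hx₀, if_true, Finset.sum_smul]
    · obtain ⟨κ, hκ, hle⟩ := Submodule.exists_le_ker_of_notMem hsp
      refine h.hull_eq_zero_of_const (κ := (κ w)⁻¹ • κ) (d := (κ w)⁻¹ * κ x₀)
        (by simp [hκ]) s.finite_toSet ⟨x₀, hx₀⟩ fun x hx => ?_
      have : κ (x - x₀) = 0 := hle (Submodule.subset_span ⟨x, hx, rfl⟩)
      rw [map_sub, sub_eq_zero] at this
      simp [this]

theorem eq_zero (h : ShearInv ψ w π N θ) (K : ConvexBody V) : ψ K = 0 :=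
  eq_zero_of_affineIndependent h.ctv.cont h.ctv.val
    (fun s hn hs => h.hull_finset _ s le_rfl hn (AffineIndependent.affFree hs)) K

end ShearInv

end ShearZero

end

section

section Components

set_option linter.unusedSectionVars false

open ConvexBody

/-- A family of translation invariant valuations which is equivariant under the special linear
group and positively homogeneous in the vector variable. -/
structure EquivFam {W : Type*} [NormedAddCommGroup W] [NormedSpace ℂ W] [FiniteDimensional ℂ W]
    (f : ConvexBody W → W → ℝ) : Prop where
  ctv : ∀ u, CTV fun K => f K u
  pos : ∀ (t : ℝ), 0 < t → ∀ K u, f K (t • u) = t * f K u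
  equiv : ∀ g : W →ₗ[ℂ] W, LinearMap.det g = 1 → ∀ K u, f (K.mapCLM (cReal g)) (g u) = f K u

/-- An equivariant family which is sublinear in the vector variable. -/
structure SublinFam {W : Type*} [NormedAddCommGroup W] [NormedSpace ℂ W] [FiniteDimensional ℂ W]
    (f : ConvexBody W → W → ℝ) : Prop extends EquivFam f where
  sub : ∀ K u v, f K (u + v) ≤ f K u + f K v

variable {W : Type*} [NormedAddCommGroup W] [NormedSpace ℂ W] [FiniteDimensional ℂ W]

/-- The dilation by `b` in direction `e`. -/
def cdil (ξ : W →ₗ[ℂ] ℂ) (e : W) (b : ℂ) : W →ₗ[ℂ] W := LinearMap.id + (b - 1) • ξ.smulRight e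

@[simp] theorem cdil_apply (ξ : W →ₗ[ℂ] ℂ) (e : W) (b : ℂ) (x : W) :
    cdil ξ e b x = x + ((b - 1) * ξ x) • e := by simp [cdil, smul_smul]

theorem cdil_self {ξ : W →ₗ[ℂ] ℂ} {e : W} (h : ξ e = 1) (b : ℂ) : cdil ξ e b e = b • e := by
  rw [cdil_apply, h]; module

theorem det_cdil {ξ : W →ₗ[ℂ] ℂ} {e : W} (h : ξ e = 1) (b : ℂ) :
    LinearMap.det (cdil ξ e b) = b := by
  have : cdil ξ e b = LinearMap.transvection ((b - 1) • ξ) e := by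
    ext x
    simp [LinearMap.transvection.apply]
  rw [this, LinearMap.transvection.det]
  simp [h]

theorem continuous_cdil (ξ : W →ₗ[ℂ] ℂ) (e : W) :
    Continuous fun b : ℝ => cReal (cdil ξ e b) := by
  have : (fun b : ℝ => cReal (cdil ξ e b))
      = fun b : ℝ => cReal (LinearMap.id - ξ.smulRight e) + b • cReal (ξ.smulRight e) := by
    ext b x
    simp [sub_mul, sub_smul, mul_smul]
    abel
  rw [this]
  fun_prop

theorem exists_dual_eq_one {e : W} (he : e ≠ 0) : ∃ ξ : W →ₗ[ℂ] ℂ, ξ e = 1 := by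
  obtain ⟨ξ, hξ⟩ := SeparatingDual.exists_eq_one (R := ℂ) he
  exact ⟨ξ, hξ⟩

namespace EquivFam

variable {F : ConvexBody W → W → ℝ} {i : ℕ}

theorem zero_right (hF : EquivFam F) (K : ConvexBody W) : F K 0 = 0 := by
  have := hF.pos 2 (by norm_num) K 0
  rw [smul_zero] at this
  linarith

theorem scale (hF : EquivFam F) (hi : ∀ u, IsHomog i fun K => F K u) {B : W →ₗ[ℂ] W} {s : ℝ}
    (hs : 0 < s) (hB : LinearMap.det B = (s ^ finrank ℂ W : ℝ)) (K : ConvexBody W) (u : W) :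
    F (K.mapCLM (cReal B)) (B u) = s ^ (i + 1) * F K u := by
  have hsc : (s : ℂ) ≠ 0 := by exact_mod_cast hs.ne'
  set g : W →ₗ[ℂ] W := ((s : ℂ)⁻¹) • B with hg
  have hdet : LinearMap.det g = 1 := by
    rw [hg, LinearMap.det_smul, hB]
    push_cast
    rw [← mul_pow, inv_mul_cancel₀ hsc, one_pow]
  have h1 : K.mapCLM (cReal B) = s • K.mapCLM (cReal g) := by
    rw [smul_eq_mapCLM, mapCLM_mapCLM]
    congr 1
    ext x
    simp [hg]
    rw [← Complex.coe_smul s, smul_smul, mul_inv_cancel₀ hsc, one_smul]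
  have h2 : B u = s • g u := by
    rw [hg, LinearMap.smul_apply, ← Complex.coe_smul s, smul_smul, mul_inv_cancel₀ hsc, one_smul]
  have h3 := hi (g u) (K.mapCLM (cReal g)) s hs.le
  simp only at h3
  rw [h1, h2, hF.pos s hs, h3, hF.equiv g hdet]
  ring

theorem lam_scale (hF : EquivFam F) (hi : ∀ u, IsHomog i fun K => F K u) {B : W →ₗ[ℂ] W} {s : ℝ}
    (hs : 0 < s) (hB : LinearMap.det B = (s ^ finrank ℂ W : ℝ)) (K : ConvexBody W) (u v : W) :
    lam (B v) (fun K => F K (B u)) (K.mapCLM (cReal B)) = s ^ (i + 1) * lam v (fun K => F K u) K := by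
  have h1 := lam_map (cReal B) v (fun K => F K (B u)) K
  rw [cReal_apply] at h1
  rw [← h1]
  simp only [hF.scale hi hs hB]
  unfold lam
  ring

end EquivFam

namespace SublinFam

variable {F : ConvexBody W → W → ℝ} {i : ℕ}

theorem eq_zero_low (hF : SublinFam F) (hi : ∀ u, IsHomog i fun K => F K u)
    (hlt : i + 1 < finrank ℂ W) (K : ConvexBody W) (u : W) : F K u = 0 := by
  rcases eq_or_ne u 0 with rfl | hu
  · exact hF.zero_right K
  obtain ⟨ξ, hξ⟩ := exists_dual_eq_one hu
  have h := eq_at_zero_of_pos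
    (f := fun s : ℝ => s ^ (finrank ℂ W - (i + 1)) *
      F (K.mapCLM (cReal (cdil ξ u ((s ^ finrank ℂ W : ℝ))))) u)
    (g := fun _ => F K u) ?_ continuous_const ?_
  · refine h.symm.trans ?_
    rw [zero_pow (by omega), zero_mul]
  · have := continuous_cdil ξ u
    have h2 := (hF.ctv u).cont
    have h3 : Continuous fun s : ℝ => K.mapCLM (cReal (cdil ξ u ((s ^ finrank ℂ W : ℝ)))) :=
      Continuous.mapCLM (this.comp (continuous_pow _)) continuous_const
    exact (continuous_pow _).mul (h2.comp h3)
  · intro s hs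
    have h1 := hF.scale hi hs (det_cdil hξ ((s ^ finrank ℂ W : ℝ))) K u
    rw [cdil_self hξ, Complex.coe_smul, hF.pos _ (pow_pos hs _)] at h1
    have h2 : s ^ finrank ℂ W = s ^ (i + 1) * s ^ (finrank ℂ W - (i + 1)) := by
      rw [← pow_add]; congr 1; omega
    have h3 : s ^ (i + 1) ≠ 0 := (pow_pos hs _).ne'
    apply mul_left_cancel₀ h3
    rw [← h1, h2]
    push_cast
    ring

theorem apply_proj (hF : SublinFam F) (hi : ∀ u, IsHomog i fun K => F K u)
    (heq : i + 1 = finrank ℂ W) {ξ : W →ₗ[ℂ] ℂ} {e : W} (hξ : ξ e = 1) (K : ConvexBody W) :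
    F K e = F (K.mapCLM (cReal (cdil ξ e 0))) e := by
  have h := eq_at_zero_of_pos
    (f := fun b : ℝ => F (K.mapCLM (cReal (cdil ξ e b))) e)
    (g := fun _ => F K e) ?_ continuous_const ?_
  · refine h.symm.trans ?_
    rw [Complex.ofReal_zero]
  · exact (hF.ctv e).cont.comp (Continuous.mapCLM (continuous_cdil ξ e) continuous_const)
  · intro b hb
    set s : ℝ := b ^ ((finrank ℂ W : ℝ)⁻¹) with hs
    have hs0 : 0 < s := Real.rpow_pos_of_pos hb _
    have hsb : s ^ finrank ℂ W = b := Real.rpow_inv_natCast_pow hb.le (by omega)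
    have h1 := hF.scale hi hs0 (by rw [hsb]; exact det_cdil hξ b) K e
    rw [cdil_self hξ, Complex.coe_smul, hF.pos _ hb, heq, hsb] at h1
    exact mul_left_cancel₀ hb.ne' h1

theorem typeY (hF : SublinFam F) {ξ : W →ₗ[ℂ] ℂ} {e : W} (hξ : ξ e = 1) :
    TypeY fun c (A : ConvexBody (LinearMap.ker ξ)) =>
      F (A.mapCLM (LinearMap.toContinuousLinearMap
        ((LinearMap.ker ξ).subtype.restrictScalars ℝ))) (c • e) where
  ctv c := (hF.ctv _).map _
  smul t ht c A := by
    rw [mul_smul, Complex.coe_smul, hF.pos t ht]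
  equiv B hB c A := by
    obtain ⟨prj, hprj⟩ : ∃ prj : W →ₗ[ℂ] LinearMap.ker ξ, ∀ x, (prj x : W) = x - ξ x • e :=
      ⟨(LinearMap.id - ξ.smulRight e).codRestrict _ (by intro x; simp [hξ]), fun _ => rfl⟩
    let E : (LinearMap.ker ξ × ℂ) ≃ₗ[ℂ] W :=
      LinearEquiv.ofLinearMap
        ((LinearMap.ker ξ).subtype.coprod (LinearMap.toSpanSingleton ℂ W e))
        (prj.prod ξ) (by ext x; simp [hprj]) (by
          ext x
          · simp [hprj]
          · simp
          · simp [hprj, hξ]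
          · simp [hξ])
    let Bh : W →ₗ[ℂ] W := (E : (LinearMap.ker ξ × ℂ) →ₗ[ℂ] W) ∘ₗ
      (B.prodMap ((LinearMap.det B)⁻¹ • LinearMap.id)) ∘ₗ
        (E.symm : W →ₗ[ℂ] (LinearMap.ker ξ × ℂ))
    have hdet : LinearMap.det Bh = 1 := by
      rw [LinearMap.det_conj, LinearMap.det_prodMap, LinearMap.det_smul]
      simp [hB]
    have hBe : Bh e = (LinearMap.det B)⁻¹ • e := by
      have : prj e = 0 := Subtype.ext (by simp [hprj, hξ])
      simp [Bh, E, this, hξ]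
    have hBi : ∀ x : LinearMap.ker ξ, Bh x = B x := by
      intro x
      have : prj x = x := Subtype.ext (by simp [hprj])
      simp [Bh, E, this]
    have h1 := hF.equiv Bh hdet (A.mapCLM (LinearMap.toContinuousLinearMap
        ((LinearMap.ker ξ).subtype.restrictScalars ℝ))) ((c * LinearMap.det B) • e)
    rw [map_smul, hBe, smul_smul, mul_assoc, mul_inv_cancel₀ hB, mul_one] at h1
    rw [← h1, mapCLM_mapCLM, mapCLM_mapCLM]
    congr 2
    ext x
    exact (hBi x).symm

theorem eq_zero_mid (hF : SublinFam F) (hi : ∀ u, IsHomog i fun K => F K u)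
    (heq : i + 1 = finrank ℂ W) (h3 : 3 ≤ finrank ℂ W) (K : ConvexBody W) (u : W) :
    F K u = 0 := by
  rcases eq_or_ne u 0 with rfl | hu
  · exact hF.zero_right K
  obtain ⟨ξ, hξ⟩ := exists_dual_eq_one hu
  have hfin := Module.Dual.finrank_ker_add_one_of_ne_zero (f := ξ) (by rintro rfl; simp at hξ)
  have h1 := TypeY.eq_zero i (by omega) (hF.typeY hξ) (by omega) 1
  let prj : W →ₗ[ℂ] LinearMap.ker ξ :=
    (LinearMap.id - ξ.smulRight u).codRestrict _ (by intro x; simp [hξ])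
  rw [hF.apply_proj hi heq hξ,
    ← h1 (K.mapCLM (LinearMap.toContinuousLinearMap (prj.restrictScalars ℝ))), mapCLM_mapCLM,
    one_smul]
  congr 2
  ext x
  simp [prj, sub_eq_add_neg]

end SublinFam

end Components

end

section

section UpperCase

set_option linter.unusedSectionVars false

open ConvexBody

variable {W : Type*} [NormedAddCommGroup W] [NormedSpace ℂ W] [FiniteDimensional ℂ W]

/-- The complex linear functional with prescribed imaginary part. -/
def imExt (ℓ : W →ₗ[ℝ] ℝ) : W →ₗ[ℂ] ℂ :=
  Complex.I • Module.Dual.extendRCLike (𝕜 := ℂ) ℓ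

theorem imExt_apply (ℓ : W →ₗ[ℝ] ℝ) (x : W) :
    imExt ℓ x = ℓ (Complex.I • x) + ℓ x * Complex.I := by
  simp [imExt, Module.Dual.extendRCLike_apply]
  ring_nf
  simp

theorem smul_eq_re_add_im (c : ℂ) (x : W) : c • x = c.re • x + c.im • Complex.I • x := by
  rw [← Complex.coe_smul, ← Complex.coe_smul, smul_smul, ← add_smul, Complex.re_add_im]

/-- The real part of a complex linear functional. -/
def reFun (ξ : W →ₗ[ℂ] ℂ) : W →L[ℝ] ℝ :=
  LinearMap.toContinuousLinearMap (Complex.reLm ∘ₗ ξ.restrictScalars ℝ)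

@[simp] theorem reFun_apply (ξ : W →ₗ[ℂ] ℂ) (x : W) : reFun ξ x = (ξ x).re := rfl

namespace EquivFam

variable {F : ConvexBody W → W → ℝ} {i : ℕ}

theorem lam_equiv (hF : EquivFam F) {B : W →ₗ[ℂ] W} (hB : LinearMap.det B = 1)
    (K : ConvexBody W) (u v : W) :
    lam (B v) (fun K => F K (B u)) (K.mapCLM (cReal B)) = lam v (fun K => F K u) K := by
  have h1 := lam_map (cReal B) v (fun K => F K (B u)) K
  rw [cReal_apply] at h1
  rw [← h1]
  simp only [hF.equiv B hB]

/-- Dilating the direction of the difference operator. -/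
theorem lam_cdil (hF : EquivFam F) (hi : ∀ u, IsHomog i fun K => F K u) {ξ : W →ₗ[ℂ] ℂ} {e : W}
    (hξ : ξ e = 1) {s : ℝ} (hs : 0 < s) (K : ConvexBody W) (u : W) :
    s ^ finrank ℂ W * lam e (fun K => F K (cdil ξ e ((s ^ finrank ℂ W : ℝ)) u))
      (K.mapCLM (cReal (cdil ξ e ((s ^ finrank ℂ W : ℝ))))) = s ^ (i + 1) * lam e (fun K => F K u) K := by
  have h1 := hF.lam_scale hi hs (det_cdil hξ ((s ^ finrank ℂ W : ℝ))) K u e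
  rw [cdil_self hξ, Complex.coe_smul, (hF.ctv _).lam_smul, abs_of_pos (pow_pos hs _)] at h1
  exact h1

end EquivFam

theorem lam_subadditive {W : Type*} [NormedAddCommGroup W] [NormedSpace ℝ W]
    {F : ConvexBody W → W → ℝ} (hc : ∀ u, CTV fun K => F K u)
    (hs : ∀ K u v, F K (u + v) ≤ F K u + F K v) (e : W) (K : ConvexBody W) (u v : W) :
    lam e (fun K => F K (u + v)) K ≤ lam e (fun K => F K u) K + lam e (fun K => F K v) K := by
  by_contra hlt
  push Not at hlt
  set d := lam e (fun K => F K (u + v)) K - lam e (fun K => F K u) K - lam e (fun K => F K v) K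
    with hd
  have hd0 : 0 < d := by linarith
  have key : ∀ t : ℝ, 0 ≤ t → t * d ≤ F K u + F K v - F K (u + v) := by
    intro t ht
    have h := hs (K + seg (t • e)) u v
    have h1 : ∀ u, F (K + seg (t • e)) u = F K u + t * lam e (fun K => F K u) K := by
      intro u
      rw [← (hc u).lam_smul_of_nonneg ht, lam]
      ring
    rw [h1, h1, h1] at h
    rw [hd]
    nlinarith
  have h0 := key 0 le_rfl
  have h1 := key ((F K u + F K v - F K (u + v) + 1) / d) (div_nonneg (by linarith) hd0.le)
  rw [div_mul_cancel₀ _ hd0.ne'] at h1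
  linarith

namespace SublinFam

variable {F : ConvexBody W → W → ℝ} {i : ℕ}

theorem lam_sub (hF : SublinFam F) (e : W) (K : ConvexBody W) (u v : W) :
    lam e (fun K => F K (u + v)) K ≤ lam e (fun K => F K u) K + lam e (fun K => F K v) K :=
  lam_subadditive hF.ctv hF.sub e K u v

variable {ξ : W →ₗ[ℂ] ℂ} {e : W}

theorem lam_self (hF : SublinFam F) (hi : ∀ u, IsHomog i fun K => F K u)
    (h2 : i + 2 ≤ 2 * finrank ℂ W) (hξ : ξ e = 1) (c : ℂ) (K : ConvexBody W) :
    lam e (fun K => F K (c • e)) K = 0 := by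
  set m := finrank ℂ W with hm
  have h := eq_at_zero_of_pos
    (f := fun s : ℝ => s ^ (2 * m - (i + 1)) *
      lam e (fun K => F K (c • e)) (K.mapCLM (cReal (cdil ξ e ((s ^ m : ℝ))))))
    (g := fun _ => lam e (fun K => F K (c • e)) K) ?_ continuous_const ?_
  · refine h.symm.trans ?_
    rw [zero_pow (by omega), zero_mul]
  · have := continuous_cdil ξ e
    have h2 := ((hF.ctv (c • e)).lam e).cont
    have h3 : Continuous fun s : ℝ => K.mapCLM (cReal (cdil ξ e ((s ^ m : ℝ)))) :=
      Continuous.mapCLM (this.comp (continuous_pow _)) continuous_const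
    exact (continuous_pow _).mul (h2.comp h3)
  · intro s hs
    have h1 := hF.lam_cdil hi hξ hs K (c • e)
    rw [← hm] at h1
    have h4 : cdil ξ e ((s ^ m : ℝ)) (c • e) = (s ^ m) • c • e := by
      rw [map_smul, cdil_self hξ, Complex.coe_smul, smul_comm]
    have h5 : lam e (fun K => F K (cdil ξ e ((s ^ m : ℝ)) (c • e)))
        (K.mapCLM (cReal (cdil ξ e ((s ^ m : ℝ))))) = s ^ m * lam e (fun K => F K (c • e))
          (K.mapCLM (cReal (cdil ξ e ((s ^ m : ℝ))))) := by
      rw [h4]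
      simp only [lam, hF.pos _ (pow_pos hs m)]
      ring
    rw [h5] at h1
    have h6 : s ^ m * s ^ m = s ^ (i + 1) * s ^ (2 * m - (i + 1)) := by
      rw [← pow_add, ← pow_add]; congr 1; omega
    apply mul_left_cancel₀ (pow_pos hs (i + 1)).ne'
    rw [← h1, ← mul_assoc, ← mul_assoc, h6]

theorem lam_add_smul (hF : SublinFam F) (hi : ∀ u, IsHomog i fun K => F K u)
    (h2 : i + 2 ≤ 2 * finrank ℂ W) (hξ : ξ e = 1) (c : ℂ) (u : W) (K : ConvexBody W) :
    lam e (fun K => F K (u + c • e)) K = lam e (fun K => F K u) K := by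
  apply le_antisymm
  · have := hF.lam_sub e K u (c • e)
    rw [hF.lam_self hi h2 hξ] at this
    linarith
  · have := hF.lam_sub e K (u + c • e) ((-c) • e)
    rw [hF.lam_self hi h2 hξ, neg_smul, add_neg_cancel_right] at this
    linarith

theorem lam_cdil_apply (hF : SublinFam F) (hi : ∀ u, IsHomog i fun K => F K u)
    (h1 : finrank ℂ W ≤ i) (h2 : i + 2 ≤ 2 * finrank ℂ W) (hξ : ξ e = 1) {s : ℝ} (hs : 0 < s)
    (u : W) (K : ConvexBody W) :
    lam e (fun K => F K u) (K.mapCLM (cReal (cdil ξ e ((s ^ finrank ℂ W : ℝ)))))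
      = s ^ (i + 1 - finrank ℂ W) * lam e (fun K => F K u) K := by
  have h3 := hF.lam_cdil hi hξ hs K u
  rw [cdil_apply, hF.lam_add_smul hi h2 hξ] at h3
  apply mul_left_cancel₀ (pow_pos hs (finrank ℂ W)).ne'
  rw [h3, ← mul_assoc, ← pow_add]
  congr 2
  omega

theorem shearInv (hF : SublinFam F) (hi : ∀ u, IsHomog i fun K => F K u)
    (h1 : finrank ℂ W ≤ i) (h2 : i + 2 ≤ 2 * finrank ℂ W) (hξ : ξ e = 1) (u : W) :
    ShearInv (V := LinearMap.ker (reFun ξ : W →ₗ[ℝ] ℝ))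
      (fun A => lam e (fun K => F K u) (A.mapCLM (Submodule.subtypeL _)))
      ⟨Complex.I • e, by simp [hξ]⟩
      (Complex.imLm ∘ₗ ξ.restrictScalars ℝ ∘ₗ Submodule.subtype _) (2 ^ finrank ℂ W)
      (2 ^ (i + 1 - finrank ℂ W)) where
  ctv := ((hF.ctv u).lam e).map _
  apply_w := by simp [hξ]
  ne := by
    push_cast
    intro h
    have := pow_right_injective₀ (a := (2 : ℝ)) (by norm_num) (by norm_num) h
    omega
  shear ℓ hℓ A := by
    let P : W →ₗ[ℝ] LinearMap.ker (reFun ξ : W →ₗ[ℝ] ℝ) :=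
      (LinearMap.id - (reFun ξ : W →ₗ[ℝ] ℝ).smulRight e).codRestrict _ (by intro x; simp [hξ])
    have hP : ∀ x, (P x : W) = x - (ξ x).re • e := fun x => rfl
    have hPe : P e = 0 := Subtype.ext (by simp [hP, hξ])
    have hPI : P (Complex.I • e) = ⟨Complex.I • e, by simp [hξ]⟩ := Subtype.ext (by simp [hP, hξ])
    have hPx : ∀ x : LinearMap.ker (reFun ξ : W →ₗ[ℝ] ℝ), P x = x := by
      intro x
      have : (ξ x).re = 0 := x.2
      exact Subtype.ext (by simp [hP, this])
    let ξ' := imExt (ℓ ∘ₗ P)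
    have hξ' : ξ' e = 0 := by
      simp only [ξ', imExt_apply, LinearMap.comp_apply, hPe, hPI, hℓ]
      simp
    let g : W →ₗ[ℂ] W := LinearMap.transvection ξ' e
    have hg : ∀ x, g x = x + ξ' x • e := fun x => LinearMap.transvection.apply _ _ _
    have hdet : LinearMap.det g = 1 := by
      rw [LinearMap.transvection.det, hξ', add_zero]
    have hge : g e = e := by rw [hg, hξ', zero_smul, add_zero]
    have h3 := hF.lam_equiv hdet (A.mapCLM (Submodule.subtypeL _)) u e
    rw [hge, hg u, hF.lam_add_smul hi h2 hξ] at h3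
    rw [← h3]
    refine ((hF.ctv u).lam_congr (f := ContinuousLinearMap.id ℝ W - (reFun ξ).smulRight e)
      (fun x hx => ⟨(ξ x).re, by simpa [sub_eq_zero] using hx⟩) ?_)
    rw [mapCLM_mapCLM, mapCLM_mapCLM, mapCLM_mapCLM, mapCLM_mapCLM]
    congr 1
    ext x
    have hx : (ξ x).re = 0 := x.2
    have h5 : ξ' x = (ℓ (P (Complex.I • (x : W))) : ℂ) + ℓ x * Complex.I := by
      simp only [ξ', imExt_apply, LinearMap.comp_apply, hPx]
    have h6 := smul_eq_re_add_im (ξ' x) e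
    simp [hg, hx, hξ, h6]
    simp [h5]
    abel
  flat A hA := by
    have h3 := hF.lam_cdil_apply hi h1 h2 hξ (s := 2) (by norm_num) u
      (A.mapCLM (Submodule.subtypeL _))
    have h4 : (A.mapCLM (Submodule.subtypeL _)).mapCLM
        (cReal (cdil ξ e ((2 ^ finrank ℂ W : ℝ)))) = A.mapCLM (Submodule.subtypeL _) := by
      rw [mapCLM_mapCLM]
      apply SetLike.coe_injective
      rw [coe_mapCLM, coe_mapCLM]
      apply Set.image_congr
      intro x hx
      have hx1 : (ξ x).re = 0 := x.2
      have hx2 : (ξ x).im = 0 := hA x hx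
      have hx3 : ξ x = 0 := Complex.ext hx1 hx2
      simp [hx3]
    rw [h4] at h3
    have h5 : (2 : ℝ) ^ (i + 1 - finrank ℂ W) ≠ 1 := by
      rw [Ne, pow_eq_one_iff_of_nonneg (by norm_num) (by omega)]
      norm_num
    by_contra h6
    exact h5 (mul_right_cancel₀ h6 (by rw [← h3, one_mul]))
  scale A := by
    rw [← hF.lam_cdil_apply hi h1 h2 hξ (s := 2) (by norm_num), mapCLM_mapCLM, mapCLM_mapCLM]
    congr 2
    ext x
    have hx1 : (ξ x).re = 0 := x.2
    have hx2 : ξ x = (ξ x).im * Complex.I := Complex.ext (by simp [hx1]) (by simp)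
    simp
    rw [hx2]
    simp
    rw [← Complex.coe_smul, smul_smul]
    congr 1
    push_cast
    ring

theorem eq_zero_high (hF : SublinFam F) (hi : ∀ u, IsHomog i fun K => F K u)
    (h1 : finrank ℂ W ≤ i) (h2 : i + 2 ≤ 2 * finrank ℂ W) (K : ConvexBody W) (u : W) :
    F K u = 0 := by
  have hS : SegFree fun K => F K u := by
    refine ⟨hF.ctv u, fun e K => ?_⟩
    rcases eq_or_ne e 0 with rfl | he
    · exact lam_zero _ _
    obtain ⟨ξ, hξ⟩ := exists_dual_eq_one he
    have h3 := hF.shearInv hi h1 h2 hξ u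
    let P : W →L[ℝ] LinearMap.ker (reFun ξ : W →ₗ[ℝ] ℝ) := LinearMap.toContinuousLinearMap
      ((LinearMap.id - (reFun ξ : W →ₗ[ℝ] ℝ).smulRight e).codRestrict _ (by intro x; simp [hξ]))
    rw [(hF.ctv u).lam_proj (ℓ := reFun ξ) (by simp [hξ]), ← h3.eq_zero (K.mapCLM P),
      mapCLM_mapCLM]
    rfl
  have hr : finrank ℝ W = 2 * finrank ℂ W := finrank_real_of_complex W
  rcases h1.eq_or_lt with h | h
  · exact hS.eq_zero_of_eq (m := i) (hi u) (by omega) (by omega) K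
  · exact hS.eq_zero_of_lt (hi u) (by omega) K

end SublinFam

end UpperCase

end

section

section FamComponents

set_option linter.unusedSectionVars false

open ConvexBody

theorem coeff_nonneg_of_sum_nonneg {n i : ℕ} {d : ℕ → ℝ} (hi : i < n) (hlow : ∀ j < i, d j = 0)
    (h : ∀ t : ℝ, 0 < t → 0 ≤ ∑ j ∈ Finset.range n, d j * t ^ j) : 0 ≤ d i := by
  set R : ℝ → ℝ := fun t => ∑ j ∈ Finset.range n, d j * t ^ (j - i) with hR
  have hc : Continuous R := by
    rw [hR]
    exact continuous_finsetSum _ fun j _ => by fun_prop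
  have h0 : R 0 = d i := by
    rw [hR]
    simp only
    rw [Finset.sum_eq_single_of_mem i (Finset.mem_range.2 hi)]
    · simp
    · intro j _ hj
      rcases hj.lt_or_gt with hj | hj
      · rw [hlow j hj, zero_mul]
      · rw [zero_pow (by omega), mul_zero]
  have hpos : ∀ t : ℝ, 0 < t → 0 ≤ R t := by
    intro t ht
    have h1 : t ^ i * R t = ∑ j ∈ Finset.range n, d j * t ^ j := by
      rw [hR, Finset.mul_sum]
      refine Finset.sum_congr rfl fun j _ => ?_
      rcases lt_or_ge j i with hj | hj
      · rw [hlow j hj]; ring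
      · rw [mul_left_comm, ← pow_add]
        congr 2
        omega
    exact nonneg_of_mul_nonneg_right (h1 ▸ h t ht) (pow_pos ht i)
  rw [← h0]
  have h2 : Filter.Tendsto R (nhdsWithin 0 (Set.Ioi 0)) (nhds (R 0)) :=
    (hc.tendsto 0).mono_left nhdsWithin_le_nhds
  exact ge_of_tendsto h2 (by filter_upwards [self_mem_nhdsWithin] with t ht using hpos t ht)

theorem bodyComp_const_mul {V : Type*} [NormedAddCommGroup V] [NormedSpace ℝ V]
    (φ : ConvexBody V → ℝ) (c : ℝ) (i : ℕ) (K : ConvexBody V) :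
    bodyComp (fun K => c * φ K) i K = c * bodyComp φ i K := by
  simp only [bodyComp, bodyDiff, Finset.mul_sum]
  refine Finset.sum_congr rfl fun j _ => Finset.sum_congr rfl fun k _ => ?_
  ring

variable {W : Type*} [NormedAddCommGroup W] [NormedSpace ℂ W] [FiniteDimensional ℂ W]
variable {f : ConvexBody W → W → ℝ}

/-- The homogeneous component of degree `i` of a family. -/
def famComp (f : ConvexBody W → W → ℝ) (i : ℕ) (K : ConvexBody W) (u : W) : ℝ :=
  bodyComp (fun K => f K u) i K

theorem EquivFam.famComp (hf : EquivFam f) (i : ℕ) : EquivFam (famComp f i) where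
  ctv u := (hf.ctv u).bodyComp i
  pos t ht K u := by
    unfold _root_.famComp
    simp only [hf.pos t ht]
    exact bodyComp_const_mul _ _ _ _
  equiv g hg K u := by
    refine bodyComp_congr (fun t => ?_) i
    rw [← mapCLM_smul, hf.equiv g hg]

theorem EquivFam.famComp_homog (hf : EquivFam f) (i : ℕ) (u : W) :
    IsHomog i fun K => _root_.famComp f i K u := (hf.ctv u).bodyComp_homog i

theorem EquivFam.smul_eq_sum (hf : EquivFam f) (K : ConvexBody W) (u : W) {t : ℝ} (ht : 0 ≤ t) :
    f (t • K) u = ∑ i ∈ Finset.range (2 * finrank ℂ W + 1), _root_.famComp f i K u * t ^ i := by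
  rw [← finrank_real_of_complex]
  exact (hf.ctv u).smul_eq_sum K ht

theorem SublinFam.famComp_eq_zero (hf : SublinFam f) (h3 : 3 ≤ finrank ℂ W) (i : ℕ) :
    i + 2 ≤ 2 * finrank ℂ W → ∀ K u, famComp f i K u = 0 := by
  induction i using Nat.strong_induction_on with
  | _ i ih =>
    intro hi
    have hF : SublinFam (famComp f i) := by
      refine ⟨hf.famComp i, fun K u v => ?_⟩
      have := coeff_nonneg_of_sum_nonneg (n := 2 * finrank ℂ W + 1) (i := i)
        (d := fun j => famComp f j K u + famComp f j K v - famComp f j K (u + v)) (by omega)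
        (fun j hj => by
          simp [ih j hj (by omega)]) (fun t ht => by
          have h := hf.sub (t • K) u v
          rw [hf.smul_eq_sum _ _ ht.le, hf.smul_eq_sum _ _ ht.le, hf.smul_eq_sum _ _ ht.le,
            ← Finset.sum_add_distrib, ← sub_nonneg, ← Finset.sum_sub_distrib] at h
          refine h.trans_eq (Finset.sum_congr rfl fun j _ => ?_)
          ring)
      linarith
    have hh := hf.famComp_homog i
    rcases lt_trichotomy (i + 1) (finrank ℂ W) with h | h | h
    · exact hF.eq_zero_low hh h
    · exact hF.eq_zero_mid hh h h3
    · exact hF.eq_zero_high hh (by omega) hi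

theorem SublinFam.eq_add (hf : SublinFam f) (h3 : 3 ≤ finrank ℂ W) (K : ConvexBody W) (u : W) :
    f K u = famComp f (2 * finrank ℂ W - 1) K u + famComp f (2 * finrank ℂ W) K u := by
  have h := hf.smul_eq_sum K u zero_le_one
  obtain ⟨k, hk⟩ : ∃ k, 2 * finrank ℂ W = k + 1 := ⟨2 * finrank ℂ W - 1, by omega⟩
  rw [one_smul, hk, Finset.sum_range_succ, Finset.sum_range_succ, Finset.sum_eq_zero] at h
  · rw [h, hk]; simp
  · intro i hi
    rw [hf.famComp_eq_zero h3 i (by have := Finset.mem_range.1 hi; omega), zero_mul]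

end FamComponents

end

section

section MultiLam

set_option linter.unusedSectionVars false

open ConvexBody

variable {V V' : Type*} [NormedAddCommGroup V] [NormedSpace ℝ V] [NormedAddCommGroup V']
  [NormedSpace ℝ V']

/-- Two bodies are congruent modulo `E` if they have the same image in the quotient by `E`. -/
def ModEq (E : Submodule ℝ V) (K L : ConvexBody V) : Prop :=
  (∀ x ∈ K, ∃ y ∈ L, x - y ∈ E) ∧ ∀ y ∈ L, ∃ x ∈ K, x - y ∈ E

namespace ModEq

variable {E F : Submodule ℝ V} {K L Q : ConvexBody V}

theorem mono (h : ModEq E K L) (hEF : E ≤ F) : ModEq F K L :=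
  ⟨fun x hx => (h.1 x hx).imp fun _ hy => ⟨hy.1, hEF hy.2⟩,
    fun y hy => (h.2 y hy).imp fun _ hx => ⟨hx.1, hEF hx.2⟩⟩

theorem symm (h : ModEq E K L) : ModEq E L K :=
  ⟨fun y hy => (h.2 y hy).imp fun _ hx => ⟨hx.1, by rw [← neg_sub]; exact E.neg_mem hx.2⟩,
    fun x hx => (h.1 x hx).imp fun _ hy => ⟨hy.1, by rw [← neg_sub]; exact E.neg_mem hy.2⟩⟩

theorem trans (h : ModEq E K L) (h' : ModEq E L Q) : ModEq E K Q := by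
  constructor
  · intro x hx
    obtain ⟨y, hy, hxy⟩ := h.1 x hx
    obtain ⟨z, hz, hyz⟩ := h'.1 y hy
    exact ⟨z, hz, by simpa using E.add_mem hxy hyz⟩
  · intro z hz
    obtain ⟨y, hy, hyz⟩ := h'.2 z hz
    obtain ⟨x, hx, hxy⟩ := h.2 y hy
    exact ⟨x, hx, by simpa using E.add_mem hxy hyz⟩

theorem refl (E : Submodule ℝ V) (K : ConvexBody V) : ModEq E K K :=
  ⟨fun x hx => ⟨x, hx, by simp⟩, fun x hx => ⟨x, hx, by simp⟩⟩

theorem add {K' L' : ConvexBody V} (h : ModEq E K L) (h' : ModEq E K' L') :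
    ModEq E (K + K') (L + L') := by
  constructor
  · rintro _ ⟨x, hx, x', hx', rfl⟩
    obtain ⟨y, hy, hxy⟩ := h.1 x hx
    obtain ⟨y', hy', hxy'⟩ := h'.1 x' hx'
    refine ⟨y + y', Set.add_mem_add hy hy', ?_⟩
    rw [add_sub_add_comm]
    exact E.add_mem hxy hxy'
  · rintro _ ⟨y, hy, y', hy', rfl⟩
    obtain ⟨x, hx, hxy⟩ := h.2 y hy
    obtain ⟨x', hx', hxy'⟩ := h'.2 y' hy'
    refine ⟨x + x', Set.add_mem_add hx hx', ?_⟩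
    rw [add_sub_add_comm]
    exact E.add_mem hxy hxy'

theorem map (h : ModEq E K L) {F : Submodule ℝ V'} (f : V →L[ℝ] V') (hf : ∀ x ∈ E, f x ∈ F) :
    ModEq F (K.mapCLM f) (L.mapCLM f) := by
  constructor
  · rintro _ ⟨x, hx, rfl⟩
    obtain ⟨y, hy, hxy⟩ := h.1 x hx
    exact ⟨f y, ⟨y, hy, rfl⟩, by rw [← map_sub]; exact hf _ hxy⟩
  · rintro _ ⟨y, hy, rfl⟩
    obtain ⟨x, hx, hxy⟩ := h.2 y hy
    exact ⟨f x, ⟨x, hx, rfl⟩, by rw [← map_sub]; exact hf _ hxy⟩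

theorem mapCLM_self (f : V →L[ℝ] V) (hf : ∀ x, x - f x ∈ E) (K : ConvexBody V) :
    ModEq E K (K.mapCLM f) := by
  constructor
  · intro x hx
    exact ⟨f x, ⟨x, hx, rfl⟩, hf x⟩
  · rintro _ ⟨x, hx, rfl⟩
    exact ⟨x, hx, hf x⟩

theorem seg {v w : V} (h : v - w ∈ E) : ModEq E (ConvexBody.seg v) (ConvexBody.seg w) := by
  constructor
  · intro x hx
    obtain ⟨t, ht, ht1, rfl⟩ := mem_seg.1 hx
    exact ⟨t • w, mem_seg.2 ⟨t, ht, ht1, rfl⟩, by rw [← smul_sub]; exact E.smul_mem _ h⟩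
  · intro x hx
    obtain ⟨t, ht, ht1, rfl⟩ := mem_seg.1 hx
    exact ⟨t • v, mem_seg.2 ⟨t, ht, ht1, rfl⟩, by rw [← smul_sub]; exact E.smul_mem _ h⟩

theorem add_seg {v : V} (h : v ∈ E) (K : ConvexBody V) : ModEq E (K + ConvexBody.seg v) K := by
  have h1 := (refl E K).add (seg (v := v) (w := 0) (by simpa using h))
  rwa [seg_zero, add_zero] at h1

theorem hull {ι : Type*} [Finite ι] [Nonempty ι] {p q : ι → V} (h : ∀ i, p i - q i ∈ E) :
    ModEq E (ConvexBody.hull (Set.range p)) (ConvexBody.hull (Set.range q)) := by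
  have key : ∀ p q : ι → V, (∀ i, p i - q i ∈ E) →
      ∀ x ∈ ConvexBody.hull (Set.range p), ∃ y ∈ ConvexBody.hull (Set.range q), x - y ∈ E := by
    intro p q h x hx
    rw [← mem_coe, coe_hull (Set.finite_range _) (Set.range_nonempty _)] at hx
    have hc : Convex ℝ {x | ∃ y ∈ ConvexBody.hull (Set.range q), x - y ∈ E} := by
      rintro a ⟨a', ha', haa⟩ b ⟨b', hb', hbb⟩ s t hs ht hst
      refine ⟨s • a' + t • b', (ConvexBody.hull (Set.range q)).convex ha' hb' hs ht hst, ?_⟩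
      have : s • a + t • b - (s • a' + t • b') = s • (a - a') + t • (b - b') := by module
      rw [this]
      exact E.add_mem (E.smul_mem _ haa) (E.smul_mem _ hbb)
    refine convexHull_min ?_ hc hx
    rintro _ ⟨i, rfl⟩
    refine ⟨q i, ?_, h i⟩
    rw [← mem_coe, coe_hull (Set.finite_range _) (Set.range_nonempty _)]
    exact subset_convexHull _ _ ⟨i, rfl⟩
  refine ⟨key p q h, fun y hy => ?_⟩
  obtain ⟨x, hx, hxy⟩ := key q p (fun i => by rw [← neg_sub]; exact E.neg_mem (h i)) y hy
  exact ⟨x, hx, by rw [← neg_sub]; exact E.neg_mem hxy⟩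

end ModEq

instance : LeftCommutative (lam (V := V)) := ⟨fun v w φ => lam_comm v w φ⟩

/-- Iterated differences along segments. -/
def lams (s : Multiset V) (φ : ConvexBody V → ℝ) : ConvexBody V → ℝ := s.foldr lam φ

@[simp] theorem lams_zero (φ : ConvexBody V → ℝ) : lams 0 φ = φ := rfl

@[simp] theorem lams_cons (v : V) (s : Multiset V) (φ : ConvexBody V → ℝ) :
    lams (v ::ₘ s) φ = lam v (lams s φ) := Multiset.foldr_cons _ _ _ _

theorem lams_add (s t : Multiset V) (φ : ConvexBody V → ℝ) :
    lams (s + t) φ = lams s (lams t φ) := by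
  induction s using Multiset.induction_on with
  | empty => simp
  | cons v s ih => simp [ih]

theorem lams_map (f : V →L[ℝ] V') (s : Multiset V) (φ : ConvexBody V' → ℝ) (K : ConvexBody V) :
    lams s (fun K => φ (K.mapCLM f)) K = lams (s.map f) φ (K.mapCLM f) := by
  induction s using Multiset.induction_on generalizing K with
  | empty => simp
  | cons v s ih =>
    rw [Multiset.map_cons, lams_cons, lams_cons, ← lam_map]
    simp only [lam, ih]

/-- The span of the elements of a multiset. -/
def mspan (s : Multiset V) : Submodule ℝ V := Submodule.span ℝ {x | x ∈ s}

theorem mspan_cons (v : V) (s : Multiset V) :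
    mspan (v ::ₘ s) = Submodule.span ℝ {v} ⊔ mspan s := by
  rw [mspan, mspan, ← Submodule.span_union]
  congr 1
  ext x
  simp

theorem subset_mspan {s : Multiset V} {x : V} (h : x ∈ s) : x ∈ mspan s :=
  Submodule.subset_span h

theorem mspan_le {s : Multiset V} {E : Submodule ℝ V} : mspan s ≤ E ↔ ∀ x ∈ s, x ∈ E :=
  Submodule.span_le

theorem mspan_mono {s t : Multiset V} (h : s ≤ t) : mspan s ≤ mspan t :=
  mspan_le.2 fun _ hx => subset_mspan (Multiset.mem_of_le h hx)

theorem mem_mspan_cons {v x : V} {s : Multiset V} :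
    x ∈ mspan (v ::ₘ s) ↔ ∃ a : ℝ, x - a • v ∈ mspan s := by
  rw [mspan_cons, Submodule.mem_sup]
  constructor
  · rintro ⟨y, hy, z, hz, rfl⟩
    obtain ⟨a, rfl⟩ := Submodule.mem_span_singleton.1 hy
    exact ⟨a, by simpa using hz⟩
  · rintro ⟨a, ha⟩
    exact ⟨a • v, Submodule.smul_mem _ _ (Submodule.mem_span_singleton_self v), _, ha, by simp⟩

namespace CTV

variable {φ : ConvexBody V → ℝ}

theorem lams (hφ : CTV φ) (s : Multiset V) : CTV (lams s φ) := by
  induction s using Multiset.induction_on with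
  | empty => simpa
  | cons v s ih => rw [lams_cons]; exact ih.lam v

theorem lams_homog (hφ : CTV φ) {j : ℕ} {s : Multiset V} (h : IsHomog (j + s.card) φ) :
    IsHomog j (_root_.lams s φ) := by
  induction s using Multiset.induction_on generalizing j with
  | empty => simpa using h
  | cons v s ih =>
    rw [lams_cons]
    refine (hφ.lams s).lam_homog (ih ?_) v
    rwa [Multiset.card_cons, ← add_assoc, add_right_comm] at h

variable [FiniteDimensional ℝ V]

theorem lams_congr (hφ : CTV φ) (s : Multiset V) : ∀ {K L : ConvexBody V},
    ModEq (mspan s) K L → _root_.lams s φ K = _root_.lams s φ L := by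
  induction s using Multiset.induction_on with
  | empty =>
    intro K L h
    congr 1
    have h0 : mspan (0 : Multiset V) = ⊥ := by simp [mspan]
    rw [h0] at h
    apply SetLike.coe_injective
    apply Set.Subset.antisymm
    · intro x hx
      obtain ⟨y, hy, hxy⟩ := h.1 x hx
      rw [Submodule.mem_bot, sub_eq_zero] at hxy
      exact hxy ▸ hy
    · intro x hx
      obtain ⟨y, hy, hxy⟩ := h.2 x hx
      rw [Submodule.mem_bot, sub_eq_zero] at hxy
      exact hxy ▸ hy
  | cons v s ih =>
    intro K L h
    rw [lams_cons]
    by_cases hv : v ∈ mspan s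
    · have h1 : ∀ K, _root_.lam v (_root_.lams s φ) K = 0 := fun K =>
        sub_eq_zero.2 (ih (ModEq.add_seg hv K))
      rw [h1, h1]
    · obtain ⟨ℓ, hℓ, hs⟩ := (mspan s).exists_le_ker_of_notMem hv
      set ℓ' : V →L[ℝ] ℝ := LinearMap.toContinuousLinearMap ((ℓ v)⁻¹ • ℓ) with hd
      have hv1 : ℓ' v = 1 := by
        simp [hd, inv_mul_cancel₀ hℓ]
      have hs1 : ∀ x ∈ mspan s, ℓ' x = 0 := by
        intro x hx
        have : ℓ x = 0 := hs hx
        simp [hd, this]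
      rw [(hφ.lams s).lam_proj hv1 K, (hφ.lams s).lam_proj hv1 L]
      have h2 : ModEq (mspan s) (K.mapCLM (ContinuousLinearMap.id ℝ V - ℓ'.smulRight v))
          (L.mapCLM (ContinuousLinearMap.id ℝ V - ℓ'.smulRight v)) := by
        refine h.map _ fun x hx => ?_
        obtain ⟨a, ha⟩ := mem_mspan_cons.1 hx
        have h3 := hs1 _ ha
        rw [map_sub, map_smul, hv1, sub_eq_zero] at h3
        simpa [h3] using ha
      rw [_root_.lam, _root_.lam, ih h2, ih (h2.add (ModEq.refl _ (ConvexBody.seg v)))]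

theorem lams_eq_zero_of_mem (hφ : CTV φ) {s : Multiset V} {v : V} (h : v ∈ mspan s)
    (K : ConvexBody V) : _root_.lams (v ::ₘ s) φ K = 0 := by
  rw [lams_cons]
  exact sub_eq_zero.2 (hφ.lams_congr s (ModEq.add_seg h K))

theorem lams_cons_congr (hφ : CTV φ) {s : Multiset V} {v w : V} (h : v - w ∈ mspan s) :
    _root_.lams (v ::ₘ s) φ = _root_.lams (w ::ₘ s) φ := by
  ext K
  rw [lams_cons, lams_cons, _root_.lam, _root_.lam, hφ.lams_congr s ((ModEq.refl _ K).add (ModEq.seg h))]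

theorem lams_cons_smul (hφ : CTV φ) (c : ℝ) (v : V) (s : Multiset V) (K : ConvexBody V) :
    _root_.lams ((c • v) ::ₘ s) φ K = |c| * _root_.lams (v ::ₘ s) φ K := by
  rw [lams_cons, lams_cons, (hφ.lams s).lam_smul]

theorem exists_cons_of_mem_mspan {s t : Multiset V} {v : V} (h : v ∈ mspan (s + t)) :
    v ∈ mspan t ∨ ∃ w s₀, ∃ c : ℝ, s = w ::ₘ s₀ ∧ c ≠ 0 ∧ v - c • w ∈ mspan (s₀ + t) := by
  induction s using Multiset.induction_on with
  | empty => left; simpa using h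
  | cons w s ih =>
    rw [Multiset.cons_add] at h
    obtain ⟨a, ha⟩ := mem_mspan_cons.1 h
    rcases eq_or_ne a 0 with rfl | ha0
    · rw [zero_smul, sub_zero] at ha
      rcases ih ha with h1 | ⟨w', s₀, c, rfl, hc, h1⟩
      · exact Or.inl h1
      · refine Or.inr ⟨w', w ::ₘ s₀, c, Multiset.cons_swap _ _ _, hc, ?_⟩
        exact mspan_mono (by rw [Multiset.cons_add]; exact Multiset.le_cons_self _ _) h1
    · exact Or.inr ⟨w, s, a, rfl, ha0, ha⟩

/-- Iterated differences along two systems with the same span are proportional. -/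
theorem exists_lams_eq (hφ : CTV φ) (s' : Multiset V) : ∀ (s t : Multiset V), s'.card = s.card →
    (∀ x ∈ s', x ∈ mspan (s + t)) →
    ∃ c : ℝ, ∀ K, _root_.lams (s' + t) φ K = c * _root_.lams (s + t) φ K := by
  induction s' using Multiset.induction_on with
  | empty =>
    intro s t hc _
    rw [Multiset.card_zero, eq_comm, Multiset.card_eq_zero] at hc
    exact ⟨1, fun K => by rw [hc, one_mul]⟩
  | cons v s' ih =>
    intro s t hc hs
    rcases exists_cons_of_mem_mspan (hs v (by simp)) with h | ⟨w, s₀, c, rfl, hc0, h⟩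
    · refine ⟨0, fun K => ?_⟩
      rw [zero_mul, Multiset.cons_add]
      exact hφ.lams_eq_zero_of_mem (mspan_mono (Multiset.le_add_left _ _) h) K
    · obtain ⟨c', hc'⟩ := ih s₀ (v ::ₘ t) (by simpa using hc) (fun x hx => by
        have h1 := hs x (Multiset.mem_cons_of_mem hx)
        rw [Multiset.cons_add] at h1
        rw [Multiset.add_cons]
        obtain ⟨a, ha⟩ := mem_mspan_cons.1 h1
        refine mem_mspan_cons.2 ⟨a * c⁻¹, ?_⟩
        have : x - (a * c⁻¹) • v = (x - a • w) - (a * c⁻¹) • (v - c • w) := by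
          rw [smul_sub, smul_smul, mul_assoc, inv_mul_cancel₀ hc0, mul_one]
          abel
        rw [this]
        exact Submodule.sub_mem _ ha (Submodule.smul_mem _ _ h))
      refine ⟨c' * |c|, fun K => ?_⟩
      rw [Multiset.cons_add, ← Multiset.add_cons, hc', Multiset.add_cons, Multiset.cons_add,
        hφ.lams_cons_congr h, hφ.lams_cons_smul, mul_assoc]

end CTV

end MultiLam

end

section

section Climb

set_option linter.unusedSectionVars false

open ConvexBody

theorem Submodule.exists_retraction {V : Type*} [NormedAddCommGroup V] [NormedSpace ℝ V]
    [FiniteDimensional ℝ V] (E : Submodule ℝ V) :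
    ∃ C : Submodule ℝ V, finrank ℝ E + finrank ℝ C = finrank ℝ V ∧
      ∃ p : V →L[ℝ] C, ∀ x, x - p x ∈ E := by
  obtain ⟨C, hC⟩ := E.exists_isCompl
  refine ⟨C, Submodule.finrank_add_eq_of_isCompl hC,
    LinearMap.toContinuousLinearMap (C.projectionOnto E hC.symm), fun x => ?_⟩
  exact Submodule.sub_projection_mem hC.symm x

namespace CTV

variable {V : Type*} [NormedAddCommGroup V] [NormedSpace ℝ V] [FiniteDimensional ℝ V]
  {φ : ConvexBody V → ℝ}

theorem lams_eq_zero_of_finrank_lt (hφ : CTV φ) (s : Multiset V)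
    (h : finrank ℝ (mspan s) < s.card) (K : ConvexBody V) : _root_.lams s φ K = 0 := by
  induction s using Multiset.induction_on generalizing K with
  | empty => simp at h
  | cons v s ih =>
    by_cases hv : v ∈ mspan s
    · exact hφ.lams_eq_zero_of_mem hv K
    · have h1 : mspan s < mspan (v ::ₘ s) := by
        refine lt_of_le_of_ne (mspan_mono (Multiset.le_cons_self _ _)) fun he => hv ?_
        rw [he]
        exact subset_mspan (by simp)
      have h2 := Submodule.finrank_lt_finrank_of_lt h1
      rw [Multiset.card_cons] at h
      have h3 := ih (by omega)
      rw [lams_cons, _root_.lam, h3, h3, sub_zero]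

theorem eq_zero_of_lams (hφ : CTV φ) {i k₀ : ℕ} (hi : IsHomog i φ)
    (h0 : ∀ s : Multiset V, s.card = k₀ → ∀ K, _root_.lams s φ K = 0)
    (hk : finrank ℝ V + k₀ ≤ 2 * i) (K : ConvexBody V) : φ K = 0 := by
  have key : ∀ j ≤ k₀, ∀ s : Multiset V, s.card = k₀ - j → ∀ K, _root_.lams s φ K = 0 := by
    intro j
    induction j with
    | zero => intro _ s hs; exact h0 s (by simpa using hs)
    | succ j ih =>
      intro hj s hs K
      have hle : finrank ℝ (mspan s) ≤ finrank ℝ V := Submodule.finrank_le _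
      rcases lt_or_ge (finrank ℝ (mspan s)) s.card with h1 | h1
      · exact hφ.lams_eq_zero_of_finrank_lt s h1 K
      obtain ⟨C, hC, p, hp⟩ := (mspan s).exists_retraction
      have hS : SegFree fun A : ConvexBody C => _root_.lams s φ (A.mapCLM C.subtypeL) := by
        refine ⟨(hφ.lams s).map _, fun v A => ?_⟩
        rw [lam_map, ← lams_cons]
        exact ih (by omega) _ (by rw [Multiset.card_cons]; omega) _
      have hh : IsHomog (i - s.card) (_root_.lams s φ) :=
        hφ.lams_homog (by rwa [Nat.sub_add_cancel (by omega)])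
      have h2 := hS.eq_zero_of_lt (i := i - s.card) (fun A t ht => by
        beta_reduce; rw [mapCLM_smul]; exact hh _ t ht) (by omega) (K.mapCLM p)
      rw [← h2, mapCLM_mapCLM]
      exact hφ.lams_congr s (ModEq.mapCLM_self _ hp K)
  exact key k₀ le_rfl 0 (by simp) K

end CTV

theorem ConvexBody.mapCLM_zero_body {V V' : Type*} [NormedAddCommGroup V] [NormedSpace ℝ V]
    [NormedAddCommGroup V'] [NormedSpace ℝ V'] (f : V →L[ℝ] V') :
    (0 : ConvexBody V).mapCLM f = 0 := by
  rw [← point_zero, mapCLM_point, map_zero, point_zero]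

section Equivariant

variable {W : Type*} [NormedAddCommGroup W] [NormedSpace ℂ W] [FiniteDimensional ℂ W]
  {F : ConvexBody W → W → ℝ}

theorem lams_const_mul {V : Type*} [NormedAddCommGroup V] [NormedSpace ℝ V] (s : Multiset V)
    (c : ℝ) (φ : ConvexBody V → ℝ) (K : ConvexBody V) :
    lams s (fun K => c * φ K) K = c * lams s φ K := by
  induction s using Multiset.induction_on generalizing K with
  | empty => simp
  | cons v s ih => simp only [lams_cons, lam, ih, mul_sub]

theorem EquivFam.lams_smul (hF : EquivFam F) (s : Multiset W) {t : ℝ} (ht : 0 < t) (u : W)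
    (K : ConvexBody W) : lams s (fun K => F K (t • u)) K = t * lams s (fun K => F K u) K := by
  simp only [hF.pos t ht]
  exact lams_const_mul _ _ _ _

theorem EquivFam.lams_equiv (hF : EquivFam F) {B : W →ₗ[ℂ] W} (hB : LinearMap.det B = 1)
    (s : Multiset W) (K : ConvexBody W) (u : W) :
    lams (s.map B) (fun K => F K (B u)) (K.mapCLM (cReal B)) = lams s (fun K => F K u) K := by
  have h1 := lams_map (cReal B) s (fun K => F K (B u)) K
  simp only [hF.equiv B hB] at h1
  exact h1.symm

theorem EquivFam.lams_scale (hF : EquivFam F) {i : ℕ} (hi : ∀ u, IsHomog i fun K => F K u)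
    {B : W →ₗ[ℂ] W} {s : ℝ} (hs : 0 < s) (hB : LinearMap.det B = (s ^ finrank ℂ W : ℝ))
    (v : Multiset W) (K : ConvexBody W) (u : W) :
    lams (v.map B) (fun K => F K (B u)) (K.mapCLM (cReal B))
      = s ^ (i + 1) * lams v (fun K => F K u) K := by
  have h1 := lams_map (cReal B) v (fun K => F K (B u)) K
  simp only [hF.scale hi hs hB] at h1
  rw [lams_const_mul] at h1
  exact h1.symm

theorem EquivFam.eq_zero_top (hF : EquivFam F) (hi : ∀ u, IsHomog (2 * finrank ℂ W) fun K => F K u)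
    (h2 : 2 ≤ finrank ℂ W) (K : ConvexBody W) (u : W) : F K u = 0 := by
  rcases eq_or_ne u 0 with rfl | hu
  · exact hF.zero_right K
  obtain ⟨ξ, hξ⟩ := exists_dual_eq_one hu
  set R : Submodule ℝ W := (LinearMap.ker ξ).restrictScalars ℝ with hR
  have hfin := Module.Dual.finrank_ker_add_one_of_ne_zero (f := ξ) (by rintro rfl; simp at hξ)
  have hfR : finrank ℝ R = 2 * finrank ℂ W - 2 := by
    have : finrank ℝ R = 2 * finrank ℂ (LinearMap.ker ξ) := finrank_real_of_complex _
    omega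
  set bR := finBasis ℝ R with hbR
  set r : Multiset W := Finset.univ.val.map fun j => (bR j : W) with hr
  have hrcard : r.card = 2 * finrank ℂ W - 2 := by simp [hr, hfR]
  have hrmem : ∀ x ∈ r, ξ x = 0 := by
    intro x hx
    obtain ⟨j, -, rfl⟩ := Multiset.mem_map.1 hx
    exact (bR j).2
  have hrspan : ∀ x, ξ x = 0 → x ∈ mspan r := by
    intro x hx
    have h1 := bR.sum_repr ⟨x, hx⟩
    have h3 : x = ∑ j, bR.repr ⟨x, hx⟩ j • (bR j : W) := by
      have := congrArg (Subtype.val) h1.symm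
      rwa [AddSubmonoidClass.coe_finsetSum] at this
    rw [h3]
    exact Submodule.sum_mem _ fun j _ => Submodule.smul_mem _ _ (subset_mspan (by simp [hr]))
  set sb : Multiset W := u ::ₘ (Complex.I • u) ::ₘ r with hsb
  set m := finrank ℂ W with hm
  have hctv := hF.ctv u
  have h0 : lams sb (fun K => F K u) 0 = 0 := by
    have h1 := hF.lams_scale hi (s := 2) (by norm_num) (det_cdil hξ ((2 ^ m : ℝ))) sb 0 u
    have h3 : sb.map (cdil ξ u ((2 ^ m : ℝ))) = ((2 : ℝ) ^ m • u) ::ₘ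
        ((2 : ℝ) ^ m • Complex.I • u) ::ₘ r := by
      rw [hsb, Multiset.map_cons, Multiset.map_cons, cdil_self hξ, map_smul, cdil_self hξ,
        Complex.coe_smul, smul_comm]
      congr 2
      conv_rhs => rw [← Multiset.map_id r]
      refine Multiset.map_congr rfl fun x hx => ?_
      simp [hrmem x hx]
    rw [h3, mapCLM_zero_body, cdil_self hξ, Complex.coe_smul, hF.lams_smul _ (by positivity),
      hctv.lams_cons_smul, Multiset.cons_swap, hctv.lams_cons_smul, Multiset.cons_swap, ← hsb,
      abs_of_pos (by positivity), ← mul_assoc, ← mul_assoc, ← pow_add, ← pow_add] at h1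
    by_contra h4
    have h5 := mul_right_cancel₀ h4 h1
    have := pow_right_injective₀ (a := (2 : ℝ)) (by norm_num) (by norm_num) h5
    omega
  refine hctv.eq_zero_of_lams (hi u) (k₀ := 2 * m) (fun s hs K => ?_)
    (by rw [finrank_real_of_complex]; omega) K
  obtain ⟨c, hc⟩ := hctv.exists_lams_eq s sb 0 (by simp [hsb, hrcard, hs]; omega) (fun x _ => by
    rw [add_zero]
    refine mem_mspan_cons.2 ⟨(ξ x).re, mem_mspan_cons.2 ⟨(ξ x).im, hrspan _ ?_⟩⟩
    rw [sub_sub, ← smul_eq_re_add_im, map_sub, map_smul, hξ]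
    simp)
  simp only [add_zero] at hc
  have hh : IsHomog 0 (lams sb fun K => F K u) := hctv.lams_homog (by
    have : 0 + sb.card = 2 * m := by simp [hsb, hrcard]; omega
    rw [this]; exact hi u)
  rw [hc, hh.eq_zero_body, h0, mul_zero]

theorem SublinFam.eq_famComp (hf : SublinFam F) (h3 : 3 ≤ finrank ℂ W) (K : ConvexBody W) (u : W) :
    F K u = famComp F (2 * finrank ℂ W - 1) K u := by
  rw [hf.eq_add h3, (hf.famComp (2 * finrank ℂ W)).eq_zero_top (hf.famComp_homog _) (by omega),
    add_zero]

theorem SublinFam.homog (hf : SublinFam F) (h3 : 3 ≤ finrank ℂ W) (u : W) :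
    IsHomog (2 * finrank ℂ W - 1) fun K => F K u := by
  have : (fun K => F K u) = fun K => famComp F (2 * finrank ℂ W - 1) K u :=
    funext fun K => hf.eq_famComp h3 K u
  rw [this]
  exact hf.famComp_homog _ u

end Equivariant

end Climb

end

section

section Reduction

set_option linter.unusedSectionVars false

open ConvexBody

theorem lams_subadditive {W : Type*} [NormedAddCommGroup W] [NormedSpace ℝ W]
    {F : ConvexBody W → W → ℝ} (hc : ∀ u, CTV fun K => F K u)
    (hs : ∀ K u v, F K (u + v) ≤ F K u + F K v) (s : Multiset W) (K : ConvexBody W) (u v : W) :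
    lams s (fun K => F K (u + v)) K ≤ lams s (fun K => F K u) K + lams s (fun K => F K v) K := by
  induction s using Multiset.induction_on generalizing K u v with
  | empty => exact hs K u v
  | cons w s ih =>
    simp only [lams_cons]
    exact lam_subadditive (F := fun K u => lams s (fun K => F K u) K) (fun u => (hc u).lams s)
      (fun K u v => ih K u v) w K u v

variable {W : Type*} [NormedAddCommGroup W] [NormedSpace ℂ W] [FiniteDimensional ℂ W]
  {F : ConvexBody W → W → ℝ}

theorem EquivFam.lams_line_self (hF : EquivFam F)
    (hi : ∀ u, IsHomog (2 * finrank ℂ W - 1) fun K => F K u) {ξ : W →ₗ[ℂ] ℂ} {e : W}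
    (hξ : ξ e = 1) {s : Multiset W} (hs : ∀ x ∈ s, ξ x = 0) (c : ℂ) (K : ConvexBody W) :
    lams (e ::ₘ (Complex.I • e) ::ₘ s) (fun K => F K (c • e)) K = 0 := by
  have hm : 0 < finrank ℂ W := by
    have : Nontrivial W := ⟨e, 0, by rintro rfl; simp at hξ⟩
    exact finrank_pos
  set m := finrank ℂ W with hmdef
  set E := mspan (e ::ₘ (Complex.I • e) ::ₘ s) with hE
  have hctv := hF.ctv (c • e)
  have h1 := hF.lams_scale hi (s := 2) (by norm_num) (det_cdil hξ ((2 ^ m : ℝ)))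
    (e ::ₘ (Complex.I • e) ::ₘ s) K (c • e)
  have h3 : (e ::ₘ (Complex.I • e) ::ₘ s).map (cdil ξ e ((2 ^ m : ℝ))) = ((2 : ℝ) ^ m • e) ::ₘ
      ((2 : ℝ) ^ m • Complex.I • e) ::ₘ s := by
    rw [Multiset.map_cons, Multiset.map_cons, cdil_self hξ, map_smul, cdil_self hξ,
      Complex.coe_smul, smul_comm]
    congr 2
    conv_rhs => rw [← Multiset.map_id s]
    refine Multiset.map_congr rfl fun x hx => ?_
    simp [hs x hx]
  have h4 : cdil ξ e ((2 ^ m : ℝ)) (c • e) = (2 : ℝ) ^ m • c • e := by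
    rw [map_smul, cdil_self hξ, Complex.coe_smul, smul_comm]
  have h5 : ModEq E K (K.mapCLM (cReal (cdil ξ e ((2 ^ m : ℝ))))) := by
    refine ModEq.mapCLM_self _ (fun x => ?_) K
    rw [cReal_apply, cdil_apply, sub_add_cancel_left, smul_eq_re_add_im]
    exact E.neg_mem (E.add_mem (E.smul_mem _ (subset_mspan (by simp)))
      (E.smul_mem _ (subset_mspan (by simp))))
  rw [h3, h4, hF.lams_smul _ (by positivity), hctv.lams_cons_smul, Multiset.cons_swap,
    hctv.lams_cons_smul, Multiset.cons_swap, abs_of_pos (by positivity),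
    ← hctv.lams_congr _ h5, ← mul_assoc, ← mul_assoc, ← pow_add, ← pow_add] at h1
  by_contra h6
  have h7 := mul_right_cancel₀ h6 h1
  have := pow_right_injective₀ (a := (2 : ℝ)) (by norm_num) (by norm_num) h7
  omega

theorem SublinFam.lams_line (hF : SublinFam F)
    (hi : ∀ u, IsHomog (2 * finrank ℂ W - 1) fun K => F K u) {ξ : W →ₗ[ℂ] ℂ} {e : W}
    (hξ : ξ e = 1) {s : Multiset W} (hs : ∀ x ∈ s, ξ x = 0) (u : W) (c : ℂ) (K : ConvexBody W) :
    lams (e ::ₘ (Complex.I • e) ::ₘ s) (fun K => F K (u + c • e)) K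
      = lams (e ::ₘ (Complex.I • e) ::ₘ s) (fun K => F K u) K := by
  apply le_antisymm
  · have := lams_subadditive hF.ctv hF.sub (e ::ₘ (Complex.I • e) ::ₘ s) K u (c • e)
    rw [hF.lams_line_self hi hξ hs] at this
    linarith
  · have := lams_subadditive hF.ctv hF.sub (e ::ₘ (Complex.I • e) ::ₘ s) K (u + c • e) ((-c) • e)
    rw [hF.lams_line_self hi hξ hs, neg_smul, add_neg_cancel_right] at this
    linarith

/-- The real multiset obtained from a complex one by adjoining all multiples by `I`. -/
def cpair (r : Multiset W) : Multiset W := r + r.map (Complex.I • ·)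

theorem cpair_cons (v : W) (r : Multiset W) :
    cpair (v ::ₘ r) = v ::ₘ (Complex.I • v) ::ₘ cpair r := by
  simp [cpair, Multiset.cons_swap]

@[simp] theorem card_cpair (r : Multiset W) : (cpair r).card = 2 * r.card := by
  simp [cpair]; ring

theorem cpair_map (g : W →ₗ[ℂ] W) (r : Multiset W) : (cpair r).map g = cpair (r.map g) := by
  simp [cpair]

theorem mem_cpair {r : Multiset W} {x : W} :
    x ∈ cpair r ↔ x ∈ r ∨ ∃ y ∈ r, Complex.I • y = x := by
  simp [cpair]

variable {k : ℕ} (e : Basis (Fin 3 ⊕ Fin k) ℂ W)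

/-- The complex vectors of a basis after the first three. -/
def restVec : Multiset W := Finset.univ.val.map fun j => e (Sum.inr j)

/-- The embedding of `ℂ³` given by the first three basis vectors. -/
def emb : (Fin 3 → ℂ) →ₗ[ℂ] W := Fintype.linearCombination ℂ fun i => e (Sum.inl i)

theorem emb_apply (x : Fin 3 → ℂ) :
    emb e x = x 0 • e (Sum.inl 0) + x 1 • e (Sum.inl 1) + x 2 • e (Sum.inl 2) := by
  simp [emb, Fintype.linearCombination_apply, Fin.sum_univ_three]

/-- `emb` as a real continuous linear map. -/
def embR : (Fin 3 → ℂ) →L[ℝ] W := LinearMap.toContinuousLinearMap ((emb e).restrictScalars ℝ)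

@[simp] theorem embR_apply (x : Fin 3 → ℂ) : embR e x = emb e x := rfl

/-- Extension of an endomorphism of `ℂ³` by the identity. -/
def extMap (g : (Fin 3 → ℂ) →ₗ[ℂ] (Fin 3 → ℂ)) : W →ₗ[ℂ] W :=
  Matrix.toLin e e (Matrix.fromBlocks (LinearMap.toMatrix' g) 0 0 1)

theorem det_extMap (g : (Fin 3 → ℂ) →ₗ[ℂ] (Fin 3 → ℂ)) :
    LinearMap.det (extMap e g) = LinearMap.det g := by
  rw [extMap, LinearMap.det_toLin, Matrix.det_fromBlocks_zero₂₁, Matrix.det_one, mul_one,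
    LinearMap.det_toMatrix']

theorem extMap_inr (g : (Fin 3 → ℂ) →ₗ[ℂ] (Fin 3 → ℂ)) (j : Fin k) :
    extMap e g (e (Sum.inr j)) = e (Sum.inr j) := by
  rw [extMap, Matrix.toLin_self]
  simp [Matrix.one_apply]

theorem extMap_emb (g : (Fin 3 → ℂ) →ₗ[ℂ] (Fin 3 → ℂ)) (x : Fin 3 → ℂ) :
    extMap e g (emb e x) = emb e (g x) := by
  have : (extMap e g) ∘ₗ emb e = emb e ∘ₗ g := by
    refine (Pi.basisFun ℂ (Fin 3)).ext fun i => ?_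
    rw [LinearMap.comp_apply, LinearMap.comp_apply, Pi.basisFun_apply]
    have h1 : emb e (Pi.single i 1) = e (Sum.inl i) := by
      simp [emb]
    rw [h1, extMap, Matrix.toLin_self]
    simp [emb, Fintype.linearCombination_apply, LinearMap.toMatrix'_apply]
  exact LinearMap.congr_fun this x

/-- The family on `ℂ³` obtained by eliminating the remaining basis vectors. -/
def redFam (F : ConvexBody W → W → ℝ) (K : ConvexBody (Fin 3 → ℂ)) (u : Fin 3 → ℂ) : ℝ :=
  lams (cpair (restVec e)) (fun K => F K (emb e u)) (K.mapCLM (embR e))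

theorem EquivFam.redFam (hF : EquivFam F) : EquivFam (redFam e F) where
  ctv u := ((hF.ctv _).lams _).map _
  pos t ht K u := by
    have : emb e (t • u) = t • emb e u := (embR e).map_smul t u
    simp only [_root_.redFam, this]
    exact hF.lams_smul _ ht _ _
  equiv g hg K u := by
    have h1 := hF.lams_equiv (B := extMap e g) (by rw [det_extMap, hg]) (cpair (restVec e))
      (K.mapCLM (embR e)) (emb e u)
    have h2 : (restVec e).map (extMap e g) = restVec e := by
      simp [restVec, Function.comp_def, extMap_inr]
    rw [cpair_map, h2, mapCLM_mapCLM, extMap_emb] at h1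
    rw [_root_.redFam, mapCLM_mapCLM, _root_.redFam, ← h1]
    congr 2
    ext x
    exact (extMap_emb e g x).symm

theorem SublinFam.redFam (hF : SublinFam F) : SublinFam (redFam e F) where
  toEquivFam := hF.toEquivFam.redFam e
  sub K u v := by
    simp only [_root_.redFam, map_add]
    exact lams_subadditive hF.ctv hF.sub _ _ _ _

theorem redFam_homog (hc : ∀ u, CTV fun K => F K u)
    (hi : ∀ u, IsHomog (2 * finrank ℂ W - 1) fun K => F K u) (u : Fin 3 → ℂ) :
    IsHomog 5 fun K => redFam e F K u := by
  have h0 : 2 * finrank ℂ W - 1 = 5 + (cpair (restVec e)).card := by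
    rw [finrank_eq_card_basis e]
    simp [restVec]
    omega
  have h1 : IsHomog 5 (lams (cpair (restVec e)) fun K => F K (emb e u)) :=
    (hc _).lams_homog (by rw [← h0]; exact hi _)
  intro K t ht
  have := h1 (K.mapCLM (embR e)) t ht
  rw [← mapCLM_smul] at this
  exact this

theorem lams_redFam (s : Multiset (Fin 3 → ℂ)) (F : ConvexBody W → W → ℝ)
    (K : ConvexBody (Fin 3 → ℂ)) (u : Fin 3 → ℂ) :
    lams s (fun K => redFam e F K u) K
      = lams (s.map (emb e) + cpair (restVec e)) (fun K => F K (emb e u)) (K.mapCLM (embR e)) := by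
  rw [lams_add]
  exact lams_map (embR e) s (lams (cpair (restVec e)) fun K => F K (emb e u)) K

theorem SublinFam.lams_eq_emb (hF : SublinFam F)
    (hi : ∀ u, IsHomog (2 * finrank ℂ W - 1) fun K => F K u) (s : Multiset W)
    (hs : ∀ x ∈ s, ∀ j, e.repr x (Sum.inr j) = 0) (u : W) (K : ConvexBody W) :
    lams (s + cpair (restVec e)) (fun K => F K u) K
      = lams (s + cpair (restVec e)) (fun K => F K (emb e fun i => e.repr u (Sum.inl i))) K := by
  have key : ∀ (T : Finset (Fin k)) (v : W) (c : Fin k → ℂ),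
      lams (s + cpair (restVec e)) (fun K => F K (v + ∑ j ∈ T, c j • e (Sum.inr j))) K
        = lams (s + cpair (restVec e)) (fun K => F K v) K := by
    intro T v c
    induction T using Finset.induction_on with
    | empty => simp
    | insert j T hj ih =>
      rw [← ih]
      have h1 : s + cpair (restVec e) = e (Sum.inr j) ::ₘ (Complex.I • e (Sum.inr j)) ::ₘ
          (s + cpair (((Finset.univ.erase j).val).map fun j => e (Sum.inr j))) := by
        have : restVec e = e (Sum.inr j) ::ₘ
            (((Finset.univ.erase j).val).map fun j => e (Sum.inr j)) := by
          rw [← Multiset.map_cons (fun j => e (Sum.inr j)), restVec, Finset.erase_val,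
            Multiset.cons_erase (by simp)]
        rw [this, cpair_cons]
        simp
      have h2 : v + ∑ i ∈ insert j T, c i • e (Sum.inr i)
          = (v + ∑ i ∈ T, c i • e (Sum.inr i)) + c j • e (Sum.inr j) := by
        rw [Finset.sum_insert hj]; abel
      rw [h2, h1]
      refine hF.lams_line hi (ξ := e.coord (Sum.inr j)) (by simp) (fun x hx => ?_) _ _ _
      rcases Multiset.mem_add.1 hx with hx | hx
      · exact hs x hx j
      · have h3 : ∀ y ∈ ((Finset.univ.erase j).val).map fun j => e (Sum.inr j),
            e.coord (Sum.inr j) y = 0 := by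
          intro y hy
          obtain ⟨i, hi, rfl⟩ := Multiset.mem_map.1 hy
          have : i ≠ j := Finset.ne_of_mem_erase (by rwa [← Finset.mem_val])
          simp [this]
        rcases mem_cpair.1 hx with hx | ⟨y, hy, rfl⟩
        · exact h3 x hx
        · rw [map_smul, h3 y hy, smul_zero]
  have h := key Finset.univ (emb e fun i => e.repr u (Sum.inl i)) fun j => e.repr u (Sum.inr j)
  rw [← h]
  have h2 : u = (emb e fun i => e.repr u (Sum.inl i))
      + ∑ j, e.repr u (Sum.inr j) • e (Sum.inr j) := by
    conv_lhs => rw [← e.sum_repr u]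
    rw [Fintype.sum_sum_type]
    simp [emb, Fintype.linearCombination_apply]
  rw [← h2]

end Reduction

end

section

section Frames

set_option linter.unusedSectionVars false

open ConvexBody

theorem CTV.lams_neg_cons {V : Type*} [NormedAddCommGroup V] [NormedSpace ℝ V]
    {φ : ConvexBody V → ℝ} (hφ : CTV φ) (v : V) (s : Multiset V) :
    _root_.lams (-v ::ₘ s) φ = _root_.lams (v ::ₘ s) φ := by
  rw [lams_cons, lams_cons, (hφ.lams s).lam_neg]

theorem ConvexBody.hull_pair {V : Type*} [NormedAddCommGroup V] [NormedSpace ℝ V] (a b : V) :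
    hull {a, b} = seg (b - a) + point a := by
  apply ConvexBody.ext
  ext x
  rw [coe_hull (by simp) (by simp), convexHull_pair, segment_eq_image', coe_add, coe_point,
    Set.add_singleton]
  constructor
  · rintro ⟨t, ⟨h0, h1⟩, rfl⟩
    exact ⟨t • (b - a), mem_seg.2 ⟨t, h0, h1, rfl⟩, add_comm _ _⟩
  · rintro ⟨y, hy, rfl⟩
    obtain ⟨t, h0, h1, rfl⟩ := mem_seg.1 hy
    exact ⟨t, ⟨h0, h1⟩, add_comm _ _⟩

theorem IsHomog.lam_zero_body {V : Type*} [NormedAddCommGroup V] [NormedSpace ℝ V]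
    {φ : ConvexBody V → ℝ} {i : ℕ} (h : IsHomog (i + 1) φ) (v : V) : lam v φ 0 = φ (seg v) := by
  rw [lam, h.apply_zero, zero_add, sub_zero]

theorem CTV.seg_eq_zero {V : Type*} [NormedAddCommGroup V] [NormedSpace ℝ V]
    {φ : ConvexBody V → ℝ} (hφ : CTV φ) (h : IsHomog 2 φ) (v : V) : φ (seg v) = 0 := by
  have h1 := hφ.lam_smul 2 v 0
  have h2 := h (seg v) 2 (by norm_num)
  rw [h.lam_zero_body, h.lam_zero_body, ← smul_seg, h2] at h1
  norm_num at h1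
  linarith

variable {W : Type*} [NormedAddCommGroup W] [NormedSpace ℂ W] [FiniteDimensional ℂ W]
  {F : ConvexBody W → W → ℝ}

theorem EquivFam.lams_cdil_zero (hF : EquivFam F)
    (hi : ∀ u, IsHomog (2 * finrank ℂ W - 1) fun K => F K u) {ξ : W →ₗ[ℂ] ℂ} {e : W}
    (hξ : ξ e = 1) {s : Multiset W} (hs : ∀ x ∈ s, ξ x = 0) (c : ℂ) (K : ConvexBody W) :
    lams ((Complex.I • e) ::ₘ s) (fun K => F K (c • e)) (K.mapCLM (cReal (cdil ξ e 0)))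
      = lams ((Complex.I • e) ::ₘ s) (fun K => F K (c • e)) K := by
  have hm : 0 < finrank ℂ W := by
    have : Nontrivial W := ⟨e, 0, by rintro rfl; simp at hξ⟩
    exact finrank_pos
  set m := finrank ℂ W with hmdef
  have hctv := hF.ctv (c • e)
  have key := eq_at_zero_of_pos
    (f := fun b : ℝ => lams ((Complex.I • e) ::ₘ s) (fun K => F K (c • e))
      (K.mapCLM (cReal (cdil ξ e ((b ^ m : ℝ))))))
    (g := fun _ => lams ((Complex.I • e) ::ₘ s) (fun K => F K (c • e)) K) ?_ continuous_const ?_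
  · simpa [hm.ne'] using key
  · exact (hctv.lams _).cont.comp
      (Continuous.mapCLM ((continuous_cdil ξ e).comp (continuous_pow _)) continuous_const)
  · intro b hb
    have h1 := hF.lams_scale hi hb (det_cdil hξ ((b ^ m : ℝ))) ((Complex.I • e) ::ₘ s) K (c • e)
    have h3 : ((Complex.I • e) ::ₘ s).map (cdil ξ e ((b ^ m : ℝ))) =
        (b ^ m • Complex.I • e) ::ₘ s := by
      rw [Multiset.map_cons, map_smul, cdil_self hξ, Complex.coe_smul, smul_comm]
      congr 1
      conv_rhs => rw [← Multiset.map_id s]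
      refine Multiset.map_congr rfl fun x hx => ?_
      simp [hs x hx]
    have h4 : cdil ξ e ((b ^ m : ℝ)) (c • e) = b ^ m • c • e := by
      rw [map_smul, cdil_self hξ, Complex.coe_smul, smul_comm]
    rw [h3, h4, hF.lams_smul _ (by positivity), hctv.lams_cons_smul, abs_of_pos (by positivity),
      ← mul_assoc, ← pow_add] at h1
    have : 2 * m - 1 + 1 = m + m := by omega
    rw [this] at h1
    exact mul_left_cancel₀ (by positivity) h1

/-- The segments used to project onto the real plane spanned by `v₀` and `v₁`. -/
def frame (v₀ v₁ v₂ : W) : Multiset W :=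
  v₂ ::ₘ (Complex.I • v₂) ::ₘ (Complex.I • v₀) ::ₘ (Complex.I • v₁) ::ₘ 0

variable {φ : ConvexBody W → ℝ} (v₀ v₁ v₂ : W)

theorem frame_swap : frame v₁ v₀ v₂ = frame v₀ v₁ v₂ := by
  rw [frame, frame, Multiset.cons_swap (Complex.I • v₀)]

theorem CTV.frame_neg_left (hφ : CTV φ) :
    _root_.lams (frame (-v₀) v₁ v₂) φ = _root_.lams (frame v₀ v₁ v₂) φ := by
  simp only [frame, lams_cons, smul_neg]
  rw [((hφ.lams 0).lam (Complex.I • v₁)).lam_neg]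

theorem CTV.frame_neg_mid (hφ : CTV φ) :
    _root_.lams (frame v₀ (-v₁) v₂) φ = _root_.lams (frame v₀ v₁ v₂) φ := by
  rw [frame_swap, hφ.frame_neg_left, frame_swap]

theorem CTV.frame_neg_right (hφ : CTV φ) :
    _root_.lams (frame v₀ v₁ (-v₂)) φ = _root_.lams (frame v₀ v₁ v₂) φ := by
  rw [frame, smul_neg, hφ.lams_neg_cons, Multiset.cons_swap, hφ.lams_neg_cons,
    Multiset.cons_swap, ← frame]

theorem CTV.frame_add_left (hφ : CTV φ) (r : ℝ) :
    _root_.lams (frame (v₀ + r • v₁) v₁ v₂) φ = _root_.lams (frame v₀ v₁ v₂) φ := by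
  simp only [frame]
  rw [lams_cons, lams_cons, hφ.lams_cons_congr (w := Complex.I • v₀), ← lams_cons, ← lams_cons]
  rw [smul_add, add_sub_cancel_left, smul_comm]
  exact Submodule.smul_mem _ _ (subset_mspan (by simp))

theorem CTV.frame_add_mid (hφ : CTV φ) (r : ℝ) :
    _root_.lams (frame v₀ (v₁ + r • v₀) v₂) φ = _root_.lams (frame v₀ v₁ v₂) φ := by
  rw [frame_swap, hφ.frame_add_left, frame_swap]

theorem frame_map (g : W →ₗ[ℂ] W) : (frame v₀ v₁ v₂).map g = frame (g v₀) (g v₁) (g v₂) := by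
  simp [frame]

theorem EquivFam.frame_equiv (hF : EquivFam F) {g : W →ₗ[ℂ] W} (hg : LinearMap.det g = 1)
    (K : ConvexBody W) (u : W) :
    _root_.lams (frame (g v₀) (g v₁) (g v₂)) (fun K => F K (g u)) (K.mapCLM (cReal g))
      = _root_.lams (frame v₀ v₁ v₂) (fun K => F K u) K := by
  rw [← frame_map, hF.lams_equiv hg]

end Frames

end

section

section Theta

set_option linter.unusedSectionVars false

open ConvexBody

/-- The standard basis vectors of `ℂ³`. -/
def c0 : Fin 3 → ℂ := ![1, 0, 0]
/-- The standard basis vectors of `ℂ³`. -/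
def c1 : Fin 3 → ℂ := ![0, 1, 0]
/-- The standard basis vectors of `ℂ³`. -/
def c2 : Fin 3 → ℂ := ![0, 0, 1]

/-- The standard triangle in the real plane spanned by the first two basis vectors. -/
def tri3 : ConvexBody (Fin 3 → ℂ) := hull {0, -c0, -c1}

theorem toLin'_three (A : Matrix (Fin 3) (Fin 3) ℂ) (x : Fin 3 → ℂ) :
    Matrix.toLin' A x = ![A 0 0 * x 0 + A 0 1 * x 1 + A 0 2 * x 2,
      A 1 0 * x 0 + A 1 1 * x 1 + A 1 2 * x 2, A 2 0 * x 0 + A 2 1 * x 1 + A 2 2 * x 2] := by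
  ext i
  fin_cases i <;> simp [Matrix.mulVec, dotProduct, Fin.sum_univ_three]

theorem vec_three_smul_add (a b c : ℂ) : (![a, b, c] : Fin 3 → ℂ) = ![a, b, 0] + c • c2 := by
  ext i; fin_cases i <;> simp [c2]

theorem vec_three_smul_add' (a b : ℂ) : (![a, b, 0] : Fin 3 → ℂ) = ![a, 0, 0] + b • c1 := by
  ext i; fin_cases i <;> simp [c1]

/-- The function of two complex variables determining a projection-type family. -/
def theta (F : ConvexBody (Fin 3 → ℂ) → (Fin 3 → ℂ) → ℝ) (a b : ℂ) : ℝ :=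
  lams (frame c0 c1 c2) (fun K => F K ![a, b, 0]) tri3

/-- The restriction of `theta` to segments. -/
def edge (F : ConvexBody (Fin 3 → ℂ) → (Fin 3 → ℂ) → ℝ) (a : ℂ) : ℝ :=
  lams (frame c0 c1 c2) (fun K => F K ![a, 0, 0]) (seg c1)

variable {F : ConvexBody (Fin 3 → ℂ) → (Fin 3 → ℂ) → ℝ}

theorem homog_finrank_three (hi : ∀ u, IsHomog 5 fun K => F K u) (u : Fin 3 → ℂ) :
    IsHomog (2 * finrank ℂ (Fin 3 → ℂ) - 1) fun K => F K u := by
  have : 2 * finrank ℂ (Fin 3 → ℂ) - 1 = 5 := by simp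
  rw [this]
  exact hi u

theorem mapCLM_tri3 (g : (Fin 3 → ℂ) →ₗ[ℂ] (Fin 3 → ℂ)) :
    tri3.mapCLM (cReal g) = hull {0, -g c0, -g c1} := by
  rw [tri3, mapCLM_hull _ (by simp) (by simp)]
  simp [Set.image_insert_eq]

theorem mapCLM_seg_cReal (g : (Fin 3 → ℂ) →ₗ[ℂ] (Fin 3 → ℂ)) (v : Fin 3 → ℂ) :
    (seg v).mapCLM (cReal g) = seg (g v) := by
  rw [mapCLM_seg, cReal_apply]

namespace SublinFam

theorem frame_last (hF : SublinFam F) (hi : ∀ u, IsHomog 5 fun K => F K u) (a b c : ℂ)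
    (K : ConvexBody (Fin 3 → ℂ)) :
    lams (frame c0 c1 c2) (fun K => F K ![a, b, c]) K
      = lams (frame c0 c1 c2) (fun K => F K ![a, b, 0]) K := by
  rw [vec_three_smul_add a b c, frame]
  refine hF.lams_line (homog_finrank_three hi) (ξ := LinearMap.proj 2) (by simp [c2]) ?_ _ _ _
  simp [c0, c1]

theorem frame_homog (hF : SublinFam F) (hi : ∀ u, IsHomog 5 fun K => F K u) (u : Fin 3 → ℂ) :
    IsHomog 1 (lams (frame c0 c1 c2) fun K => F K u) :=
  (hF.ctv u).lams_homog (by simpa [frame] using hi u)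

theorem edge_eq (hF : SublinFam F) (hi : ∀ u, IsHomog 5 fun K => F K u) (a b c : ℂ) :
    lams (frame c0 c1 c2) (fun K => F K ![a, b, c]) (seg c1) = edge F a := by
  rw [hF.frame_last hi, edge, ← (hF.frame_homog hi _).lam_zero_body,
    ← (hF.frame_homog hi _).lam_zero_body, ← lams_cons, ← lams_cons, vec_three_smul_add' a b]
  have h : c1 ::ₘ frame c0 c1 c2 = c1 ::ₘ (Complex.I • c1) ::ₘ
      (c2 ::ₘ (Complex.I • c2) ::ₘ (Complex.I • c0) ::ₘ 0) := by
    rw [frame]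
    congr 1
    rw [Multiset.cons_swap (Complex.I • c0), Multiset.cons_swap (Complex.I • c2),
      Multiset.cons_swap c2]
  rw [h]
  refine hF.lams_line (homog_finrank_three hi) (ξ := LinearMap.proj 1) (by simp [c1]) ?_ _ _ _
  simp [c0, c2]

theorem theta_comm (hF : SublinFam F) (a b : ℂ) : theta F a b = theta F b a := by
  have h := hF.frame_equiv c0 c1 c2 (g := Matrix.toLin' !![0, 1, 0; 1, 0, 0; 0, 0, -1])
    (by simp [Matrix.det_fin_three]) tri3 ![a, b, 0]
  rw [mapCLM_tri3] at h
  have e0 : Matrix.toLin' !![0, 1, 0; 1, 0, 0; 0, 0, -1] c0 = c1 := by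
    rw [toLin'_three]; simp [c0, c1]
  have e1 : Matrix.toLin' !![0, 1, 0; 1, 0, 0; 0, 0, -1] c1 = c0 := by
    rw [toLin'_three]; simp [c0, c1]
  have e2 : Matrix.toLin' !![0, 1, 0; 1, 0, 0; 0, 0, -1] c2 = -c2 := by
    rw [toLin'_three]; simp [c2]
  have eu : Matrix.toLin' !![0, 1, 0; 1, 0, 0; 0, 0, -1] ![a, b, 0] = ![b, a, 0] := by
    rw [toLin'_three]; simp []
  rw [e0, e1, e2, eu, (hF.ctv _).frame_neg_right, frame_swap, Set.pair_comm, ← tri3] at h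
  exact h.symm

theorem theta_neg_add (hF : SublinFam F) (a b : ℂ) : theta F a b = theta F a (-a - b) := by
  have h := hF.frame_equiv c0 c1 c2 (g := Matrix.toLin' !![1, 0, 0; -1, -1, 0; 0, 0, -1])
    (by simp [Matrix.det_fin_three]) tri3 ![a, b, 0]
  rw [mapCLM_tri3] at h
  have e0 : Matrix.toLin' !![1, 0, 0; -1, -1, 0; 0, 0, -1] c0 = c0 + (1 : ℝ) • -c1 := by
    rw [toLin'_three]; simp [c0, c1]
  have e1 : Matrix.toLin' !![1, 0, 0; -1, -1, 0; 0, 0, -1] c1 = -c1 := by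
    rw [toLin'_three]; simp [c1]
  have e2 : Matrix.toLin' !![1, 0, 0; -1, -1, 0; 0, 0, -1] c2 = -c2 := by
    rw [toLin'_three]; simp [c2]
  have eu : Matrix.toLin' !![1, 0, 0; -1, -1, 0; 0, 0, -1] ![a, b, 0] = ![a, -a - b, 0] := by
    rw [toLin'_three]; simp [sub_eq_add_neg]
  have eT : (hull {0, -(c0 + (1 : ℝ) • -c1), - -c1} : ConvexBody (Fin 3 → ℂ)) = tri3 + point c1 := by
    rw [tri3, hull_add_point (by simp) (by simp)]
    congr 1
    simp only [Set.image_insert_eq, Set.image_singleton, zero_add, neg_add_cancel, neg_neg]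
    rw [Set.insert_comm, Set.pair_comm, Set.insert_comm]
    congr 2
    module
  rw [e0, e1, e2, eu, eT, (hF.ctv _).frame_neg_right, (hF.ctv _).frame_add_left,
    (hF.ctv _).frame_neg_mid, ((hF.ctv _).lams _).add_point] at h
  exact h.symm

theorem edge_neg (hF : SublinFam F) (a : ℂ) : edge F (-a) = edge F a := by
  have h := hF.frame_equiv c0 c1 c2 (g := Matrix.toLin' !![-1, 0, 0; 0, 1, 0; 0, 0, -1])
    (by simp [Matrix.det_fin_three]) (seg c1) ![a, 0, 0]
  rw [mapCLM_seg_cReal] at h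
  have e0 : Matrix.toLin' !![-1, 0, 0; 0, 1, 0; 0, 0, -1] c0 = -c0 := by
    rw [toLin'_three]; simp [c0]
  have e1 : Matrix.toLin' !![-1, 0, 0; 0, 1, 0; 0, 0, -1] c1 = c1 := by
    rw [toLin'_three]; simp [c1]
  have e2 : Matrix.toLin' !![-1, 0, 0; 0, 1, 0; 0, 0, -1] c2 = -c2 := by
    rw [toLin'_three]; simp [c2]
  have eu : Matrix.toLin' !![-1, 0, 0; 0, 1, 0; 0, 0, -1] ![a, 0, 0] = ![-a, 0, 0] := by
    rw [toLin'_three]; simp []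
  rw [e0, e1, e2, eu, (hF.ctv _).frame_neg_right, (hF.ctv _).frame_neg_left] at h
  exact h

theorem theta_add (hF : SublinFam F) (a b a' b' : ℂ) :
    theta F (a + a') (b + b') ≤ theta F a b + theta F a' b' := by
  have : (![a + a', b + b', 0] : Fin 3 → ℂ) = ![a, b, 0] + ![a', b', 0] := by simp
  rw [theta, this]
  exact lams_subadditive hF.ctv hF.sub _ _ _ _

theorem theta_smul (hF : SublinFam F) {t : ℝ} (ht : 0 < t) (a b : ℂ) :
    theta F (t * a) (t * b) = t * theta F a b := by
  have : (![t * a, t * b, 0] : Fin 3 → ℂ) = t • ![a, b, 0] := by simp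
  rw [theta, this]
  exact hF.lams_smul _ ht _ _

theorem edge_smul (hF : SublinFam F) {t : ℝ} (ht : 0 < t) (a : ℂ) :
    edge F (t * a) = t * edge F a := by
  have : (![t * a, 0, 0] : Fin 3 → ℂ) = t • ![a, 0, 0] := by simp
  rw [edge, this]
  exact hF.lams_smul _ ht _ _

theorem theta_collinear (hF : SublinFam F) (hi : ∀ u, IsHomog 5 fun K => F K u) {s t : ℝ}
    (hs : 0 < s) (ht : 0 ≤ t) (a : ℂ) : theta F (s * a) (t * a) = (s + t) * edge F a := by
  set d : Fin 3 → ℂ := ![s, t, 0] with hd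
  have hs' : (s : ℂ) ≠ 0 := by exact_mod_cast hs.ne'
  set ξ : (Fin 3 → ℂ) →ₗ[ℂ] ℂ := (s : ℂ)⁻¹ • LinearMap.proj 0 with hξ
  have hξd : ξ d = 1 := by simp [hξ, hd, hs']
  set u : Fin 3 → ℂ := ![s * a, t * a, 0] with hu
  have hua : u = a • d := by simp [hu, hd, mul_comm]
  have hctv := hF.ctv u
  have hd' : d = s • (c0 + (t / s) • c1) := by
    ext i; fin_cases i <;> simp [hd, c0, c1]; field_simp
  have hfr : ∀ K, lams (frame d c1 c2) (fun K => F K u) K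
      = s * lams (frame c0 c1 c2) (fun K => F K u) K := by
    intro K
    rw [← hctv.frame_add_left c0 c1 c2 (t / s), frame, frame, hd',
      Multiset.cons_swap (Complex.I • c2), Multiset.cons_swap c2, smul_comm Complex.I,
      hctv.lams_cons_smul, abs_of_pos hs, Multiset.cons_swap _ c2, Multiset.cons_swap _ (Complex.I • c2)]
  have h1 := hF.lams_cdil_zero (homog_finrank_three hi) hξd
    (s := c2 ::ₘ (Complex.I • c2) ::ₘ (Complex.I • c1) ::ₘ 0) (by simp [hξ, c1, c2]) a tri3
  rw [← hua, Multiset.cons_swap _ c2, Multiset.cons_swap _ (Complex.I • c2), ← frame, hfr, hfr] at h1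
  have h2 := mul_left_cancel₀ hs.ne' h1
  have h3 : tri3.mapCLM (cReal (cdil ξ d 0)) = ((s + t) / s) • seg c1 + point (-c1) := by
    have e0 : -cdil ξ d 0 c0 = (t / s) • c1 := by
      ext i; fin_cases i <;> simp [hξ, hd, c0, c1, hs']; field_simp
    have e1 : -cdil ξ d 0 c1 = -c1 := by simp [hξ, c1]
    rw [mapCLM_tri3, e0, e1]
    have h0 : (0 : Fin 3 → ℂ) ∈ convexHull ℝ {(t / s) • c1, -c1} := by
      rw [convexHull_pair]
      refine ⟨s / (s + t), t / (s + t), by positivity, by positivity, by field_simp, ?_⟩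
      rw [smul_smul, smul_neg, ← sub_eq_add_neg, ← sub_smul]
      have : s / (s + t) * (t / s) - t / (s + t) = 0 := by field_simp; ring
      rw [this, zero_smul]
    rw [hull_insert_of_mem (by simp) h0, Set.pair_comm, hull_pair, smul_seg]
    congr 2
    rw [sub_neg_eq_add, add_div, div_self hs.ne']
    module
  have h4 := hF.frame_homog hi u (seg c1) ((s + t) / s) (by positivity)
  rw [theta, ← hu, ← h2, h3, (hctv.lams _).add_point, h4, hu, hF.edge_eq hi, hF.edge_smul hs]
  field_simp

end SublinFam

end Theta

end

section

section Tetra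

set_option linter.unusedSectionVars false

open ConvexBody

theorem CTV.two_mul_tetra {V : Type*} [NormedAddCommGroup V] [NormedSpace ℝ V]
    {φ : ConvexBody V → ℝ} (hφ : CTV φ) (h : IsHomog 2 φ) (a b c : V) :
    2 * φ (hull {0, -a, -b, -c}) = _root_.lam a φ (hull {0, -a, -b, -c})
      + _root_.lam (b - c) φ (hull {0, -a, -b, -c}) - _root_.lam a φ (seg (b - c)) := by
  have h1 := hφ.val.hull_union (s := {0, -a}) (t := {-b, -c}) (by simp) (by simp) (by simp) (by simp)
  have e1 : ({0, -a} ∪ {-b, -c} : Set V) = {0, -a, -b, -c} := by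
    rw [Set.insert_union, Set.singleton_union]
  have e2 : (hull {0, -a} : ConvexBody V) = seg a + point (-a) := by
    rw [Set.pair_comm, hull_pair]; simp
  have e3 : (hull {-b, -c} : ConvexBody V) = seg (b - c) + point (-b) := by
    rw [hull_pair, show -c - -b = b - c by abel]
  have e4 : ∀ K : ConvexBody V, K + K = (2 : ℝ) • K := by
    intro K
    rw [show (2 : ℝ) = 1 + 1 by norm_num, add_smul_body _ _ zero_le_one zero_le_one, one_smul]
  rw [e1, e4, h _ 2 (by norm_num), e2, e3, ← add_assoc, ← add_assoc, ← add_assoc, hφ.add_point,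
    hφ.add_point, hφ.add_point, add_right_comm (seg a), hφ.add_point, add_comm (seg a)] at h1
  simp only [_root_.lam]
  rw [hφ.seg_eq_zero h]
  linarith

variable {F : ConvexBody (Fin 3 → ℂ) → (Fin 3 → ℂ) → ℝ}

/-- The standard tetrahedron in the real space spanned by the basis vectors of `ℂ³`. -/
def tetra3 : ConvexBody (Fin 3 → ℂ) := hull {0, -c2, -c0, -c1}

/-- The three vectors defining the degree two part of a family. -/
def imFrame : Multiset (Fin 3 → ℂ) :=
  (Complex.I • c2) ::ₘ (Complex.I • c0) ::ₘ (Complex.I • c1) ::ₘ 0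

theorem tetra3_modEq {E : Submodule ℝ (Fin 3 → ℂ)} {p q : Fin 4 → Fin 3 → ℂ} {S T : Set (Fin 3 → ℂ)}
    (hp : S = Set.range p) (hq : T = Set.range q) (h : ∀ i, p i - q i ∈ E) :
    ModEq E (hull S) (hull T) := by
  rw [hp, hq]
  exact ModEq.hull h

theorem range_four {V : Type*} (a b c d : V) : ({a, b, c, d} : Set V) = Set.range ![a, b, c, d] := by
  ext x
  simp only [Matrix.range_cons, Matrix.range_empty, Set.union_empty, Set.mem_insert_iff,
    Set.mem_singleton_iff, Set.mem_union]

namespace SublinFam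

theorem tetra_eq (hF : SublinFam F) (hi : ∀ u, IsHomog 5 fun K => F K u) (a b c : ℂ) :
    2 * lams imFrame (fun K => F K ![a, b, c]) tetra3
      = theta F a b + theta F c (a + b) - edge F (a + b) := by
  have hφ := (hF.ctv ![a, b, c]).lams imFrame
  have hφ2 : IsHomog 2 (lams imFrame (fun K => F K ![a, b, c])) :=
    (hF.ctv _).lams_homog (by simpa [imFrame] using hi _)
  rw [tetra3, hφ.two_mul_tetra hφ2 c2 c0 c1, ← lams_cons, ← lams_cons]
  have hfr : c2 ::ₘ imFrame = frame c0 c1 c2 := by rw [imFrame, frame]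
  congr 1
  · congr 1
    · rw [hfr, theta, ← hF.frame_last hi a b c]
      refine (hF.ctv _).lams_congr _ ?_
      have : ({0, -c0, -c1} : Set (Fin 3 → ℂ)) = {0, 0, -c0, -c1} := by simp
      rw [tri3, this]
      refine tetra3_modEq (range_four _ _ _ _) (range_four _ _ _ _) ?_
      intro i
      fin_cases i
      · simp
      · simpa using subset_mspan (s := frame c0 c1 c2) (x := c2) (by simp [frame])
      · simp
      · simp
    · have h := hF.frame_equiv c0 c1 c2 (g := Matrix.toLin' !![0, 1, -1; 0, 0, 1; 1, 0, 0])
        (by simp [Matrix.det_fin_three]) tri3 ![c, a + b, b]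
      rw [mapCLM_tri3] at h
      have e0 : Matrix.toLin' !![0, 1, -1; 0, 0, 1; 1, 0, 0] c0 = c2 := by
        rw [toLin'_three]; simp [c0, c2]
      have e1 : Matrix.toLin' !![0, 1, -1; 0, 0, 1; 1, 0, 0] c1 = c0 := by
        rw [toLin'_three]; simp [c0, c1]
      have e2 : Matrix.toLin' !![0, 1, -1; 0, 0, 1; 1, 0, 0] c2 = -(c0 - c1) := by
        rw [toLin'_three]; simp [c0, c1, c2]
      have eu : Matrix.toLin' !![0, 1, -1; 0, 0, 1; 1, 0, 0] ![c, a + b, b] = ![a, b, c] := by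
        rw [toLin'_three]; simp
      rw [e0, e1, e2, eu, (hF.ctv _).frame_neg_right, hF.frame_last hi] at h
      rw [theta, ← h, frame, imFrame]
      have hw : (c0 - c1) ::ₘ (Complex.I • c2) ::ₘ (Complex.I • c0) ::ₘ (Complex.I • c1) ::ₘ 0
          = (Complex.I • c1) ::ₘ (c0 - c1) ::ₘ (Complex.I • c2) ::ₘ (Complex.I • c0) ::ₘ 0 := by
        rw [Multiset.cons_swap (Complex.I • c0), Multiset.cons_swap (Complex.I • c2),
          Multiset.cons_swap (c0 - c1)]
      have hI : (Complex.I • c1) ::ₘ (c0 - c1) ::ₘ (Complex.I • c2) ::ₘ (Complex.I • c0) ::ₘ 0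
          = (Complex.I • c1) ::ₘ (Complex.I • c0) ::ₘ (c0 - c1) ::ₘ (Complex.I • c2) ::ₘ 0 := by
        rw [Multiset.cons_swap (Complex.I • c2), Multiset.cons_swap (c0 - c1)]
      have hI' : (c0 - c1) ::ₘ (Complex.I • (c0 - c1)) ::ₘ (Complex.I • c2) ::ₘ (Complex.I • c0) ::ₘ 0
          = (Complex.I • (c0 - c1)) ::ₘ (Complex.I • c0) ::ₘ (c0 - c1) ::ₘ (Complex.I • c2) ::ₘ 0 := by
        rw [Multiset.cons_swap (c0 - c1), Multiset.cons_swap (Complex.I • c2),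
          Multiset.cons_swap (c0 - c1)]
      have hneg : lams ((Complex.I • c1) ::ₘ (Complex.I • c0) ::ₘ (c0 - c1) ::ₘ (Complex.I • c2) ::ₘ 0)
            (fun K => F K ![a, b, c])
          = lams ((Complex.I • (c0 - c1)) ::ₘ (Complex.I • c0) ::ₘ (c0 - c1) ::ₘ (Complex.I • c2) ::ₘ 0)
            (fun K => F K ![a, b, c]) := by
        rw [← (hF.ctv _).lams_neg_cons]
        refine (hF.ctv _).lams_cons_congr ?_
        rw [smul_sub, show -(Complex.I • c1) - (Complex.I • c0 - Complex.I • c1)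
          = -(Complex.I • c0) by abel]
        exact Submodule.neg_mem _ (subset_mspan (by simp))
      rw [hw, hI, hI', hneg]
      refine (hF.ctv _).lams_congr _ ?_
      have : ({0, -c2, -c0} : Set (Fin 3 → ℂ)) = {0, -c2, -c0, -c0} := by simp
      rw [this]
      refine tetra3_modEq (range_four _ _ _ _) (range_four _ _ _ _) ?_
      intro i
      fin_cases i
      · simp
      · simp
      · simp
      · rw [show (![0, -c2, -c0, -c1] : Fin 4 → Fin 3 → ℂ) ((fun i => i) ⟨3, by norm_num⟩)
          - (![0, -c2, -c0, -c0] : Fin 4 → Fin 3 → ℂ) ((fun i => i) ⟨3, by norm_num⟩) = c0 - c1 by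
            change -c1 - -c0 = c0 - c1; abel]
        exact subset_mspan (by simp)
  · have h := hF.frame_equiv c0 c1 c2 (g := Matrix.toLin' !![1, 1, 0; 0, -1, 0; 0, 0, -1])
      (by simp [Matrix.det_fin_three]) (seg c1) ![a + b, -b, -c]
    rw [mapCLM_seg_cReal] at h
    have e0 : Matrix.toLin' !![1, 1, 0; 0, -1, 0; 0, 0, -1] c0 = c0 := by
      rw [toLin'_three]; simp [c0]
    have e1 : Matrix.toLin' !![1, 1, 0; 0, -1, 0; 0, 0, -1] c1 = c0 - c1 := by
      rw [toLin'_three]; simp [c0, c1]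
    have e2 : Matrix.toLin' !![1, 1, 0; 0, -1, 0; 0, 0, -1] c2 = -c2 := by
      rw [toLin'_three]; simp [c2]
    have eu : Matrix.toLin' !![1, 1, 0; 0, -1, 0; 0, 0, -1] ![a + b, -b, -c] = ![a, b, c] := by
      rw [toLin'_three]; simp
    rw [e0, e1, e2, eu, (hF.ctv _).frame_neg_right, hF.edge_eq hi,
      show c0 - c1 = -(c1 + (-1 : ℝ) • c0) by module, (hF.ctv _).frame_neg_mid,
      (hF.ctv _).frame_add_mid] at h
    rw [hfr, ← h]
    congr 2
    module

theorem tetra_cycle (hF : SublinFam F) (a b c : ℂ) :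
    lams imFrame (fun K => F K ![a, b, c]) tetra3 = lams imFrame (fun K => F K ![c, a, b]) tetra3 := by
  have e0 : Matrix.toLin' !![0, 0, 1; 1, 0, 0; 0, 1, 0] c0 = c1 := by
    rw [toLin'_three]; simp [c0, c1]
  have e1 : Matrix.toLin' !![0, 0, 1; 1, 0, 0; 0, 1, 0] c1 = c2 := by
    rw [toLin'_three]; simp [c1, c2]
  have e2 : Matrix.toLin' !![0, 0, 1; 1, 0, 0; 0, 1, 0] c2 = c0 := by
    rw [toLin'_three]; simp [c0, c2]
  have eu : Matrix.toLin' !![0, 0, 1; 1, 0, 0; 0, 1, 0] ![a, b, c] = ![c, a, b] := by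
    rw [toLin'_three]; simp
  have h := hF.lams_equiv (B := Matrix.toLin' !![0, 0, 1; 1, 0, 0; 0, 1, 0])
    (by simp [Matrix.det_fin_three]) imFrame tetra3 ![a, b, c]
  have es : imFrame.map (Matrix.toLin' !![0, 0, 1; 1, 0, 0; 0, 1, 0]) = imFrame := by
    rw [imFrame, Multiset.map_cons, Multiset.map_cons, Multiset.map_cons, Multiset.map_zero, map_smul, map_smul, map_smul, e0, e1, e2,
      Multiset.cons_swap (Complex.I • c1), Multiset.cons_swap (Complex.I • c0)]
  have et : tetra3.mapCLM (cReal (Matrix.toLin' !![0, 0, 1; 1, 0, 0; 0, 1, 0])) = tetra3 := by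
    rw [tetra3, mapCLM_hull _ (by simp) (by simp)]
    simp only [Set.image_insert_eq, Set.image_singleton, map_zero, map_neg, cReal_apply, e0, e1, e2]
    rw [Set.pair_comm (-c1), Set.insert_comm (-c0)]
  rw [eu, es, et] at h
  exact h.symm

theorem theta_cocycle (hF : SublinFam F) (hi : ∀ u, IsHomog 5 fun K => F K u) (a b c : ℂ) :
    theta F a b + theta F c (a + b) - edge F (a + b)
      = theta F c a + theta F b (c + a) - edge F (c + a) := by
  rw [← hF.tetra_eq hi, ← hF.tetra_eq hi, hF.tetra_cycle]

end SublinFam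

end Tetra

end

section

section Cocycle

/-- The properties of the functions `theta` and `edge` of a projection-type family which determine
its generating function. -/
structure ThetaData (ϑ : ℂ → ℂ → ℝ) (E : ℂ → ℝ) : Prop where
  comm : ∀ a b, ϑ a b = ϑ b a
  neg_add : ∀ a b, ϑ a b = ϑ a (-a - b)
  edge_neg : ∀ a, E (-a) = E a
  edge_smul : ∀ t : ℝ, 0 < t → ∀ a, E (t * a) = t * E a
  smul : ∀ t : ℝ, 0 < t → ∀ a b, ϑ (t * a) (t * b) = t * ϑ a b
  collinear : ∀ s t : ℝ, 0 < s → 0 ≤ t → ∀ a, ϑ (s * a) (t * a) = (s + t) * E a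
  cocycle : ∀ a b c, ϑ a b + ϑ c (a + b) - E (a + b) = ϑ c a + ϑ b (c + a) - E (c + a)
  add : ∀ a b a' b', ϑ (a + a') (b + b') ≤ ϑ a b + ϑ a' b'

namespace ThetaData

variable {ϑ : ℂ → ℂ → ℝ} {E : ℂ → ℝ}

theorem zero_zero (h : ThetaData ϑ E) : ϑ 0 0 = 0 := by
  have := h.smul 2 (by norm_num) 0 0
  simp only [mul_zero] at this
  linarith

theorem edge_zero (h : ThetaData ϑ E) : E 0 = 0 := by
  have := h.edge_smul 2 (by norm_num) 0
  simp only [mul_zero] at this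
  linarith

theorem apply_zero (h : ThetaData ϑ E) (a : ℂ) : ϑ a 0 = E a := by
  have := h.collinear 1 0 one_pos le_rfl a
  simpa using this

theorem apply_line (h : ThetaData ϑ E) (x y : ℝ) (d : ℂ) :
    ϑ (x * d) (y * d) = (|x| + |y| + |x + y|) / 2 * E d := by
  have h1 : ∀ x y : ℝ, ∀ d : ℂ, 0 ≤ x → 0 ≤ y → ϑ (x * d) (y * d) = (x + y) * E d := by
    intro x y d hx hy
    rcases hx.eq_or_lt with rfl | hx
    · rcases hy.eq_or_lt with rfl | hy
      · simp [h.zero_zero]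
      · rw [h.comm, h.collinear y 0 hy le_rfl, add_comm]
    · exact h.collinear x y hx hy d
  have h2 : ∀ x y : ℝ, ∀ d : ℂ, x ≤ 0 → y ≤ 0 → ϑ (x * d) (y * d) = -(x + y) * E d := by
    intro x y d hx hy
    have := h1 (-x) (-y) (-d) (by linarith) (by linarith)
    rw [h.edge_neg] at this
    push_cast at this
    rw [neg_mul_neg, neg_mul_neg] at this
    rw [this]; ring
  have h3 : ∀ x y : ℝ, ∀ d : ℂ, 0 ≤ x → y ≤ 0 →
      ϑ (x * d) (y * d) = (|x| + |y| + |x + y|) / 2 * E d := by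
    intro x y d hx hy
    have e : ∀ x y : ℝ, -((x : ℂ) * d) - (y : ℂ) * d = ((-x - y : ℝ) : ℂ) * d := by
      intro x y; push_cast; ring
    rw [abs_of_nonneg hx, abs_of_nonpos hy]
    rcases le_total 0 (x + y) with hxy | hxy
    · rw [h.comm, h.neg_add, e, h2 _ _ _ hy (by linarith), abs_of_nonneg hxy]; ring
    · rw [h.neg_add, e, h1 _ _ _ hx (by linarith), abs_of_nonpos hxy]; ring
  rcases le_total 0 x with hx | hx <;> rcases le_total 0 y with hy | hy
  · rw [h1 _ _ _ hx hy, abs_of_nonneg hx, abs_of_nonneg hy, abs_of_nonneg (by linarith)]; ring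
  · exact h3 _ _ _ hx hy
  · rw [h.comm, h3 _ _ _ hy hx, add_comm |y|, add_comm y]
  · rw [h2 _ _ _ hx hy, abs_of_nonpos hx, abs_of_nonpos hy, abs_of_nonpos (by linarith)]; ring

/-- A sublinear function generating the data `ϑ`. -/
theorem exists_generator (h : ThetaData ϑ E) : ∃ G : ℂ → ℝ, (∀ t : ℝ, 0 < t → ∀ a, G (t * a) = t * G a) ∧
    (∀ a b, G (a + b) ≤ G a + G b) ∧ ∀ a b, ϑ a b = G a + G b + G (-a - b) := by
  set q : ℂ → ℂ → ℝ := fun a b => ϑ a b - E (a + b) with hq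
  set G : ℂ → ℝ := fun z => (|z.re| - z.re) / 2 * E 1 + (|z.im| - z.im) / 2 * E Complex.I
    - q z.re (z.im * Complex.I) with hG
  set r : ℂ → ℂ → ℝ := fun a b => q a b - G a - G b + G (a + b) with hr
  have qc : ∀ a b, q a b = q b a := fun a b => by simp only [hq, h.comm a b, add_comm a b]
  have rc : ∀ a b, r a b = r b a := fun a b => by simp only [hr, qc a b, add_comm a b]; ring
  have q3 : ∀ a b c, q a b + q (a + b) c = q a c + q (a + c) b := by
    intro a b c
    have := h.cocycle a b c
    rw [qc (a + b) c, qc (a + c) b, qc a c]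
    simp only [hq]
    rw [show c + (a + b) = a + b + c by ring, show b + (a + c) = a + b + c by ring,
      add_comm a c]
    linarith
  have r3 : ∀ a b c, r a b + r (a + b) c = r a c + r (a + c) b := by
    intro a b c
    have := q3 a b c
    simp only [hr]
    rw [show a + c + b = a + b + c by ring]
    linarith
  have q0 : ∀ x y : ℝ, ∀ d : ℂ, q (x * d) (y * d) = (|x| + |y| - |x + y|) / 2 * E d := by
    intro x y d
    have h1 := h.apply_line x y d
    have h2 := h.apply_line (x + y) 0 d
    rw [Complex.ofReal_zero, zero_mul, h.apply_zero] at h2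
    simp only [hq]
    rw [← add_mul, ← Complex.ofReal_add, h1, h2, abs_zero, add_zero, add_zero]
    ring
  have q00 : ∀ a, q a 0 = 0 := fun a => by simp [hq, h.apply_zero]
  have Gx : ∀ x : ℝ, G x = (|x| - x) / 2 * E 1 := by
    intro x
    simp [hG, q00]
  have Gy : ∀ y : ℝ, G (y * Complex.I) = (|y| - y) / 2 * E Complex.I := by
    intro y
    simp [hG, qc 0, q00]
  have rxx : ∀ x x' : ℝ, r x x' = 0 := by
    intro x x'
    have := q0 x x' 1
    rw [mul_one, mul_one] at this
    simp only [hr]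
    rw [this, ← Complex.ofReal_add, Gx, Gx, Gx]
    ring
  have ryy : ∀ y y' : ℝ, r (y * Complex.I) (y' * Complex.I) = 0 := by
    intro y y'
    have := q0 y y' Complex.I
    simp only [hr]
    rw [this, ← add_mul, ← Complex.ofReal_add, Gy, Gy, Gy]
    ring
  have rxy : ∀ x y : ℝ, r x (y * Complex.I) = 0 := by
    intro x y
    simp only [hr]
    rw [Gx, Gy]
    simp [hG]
    ring
  have rzx : ∀ x y x' : ℝ, r (x + y * Complex.I) x' = 0 := by
    intro x y x'
    have := r3 x (y * Complex.I) x'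
    rw [rxy, rxx, ← Complex.ofReal_add, rxy] at this
    linarith
  have rzy : ∀ x y y' : ℝ, r (x + y * Complex.I) (y' * Complex.I) = 0 := by
    intro x y y'
    have := r3 (y * Complex.I) x (y' * Complex.I)
    rw [rc _ (x : ℂ), rxy, ryy, ← add_mul, ← Complex.ofReal_add, rc _ (x : ℂ), rxy,
      add_comm _ (x : ℂ)] at this
    linarith
  have rz : ∀ a b, r a b = 0 := by
    intro a b
    have := r3 b.re (b.im * Complex.I) a
    rw [rxy, Complex.re_add_im, rc (b.re : ℂ) a, add_comm (b.re : ℂ) a] at this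
    have h1 := rzx a.re a.im b.re
    have h2 := rzy (a + b.re).re (a + b.re).im b.im
    rw [Complex.re_add_im] at h1 h2
    rw [h1, h2, rc] at this
    linarith
  have hE : ∀ z, E z = G z + G (-z) := by
    intro z
    have h1 := rz z (-z)
    have h2 : G 0 = 0 := by simpa using Gx 0
    simp only [hr, hq, add_neg_cancel] at h1
    rw [h.neg_add, neg_sub_neg, sub_self, h.apply_zero, h.edge_zero, h2] at h1
    linarith
  have hϑ : ∀ a b, ϑ a b = G a + G b + G (-a - b) := by
    intro a b
    have h1 := rz a b
    simp only [hr, hq] at h1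
    rw [hE (a + b), neg_add'] at h1
    linarith
  have Gh : ∀ t : ℝ, 0 < t → ∀ a, G (t * a) = t * G a := by
    intro t ht a
    simp only [hG, hq, Complex.re_ofReal_mul, Complex.im_ofReal_mul, abs_mul, abs_of_pos ht,
      Complex.ofReal_mul]
    rw [mul_assoc, h.smul t ht, ← mul_add, h.edge_smul t ht]
    ring
  refine ⟨G, Gh, ?_, hϑ⟩
  intro a b
  set s : ℂ := ((1 / 2 : ℝ) : ℂ) * (a + b)
  have h1 := h.add a b b a
  have h2 := h.smul 2 (by norm_num) s s
  have e : ((2 : ℝ) : ℂ) * s = a + b := by simp only [s]; push_cast; ring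
  have e2 : -b - a = -a - b := by ring
  have e3 : -s - s = -a - b := by simp only [s]; push_cast; ring
  rw [e] at h2
  rw [add_comm b a, h2, hϑ, hϑ, hϑ, e2, e3] at h1
  have h3 := Gh 2 (by norm_num) s
  rw [e] at h3
  linarith

end ThetaData

theorem SublinFam.thetaData {F : ConvexBody (Fin 3 → ℂ) → (Fin 3 → ℂ) → ℝ} (hF : SublinFam F)
    (hi : ∀ u, IsHomog 5 fun K => F K u) : ThetaData (theta F) (edge F) where
  comm := hF.theta_comm
  neg_add := hF.theta_neg_add
  edge_neg := hF.edge_neg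
  edge_smul _ ht := hF.edge_smul ht
  smul _ ht := hF.theta_smul ht
  collinear _ _ hs ht := hF.theta_collinear hi hs ht
  cocycle := hF.theta_cocycle hi
  add := hF.theta_add

/-- A sublinear function on `ℂ` is the support function of a convex body. -/
theorem exists_body_of_sublinear {G : ℂ → ℝ} (hs : ∀ t : ℝ, 0 < t → ∀ a, G (t * a) = t * G a)
    (ha : ∀ a b, G (a + b) ≤ G a + G b) : ∃ N : ConvexBody ℂ, ∀ a, G a = hSupp N fun c => (c * a).re := by
  have h0 : G 0 = 0 := by
    have := hs 2 (by norm_num) 0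
    simp only [mul_zero] at this
    linarith
  have hline : ∀ x : ℝ, ∀ d, G (x * d) ≤ |x| * (|G d| + |G (-d)|) := by
    intro x d
    have p1 := le_abs_self (G d)
    have p2 := le_abs_self (G (-d))
    have p3 := abs_nonneg (G d)
    have p4 := abs_nonneg (G (-d))
    rcases lt_trichotomy x 0 with hx | rfl | hx
    · have := hs (-x) (by linarith) (-d)
      rw [Complex.ofReal_neg, neg_mul_neg] at this
      rw [this, abs_of_neg hx]
      exact mul_le_mul_of_nonneg_left (by linarith) (by linarith)
    · simp [h0]
    · rw [hs x hx, abs_of_pos hx]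
      exact mul_le_mul_of_nonneg_left (by linarith) hx.le
  set C := |G 1| + |G (-1)| + (|G Complex.I| + |G (-Complex.I)|) with hC
  have hb : ∀ z, G z ≤ C * ‖z‖ := by
    intro z
    have h1 := hline z.re 1
    have h2 := hline z.im Complex.I
    have h3 := ha (z.re * 1) (z.im * Complex.I)
    rw [mul_one, Complex.re_add_im] at h3
    rw [mul_one] at h1
    have h4 := mul_le_mul_of_nonneg_right (Complex.abs_re_le_norm z) (show 0 ≤ |G 1| + |G (-1)| by positivity)
    have h5 := mul_le_mul_of_nonneg_right (Complex.abs_im_le_norm z)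
      (show 0 ≤ |G Complex.I| + |G (-Complex.I)| by positivity)
    rw [hC]
    linarith
  set S : Set ℂ := {c | ∀ a, (c * a).re ≤ G a} with hS
  have hex' : ∀ a ≠ 0, ∃ c ∈ S, (c * a).re = G a := by
    intro a ha0
    obtain ⟨g, hg1, hg2⟩ := exists_extension_of_le_sublinear (LinearPMap.mkSpanSingleton a (G a) ha0) G
      (fun t ht x => by rw [Complex.real_smul]; exact hs t ht x) ha (by
        rintro ⟨x, hx⟩
        obtain ⟨t, rfl⟩ := Submodule.mem_span_singleton.1 hx
        rw [LinearPMap.mkSpanSingleton'_apply, smul_eq_mul]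
        change t * G a ≤ G (t • a)
        rw [Complex.real_smul]
        rcases lt_trichotomy t 0 with ht | rfl | ht
        · have h1 := hs (-t) (by linarith) (-a)
          have h2 := ha a (-a)
          rw [add_neg_cancel, h0] at h2
          rw [Complex.ofReal_neg, neg_mul_neg] at h1
          rw [h1]
          nlinarith
        · simp [h0]
        · exact (hs t ht a).ge)
    have hgc : ∀ z, ((g 1 - g Complex.I * Complex.I : ℂ) * z).re = g z := by
      intro z
      have : g z = g (z.re • 1 + z.im • Complex.I) := by
        congr 1
        simp [Complex.real_smul]
      rw [this, map_add, map_smul, map_smul]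
      simp
      ring
    refine ⟨g 1 - g Complex.I * Complex.I, fun z => ?_, ?_⟩
    · rw [hgc]; exact hg2 z
    · rw [hgc]
      have := hg1 ⟨a, Submodule.mem_span_singleton_self a⟩
      rw [this]
      simpa using LinearPMap.mkSpanSingleton_apply ℝ ℝ ha0 (G a)
  have hex : ∀ a, ∃ c ∈ S, (c * a).re = G a := by
    intro a
    rcases eq_or_ne a 0 with rfl | ha0
    · obtain ⟨c, hc, -⟩ := hex' 1 one_ne_zero
      exact ⟨c, hc, by simp [h0]⟩
    · exact hex' a ha0
  have hconv : Convex ℝ S := by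
    intro x hx y hy s t hs0 ht0 hst a
    have h1 := mul_le_mul_of_nonneg_left (hx a) hs0
    have h2 := mul_le_mul_of_nonneg_left (hy a) ht0
    have h3 : ((s • x + t • y) * a).re = s * (x * a).re + t * (y * a).re := by
      rw [add_mul, smul_mul_assoc, smul_mul_assoc, Complex.add_re, Complex.smul_re, Complex.smul_re,
        smul_eq_mul, smul_eq_mul]
    rw [h3]
    calc _ ≤ s * G a + t * G a := add_le_add h1 h2
      _ = G a := by rw [← add_mul, hst, one_mul]
  have hclosed : IsClosed S := by
    have : S = ⋂ a, {c : ℂ | (c * a).re ≤ G a} := by ext; simp [hS]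
    rw [this]
    exact isClosed_iInter fun a => isClosed_le (by fun_prop) continuous_const
  have hbdd : Bornology.IsBounded S := by
    refine isBounded_iff_forall_norm_le.2 ⟨C, fun c hc => ?_⟩
    have h1 := (hc (starRingEnd ℂ c)).trans (hb _)
    rw [Complex.mul_conj, Complex.ofReal_re, Complex.normSq_eq_norm_sq, RCLike.norm_conj] at h1
    rcases (norm_nonneg c).eq_or_lt with h | h
    · rw [← h]
      have := (abs_nonneg (G 1))
      rw [hC]; positivity
    · nlinarith
  refine ⟨⟨S, hconv, Metric.isCompact_of_isClosed_isBounded hclosed hbdd, (hex 0).imp fun _ h => h.1⟩, ?_⟩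
  intro a
  refine (IsGreatest.csSup_eq ?_).symm
  obtain ⟨c, hc, hca⟩ := hex a
  refine ⟨⟨c, hc, hca⟩, ?_⟩
  rintro _ ⟨c, hc, rfl⟩
  exact hc a

end Cocycle

end

section

set_option linter.unusedSectionVars false

section Volume

open ConvexBody

variable {V : Type*} [NormedAddCommGroup V] [NormedSpace ℝ V]

theorem ConvexBody.mem_of_ball_subset {K L : ConvexBody V} {x : V} {ε : ℝ} (hε : Metric.ball x ε ⊆ K)
    (hd : dist K L < ε) : x ∈ L := by
  by_contra hx
  obtain ⟨f, u, hf, hu⟩ := geometric_hahn_banach_closed_point L.convex L.isClosed hx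
  obtain ⟨l₀, hl₀⟩ := L.nonempty
  have hε0 : 0 < ε := dist_nonneg.trans_lt hd
  have hf0 : 0 < ‖f‖ := by
    rw [norm_pos_iff]
    rintro rfl
    have := hf l₀ hl₀
    simp at this hu
    linarith
  have hr : dist K L / ε * ‖f‖ < ‖f‖ := by
    have : dist K L / ε < 1 := (div_lt_one hε0).2 hd
    nlinarith
  obtain ⟨v, hv, hfv⟩ := f.exists_lt_apply_of_lt_opNorm hr
  obtain ⟨w, hw, hfw⟩ : ∃ w : V, ‖w‖ < 1 ∧ dist K L / ε * ‖f‖ < f w := by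
    rcases abs_cases (f v) with h | h
    · exact ⟨v, hv, by rwa [Real.norm_eq_abs, h.1] at hfv⟩
    · exact ⟨-v, by rwa [norm_neg], by rwa [Real.norm_eq_abs, h.1, ← map_neg] at hfv⟩
  have hy : x + ε • w ∈ Metric.ball x ε := by
    rw [Metric.mem_ball, dist_eq_norm, add_sub_cancel_left, norm_smul, Real.norm_of_nonneg hε0.le]
    nlinarith
  obtain ⟨l, hl, hyl⟩ := exists_dist_le K L (mem_coe.1 (hε hy))
  have h1 := hf l hl
  have h2 : f (x + ε • w) - f l ≤ ‖f‖ * dist K L := by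
    rw [← map_sub]
    refine (le_abs_self _).trans ((f.le_opNorm _).trans ?_)
    rw [← dist_eq_norm]
    exact mul_le_mul_of_nonneg_left hyl hf0.le
  rw [map_add, map_smul, smul_eq_mul] at h2
  have h3 : ε * (dist K L / ε * ‖f‖) = ‖f‖ * dist K L := by field_simp
  nlinarith

variable [FiniteDimensional ℝ V] [MeasurableSpace V] [BorelSpace V] (μ : Measure V)
  [μ.IsAddHaarMeasure]

/-- The volume of a convex body. -/
def vol (K : ConvexBody V) : ℝ := (μ (K : Set V)).toReal

theorem ConvexBody.measure_ne_top (K : ConvexBody V) : μ (K : Set V) ≠ ⊤ :=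
  K.isCompact.measure_lt_top.ne

theorem vol_mono {K L : ConvexBody V} (h : (K : Set V) ⊆ L) : vol μ K ≤ vol μ L :=
  ENNReal.toReal_mono (L.measure_ne_top μ) (measure_mono h)

theorem continuous_vol : Continuous (vol μ) := by
  rw [continuous_iff_continuousAt]
  intro K
  refine (ENNReal.tendsto_toReal (K.measure_ne_top μ)).comp (g := ENNReal.toReal)
    (f := fun L : ConvexBody V => μ (L : Set V)) ?_
  refine tendsto_measure_of_ae_tendsto_indicator (nhds K) K.isClosed.measurableSet
    (fun L => L.isClosed.measurableSet) (B := Metric.cthickening 1 (K : Set V))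
    Metric.isClosed_cthickening.measurableSet
    (K.isCompact.cthickening (r := 1)).measure_lt_top.ne ?_ ?_
  · filter_upwards [Metric.ball_mem_nhds K one_pos] with L hL x hx
    obtain ⟨y, hy, hxy⟩ := exists_dist_le L K hx
    exact Metric.mem_cthickening_of_dist_le x y 1 _ hy (hxy.trans (Metric.mem_ball.1 hL).le)
  · have h0 : ∀ᵐ x ∂μ, x ∉ frontier (K : Set V) :=
      measure_eq_zero_iff_ae_notMem.1 (K.convex.addHaar_frontier μ)
    filter_upwards [h0] with x hx
    by_cases hxK : x ∈ K
    · have hint : x ∈ interior (K : Set V) := by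
        by_contra h
        exact hx ⟨subset_closure hxK, h⟩
      obtain ⟨ε, hε, hball⟩ := Metric.isOpen_iff.1 isOpen_interior x hint
      filter_upwards [Metric.ball_mem_nhds K hε] with L hL
      refine iff_of_true ?_ hxK
      refine mem_of_ball_subset (hball.trans interior_subset) ?_
      rw [dist_comm]
      exact Metric.mem_ball.1 hL
    · have hpos : 0 < Metric.infDist x (K : Set V) :=
        (K.isClosed.notMem_iff_infDist_pos K.nonempty).1 hxK
      filter_upwards [Metric.ball_mem_nhds K hpos] with L hL
      refine iff_of_false ?_ hxK
      intro hxL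
      obtain ⟨y, hy, hxy⟩ := exists_dist_le L K hxL
      have := Metric.infDist_le_dist_of_mem (x := x) hy
      have := Metric.mem_ball.1 hL
      linarith

theorem CTV.vol : CTV (vol μ) := by
  refine ⟨continuous_vol μ, fun K L hU hI => ?_, fun K x => ?_⟩
  · simp only [_root_.vol]
    rw [← ENNReal.toReal_add ((K.union L hU).measure_ne_top μ) ((K.inter L hI).measure_ne_top μ),
      ← ENNReal.toReal_add (K.measure_ne_top μ) (L.measure_ne_top μ), coe_union, coe_inter,
      measure_union_add_inter _ L.isClosed.measurableSet]
  · simp only [_root_.vol, coe_translate]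
    rw [Set.image_add_left, measure_preimage_add]

theorem vol_homog : IsHomog (finrank ℝ V) (vol μ) := by
  intro K t ht
  rw [vol, coe_smul, μ.addHaar_smul, ENNReal.toReal_mul, ENNReal.toReal_ofReal (abs_nonneg _),
    abs_of_nonneg (by positivity), vol]

theorem vol_mapCLM (f : V →L[ℝ] V) (K : ConvexBody V) :
    vol μ (K.mapCLM f) = |LinearMap.det (f : V →ₗ[ℝ] V)| * vol μ K := by
  rw [vol, coe_mapCLM, μ.addHaar_image_continuousLinearMap, ENNReal.toReal_mul,
    ENNReal.toReal_ofReal (abs_nonneg _), vol]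

end Volume

end

section

set_option linter.unusedSectionVars false

section MixedVolume

open ConvexBody

theorem sum_choose_eq_coeff (k : ℕ) (c : ℕ → ℝ) :
    ∑ j ∈ Finset.range (k + 1), (k.choose j : ℝ) * ((-1) ^ (k - j) *
      ∑ i ∈ Finset.range (k + 1), c i * (j : ℝ) ^ i) = k.factorial * c k := by
  have h1 : (fun r : ℝ => ∑ i ∈ Finset.range (k + 1), c i * r ^ i) =
      (fun r : ℝ => ∑ i ∈ Finset.range k, c i * r ^ i) + c k • fun r : ℝ => r ^ k := by
    ext r
    simp [Finset.sum_range_succ]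
  have h2 := fwdDiff_iter_eq_sum_shift (1 : ℝ)
    (fun r : ℝ => ∑ i ∈ Finset.range (k + 1), c i * r ^ i) k 0
  have h3 := congrFun (congrArg (fun g : ℝ → ℝ => (fwdDiff (1 : ℝ))^[k] g) h1) 0
  beta_reduce at h3
  rw [fwdDiff_iter_add, fwdDiff_iter_sum_mul_pow_eq_zero, fwdDiff_iter_const_smul,
    fwdDiff_iter_eq_factorial] at h3
  rw [h3] at h2
  simp only [zero_add, Pi.smul_apply, smul_eq_mul, Pi.natCast_apply, nsmul_eq_mul, mul_one,
    zsmul_eq_mul, Int.cast_mul, Int.cast_pow, Int.cast_neg, Int.cast_one, Int.cast_natCast] at h2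
  rw [mul_comm, h2]
  refine Finset.sum_congr rfl fun j _ => ?_
  ring

variable {V : Type*} [NormedAddCommGroup V] [NormedSpace ℝ V] [FiniteDimensional ℝ V]
  [MeasurableSpace V] [BorelSpace V] (μ : Measure V) [μ.IsAddHaarMeasure]

/-- The mixed volume `V(K,…,K,L)`, times the dimension. -/
def dVol (K L : ConvexBody V) : ℝ :=
  bodyComp (fun A => vol μ (A + L)) (finrank ℝ V - 1) K

/-- The difference quotient `(vol(K + tL) - vol K) / t` as a polynomial in `t`. -/
def volQuot (K L : ConvexBody V) (t : ℝ) : ℝ :=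
  ∑ i ∈ Finset.range (finrank ℝ V),
    bodyComp (fun A => vol μ (A + L)) i K * t ^ (finrank ℝ V - 1 - i)

theorem vol_add_smul (K L : ConvexBody V) {t : ℝ} (ht : 0 < t) :
    vol μ (K + t • L) = ∑ i ∈ Finset.range (finrank ℝ V + 1),
      bodyComp (fun A => vol μ (A + L)) i K * t ^ (finrank ℝ V - i) := by
  have h1 : K + t • L = t • (t⁻¹ • K + L) := by
    rw [smul_add, smul_smul, mul_inv_cancel₀ ht.ne', one_smul]
  rw [h1, vol_homog μ _ t ht.le,
    ((CTV.vol μ).addRight L).smul_eq_sum K (inv_nonneg.2 ht.le), Finset.mul_sum]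
  refine Finset.sum_congr rfl fun i hi => ?_
  have hi' : i ≤ finrank ℝ V := Nat.lt_succ_iff.1 (Finset.mem_range.1 hi)
  rw [mul_left_comm, inv_pow, ← div_eq_mul_inv, pow_sub₀ _ ht.ne' hi', div_eq_mul_inv]

theorem bodyComp_vol_add_top (K L : ConvexBody V) :
    bodyComp (fun A => vol μ (A + L)) (finrank ℝ V) K = vol μ K := by
  have h := eq_at_zero_of_pos (f := fun t : ℝ => vol μ (K + t • L))
    (g := fun t : ℝ => ∑ i ∈ Finset.range (finrank ℝ V + 1),
      bodyComp (fun A => vol μ (A + L)) i K * t ^ (finrank ℝ V - i))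
    ((continuous_vol μ).comp (by fun_prop)) (by fun_prop) fun t ht => vol_add_smul μ K L ht
  beta_reduce at h
  rw [zero_smul_body, add_zero, Finset.sum_range_succ, Finset.sum_eq_zero, zero_add] at h
  · simpa using h.symm
  · intro i hi
    have := Finset.mem_range.1 hi
    rw [zero_pow (by omega), mul_zero]

theorem vol_add_smul_eq (K L : ConvexBody V) {t : ℝ} (ht : 0 < t) :
    vol μ (K + t • L) = vol μ K + t * volQuot μ K L t := by
  rw [vol_add_smul μ K L ht, Finset.sum_range_succ, bodyComp_vol_add_top, volQuot, Finset.mul_sum,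
    add_comm]
  simp only [Nat.sub_self, pow_zero, mul_one]
  congr 1
  refine Finset.sum_congr rfl fun i hi => ?_
  have := Finset.mem_range.1 hi
  have h1 : finrank ℝ V - i = finrank ℝ V - 1 - i + 1 := by omega
  rw [h1, pow_succ]
  ring

theorem volQuot_zero (hV : 0 < finrank ℝ V) (K L : ConvexBody V) :
    volQuot μ K L 0 = dVol μ K L := by
  rw [volQuot, dVol, Finset.sum_eq_single (finrank ℝ V - 1)]
  · simp
  · intro i hi hne
    have := Finset.mem_range.1 hi
    rw [zero_pow (by omega), mul_zero]
  · intro h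
    exact absurd (Finset.mem_range.2 (by omega)) h

theorem continuous_volQuot (K L : ConvexBody V) : Continuous (volQuot μ K L) := by
  unfold volQuot
  fun_prop

theorem continuous_volQuot_left (L : ConvexBody V) :
    Continuous fun p : ConvexBody V × ℝ => volQuot μ p.1 L p.2 := by
  unfold volQuot
  refine continuous_finsetSum _ fun i _ => ?_
  exact (((((CTV.vol μ).addRight L).bodyComp i).cont).comp continuous_fst).mul
    (continuous_snd.pow _)

theorem ConvexBody.coe_sum {ι : Type*} (s : Finset ι) (K : ι → ConvexBody V) :
    ((∑ i ∈ s, K i : ConvexBody V) : Set V) = ∑ i ∈ s, (K i : Set V) := by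
  classical
  induction s using Finset.induction_on with
  | empty => simp
  | insert a s ha ih => rw [Finset.sum_insert ha, Finset.sum_insert ha, coe_add, ih]

/-- Mixed volumes with one distinguished body. -/
theorem mixedVol_eq_dVol {n : ℕ} (hn : finrank ℝ V = n) (hn0 : 0 < n) (K L : ConvexBody V) :
    mixedVol μ (fun i : Fin n => if (i : ℕ) < n - 1 then K else L) =
      (n : ℝ)⁻¹ * dVol μ K L := by
  obtain ⟨k, rfl⟩ : ∃ k, n = k + 1 := ⟨n - 1, by omega⟩
  set B : Fin (k + 1) → ConvexBody V := fun i => if (i : ℕ) < k + 1 - 1 then K else L with hB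
  set s₀ : Finset (Fin (k + 1)) := Finset.univ.erase (Fin.last k) with hs₀
  have hc₀ : s₀.card = k := by simp [hs₀]
  have hlast : B (Fin.last k) = L := by simp [hB]
  have hsum : ∀ s ∈ s₀.powerset, ∑ i ∈ s, B i = (s.card : ℝ) • K := by
    intro s hs
    rw [natCast_smul, ← Finset.sum_const]
    refine Finset.sum_congr rfl fun i hi => ?_
    have h1 := Finset.ne_of_mem_erase (Finset.mem_powerset.1 hs hi)
    have h2 : (i : ℕ) ≠ k := fun h => h1 (Fin.ext h)
    have h3 : (i : ℕ) < k + 1 - 1 := by have := i.2; omega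
    simp only [hB, if_pos h3]
  have huniv : (Finset.univ : Finset (Finset (Fin (k + 1)))) =
      (insert (Fin.last k) s₀).powerset := by
    rw [hs₀, Finset.insert_erase (Finset.mem_univ _), Finset.powerset_univ]
  have hnot : Fin.last k ∉ s₀ := Finset.notMem_erase _ _
  have e1 : ∑ s ∈ s₀.powerset, (-1 : ℝ) ^ (k + 1 - s.card) * vol μ (∑ i ∈ s, B i) =
      ∑ j ∈ Finset.range (k + 1), k.choose j •
        ((-1 : ℝ) ^ (k + 1 - j) * vol μ ((j : ℝ) • K)) := by
    have hp := Finset.sum_powerset_apply_card (x := s₀)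
      (fun j => (-1 : ℝ) ^ (k + 1 - j) * vol μ ((j : ℝ) • K))
    rw [hc₀] at hp
    rw [← hp]
    exact Finset.sum_congr rfl fun s hs => by rw [hsum s hs]
  have e2 : ∑ s ∈ s₀.powerset, (-1 : ℝ) ^ (k + 1 - (insert (Fin.last k) s).card) *
      vol μ (∑ i ∈ insert (Fin.last k) s, B i) =
      ∑ j ∈ Finset.range (k + 1), k.choose j •
        ((-1 : ℝ) ^ (k - j) * vol μ ((j : ℝ) • K + L)) := by
    have hp := Finset.sum_powerset_apply_card (x := s₀)
      (fun j => (-1 : ℝ) ^ (k - j) * vol μ ((j : ℝ) • K + L))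
    rw [hc₀] at hp
    rw [← hp]
    refine Finset.sum_congr rfl fun s hs => ?_
    have hns : Fin.last k ∉ s := fun h => hnot (Finset.mem_powerset.1 hs h)
    rw [Finset.sum_insert hns, hlast, hsum s hs, add_comm L, Finset.card_insert_of_notMem hns,
      Nat.add_sub_add_right]
  have e3 : mixedVol μ B = ((k + 1).factorial : ℝ)⁻¹ *
      ∑ S : Finset (Fin (k + 1)), (-1 : ℝ) ^ (k + 1 - S.card) * vol μ (∑ i ∈ S, B i) := by
    simp only [mixedVol, _root_.vol, coe_sum]
  rw [e3, huniv, Finset.sum_powerset_insert hnot, e1, e2, ← Finset.sum_add_distrib]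
  have e4 : ∀ j ∈ Finset.range (k + 1),
      k.choose j • ((-1 : ℝ) ^ (k + 1 - j) * vol μ ((j : ℝ) • K)) +
        k.choose j • ((-1 : ℝ) ^ (k - j) * vol μ ((j : ℝ) • K + L)) =
      (k.choose j : ℝ) * ((-1) ^ (k - j) *
        ∑ i ∈ Finset.range (k + 1), bodyComp (fun A => vol μ (A + L)) i K * (j : ℝ) ^ i) := by
    intro j hj
    have hj' := Finset.mem_range.1 hj
    have h1 : k + 1 - j = k - j + 1 := by omega
    rw [vol_homog μ K _ j.cast_nonneg, ((CTV.vol μ).addRight L).smul_eq_sum K j.cast_nonneg,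
      Finset.sum_range_succ, bodyComp_vol_add_top, hn, h1, nsmul_eq_mul, nsmul_eq_mul]
    ring
  rw [Finset.sum_congr rfl e4, sum_choose_eq_coeff, dVol, hn, Nat.add_sub_cancel,
    Nat.factorial_succ, Nat.cast_mul]
  have : (k.factorial : ℝ) ≠ 0 := by exact_mod_cast k.factorial_ne_zero
  field_simp

theorem CTV.dVol (L : ConvexBody V) : CTV fun K => dVol μ K L :=
  ((CTV.vol μ).addRight L).bodyComp _

theorem dVol_homog (L : ConvexBody V) : IsHomog (finrank ℝ V - 1) fun K => dVol μ K L :=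
  ((CTV.vol μ).addRight L).bodyComp_homog _

theorem dVol_add_right (hV : 0 < finrank ℝ V) (K L M : ConvexBody V) :
    dVol μ K (L + M) = dVol μ K L + dVol μ K M := by
  have hc : Continuous fun t : ℝ => (K + t • L, t) := by fun_prop
  have hc' : Continuous fun t : ℝ => volQuot μ (K + t • L) M t := by
    have := Continuous.comp (continuous_volQuot_left μ M) hc
    simpa only [Function.comp_def] using this
  have hc'' : Continuous fun t : ℝ => volQuot μ K L t + volQuot μ (K + t • L) M t :=
    Continuous.add (continuous_volQuot μ K L) hc'
  have h := eq_at_zero_of_pos (f := volQuot μ K (L + M))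
    (g := fun t => volQuot μ K L t + volQuot μ (K + t • L) M t) (continuous_volQuot μ _ _)
    hc'' ?_
  · beta_reduce at h
    rwa [zero_smul_body, add_zero, volQuot_zero μ hV, volQuot_zero μ hV, volQuot_zero μ hV] at h
  · intro t ht
    have h1 := vol_add_smul_eq μ K (L + M) ht
    have h2 := vol_add_smul_eq μ K L ht
    have h3 := vol_add_smul_eq μ (K + t • L) M ht
    rw [smul_add, ← add_assoc] at h1
    have : t * volQuot μ K (L + M) t = t * (volQuot μ K L t + volQuot μ (K + t • L) M t) := by
      linarith
    exact mul_left_cancel₀ ht.ne' this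

theorem dVol_smul_right (hV : 0 < finrank ℝ V) (K L : ConvexBody V) {s : ℝ} (hs : 0 < s) :
    dVol μ K (s • L) = s * dVol μ K L := by
  have h := eq_at_zero_of_pos (f := volQuot μ K (s • L))
    (g := fun t => s * volQuot μ K L (t * s)) (continuous_volQuot μ _ _)
    (((continuous_volQuot μ _ _).comp (continuous_id.mul continuous_const)).const_mul _) ?_
  · beta_reduce at h
    rwa [zero_mul, volQuot_zero μ hV, volQuot_zero μ hV] at h
  · intro t ht
    have h1 := vol_add_smul_eq μ K (s • L) ht
    have h2 := vol_add_smul_eq μ K L (mul_pos ht hs)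
    rw [smul_smul] at h1
    have : t * volQuot μ K (s • L) t = t * (s * volQuot μ K L (t * s)) := by linarith
    exact mul_left_cancel₀ ht.ne' this

theorem dVol_mono_right (hV : 0 < finrank ℝ V) (K : ConvexBody V) {L M : ConvexBody V}
    (h : (L : Set V) ⊆ M) : dVol μ K L ≤ dVol μ K M := by
  rw [← volQuot_zero μ hV, ← volQuot_zero μ hV]
  have h1 : Filter.Tendsto (volQuot μ K L) (nhdsWithin 0 (Set.Ioi 0))
      (nhds (volQuot μ K L 0)) :=
    (continuous_volQuot μ K L).continuousAt.tendsto.mono_left nhdsWithin_le_nhds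
  have h2 : Filter.Tendsto (volQuot μ K M) (nhdsWithin 0 (Set.Ioi 0))
      (nhds (volQuot μ K M 0)) :=
    (continuous_volQuot μ K M).continuousAt.tendsto.mono_left nhdsWithin_le_nhds
  refine le_of_tendsto_of_tendsto h1 h2 ?_
  filter_upwards [self_mem_nhdsWithin] with t ht
  have h3 := vol_add_smul_eq μ K L ht
  have h4 := vol_add_smul_eq μ K M ht
  have h5 : vol μ (K + t • L) ≤ vol μ (K + t • M) := by
    refine vol_mono μ ?_
    rw [coe_add, coe_add, coe_smul, coe_smul]
    exact Set.add_subset_add_left (Set.smul_set_mono h)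
  refine le_of_mul_le_mul_left ?_ (Set.mem_Ioi.1 ht)
  linarith

theorem dVol_mapCLM (hV : 0 < finrank ℝ V) (f : V →L[ℝ] V) (K L : ConvexBody V) :
    dVol μ (K.mapCLM f) (L.mapCLM f) = |LinearMap.det (f : V →ₗ[ℝ] V)| * dVol μ K L := by
  rw [← volQuot_zero μ hV, ← volQuot_zero μ hV]
  refine eq_at_zero_of_pos (f := volQuot μ (K.mapCLM f) (L.mapCLM f))
    (g := fun t => |LinearMap.det (f : V →ₗ[ℝ] V)| * volQuot μ K L t)
    (continuous_volQuot μ _ _) ((continuous_volQuot μ _ _).const_mul _) fun t ht => ?_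
  have h1 := vol_add_smul_eq μ (K.mapCLM f) (L.mapCLM f) ht
  have h2 := vol_add_smul_eq μ K L ht
  rw [← mapCLM_smul, ← mapCLM_add, vol_mapCLM, vol_mapCLM, h2] at h1
  have : t * volQuot μ (K.mapCLM f) (L.mapCLM f) t =
      t * (|LinearMap.det (f : V →ₗ[ℝ] V)| * volQuot μ K L t) := by linarith
  exact mul_left_cancel₀ ht.ne' this

end MixedVolume

end

section

set_option linter.unusedSectionVars false

section ProjectionBody

open ConvexBody

theorem continuous_bodyComp_add {V : Type*} [NormedAddCommGroup V] [NormedSpace ℝ V]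
    [FiniteDimensional ℝ V] {φ : ConvexBody V → ℝ} (hφ : Continuous φ) (i : ℕ) :
    Continuous fun p : ConvexBody V × ConvexBody V => bodyComp (fun A => φ (A + p.2)) i p.1 := by
  unfold bodyComp bodyDiff
  refine continuous_finsetSum _ fun j _ => continuous_const.mul ?_
  refine continuous_finsetSum _ fun l _ => continuous_const.mul ?_
  have h : Continuous fun p : ConvexBody V × ConvexBody V => (l : ℝ) • p.1 + p.2 := by fun_prop
  exact hφ.comp h

variable {W : Type*} [NormedAddCommGroup W] [NormedSpace ℂ W] [FiniteDimensional ℂ W]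

theorem dotBody_add_subset (N : ConvexBody ℂ) (u v : W) :
    (dotBody N (u + v) : Set W) ⊆ (dotBody N u + dotBody N v : ConvexBody W) := by
  rintro _ ⟨c, hc, rfl⟩
  rw [coe_add]
  exact ⟨c • u, ⟨c, hc, rfl⟩, c • v, ⟨c, hc, rfl⟩, (smul_add c u v).symm⟩

theorem dotBody_smul (N : ConvexBody ℂ) (t : ℝ) (u : W) :
    dotBody N (t • u) = t • dotBody N u := by
  rw [smul_eq_mapCLM, dotBody, dotBody, mapCLM_mapCLM]
  congr 1
  ext x
  simp [smul_comm x t u]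

theorem continuous_dotBody (N : ConvexBody ℂ) : Continuous fun u : W => dotBody N u := by
  unfold dotBody
  refine Continuous.mapCLM ?_ continuous_const
  let f : W →ₗ[ℝ] (ℂ →L[ℝ] W) :=
    { toFun := fun w =>
        LinearMap.toContinuousLinearMap ((LinearMap.toSpanSingleton ℂ W w).restrictScalars ℝ)
      map_add' := fun x y => by ext; simp
      map_smul' := fun t x => by ext c; simp [smul_comm c t x] }
  exact f.continuous_of_finiteDimensional

theorem hSupp_dotBody (N : ConvexBody ℂ) (u : W) (ξ : W →ₗ[ℂ] ℂ) :
    hSupp (dotBody N u) (fun x => (ξ x).re) = hSupp N fun c => (c * ξ u).re := by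
  unfold hSupp
  rw [dotBody, coe_mapCLM, Set.image_image]
  simp

variable [MeasurableSpace W] [BorelSpace W] (μ : Measure W) [μ.IsAddHaarMeasure]

/-- The support function of the projection body `Π_N K`. -/
def piFam (N : ConvexBody ℂ) (K : ConvexBody W) (u : W) : ℝ :=
  (finrank ℝ W : ℝ)⁻¹ * dVol μ K (dotBody N u)

theorem mixedVol_eq_piFam (hW : 0 < finrank ℂ W) (N : ConvexBody ℂ) (K : ConvexBody W) (u : W) :
    mixedVol μ (fun i : Fin (2 * finrank ℂ W) =>
      if (i : ℕ) < 2 * finrank ℂ W - 1 then K else dotBody N u) = piFam μ N K u := by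
  rw [mixedVol_eq_dVol μ (finrank_real_of_complex W) (by omega), piFam, finrank_real_of_complex]

theorem abs_det_restrictScalars (g : W →ₗ[ℂ] W) :
    |LinearMap.det (cReal g : W →ₗ[ℝ] W)| = ‖LinearMap.det g‖ ^ 2 := by
  have : (cReal g : W →ₗ[ℝ] W) = g.restrictScalars ℝ := by ext; simp
  rw [this, LinearMap.det_restrictScalars, Algebra.norm_complex_apply, Complex.normSq_eq_norm_sq,
    abs_of_nonneg (by positivity)]

theorem piFam_sublinFam (hW : 0 < finrank ℂ W) (N : ConvexBody ℂ) :
    SublinFam (piFam (W := W) μ N) := by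
  have hV : 0 < finrank ℝ W := by rw [finrank_real_of_complex]; omega
  refine ⟨⟨fun u => (CTV.dVol μ _).const_mul _, fun t ht K u => ?_, fun g hg K u => ?_⟩,
    fun K u v => ?_⟩
  · rw [piFam, dotBody_smul, dVol_smul_right μ hV _ _ ht, piFam]
    ring
  · rw [piFam, ← mapCLM_dotBody, dVol_mapCLM μ hV, abs_det_restrictScalars, hg, piFam]
    simp
  · rw [piFam, piFam, piFam, ← mul_add, ← dVol_add_right μ hV]
    exact mul_le_mul_of_nonneg_left (dVol_mono_right μ hV K (dotBody_add_subset N u v))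
      (by positivity)

theorem piFam_homog (N : ConvexBody ℂ) (u : W) :
    IsHomog (2 * finrank ℂ W - 1) fun K => piFam μ N K u := by
  intro K t ht
  have := dVol_homog μ (dotBody N u) K t ht
  beta_reduce at this
  rw [finrank_real_of_complex] at this
  simp only [piFam]
  rw [this]
  ring

theorem continuous_piFam (N : ConvexBody ℂ) :
    Continuous fun p : ConvexBody W × W => piFam μ N p.1 p.2 := by
  unfold piFam dVol
  refine continuous_const.mul ?_
  have h1 : Continuous fun p : ConvexBody W × W => (p.1, dotBody N p.2) :=
    continuous_fst.prodMk ((continuous_dotBody N).comp continuous_snd)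
  have h2 := Continuous.comp (continuous_bodyComp_add (continuous_vol μ) (finrank ℝ W - 1)) h1
  simpa only [Function.comp_def] using h2

end ProjectionBody

end

section

set_option linter.unusedSectionVars false

section MixedArea

open ConvexBody

section Support

variable {V : Type*} [NormedAddCommGroup V] [NormedSpace ℝ V]

theorem ConvexBody.le_hSupp (K : ConvexBody V) {p : V → ℝ} (hp : Continuous p) {x : V}
    (hx : x ∈ K) : p x ≤ hSupp K p :=
  le_csSup (K.isCompact.image hp).bddAbove ⟨x, hx, rfl⟩

theorem ConvexBody.exists_hSupp_eq (K : ConvexBody V) {p : V → ℝ} (hp : Continuous p) :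
    ∃ x ∈ K, hSupp K p = p x := by
  obtain ⟨x, hx, h⟩ := (K.isCompact.image hp).sSup_mem (K.nonempty.image p)
  exact ⟨x, hx, h.symm⟩

theorem ConvexBody.hSupp_le (K : ConvexBody V) {p : V → ℝ} {r : ℝ} (h : ∀ x ∈ K, p x ≤ r) :
    hSupp K p ≤ r := by
  refine csSup_le (K.nonempty.image p) ?_
  rintro _ ⟨x, hx, rfl⟩
  exact h x hx

end Support

variable {V : Type*} [NormedAddCommGroup V] [NormedSpace ℝ V] [FiniteDimensional ℝ V]
  [MeasurableSpace V] [BorelSpace V] (μ : Measure V) [μ.IsAddHaarMeasure]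

theorem finrank_sup_span_singleton_le (E : Submodule ℝ V) (v : V) :
    finrank ℝ ↥(E ⊔ Submodule.span ℝ {v}) ≤ finrank ℝ E + 1 := by
  refine (Submodule.finrank_add_le_finrank_add_finrank _ _).trans ?_
  have := finrank_span_le_card (R := ℝ) ({v} : Set V)
  simp at this
  omega

theorem add_seg_subset {K : ConvexBody V} {E : Submodule ℝ V} (h : (K : Set V) ⊆ E) (v : V) :
    ((K + seg v : ConvexBody V) : Set V) ⊆ (E ⊔ Submodule.span ℝ {v} : Submodule ℝ V) := by
  rw [coe_add]
  rintro _ ⟨x, hx, y, hy, rfl⟩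
  obtain ⟨t, -, -, rfl⟩ := mem_seg.1 hy
  exact Submodule.add_mem_sup (h hx) (Submodule.smul_mem _ _ (Submodule.mem_span_singleton_self v))

theorem lams_vol_eq_zero (s : Multiset V) : ∀ {E : Submodule ℝ V} {K : ConvexBody V},
    (K : Set V) ⊆ E → finrank ℝ E + s.card < finrank ℝ V → lams s (vol μ) K = 0 := by
  induction s using Multiset.induction_on with
  | empty =>
    intro E K hK hE
    rw [lams_zero, vol, measure_mono_null hK, ENNReal.toReal_zero]
    refine μ.addHaar_submodule E ?_
    rintro rfl
    simp at hE
  | cons v s ih =>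
    intro E K hK hE
    rw [Multiset.card_cons] at hE
    have := finrank_sup_span_singleton_le E v
    rw [lams_cons, lam, ih (add_seg_subset hK v) (by omega), ih hK (by omega), sub_zero]

theorem lams_cons_vol {s : Multiset V} {E : Submodule ℝ V} {K : ConvexBody V} {v : V}
    (hK : (K : Set V) ⊆ E) (hE : finrank ℝ E + (v ::ₘ s).card ≤ finrank ℝ V) :
    lams (v ::ₘ s) (vol μ) K = lams s (vol μ) (K + seg v) := by
  rw [Multiset.card_cons] at hE
  rw [lams_cons, lam, lams_vol_eq_zero μ s hK (by omega), sub_zero]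

theorem lams_vol_mono (s : Multiset V) : ∀ {E : Submodule ℝ V} {K L : ConvexBody V},
    (L : Set V) ⊆ E → finrank ℝ E + s.card ≤ finrank ℝ V → (K : Set V) ⊆ L →
    lams s (vol μ) K ≤ lams s (vol μ) L := by
  induction s using Multiset.induction_on with
  | empty => intro E K L _ _ h; exact vol_mono μ h
  | cons v s ih =>
    intro E K L hL hE h
    rw [lams_cons_vol μ (h.trans hL) hE, lams_cons_vol μ hL hE]
    have := finrank_sup_span_singleton_le E v
    rw [Multiset.card_cons] at hE
    refine ih (add_seg_subset hL v) (by omega) ?_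
    rw [coe_add, coe_add]
    exact Set.add_subset_add_right h

theorem lams_vol_pos (s : Multiset V) : ∀ {E : Submodule ℝ V} {K : ConvexBody V},
    (K : Set V) ⊆ E → finrank ℝ E + s.card ≤ finrank ℝ V → (0 : V) ∈ K →
    Submodule.span ℝ (K : Set V) ⊔ mspan s = ⊤ → 0 < lams s (vol μ) K := by
  induction s using Multiset.induction_on with
  | empty =>
    intro E K _ _ h0 hs
    rw [lams_zero, vol]
    refine ENNReal.toReal_pos ?_ (K.measure_ne_top μ)
    have hint : (interior (K : Set V)).Nonempty := by
      rw [K.convex.interior_nonempty_iff_affineSpan_eq_top]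
      have hs' : Submodule.span ℝ (K : Set V) = ⊤ := by simpa [mspan] using hs
      rw [AffineSubspace.affineSpan_eq_top_iff_vectorSpan_eq_top_of_nonempty ℝ V V K.nonempty,
        eq_top_iff, ← hs', Submodule.span_le]
      intro x hx
      simpa using vsub_mem_vectorSpan ℝ hx h0
    exact (Measure.measure_pos_of_nonempty_interior μ hint).ne'
  | cons v s ih =>
    intro E K hK hE h0 hs
    rw [lams_cons_vol μ hK hE]
    have := finrank_sup_span_singleton_le E v
    rw [Multiset.card_cons] at hE
    have hadd : ∀ x ∈ K, ∀ y ∈ seg v, x + y ∈ K + seg v := fun x hx y hy => by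
      rw [← SetLike.mem_coe, coe_add]
      exact ⟨x, hx, y, hy, rfl⟩
    have z0 : (0 : V) ∈ seg v := mem_seg.2 ⟨0, le_rfl, zero_le_one, by simp⟩
    have z1 : v ∈ seg v := mem_seg.2 ⟨1, zero_le_one, le_rfl, by simp⟩
    refine ih (add_seg_subset hK v) (by omega) ?_ ?_
    · simpa using hadd 0 h0 0 z0
    · rw [eq_top_iff, ← hs, mspan_cons]
      refine sup_le (le_sup_of_le_left (Submodule.span_mono fun x hx => ?_))
        (sup_le (le_sup_of_le_left ?_) le_sup_right)
      · have := hadd x hx 0 z0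
        rwa [add_zero] at this
      · rw [Submodule.span_singleton_le_iff_mem]
        have := hadd 0 h0 v z1
        rw [zero_add] at this
        exact Submodule.subset_span this

theorem lams_add_mul {φ ψ : ConvexBody V → ℝ} {Q : ConvexBody V} {t : ℝ} (s : Multiset V)
    (h : ∀ K, φ (K + Q) = φ K + t * ψ K) (K : ConvexBody V) :
    lams s φ (K + Q) = lams s φ K + t * lams s ψ K := by
  induction s using Multiset.induction_on generalizing K with
  | empty => exact h K
  | cons v s ih =>
    simp only [lams_cons, lam]
    rw [add_right_comm, ih, ih]
    ring

theorem continuous_lams_param {ψ : ℝ → ConvexBody V → ℝ} (s : Multiset V)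
    (h : ∀ K, Continuous fun t => ψ t K) (K : ConvexBody V) :
    Continuous fun t => lams s (ψ t) K := by
  induction s using Multiset.induction_on generalizing K with
  | empty => exact h K
  | cons v s ih =>
    simp only [lams_cons, lam]
    exact (ih _).sub (ih _)

theorem exists_lams_dVol_deriv (hV : 0 < finrank ℝ V) (s : Multiset V) (K L : ConvexBody V) :
    ∃ Q : ℝ → ℝ, Continuous Q ∧ Q 0 = lams s (fun A => dVol μ A L) K ∧
      ∀ t, 0 < t → lams s (vol μ) (K + t • L) = lams s (vol μ) K + t * Q t := by
  refine ⟨fun t => lams s (fun A => volQuot μ A L t) K,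
    continuous_lams_param s (fun A => continuous_volQuot μ A L) K, ?_, fun t ht => ?_⟩
  · simp only [volQuot_zero μ hV]
  · exact lams_add_mul s (fun A => vol_add_smul_eq μ A L ht) K

/-- The triangle with vertices `0`, `-v`, `-w`. -/
def negTri (v w : V) : ConvexBody V := hull {0, -v, -w}

theorem mem_smul_negTri {v w : V} {a b r : ℝ} (ha : 0 ≤ a) (hb : 0 ≤ b) (h : a + b ≤ r) :
    -(a • v) - b • w ∈ r • negTri v w := by
  have key : ∀ p q : ℝ, 0 ≤ p → 0 ≤ q → p + q ≤ 1 → -(p • v) - q • w ∈ negTri v w := by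
    intro p q hp hq hpq
    have hv : ∀ x ∈ ({0, -v, -w} : Set V), x ∈ negTri v w := fun x hx => by
      rw [negTri, ← SetLike.mem_coe, coe_hull (by simp) (by simp)]
      exact subset_convexHull ℝ _ hx
    have := (negTri v w).convex.sum_mem (t := Finset.univ) (w := ![1 - p - q, p, q])
      (z := ![0, -v, -w]) (fun i _ => by fin_cases i <;> simp <;> linarith)
      (by simp [Fin.sum_univ_three]; ring)
      (fun i _ => by fin_cases i <;> exact hv _ (by simp))
    simp only [Fin.sum_univ_three, Matrix.cons_val_zero, Matrix.cons_val_one,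
      Matrix.cons_val_two, Matrix.tail_cons, Matrix.head_cons, Matrix.cons_val] at this
    have h2 : (1 - p - q) • (0 : V) + p • -v + q • -w = -(p • v) - q • w := by module
    rwa [h2] at this
  rw [← SetLike.mem_coe, coe_smul]
  rcases (ha.trans (le_add_of_nonneg_right hb) |>.trans h).eq_or_lt with hr | hr
  · have h1 : a = 0 := by linarith
    have h2 : b = 0 := by linarith
    refine ⟨0, by simpa using key 0 0 le_rfl le_rfl (by norm_num), ?_⟩
    simp [h1, h2]
  · refine ⟨_, key (a / r) (b / r) (by positivity) (by positivity) ?_, ?_⟩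
    · rw [← add_div, div_le_one hr]
      exact h
    · beta_reduce
      rw [smul_sub, smul_neg, smul_smul, smul_smul, mul_div_cancel₀ _ hr.ne',
        mul_div_cancel₀ _ hr.ne']

theorem CTV.lam_negTri {φ : ConvexBody V → ℝ} (hφ : CTV φ) (h : IsHomog 2 φ) (v w : V) :
    _root_.lam v φ (negTri v w) = 2 * φ (negTri v w) := by
  have h1 := hφ.val.hull_union (s := {0, -v}) (t := {-w}) (by simp) (by simp) (by simp) (by simp)
  have h2 : ({0, -v} : Set V) ∪ {-w} = {0, -v, -w} := by
    ext x
    simp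
    tauto
  have h3 := h (negTri v w) 2 (by norm_num)
  have h4 : (2 : ℝ) • negTri v w = negTri v w + negTri v w := by
    rw [← one_add_one_eq_two, add_smul_body _ _ zero_le_one zero_le_one, one_smul]
  rw [h2, ← negTri, hull_singleton, hull_pair, hφ.add_point, hφ.add_point, ← add_assoc,
    hφ.add_point, hφ.add_point, ← h4, h3, sub_zero, hφ.seg_eq_zero h] at h1
  have h5 := hφ.lam_neg v
  rw [← h5, _root_.lam]
  linarith

section Triangle

variable {s : Multiset V} {v w : V} {ξ η : V →L[ℝ] ℝ}

theorem negTri_subset {E : Submodule ℝ V} (hv : v ∈ E) (hw : w ∈ E) :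
    (negTri v w : Set V) ⊆ E := by
  rw [negTri, coe_hull (by simp) (by simp)]
  refine convexHull_min ?_ E.convex
  rintro x (rfl | rfl | rfl)
  · exact E.zero_mem
  · exact E.neg_mem hv
  · exact E.neg_mem hw

theorem finrank_span_pair_le : finrank ℝ ↥(Submodule.span ℝ {v, w}) ≤ 2 := by
  classical
  refine (finrank_span_le_card (R := ℝ) ({v, w} : Set V)).trans ?_
  rw [Set.toFinset_insert, Set.toFinset_singleton]
  exact Finset.card_le_two

theorem lams_negTri_pos (hs : s.card + 2 = finrank ℝ V)
    (hf : ∀ x, x - (ξ x • v + η x • w) ∈ mspan s) : 0 < lams s (vol μ) (negTri v w) := by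
  have hv : v ∈ Submodule.span ℝ {v, w} := Submodule.subset_span (by simp)
  have hw : w ∈ Submodule.span ℝ {v, w} := Submodule.subset_span (by simp)
  have hm : ∀ x ∈ ({0, -v, -w} : Set V), x ∈ negTri v w := fun x hx => by
    rw [negTri, ← SetLike.mem_coe, coe_hull (by simp) (by simp)]
    exact subset_convexHull ℝ _ hx
  have := finrank_span_pair_le (v := v) (w := w)
  refine lams_vol_pos μ s (negTri_subset hv hw) (by omega) (hm 0 (by simp)) ?_
  rw [eq_top_iff]
  rintro x -
  have h1 : -v ∈ Submodule.span ℝ (negTri v w : Set V) := Submodule.subset_span (hm _ (by simp))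
  have h2 : -w ∈ Submodule.span ℝ (negTri v w : Set V) := Submodule.subset_span (hm _ (by simp))
  have h3 : x = (-ξ x) • -v + (-η x) • -w + (x - (ξ x • v + η x • w)) := by module
  rw [h3]
  exact Submodule.add_mem_sup (Submodule.add_mem _ (Submodule.smul_mem _ _ h1)
    (Submodule.smul_mem _ _ h2)) (hf x)

theorem lams_add_smul_proj (hf : ∀ x, x - (ξ x • v + η x • w) ∈ mspan s) (K L : ConvexBody V)
    (t : ℝ) : lams s (vol μ) (K + t • L) =
      lams s (vol μ) (K + t • L.mapCLM (ξ.smulRight v + η.smulRight w)) := by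
  refine (CTV.vol μ).lams_congr s ((ModEq.refl _ K).add ?_)
  rw [← mapCLM_smul]
  exact ModEq.mapCLM_self _ (fun x => by simpa using hf x) _

theorem lams_vol_homog_two (hs : s.card + 2 = finrank ℝ V) : IsHomog 2 (lams s (vol μ)) := by
  refine (CTV.vol μ).lams_homog ?_
  rw [add_comm, hs]
  exact vol_homog μ

theorem lams_dVol_le (hs : s.card + 2 = finrank ℝ V)
    (hf : ∀ x, x - (ξ x • v + η x • w) ∈ mspan s) (L : ConvexBody V) :
    lams s (fun A => dVol μ A L) (negTri v w) ≤ 2 * lams s (vol μ) (negTri v w) *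
      (hSupp L ξ + hSupp L η + hSupp L fun x => -ξ x - η x) := by
  obtain ⟨Q, hQ, hQ0, hQt⟩ := exists_lams_dVol_deriv μ (by omega) s (negTri v w) L
  set a := hSupp L ξ with ha
  set b := hSupp L η with hb
  set r := a + b + hSupp L fun x => -ξ x - η x with hr
  set A := lams s (vol μ) (negTri v w) with hA
  have hbd : ∀ x ∈ L, ξ x ≤ a ∧ η x ≤ b ∧ (a - ξ x) + (b - η x) ≤ r := by
    intro x hx
    have h3 := L.le_hSupp (p := fun x => -ξ x - η x) (by fun_prop) hx
    exact ⟨L.le_hSupp ξ.continuous hx, L.le_hSupp η.continuous hx, by rw [hr]; linarith⟩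
  have hr0 : 0 ≤ r := by
    obtain ⟨x, hx⟩ := L.nonempty
    obtain ⟨h1, h2, h3⟩ := hbd x hx
    linarith
  have hsub : (L.mapCLM (ξ.smulRight v + η.smulRight w) : Set V) ⊆
      (r • negTri v w + point (a • v + b • w) : ConvexBody V) := by
    rw [coe_mapCLM]
    rintro _ ⟨x, hx, rfl⟩
    obtain ⟨h1, h2, h3⟩ := hbd x hx
    rw [coe_add]
    refine ⟨_, mem_smul_negTri (sub_nonneg.2 h1) (sub_nonneg.2 h2) h3, _, rfl, ?_⟩
    simp only [add_apply, ContinuousLinearMap.smulRight_apply]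
    module
  have hv : v ∈ Submodule.span ℝ {v, w} := Submodule.subset_span (by simp)
  have hw : w ∈ Submodule.span ℝ {v, w} := Submodule.subset_span (by simp)
  have hfr := finrank_span_pair_le (v := v) (w := w)
  have hle : ∀ t, 0 < t → Q t ≤ 2 * A * r + t * (r ^ 2 * A) := by
    intro t ht
    have e1 : negTri v w + t • (r • negTri v w + point (a • v + b • w)) =
        (1 + t * r) • negTri v w + point (t • (a • v + b • w)) := by
      rw [smul_add, smul_smul, add_smul_body _ _ zero_le_one (by positivity), one_smul, add_assoc,
        smul_eq_mapCLM t (point _), mapCLM_point]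
      rfl
    have h1 := lams_vol_mono μ s (E := Submodule.span ℝ {v, w})
      (K := negTri v w + t • L.mapCLM (ξ.smulRight v + η.smulRight w))
      (L := negTri v w + t • (r • negTri v w + point (a • v + b • w))) ?_ (by omega) ?_
    · rw [← lams_add_smul_proj μ hf, hQt t ht, e1, ((CTV.vol μ).lams s).add_point,
        lams_vol_homog_two μ hs _ _ (by positivity), ← hA] at h1
      have : t * Q t ≤ t * (2 * A * r + t * (r ^ 2 * A)) := by linarith
      exact le_of_mul_le_mul_left this ht
    · rw [e1, coe_add, coe_smul]
      rintro _ ⟨_, ⟨x, hx, rfl⟩, _, rfl, rfl⟩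
      exact Submodule.add_mem _ (Submodule.smul_mem _ _ (negTri_subset hv hw hx))
        (Submodule.smul_mem _ _ (Submodule.add_mem _ (Submodule.smul_mem _ _ hv)
          (Submodule.smul_mem _ _ hw)))
    · rw [coe_add, coe_add, coe_smul, coe_smul]
      exact Set.add_subset_add_left (Set.smul_set_mono hsub)
  rw [← hQ0]
  have l1 : Filter.Tendsto Q (nhdsWithin 0 (Set.Ioi 0)) (nhds (Q 0)) :=
    hQ.continuousAt.tendsto.mono_left nhdsWithin_le_nhds
  have hc : Continuous fun t : ℝ => 2 * A * r + t * (r ^ 2 * A) := by fun_prop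
  have l2 : Filter.Tendsto (fun t : ℝ => 2 * A * r + t * (r ^ 2 * A)) (nhdsWithin 0 (Set.Ioi 0))
      (nhds (2 * A * r + 0 * (r ^ 2 * A))) :=
    hc.continuousAt.tendsto.mono_left nhdsWithin_le_nhds
  rw [zero_mul, add_zero] at l2
  refine le_of_tendsto_of_tendsto l1 l2 ?_
  filter_upwards [self_mem_nhdsWithin] with t ht
  exact hle t ht

theorem le_lams_dVol (hs : s.card + 2 = finrank ℝ V)
    (hf : ∀ x, x - (ξ x • v + η x • w) ∈ mspan s) (L : ConvexBody V) (hη : ∀ x ∈ L, η x = 0) :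
    2 * lams s (vol μ) (negTri v w) * (hSupp L ξ + hSupp L fun x => -ξ x) ≤
      lams s (fun A => dVol μ A L) (negTri v w) := by
  obtain ⟨Q, hQ, hQ0, hQt⟩ := exists_lams_dVol_deriv μ (by omega) s (negTri v w) L
  obtain ⟨x₁, hx₁, h₁⟩ := L.exists_hSupp_eq (p := ξ) ξ.continuous
  obtain ⟨x₀, hx₀, h₀⟩ := L.exists_hSupp_eq (p := fun x => -ξ x) (by fun_prop)
  set A := lams s (vol μ) (negTri v w) with hA
  set d := hSupp L ξ + hSupp L fun x => -ξ x with hd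
  have hd' : d = ξ x₁ - ξ x₀ := by rw [hd, h₁, h₀]; ring
  have hd0 : 0 ≤ d := by
    have := L.le_hSupp ξ.continuous hx₀
    rw [h₁] at this
    rw [hd']
    linarith
  have hsub : (seg (d • v) + point (ξ x₀ • v) : ConvexBody V) ≤
      (L.mapCLM (ξ.smulRight v + η.smulRight w) : Set V) := by
    rw [coe_add]
    rintro _ ⟨x, hx, _, rfl, rfl⟩
    obtain ⟨t, ht, ht1, rfl⟩ := mem_seg.1 hx
    have hmem : x₀ + t • (x₁ - x₀) ∈ L := L.convex.add_smul_sub_mem hx₀ hx₁ ⟨ht, ht1⟩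
    refine ⟨_, hmem, ?_⟩
    simp only [add_apply, ContinuousLinearMap.smulRight_apply]
    rw [hη _ hmem, hd']
    simp only [map_add, map_smul, map_sub, smul_eq_mul]
    module
  have hv : v ∈ Submodule.span ℝ {v, w} := Submodule.subset_span (by simp)
  have hw : w ∈ Submodule.span ℝ {v, w} := Submodule.subset_span (by simp)
  have hfr := finrank_span_pair_le (v := v) (w := w)
  have hle : ∀ t, 0 < t → 2 * A * d ≤ Q t := by
    intro t ht
    have h1 := lams_vol_mono μ s (E := Submodule.span ℝ {v, w})
      (L := negTri v w + t • L.mapCLM (ξ.smulRight v + η.smulRight w))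
      (K := negTri v w + t • (seg (d • v) + point (ξ x₀ • v))) ?_ (by omega) ?_
    · have e1 : negTri v w + t • (seg (d • v) + point (ξ x₀ • v)) =
          negTri v w + seg ((t * d) • v) + point (t • ξ x₀ • v) := by
        rw [smul_add, smul_seg, smul_smul, smul_eq_mapCLM t (point _), mapCLM_point, add_assoc]
        rfl
      have e2 := ((CTV.vol μ).lams s).lam_smul (t * d) v (negTri v w)
      rw [((CTV.vol μ).lams s).lam_negTri (lams_vol_homog_two μ hs),
        abs_of_nonneg (by positivity), lam, ← hA] at e2
      rw [← lams_add_smul_proj μ hf, hQt t ht, e1, ((CTV.vol μ).lams s).add_point] at h1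
      have : t * (2 * A * d) ≤ t * Q t := by linarith
      exact le_of_mul_le_mul_left this ht
    · rw [coe_add, coe_smul, coe_mapCLM]
      rintro _ ⟨y, hy, _, ⟨_, ⟨x, hx, rfl⟩, rfl⟩, rfl⟩
      exact Submodule.add_mem _ (negTri_subset hv hw hy)
        (Submodule.smul_mem _ _ (Submodule.add_mem _ (Submodule.smul_mem _ _ hv)
          (Submodule.smul_mem _ _ hw)))
    · rw [coe_add, coe_add, coe_smul, coe_smul]
      exact Set.add_subset_add_left (Set.smul_set_mono hsub)
  rw [← hQ0]
  have l1 : Filter.Tendsto Q (nhdsWithin 0 (Set.Ioi 0)) (nhds (Q 0)) :=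
    hQ.continuousAt.tendsto.mono_left nhdsWithin_le_nhds
  refine ge_of_tendsto l1 ?_
  filter_upwards [self_mem_nhdsWithin] with t ht
  exact hle t ht

end Triangle

end MixedArea

end

section

open ConvexBody

set_option linter.unusedSectionVars false

section ThetaPi

/-- The support function of a convex body in `ℂ`. -/
def suppC (N : ConvexBody ℂ) (a : ℂ) : ℝ := hSupp N fun c => (c * a).re

theorem continuous_re_mul (a : ℂ) : Continuous fun c : ℂ => (c * a).re := by fun_prop

@[simp] theorem suppC_zero (N : ConvexBody ℂ) : suppC N 0 = 0 := by
  obtain ⟨x, -, hx⟩ := N.exists_hSupp_eq (continuous_re_mul 0)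
  rw [suppC, hx, mul_zero, Complex.zero_re]

theorem suppC_smul (N : ConvexBody ℂ) {t : ℝ} (ht : 0 < t) (a : ℂ) :
    suppC N (t * a) = t * suppC N a := by
  have h : ∀ c : ℂ, (c * (t * a)).re = t * (c * a).re := fun c => by
    rw [mul_left_comm, Complex.re_ofReal_mul]
  obtain ⟨x, hx, h1⟩ := N.exists_hSupp_eq (continuous_re_mul (t * a))
  obtain ⟨y, hy, h2⟩ := N.exists_hSupp_eq (continuous_re_mul a)
  have h3 := N.le_hSupp (continuous_re_mul (t * a)) hy
  have h4 := N.le_hSupp (continuous_re_mul a) hx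
  rw [suppC, suppC]
  apply le_antisymm
  · rw [h1, h]
    exact mul_le_mul_of_nonneg_left h4 ht.le
  · rw [h2, ← h]
    exact h3

variable {W : Type*} [NormedAddCommGroup W] [NormedSpace ℂ W] [FiniteDimensional ℂ W]
variable {k : ℕ} (e : Basis (Fin 3 ⊕ Fin k) ℂ W)

theorem emb_c0 : emb e c0 = e (Sum.inl 0) := by simp [emb_apply, c0]
theorem emb_c1 : emb e c1 = e (Sum.inl 1) := by simp [emb_apply, c1]
theorem emb_c2 : emb e c2 = e (Sum.inl 2) := by simp [emb_apply, c2]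

/-- The segments eliminated in the definition of `theta`, in coordinates of a basis. -/
def frameW : Multiset W :=
  frame (e (Sum.inl 0)) (e (Sum.inl 1)) (e (Sum.inl 2)) + cpair (restVec e)

theorem theta_redFam (F : ConvexBody W → W → ℝ) (a b : ℂ) :
    theta (redFam e F) a b = lams (frameW e) (fun K => F K (emb e ![a, b, 0]))
      (negTri (e (Sum.inl 0)) (e (Sum.inl 1))) := by
  have hm : (frame c0 c1 c2).map (emb e) = frame (emb e c0) (emb e c1) (emb e c2) := by
    simp [frame]
  rw [theta, lams_redFam, hm, emb_c0, emb_c1, emb_c2, tri3,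
    mapCLM_hull _ (by simp) (by simp), frameW, negTri]
  congr 2
  simp [Set.image_insert_eq, emb_c0, emb_c1]

theorem card_frameW : (frameW e).card + 2 = finrank ℝ W := by
  rw [finrank_real_of_complex, finrank_eq_card_basis e, frameW, Multiset.card_add, card_cpair]
  simp [frame, restVec]
  ring

theorem complex_smul_mem {E : Submodule ℝ W} {v : W} (h1 : v ∈ E) (h2 : Complex.I • v ∈ E)
    (c : ℂ) : c • v ∈ E := by
  rw [smul_eq_re_add_im]
  exact E.add_mem (E.smul_mem _ h1) (E.smul_mem _ h2)

theorem sub_mem_mspan_frameW (x : W) :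
    x - (reFun (e.coord (Sum.inl 0)) x • e (Sum.inl 0) +
      reFun (e.coord (Sum.inl 1)) x • e (Sum.inl 1)) ∈ mspan (frameW e) := by
  have hm : ∀ y ∈ frameW e, y ∈ mspan (frameW e) := fun y hy => subset_mspan hy
  have hI0 := hm (Complex.I • e (Sum.inl 0)) (by simp [frameW, frame])
  have hI1 := hm (Complex.I • e (Sum.inl 1)) (by simp [frameW, frame])
  have h2 := complex_smul_mem (hm (e (Sum.inl 2)) (by simp [frameW, frame]))
    (hm (Complex.I • e (Sum.inl 2)) (by simp [frameW, frame]))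
  have h3 : ∀ j, ∀ c : ℂ, c • e (Sum.inr j) ∈ mspan (frameW e) := fun j =>
    complex_smul_mem (hm _ (Multiset.mem_add.2 (Or.inr (mem_cpair.2 (Or.inl (by simp [restVec]))))))
      (hm _ (Multiset.mem_add.2 (Or.inr (mem_cpair.2 (Or.inr ⟨_, by simp [restVec], rfl⟩)))))
  have hx : x - (reFun (e.coord (Sum.inl 0)) x • e (Sum.inl 0) +
      reFun (e.coord (Sum.inl 1)) x • e (Sum.inl 1)) =
      (e.repr x (Sum.inl 0)).im • Complex.I • e (Sum.inl 0) +
      (e.repr x (Sum.inl 1)).im • Complex.I • e (Sum.inl 1) +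
      e.repr x (Sum.inl 2) • e (Sum.inl 2) + ∑ j, e.repr x (Sum.inr j) • e (Sum.inr j) := by
    have h := e.sum_repr x
    rw [Fintype.sum_sum_type, Fin.sum_univ_three, smul_eq_re_add_im _ (e (Sum.inl 0)),
      smul_eq_re_add_im _ (e (Sum.inl 1))] at h
    nth_rw 1 [← h]
    simp only [reFun_apply, Basis.coord_apply]
    abel
  rw [hx]
  exact Submodule.add_mem _ (Submodule.add_mem _ (Submodule.add_mem _
    (Submodule.smul_mem _ _ hI0) (Submodule.smul_mem _ _ hI1)) (h2 _))
    (Submodule.sum_mem _ fun j _ => h3 j _)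

variable [MeasurableSpace W] [BorelSpace W] (μ : Measure W) [μ.IsAddHaarMeasure]

/-- The normalising constant relating `theta` of a projection family to the support function. -/
def thetaConst : ℝ := (finrank ℝ W : ℝ)⁻¹ *
  (2 * lams (frameW e) (vol μ) (negTri (e (Sum.inl 0)) (e (Sum.inl 1))))

theorem finrank_pos_of_basis {W : Type*} [NormedAddCommGroup W] [NormedSpace ℂ W] {k : ℕ}
    (e : Basis (Fin 3 ⊕ Fin k) ℂ W) : 0 < finrank ℂ W := by
  rw [finrank_eq_card_basis e]
  simp

theorem thetaConst_pos : 0 < thetaConst e μ := by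
  have h := finrank_pos_of_basis e
  have h1 : 0 < finrank ℝ W := by rw [finrank_real_of_complex]; omega
  have h2 := lams_negTri_pos μ (card_frameW e) (sub_mem_mspan_frameW e)
  unfold thetaConst
  positivity

theorem hSupp_dotBody_emb (N : ConvexBody ℂ) (a b : ℂ) :
    hSupp (dotBody N (emb e ![a, b, 0])) (reFun (e.coord (Sum.inl 0))) = suppC N a ∧
    hSupp (dotBody N (emb e ![a, b, 0])) (reFun (e.coord (Sum.inl 1))) = suppC N b ∧
    hSupp (dotBody N (emb e ![a, b, 0])) (fun x => -reFun (e.coord (Sum.inl 0)) x -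
      reFun (e.coord (Sum.inl 1)) x) = suppC N (-a - b) := by
  have h0 : e.coord (Sum.inl 0) (emb e ![a, b, 0]) = a := by simp [emb_apply]
  have h1 : e.coord (Sum.inl 1) (emb e ![a, b, 0]) = b := by simp [emb_apply]
  refine ⟨?_, ?_, ?_⟩
  · have := hSupp_dotBody N (emb e ![a, b, 0]) (e.coord (Sum.inl 0))
    rwa [h0] at this
  · have := hSupp_dotBody N (emb e ![a, b, 0]) (e.coord (Sum.inl 1))
    rwa [h1] at this
  · have := hSupp_dotBody N (emb e ![a, b, 0]) (-e.coord (Sum.inl 0) - e.coord (Sum.inl 1))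
    simp only [LinearMap.sub_apply, LinearMap.neg_apply, h0, h1] at this
    exact this

theorem theta_piFam_le (N : ConvexBody ℂ) (a b : ℂ) :
    theta (redFam e (piFam μ N)) a b ≤
      thetaConst e μ * (suppC N a + suppC N b + suppC N (-a - b)) := by
  rw [theta_redFam]
  have h := lams_dVol_le μ (card_frameW e) (sub_mem_mspan_frameW e)
    (dotBody N (emb e ![a, b, 0]))
  obtain ⟨h0, h1, h2⟩ := hSupp_dotBody_emb e N a b
  rw [h0, h1, h2] at h
  simp only [piFam]
  rw [lams_const_mul, thetaConst, mul_assoc]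
  exact mul_le_mul_of_nonneg_left h (by positivity)

theorem theta_piFam_line (N : ConvexBody ℂ) (a : ℂ) :
    theta (redFam e (piFam μ N)) a 0 = thetaConst e μ * (suppC N a + suppC N (-a)) := by
  apply le_antisymm
  · have := theta_piFam_le e μ N a 0
    rwa [suppC_zero, add_zero, sub_zero] at this
  · rw [theta_redFam]
    obtain ⟨h0, -, h2⟩ := hSupp_dotBody_emb e N a 0
    have hη : ∀ x ∈ dotBody N (emb e ![a, 0, 0]), reFun (e.coord (Sum.inl 1)) x = 0 := by
      rintro _ ⟨c, hc, rfl⟩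
      have : e.coord (Sum.inl 1) (c • emb e ![a, 0, 0]) = 0 := by simp [emb_apply]
      exact congrArg Complex.re this
    have h := le_lams_dVol μ (card_frameW e) (sub_mem_mspan_frameW e)
      (dotBody N (emb e ![a, 0, 0])) hη
    have h3 : hSupp (dotBody N (emb e ![a, 0, 0])) (fun x => -reFun (e.coord (Sum.inl 0)) x) =
        suppC N (-a) := by
      have := hSupp_dotBody N (emb e ![a, 0, 0]) (-e.coord (Sum.inl 0))
      have h0 : e.coord (Sum.inl 0) (emb e ![a, 0, 0]) = a := by simp [emb_apply]
      simp only [LinearMap.neg_apply, h0] at this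
      exact this
    rw [h0, h3] at h
    simp only [piFam]
    rw [lams_const_mul, thetaConst, mul_assoc]
    exact mul_le_mul_of_nonneg_left h (by positivity)

theorem theta_piFam (N : ConvexBody ℂ) (a b : ℂ) :
    theta (redFam e (piFam μ N)) a b =
      thetaConst e μ * (suppC N a + suppC N b + suppC N (-a - b)) := by
  have hF := piFam_sublinFam μ (finrank_pos_of_basis e) N
  have hi := piFam_homog μ (W := W) N
  obtain ⟨G, hG, -, hθ⟩ := ((hF.redFam e).thetaData
    (redFam_homog e hF.ctv hi)).exists_generator
  have hG0 : G 0 = 0 := by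
    have := hG 2 (by norm_num) 0
    simp only [mul_zero] at this
    linarith
  have h1 : ∀ a, thetaConst e μ * suppC N (-a) - G (-a) = -(thetaConst e μ * suppC N a - G a) := by
    intro a
    have h1 := theta_piFam_line e μ N a
    rw [hθ, hG0, sub_zero] at h1
    linarith
  have h2 : ∀ a b, 0 ≤ (thetaConst e μ * suppC N a - G a) + (thetaConst e μ * suppC N b - G b) +
      (thetaConst e μ * suppC N (-a - b) - G (-a - b)) := by
    intro a b
    have h1 := theta_piFam_le e μ N a b
    rw [hθ] at h1
    linarith
  have h3 := h2 a b
  have h4 := h2 (-a) (-b)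
  have h5 := h1 (a + b)
  rw [neg_add'] at h5
  rw [h1, h1, neg_neg, sub_neg_eq_add] at h4
  rw [hθ]
  linarith

end ThetaPi

end

section

open ConvexBody

set_option linter.unusedSectionVars false

section AdaptedBasis

variable {W : Type*} [NormedAddCommGroup W] [NormedSpace ℂ W] [FiniteDimensional ℂ W]
variable {k : ℕ} (e : Basis (Fin 3 ⊕ Fin k) ℂ W)

theorem exists_basis_coord_eq {W : Type*} [NormedAddCommGroup W] [NormedSpace ℂ W]
    [FiniteDimensional ℂ W] {k : ℕ} (e : Basis (Fin 3 ⊕ Fin k) ℂ W) {ξ₀ ξ₁ : W →ₗ[ℂ] ℂ}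
    (hind : ∀ a b : ℂ, a • ξ₀ + b • ξ₁ = 0 → a = 0 ∧ b = 0) :
    ∃ e' : Basis (Fin 3 ⊕ Fin k) ℂ W, ∀ i, ξ₀ (e' i) = (if i = Sum.inl 0 then 1 else 0) ∧
      ξ₁ (e' i) = if i = Sum.inl 1 then 1 else 0 := by
  have hsurj : LinearMap.range (ξ₀.prod ξ₁) = ⊤ := by
    by_contra h
    obtain ⟨f, hf, hle⟩ := Submodule.exists_le_ker_of_lt_top _ (lt_top_iff_ne_top.2 h)
    have hfx : ∀ x y, f (x, y) = f (1, 0) * x + f (0, 1) * y := fun x y => by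
      have : ((x, y) : ℂ × ℂ) = x • (1, 0) + y • (0, 1) := by simp
      rw [this, map_add, map_smul, map_smul, smul_eq_mul, smul_eq_mul, mul_comm x, mul_comm y]
    obtain ⟨ha, hb⟩ := hind (f (1, 0)) (f (0, 1)) (LinearMap.ext fun x => by
      have : f (ξ₀ x, ξ₁ x) = 0 := hle ⟨x, rfl⟩
      rw [hfx] at this
      simpa using this)
    refine hf (LinearMap.ext fun x => ?_)
    obtain ⟨x, y⟩ := x
    rw [hfx, ha, hb]
    simp
  obtain ⟨v₀, hv₀⟩ := LinearMap.range_eq_top.1 hsurj (1, 0)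
  obtain ⟨v₁, hv₁⟩ := LinearMap.range_eq_top.1 hsurj (0, 1)
  have hv₀ : ξ₀ v₀ = 1 ∧ ξ₁ v₀ = 0 := Prod.ext_iff.1 hv₀
  have hv₁ : ξ₀ v₁ = 0 ∧ ξ₁ v₁ = 1 := Prod.ext_iff.1 hv₁
  have hker : finrank ℂ (LinearMap.ker (ξ₀.prod ξ₁)) = k + 1 := by
    have := LinearMap.finrank_range_add_finrank_ker (ξ₀.prod ξ₁)
    rw [hsurj, finrank_top, finrank_eq_card_basis e] at this
    simp at this
    omega
  set b := finBasisOfFinrankEq ℂ _ hker with hb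
  have hbk : ∀ j, ξ₀ (b j) = 0 ∧ ξ₁ (b j) = 0 := fun j => by
    have := (b j).2
    simpa using this
  let v : Fin 3 ⊕ Fin k → W := Sum.elim ![v₀, v₁, b 0] fun j => b j.succ
  have hspan : ⊤ ≤ Submodule.span ℂ (Set.range v) := by
    rintro x -
    have hm : ∀ i, v i ∈ Submodule.span ℂ (Set.range v) := fun i =>
      Submodule.subset_span (Set.mem_range_self i)
    have h0 : v₀ ∈ Submodule.span ℂ (Set.range v) := hm (Sum.inl 0)
    have h1 : v₁ ∈ Submodule.span ℂ (Set.range v) := hm (Sum.inl 1)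
    have h2 : ∀ j, (b j : W) ∈ Submodule.span ℂ (Set.range v) := fun j => by
      refine Fin.cases ?_ (fun j => ?_) j
      · exact hm (Sum.inl 2)
      · exact hm (Sum.inr j)
    have hy : x - (ξ₀ x • v₀ + ξ₁ x • v₁) ∈ LinearMap.ker (ξ₀.prod ξ₁) := by
      simp [hv₀, hv₁]
    have h3 : x - (ξ₀ x • v₀ + ξ₁ x • v₁) = ∑ j, b.repr ⟨_, hy⟩ j • (b j : W) := by
      have := congrArg Subtype.val (b.sum_repr ⟨_, hy⟩).symm
      rwa [AddSubmonoidClass.coe_finsetSum] at this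
    rw [sub_eq_iff_eq_add] at h3
    rw [h3]
    exact Submodule.add_mem _ (Submodule.sum_mem _ fun j _ => Submodule.smul_mem _ _ (h2 j))
      (Submodule.add_mem _ (Submodule.smul_mem _ _ h0) (Submodule.smul_mem _ _ h1))
  refine ⟨basisOfTopLeSpanOfCardEqFinrank v hspan (finrank_eq_card_basis e).symm, fun i => ?_⟩
  rw [coe_basisOfTopLeSpanOfCardEqFinrank]
  rcases i with i | j
  · fin_cases i <;> simp [v, hv₀, hv₁, hbk]
  · simp [v, hbk]

theorem exists_adapted_basis {W : Type*} [NormedAddCommGroup W] [NormedSpace ℂ W]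
    [FiniteDimensional ℂ W] {k : ℕ} (e : Basis (Fin 3 ⊕ Fin k) ℂ W) {ξ₀ ξ₁ : W →ₗ[ℂ] ℂ}
    (hind : ∀ a b : ℂ, a • ξ₀ + b • ξ₁ = 0 → a = 0 ∧ b = 0) :
    ∃ g : W →ₗ[ℂ] W, LinearMap.det g = 1 ∧ ∃ e' : Basis (Fin 3 ⊕ Fin k) ℂ W,
      (∀ i, e' i = g (e i)) ∧ e'.coord (Sum.inl 0) = ξ₀ ∧ e'.coord (Sum.inl 1) = ξ₁ := by
  obtain ⟨e₁, he₁⟩ := exists_basis_coord_eq e hind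
  let g₁ := e.equiv e₁ (Equiv.refl _)
  have hg₁ : ∀ i, g₁ (e i) = e₁ i := fun i => by simp [g₁]
  set δ := LinearMap.det (g₁ : W →ₗ[ℂ] W) with hδ
  have hδ0 : δ ≠ 0 := g₁.isUnit_det'.ne_zero
  let g : W →ₗ[ℂ] W := (g₁ : W →ₗ[ℂ] W) ∘ₗ cdil (e.coord (Sum.inl 2)) (e (Sum.inl 2)) δ⁻¹
  have hg : LinearMap.det g = 1 := by
    rw [LinearMap.det_comp, det_cdil (by simp), mul_inv_cancel₀ hδ0]
  let ge := LinearEquiv.ofIsUnitDet (f := g) (v := e) (v' := e)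
    (by rw [LinearMap.det_toMatrix, hg]; exact isUnit_one)
  have hge : ∀ x, ge x = g x := fun x => rfl
  have hval : ∀ i, ξ₀ (g (e i)) = ξ₀ (e₁ i) ∧ ξ₁ (g (e i)) = ξ₁ (e₁ i) := fun i => by
    simp [g, hg₁, he₁]
  refine ⟨g, hg, e.map ge, fun i => by rw [Basis.map_apply, hge], ?_, ?_⟩
  · refine (e.map ge).ext fun i => ?_
    rw [Basis.coord_apply, Basis.repr_self, Basis.map_apply, hge, (hval i).1, (he₁ i).1,
      Finsupp.single_apply]
  · refine (e.map ge).ext fun i => ?_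
    rw [Basis.coord_apply, Basis.repr_self, Basis.map_apply, hge, (hval i).2, (he₁ i).2,
      Finsupp.single_apply]

variable {F : ConvexBody W → W → ℝ}

theorem theta_redFam_map (hF : EquivFam F) {g : W →ₗ[ℂ] W} (hg : LinearMap.det g = 1)
    {e' : Basis (Fin 3 ⊕ Fin k) ℂ W} (he : ∀ i, e' i = g (e i)) (a b : ℂ) :
    theta (redFam e' F) a b = theta (redFam e F) a b := by
  rw [theta_redFam, theta_redFam,
    ← hF.lams_equiv hg (frameW e) (negTri (e (Sum.inl 0)) (e (Sum.inl 1))) (emb e ![a, b, 0])]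
  have h1 : (frameW e).map g = frameW e' := by
    simp only [frameW, frame, restVec, cpair, he, Multiset.map_add, Multiset.map_map,
      Function.comp_def, map_smul, Multiset.map_cons, Multiset.map_zero]
  have h2 : g (emb e ![a, b, 0]) = emb e' ![a, b, 0] := by simp [emb_apply, he]
  have h3 : (negTri (e (Sum.inl 0)) (e (Sum.inl 1))).mapCLM (cReal g) =
      negTri (e' (Sum.inl 0)) (e' (Sum.inl 1)) := by
    rw [negTri, mapCLM_hull _ (by simp) (by simp), negTri]
    simp [Set.image_insert_eq, he]
  rw [h1, h2, h3]

theorem SublinFam.lams_frameW (hF : SublinFam F)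
    (hi : ∀ u, IsHomog (2 * finrank ℂ W - 1) fun K => F K u) (u : W) :
    lams (frameW e) (fun K => F K u) (negTri (e (Sum.inl 0)) (e (Sum.inl 1))) =
      theta (_root_.redFam e F) (e.coord (Sum.inl 0) u) (e.coord (Sum.inl 1) u) := by
  have hs : ∀ x ∈ frame (e (Sum.inl 0)) (e (Sum.inl 1)) (e (Sum.inl 2)), ∀ j,
      e.repr x (Sum.inr j) = 0 := by
    intro x hx j
    simp only [frame, Multiset.mem_cons, Multiset.notMem_zero, or_false] at hx
    rcases hx with rfl | rfl | rfl | rfl <;> simp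
  have hv : (fun i => e.repr u (Sum.inl i)) = ![e.repr u (Sum.inl 0), e.repr u (Sum.inl 1),
      e.repr u (Sum.inl 2)] := by
    ext i
    fin_cases i <;> rfl
  have h := (hF.redFam e).frame_last (redFam_homog e hF.ctv hi) (e.repr u (Sum.inl 0))
    (e.repr u (Sum.inl 1)) (e.repr u (Sum.inl 2)) tri3
  have hm : (frame c0 c1 c2).map (emb e) =
      frame (e (Sum.inl 0)) (e (Sum.inl 1)) (e (Sum.inl 2)) := by
    simp [frame, emb_c0, emb_c1, emb_c2]
  have ht : tri3.mapCLM (embR e) = negTri (e (Sum.inl 0)) (e (Sum.inl 1)) := by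
    rw [tri3, mapCLM_hull _ (by simp) (by simp), negTri]
    simp [Set.image_insert_eq, emb_c0, emb_c1]
  rw [Basis.coord_apply, Basis.coord_apply, theta, ← h, lams_redFam, hm, ht, frameW,
    hF.lams_eq_emb e hi _ hs, hv]

end AdaptedBasis

end

section

open ConvexBody

set_option linter.unusedSectionVars false

section Perturbation

variable {V : Type*} [NormedAddCommGroup V] [NormedSpace ℝ V]

theorem lams_sub (s : Multiset V) (φ ψ : ConvexBody V → ℝ) (K : ConvexBody V) :
    lams s (fun K => φ K - ψ K) K = lams s φ K - lams s ψ K := by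
  induction s using Multiset.induction_on generalizing K with
  | empty => rfl
  | cons v s ih =>
    simp only [lams_cons, lam, ih]
    ring

theorem ConvexBody.hull_triple (a b c : V) : hull {a, b, c} = negTri (a - b) (a - c) + point a := by
  rw [negTri, hull_add_point (by simp) (by simp)]
  congr 1
  ext z
  simp only [Set.image_insert_eq, Set.image_singleton, Set.mem_insert_iff, Set.mem_singleton_iff,
    neg_sub, sub_add_cancel, zero_add]

theorem Multiset.exists_map_eq {ι : Type*} [DecidableEq ι] (T : Finset ι) (s : Multiset V)
    (h : s.card = T.card) : ∃ x : ι → V, T.val.map x = s := by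
  induction T using Finset.induction_on generalizing s with
  | empty => exact ⟨0, by simpa [eq_comm] using h⟩
  | insert a T ha ih =>
    rw [Finset.card_insert_of_notMem ha] at h
    have hs : s ≠ 0 := by
      rintro rfl
      simp at h
    obtain ⟨v, hv⟩ := Multiset.exists_mem_of_ne_zero hs
    obtain ⟨s, rfl⟩ := Multiset.exists_cons_of_mem hv
    obtain ⟨x, hx⟩ := ih s (by simpa using h)
    refine ⟨Function.update x a v, ?_⟩
    rw [Finset.insert_val_of_notMem ha, Multiset.map_cons, Function.update_self, ← hx]
    congr 1
    refine Multiset.map_congr rfl fun i hi => Function.update_of_ne ?_ _ _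
    rintro rfl
    exact ha hi

variable [FiniteDimensional ℝ V]

theorem finite_not_linearIndependent {ι : Type*} (y : Basis ι ℝ V) (x : ι → V) :
    {t : ℝ | ¬ LinearIndependent ℝ fun i => x i + t • y i}.Finite := by
  have h := (Module.End.finite_hasEigenvalue (y.constr ℝ x)).preimage
    (f := fun t : ℝ => -t) neg_injective.injOn
  refine h.subset fun t ht => ?_
  by_contra h1
  refine ht ?_
  have h2 : (fun i => x i + t • y i) = (y.constr ℝ x - (-t) • (LinearMap.id : V →ₗ[ℝ] V)) ∘ y := by
    ext i
    simp
  rw [h2]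
  refine y.linearIndependent.map' _ ?_
  rw [Set.mem_preimage, Set.mem_ofPred_eq, Module.End.hasEigenvalue_iff, not_not,
    Module.End.eigenspace_def] at h1
  exact h1

theorem CTV.continuous_lams {X ι : Type*} [TopologicalSpace X] {φ : ConvexBody V → ℝ}
    (hφ : CTV φ) {x : ι → X → V} (hx : ∀ i, Continuous (x i)) (S : Multiset ι) :
    ∀ {K : X → ConvexBody V}, Continuous K →
      Continuous fun t => _root_.lams (S.map fun i => x i t) φ (K t) := by
  induction S using Multiset.induction_on with
  | empty =>
    intro K hK
    have := hφ.cont.comp hK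
    simp only [Multiset.map_zero, lams_zero]
    simpa only [Function.comp_def] using this
  | cons i S ih =>
    intro K hK
    simp only [Multiset.map_cons, lams_cons, _root_.lam]
    exact (ih (hK.add (hx i).seg)).sub (ih hK)

end Perturbation

section Determination

variable {W : Type*} [NormedAddCommGroup W] [NormedSpace ℂ W] [FiniteDimensional ℂ W]

theorem exists_functionals {ι : Type*} [Fintype ι] [DecidableEq ι] {i₀ i₁ i₂ : ι}
    (h01 : i₀ ≠ i₁) (h02 : i₀ ≠ i₂) (h12 : i₁ ≠ i₂) {x : ι → W}
    (hc : Fintype.card ι = finrank ℝ W) (hx : LinearIndependent ℝ x)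
    (hx' : LinearIndependent ℝ (Function.update x i₁ (Complex.I • x i₀))) :
    ∃ ξ₀ ξ₁ : W →ₗ[ℂ] ℂ, (∀ a b : ℂ, a • ξ₀ + b • ξ₁ = 0 → a = 0 ∧ b = 0) ∧
      (∀ i, (ξ₀ (x i)).re = if i = i₁ then 1 else 0) ∧
      ∀ i, (ξ₁ (x i)).re = if i = i₂ then 1 else 0 := by
  have hne : Nonempty ι := ⟨i₀⟩
  let B := basisOfLinearIndependentOfCardEqFinrank hx hc
  have hB : ∀ i, B i = x i := fun i => by simp [B]
  have hre : ∀ i (z : W), (Module.Dual.extendRCLike (𝕜 := ℂ) (B.coord i) z).re = B.repr z i := fun i z =>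
    Module.Dual.re_extendRCLike_apply (𝕜 := ℂ) (B.coord i) z
  have him : ∀ i (z : W), (Module.Dual.extendRCLike (𝕜 := ℂ) (B.coord i) z).im =
      -B.repr (Complex.I • z) i := fun i z =>
    Module.Dual.im_extendRCLike_apply (𝕜 := ℂ) (B.coord i) z
  refine ⟨Module.Dual.extendRCLike (𝕜 := ℂ) (B.coord i₁),
    Module.Dual.extendRCLike (𝕜 := ℂ) (B.coord i₂), ?_, ?_, ?_⟩
  · have hα : B.repr (Complex.I • x i₀) i₁ ≠ 0 := by
      intro h0
      have h1 := hx'.notMem_span_image (s := {i₁}ᶜ) (x := i₁) (by simp)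
      rw [Function.update_self] at h1
      refine h1 ?_
      have h2 : Function.update x i₁ (Complex.I • x i₀) '' {i₁}ᶜ = B '' {i₁}ᶜ :=
        Set.image_congr fun i hi => by rw [Function.update_of_ne hi, hB]
      rw [h2, B.mem_span_image]
      intro i hi
      rintro rfl
      exact (Finsupp.mem_support_iff.1 hi) h0
    intro a b hab
    have e0 := LinearMap.congr_fun hab (x i₀)
    have e2 := LinearMap.congr_fun hab (x i₂)
    have r1 := hre i₁ (x i₀)
    have r2 := hre i₂ (x i₀)
    have m1 := him i₁ (x i₀)
    have m2 := him i₂ (x i₀)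
    have s1 := hre i₁ (x i₂)
    have s2 := hre i₂ (x i₂)
    rw [← hB i₀, B.repr_self, Finsupp.single_eq_of_ne (by tauto), hB] at r1 r2
    rw [← hB i₂, B.repr_self, hB] at s1 s2
    rw [Finsupp.single_eq_of_ne (by tauto)] at s1
    rw [Finsupp.single_eq_same] at s2
    set α := B.repr (Complex.I • x i₀) i₁
    set β := B.repr (Complex.I • x i₀) i₂
    simp only [LinearMap.add_apply, LinearMap.smul_apply, smul_eq_mul, LinearMap.zero_apply]
      at e0 e2
    set p := Module.Dual.extendRCLike (𝕜 := ℂ) (B.coord i₁) (x i₀)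
    set q := Module.Dual.extendRCLike (𝕜 := ℂ) (B.coord i₂) (x i₀)
    set p' := Module.Dual.extendRCLike (𝕜 := ℂ) (B.coord i₁) (x i₂)
    set q' := Module.Dual.extendRCLike (𝕜 := ℂ) (B.coord i₂) (x i₂)
    have hp : p = -Complex.I * (α : ℂ) := by apply Complex.ext <;> simp [r1, m1]
    have hq : q = -Complex.I * (β : ℂ) := by apply Complex.ext <;> simp [r2, m2]
    have e3 : a * α = -(b * β) := by
      rw [hp, hq] at e0
      have : Complex.I * (a * α + b * β) = 0 := by linear_combination -e0
      rw [mul_eq_zero] at this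
      have := this.resolve_left Complex.I_ne_zero
      linear_combination this
    have e4 : b * ((α : ℂ) * q' - (β : ℂ) * p') = 0 := by
      linear_combination (α : ℂ) * e2 - p' * e3
    have hb : b = 0 := by
      refine (mul_eq_zero.1 e4).resolve_right fun h => hα ?_
      have := congrArg Complex.re h
      simpa [s1, s2] using this
    refine ⟨?_, hb⟩
    rw [hb, zero_mul, neg_zero, mul_eq_zero] at e3
    exact e3.resolve_right (by exact_mod_cast hα)
  · intro i
    rw [hre, ← hB, B.repr_self, Finsupp.single_apply]
  · intro i
    rw [hre, ← hB, B.repr_self, Finsupp.single_apply]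

variable {F P : ConvexBody W → W → ℝ} {k : ℕ}

theorem SublinFam.lams_eq_of_functionals (hF : SublinFam F) (hP : SublinFam P)
    (hFi : ∀ u, IsHomog (2 * finrank ℂ W - 1) fun K => F K u)
    (hPi : ∀ u, IsHomog (2 * finrank ℂ W - 1) fun K => P K u)
    (e : Basis (Fin 3 ⊕ Fin k) ℂ W)
    (hθ : ∀ a b, theta (_root_.redFam e F) a b = theta (_root_.redFam e P) a b)
    {s : Multiset W} (hs : s.card + 2 = finrank ℝ W) {v w : W} {ξ₀ ξ₁ : W →ₗ[ℂ] ℂ}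
    (hind : ∀ a b : ℂ, a • ξ₀ + b • ξ₁ = 0 → a = 0 ∧ b = 0)
    (h₀ : ∀ x ∈ s, (ξ₀ x).re = 0) (h₁ : ∀ x ∈ s, (ξ₁ x).re = 0)
    (hv₀ : (ξ₀ v).re = 1) (hv₁ : (ξ₁ v).re = 0) (hw₀ : (ξ₀ w).re = 0) (hw₁ : (ξ₁ w).re = 1)
    (u : W) : lams s (fun K => F K u - P K u) (negTri v w) = 0 := by
  obtain ⟨g, hg, e', he', hc₀, hc₁⟩ := exists_adapted_basis e hind
  have hφ : CTV fun K => F K u - P K u := (hF.ctv u).sub (hP.ctv u)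
  have hmem : ∀ x, x - ((ξ₀ x).re • e' (Sum.inl 0) + (ξ₁ x).re • e' (Sum.inl 1)) ∈
      mspan (frameW e') := fun x => by
    have := sub_mem_mspan_frameW e' x
    rwa [hc₀, hc₁, reFun_apply, reFun_apply] at this
  have hcard := card_frameW e'
  obtain ⟨c, hc⟩ := hφ.exists_lams_eq s (frameW e') 0 (by omega) fun x hx => by
    have := hmem x
    rw [h₀ x hx, h₁ x hx] at this
    simpa using this
  simp only [add_zero] at hc
  have hmv := hmem v
  have hmw := hmem w
  rw [hv₀, hv₁, one_smul, zero_smul, add_zero] at hmv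
  rw [hw₀, hw₁, one_smul, zero_smul, zero_add] at hmw
  have hr : ∀ v w : W, negTri v w = hull (Set.range ![0, -v, -w]) := fun v w => by
    rw [negTri]
    simp only [Matrix.range_cons, Matrix.range_empty, Set.union_empty, Set.singleton_union]
  have hM : ModEq (mspan (frameW e')) (negTri v w)
      (negTri (e' (Sum.inl 0)) (e' (Sum.inl 1))) := by
    rw [hr, hr]
    refine ModEq.hull fun i => ?_
    fin_cases i
    · simp
    · have := Submodule.neg_mem _ hmv
      simpa [neg_add_eq_sub] using this
    · have := Submodule.neg_mem _ hmw
      simpa [neg_add_eq_sub] using this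
  rw [hc, hφ.lams_congr _ hM, lams_sub, hF.lams_frameW e' hFi, hP.lams_frameW e' hPi,
    theta_redFam_map e hF.toEquivFam hg he', theta_redFam_map e hP.toEquivFam hg he', hθ, sub_self,
    mul_zero]

theorem SublinFam.lams_negTri_eq (hF : SublinFam F) (hP : SublinFam P)
    (hFi : ∀ u, IsHomog (2 * finrank ℂ W - 1) fun K => F K u)
    (hPi : ∀ u, IsHomog (2 * finrank ℂ W - 1) fun K => P K u)
    (e : Basis (Fin 3 ⊕ Fin k) ℂ W)
    (hθ : ∀ a b, theta (_root_.redFam e F) a b = theta (_root_.redFam e P) a b)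
    {s : Multiset W} (hs : s.card + 2 = finrank ℝ W) (v w u : W) :
    lams s (fun K => F K u - P K u) (negTri v w) = 0 := by
  have hφ : CTV fun K => F K u - P K u := (hF.ctv u).sub (hP.ctv u)
  let y := Complex.basisOneI.smulTower e
  let i₀ : Fin 2 × (Fin 3 ⊕ Fin k) := (0, Sum.inl 0)
  let i₁ : Fin 2 × (Fin 3 ⊕ Fin k) := (1, Sum.inl 0)
  let i₂ : Fin 2 × (Fin 3 ⊕ Fin k) := (1, Sum.inl 1)
  have h01 : i₀ ≠ i₁ := by simp [i₀, i₁]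
  have h02 : i₀ ≠ i₂ := by simp [i₀, i₂]
  have h12 : i₁ ≠ i₂ := by simp [i₁, i₂]
  have hy : y i₁ = Complex.I • y i₀ := by
    simp [y, i₀, i₁, Basis.smulTower_apply]
  have hcard : Fintype.card (Fin 2 × (Fin 3 ⊕ Fin k)) = finrank ℝ W :=
    (finrank_eq_card_basis y).symm
  let T := (Finset.univ.erase i₁).erase i₂
  have hT : T.card + 2 = finrank ℝ W := by
    rw [← hcard, Finset.card_erase_of_mem (by simp [h12.symm]),
      Finset.card_erase_of_mem (by simp), Finset.card_univ]
    simp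
    omega
  have hTi : ∀ i ∈ T, i ≠ i₁ ∧ i ≠ i₂ := fun i hi => by
    simp only [T, Finset.mem_erase, Finset.mem_univ, and_true] at hi
    exact hi.symm
  obtain ⟨x', hx'⟩ := Multiset.exists_map_eq T s (by omega)
  let x := Function.update (Function.update x' i₁ v) i₂ w
  have hx₁ : x i₁ = v := by
    simp only [x]
    rw [Function.update_of_ne h12, Function.update_self]
  have hx₂ : x i₂ = w := Function.update_self ..
  have hxs : T.val.map x = s := by
    rw [← hx']
    refine Multiset.map_congr rfl fun i hi => ?_
    obtain ⟨h1, h2⟩ := hTi i hi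
    simp only [x]
    rw [Function.update_of_ne h2, Function.update_of_ne h1]
  let X : Fin 2 × (Fin 3 ⊕ Fin k) → ℝ → W := fun i t => x i + t • y i
  have hX : ∀ i, Continuous (X i) := fun i => by fun_prop
  have hK : Continuous fun t => negTri (X i₁ t) (X i₂ t) := by
    have h := Continuous.hull_image (X := ℝ) (s := (Set.univ : Set (Fin 3))) Set.finite_univ
      Set.univ_nonempty (g := fun t => ![0, -X i₁ t, -X i₂ t]) (fun a => by
        have h1 := hX i₁
        have h2 := hX i₂
        fin_cases a
        · exact continuous_const
        · exact h1.neg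
        · exact h2.neg)
    convert h using 3
    rw [negTri, Set.image_univ]
    simp only [Matrix.range_cons, Matrix.range_empty, Set.union_empty, Set.singleton_union]
  have hcont := hφ.continuous_lams hX T.val hK
  have hfin := (finite_not_linearIndependent y x).union
    (finite_not_linearIndependent y (Function.update x i₁ (Complex.I • x i₀)))
  have hzero := Continuous.ext_on (hfin.countable.dense_compl ℝ) hcont continuous_const (g := fun _ => (0 : ℝ)) (by
    intro t ht
    simp only [Set.compl_union, Set.mem_inter_iff, Set.mem_compl_iff, Set.mem_ofPred_eq,
      not_not] at ht
    have h2 : Function.update (fun i => X i t) i₁ (Complex.I • X i₀ t) =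
        fun i => Function.update x i₁ (Complex.I • x i₀) i + t • y i := by
      ext i
      rcases eq_or_ne i i₁ with rfl | hi
      · rw [Function.update_self, Function.update_self, hy, smul_add, smul_comm t Complex.I]
      · rw [Function.update_of_ne hi, Function.update_of_ne hi]
    obtain ⟨ξ₀, ξ₁, hind, hξ₀, hξ₁⟩ := exists_functionals h01 h02 h12 (x := fun i => X i t) hcard
      ht.1 (by rw [h2]; exact ht.2)
    refine hF.lams_eq_of_functionals hP hFi hPi e hθ (by simpa using hT) hind ?_ ?_
      (by rw [hξ₀]; simp) (by rw [hξ₁]; simp [h12]) (by rw [hξ₀]; simp [h12.symm])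
      (by rw [hξ₁]; simp) u
    · intro z hz
      obtain ⟨i, hi, rfl⟩ := Multiset.mem_map.1 hz
      rw [hξ₀, if_neg (hTi i hi).1]
    · intro z hz
      obtain ⟨i, hi, rfl⟩ := Multiset.mem_map.1 hz
      rw [hξ₁, if_neg (hTi i hi).2])
  have := congrFun hzero 0
  simpa [X, hx₁, hx₂, hxs] using this

/-- A sublinear equivariant family is determined by its function `theta`. -/
theorem SublinFam.eq_of_theta_eq (hF : SublinFam F) (hP : SublinFam P)
    (hFi : ∀ u, IsHomog (2 * finrank ℂ W - 1) fun K => F K u)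
    (hPi : ∀ u, IsHomog (2 * finrank ℂ W - 1) fun K => P K u)
    (e : Basis (Fin 3 ⊕ Fin k) ℂ W)
    (hθ : ∀ a b, theta (_root_.redFam e F) a b = theta (_root_.redFam e P) a b)
    (K : ConvexBody W) (u : W) : F K u = P K u := by
  have hφ : CTV fun K => F K u - P K u := (hF.ctv u).sub (hP.ctv u)
  have hhom : IsHomog (2 * finrank ℂ W - 1) fun K => F K u - P K u := fun K t ht => by
    have h1 := hFi u K t ht
    have h2 := hPi u K t ht
    beta_reduce at h1 h2 ⊢
    rw [h1, h2, mul_sub]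
  have hW := finrank_pos_of_basis e
  have hR := finrank_real_of_complex W
  refine sub_eq_zero.1 (hφ.eq_zero_of_lams hhom (k₀ := 2 * finrank ℂ W - 2) (fun s hs K => ?_)
    (by omega) K)
  rcases lt_or_ge (finrank ℝ (mspan s)) s.card with h1 | h1
  · exact hφ.lams_eq_zero_of_finrank_lt s h1 K
  obtain ⟨C, hC, p, hp⟩ := (mspan s).exists_retraction
  have hψ : CTV fun A : ConvexBody C => lams s (fun K => F K u - P K u) (A.mapCLM C.subtypeL) :=
    (hφ.lams s).map _
  have h1hom : IsHomog 1 (lams s fun K => F K u - P K u) := hφ.lams_homog (by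
    have : 1 + s.card = 2 * finrank ℂ W - 1 := by omega
    rw [this]
    exact hhom)
  have hψtri : ∀ a b c : C, lams s (fun K => F K u - P K u)
      ((ConvexBody.hull {a, b, c}).mapCLM C.subtypeL) = 0 := fun a b c => by
    rw [mapCLM_hull _ (by simp) (by simp), Set.image_insert_eq, Set.image_pair, hull_triple,
      (hφ.lams s).add_point]
    exact hF.lams_negTri_eq hP hFi hPi e hθ (by omega) _ _ u
  have hz := eq_zero_of_affineIndependent hψ.cont hψ.val (fun S hS hSi => by
    classical
    have hc := card_le_of_affineIndependent S hSi
    have hpos := hS.card_pos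
    have : S.card = 1 ∨ S.card = 2 ∨ S.card = 3 := by omega
    rcases this with h | h | h
    · obtain ⟨a, rfl⟩ := Finset.card_eq_one.1 h
      simpa using hψtri a a a
    · obtain ⟨a, b, -, rfl⟩ := Finset.card_eq_two.1 h
      simpa using hψtri a a b
    · obtain ⟨a, b, c, -, -, -, rfl⟩ := Finset.card_eq_three.1 h
      simpa using hψtri a b c) (K.mapCLM p)
  rw [← hz, mapCLM_mapCLM]
  exact hφ.lams_congr s (ModEq.mapCLM_self _ hp K)

end Determination

end

section

open ConvexBody

set_option linter.unusedSectionVars false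

section SupportFunctions

variable {V V' : Type*} [NormedAddCommGroup V] [NormedSpace ℝ V]
  [NormedAddCommGroup V'] [NormedSpace ℝ V']

theorem ConvexBody.hSupp_add (K L : ConvexBody V) (ℓ : V →L[ℝ] ℝ) :
    hSupp (K + L) ℓ = hSupp K ℓ + hSupp L ℓ := by
  obtain ⟨x, hx, h1⟩ := K.exists_hSupp_eq ℓ.continuous
  obtain ⟨y, hy, h2⟩ := L.exists_hSupp_eq ℓ.continuous
  apply le_antisymm
  · refine hSupp_le _ fun z hz => ?_
    rw [← mem_coe, coe_add] at hz
    obtain ⟨a, ha, b, hb, rfl⟩ := hz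
    rw [map_add]
    exact add_le_add (K.le_hSupp ℓ.continuous ha) (L.le_hSupp ℓ.continuous hb)
  · rw [h1, h2, ← map_add]
    refine le_hSupp _ ℓ.continuous ?_
    rw [← mem_coe, coe_add]
    exact Set.add_mem_add hx hy

theorem ConvexBody.hSupp_point (x : V) (p : V → ℝ) : hSupp (point x) p = p x := by
  simp [hSupp]

theorem ConvexBody.hSupp_mapCLM (f : V →L[ℝ] V') (K : ConvexBody V) (p : V' → ℝ) :
    hSupp (K.mapCLM f) p = hSupp K fun x => p (f x) := by
  rw [hSupp, coe_mapCLM, Set.image_image, hSupp]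

theorem ConvexBody.subset_of_hSupp_le {K L : ConvexBody V}
    (h : ∀ ℓ : V →L[ℝ] ℝ, hSupp K ℓ ≤ hSupp L ℓ) : (K : Set V) ⊆ L := by
  intro x hx
  by_contra hxL
  obtain ⟨ℓ, r, h1, h2⟩ := geometric_hahn_banach_closed_point L.convex L.isClosed hxL
  have h3 : hSupp L ℓ ≤ r := hSupp_le _ fun a ha => (h1 a ha).le
  have h4 := K.le_hSupp ℓ.continuous hx
  linarith [h ℓ]

theorem ConvexBody.ext_of_hSupp_eq {K L : ConvexBody V}
    (h : ∀ ℓ : V →L[ℝ] ℝ, hSupp K ℓ = hSupp L ℓ) : K = L :=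
  ConvexBody.ext ((subset_of_hSupp_le fun ℓ => (h ℓ).le).antisymm
    (subset_of_hSupp_le fun ℓ => (h ℓ).ge))

theorem ConvexBody.hSupp_le_add (K L : ConvexBody V) {p : V → ℝ} (hp : Continuous p) {r : ℝ}
    (hr : ∀ x y, p x - p y ≤ r * dist x y) (hr0 : 0 ≤ r) :
    hSupp K p ≤ hSupp L p + r * dist K L := by
  refine hSupp_le _ fun x hx => ?_
  obtain ⟨y, hy, h⟩ := K.exists_dist_le L hx
  have h1 := L.le_hSupp hp hy
  have h2 := mul_le_mul_of_nonneg_left h hr0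
  linarith [hr x y]

theorem exists_re_mul_eq (ℓ : ℂ →L[ℝ] ℝ) : ∃ a : ℂ, ∀ c, ℓ c = (c * a).re := by
  refine ⟨⟨ℓ 1, -ℓ Complex.I⟩, fun c => ?_⟩
  have h : c = c.re • (1 : ℂ) + c.im • Complex.I := by
    apply Complex.ext <;> simp
  rw [congrArg ℓ h, map_add, map_smul, map_smul]
  simp

theorem suppC_add_point (N : ConvexBody ℂ) (x a : ℂ) :
    suppC (N + point x) a = suppC N a + (x * a).re := by
  have h := hSupp_add N (point x) (Complex.reCLM.comp
    ((ContinuousLinearMap.mul ℝ ℂ).flip a))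
  rw [hSupp_point] at h
  exact h

theorem eq_add_point_of_suppC {N₁ N₂ : ConvexBody ℂ}
    (h : ∀ a b, suppC N₁ a + suppC N₁ b + suppC N₁ (-a - b) =
      suppC N₂ a + suppC N₂ b + suppC N₂ (-a - b)) : ∃ x, N₂ = N₁ + point x := by
  set g : ℂ → ℝ := fun a => suppC N₂ a - suppC N₁ a with hg
  have h3 : ∀ a b, g a + g b + g (-a - b) = 0 := fun a b => by
    simp only [hg]
    linarith [h a b]
  have h0 : g 0 = 0 := by simp [hg]
  have hneg : ∀ a, g (-a) = -g a := fun a => by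
    have := h3 a 0
    rw [h0, sub_zero] at this
    linarith
  have hadd : ∀ a b, g (a + b) = g a + g b := fun a b => by
    have := h3 a b
    rw [← neg_add', hneg] at this
    linarith
  have hpos : ∀ (t : ℝ) (a : ℂ), 0 < t → g (t * a) = t * g a := fun t a ht => by
    simp only [hg]
    rw [suppC_smul _ ht, suppC_smul _ ht, mul_sub]
  have hmul : ∀ (t : ℝ) (a : ℂ), g (t * a) = t * g a := fun t a => by
    rcases lt_trichotomy t 0 with ht | rfl | ht
    · have := hpos (-t) a (by linarith)
      rw [Complex.ofReal_neg, neg_mul, hneg] at this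
      linarith
    · simp [h0]
    · exact hpos t a ht
  have hlin : ∀ a : ℂ, g a = a.re * g 1 + a.im * g Complex.I := fun a => by
    conv_lhs => rw [← Complex.re_add_im a]
    rw [hadd, hmul, ← hmul a.re 1, mul_one]
  refine ⟨⟨g 1, -g Complex.I⟩, ext_of_hSupp_eq fun ℓ => ?_⟩
  obtain ⟨a, ha⟩ := exists_re_mul_eq ℓ
  have : (ℓ : ℂ → ℝ) = fun c => (c * a).re := funext ha
  rw [this]
  change suppC N₂ a = suppC (N₁ + _) a
  rw [suppC_add_point]
  have h1 : g a = suppC N₂ a - suppC N₁ a := rfl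
  rw [hlin] at h1
  simp only [Complex.mul_re]
  linarith

end SupportFunctions

section Dual

variable {W : Type*} [NormedAddCommGroup W] [NormedSpace ℂ W] [FiniteDimensional ℂ W]

/-- The real functional `ξ ↦ Re ξ(u)` on the complex dual. -/
def evalRe (u : W) : (W →L[ℂ] ℂ) →L[ℝ] ℝ :=
  Complex.reCLM.comp ((ContinuousLinearMap.apply ℂ ℂ u).restrictScalars ℝ)

@[simp] theorem evalRe_apply (u : W) (ξ : W →L[ℂ] ℂ) : evalRe u ξ = (ξ u).re := rfl

theorem exists_eq_evalRe (ℓ : (W →L[ℂ] ℂ) →L[ℝ] ℝ) : ∃ u : W, ℓ = evalRe u := by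
  let Λ : Module.Dual ℂ (W →L[ℂ] ℂ) :=
    Module.Dual.extendRCLike (𝕜 := ℂ) (ℓ : (W →L[ℂ] ℂ) →ₗ[ℝ] ℝ)
  let Λ' : Module.Dual ℂ (Module.Dual ℂ W) :=
    Λ ∘ₗ (LinearMap.toContinuousLinearMap : (W →ₗ[ℂ] ℂ) ≃ₗ[ℂ] (W →L[ℂ] ℂ)).toLinearMap
  obtain ⟨u, hu⟩ := (Module.evalEquiv ℂ W).surjective Λ'
  refine ⟨u, ContinuousLinearMap.ext fun ξ => ?_⟩
  have h1 : (ξ : W →ₗ[ℂ] ℂ) u = Λ' ξ := by rw [← hu]; rfl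
  have h2 : Λ' ξ = Λ ξ := congrArg Λ (ContinuousLinearMap.ext fun _ => rfl)
  have h3 : (Λ ξ).re = ℓ ξ := Module.Dual.re_extendRCLike_apply (𝕜 := ℂ) _ ξ
  rw [evalRe_apply, ← h3, ← h2, ← h1]
  rfl

/-- The support function of a convex body in the complex dual. -/
def suppD (A : ConvexBody (W →L[ℂ] ℂ)) (u : W) : ℝ := hSupp A fun ξ => (ξ u).re

theorem suppD_add (A B : ConvexBody (W →L[ℂ] ℂ)) (u : W) :
    suppD (A + B) u = suppD A u + suppD B u := hSupp_add A B (evalRe u)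

theorem suppD_mapCLM_precompDual (A : ConvexBody (W →L[ℂ] ℂ)) (g : W →L[ℂ] W) (u : W) :
    suppD (A.mapCLM (precompDual g)) u = suppD A (g u) := hSupp_mapCLM _ _ _

theorem suppD_zero (A : ConvexBody (W →L[ℂ] ℂ)) : suppD A 0 = 0 := by
  obtain ⟨ξ, -, h⟩ := A.exists_hSupp_eq (evalRe (0 : W)).continuous
  exact h.trans (by simp)

theorem suppD_add_le (A : ConvexBody (W →L[ℂ] ℂ)) (u v : W) :
    suppD A (u + v) ≤ suppD A u + suppD A v := by
  refine hSupp_le _ fun ξ hξ => ?_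
  rw [map_add, Complex.add_re]
  exact add_le_add (A.le_hSupp (evalRe u).continuous hξ) (A.le_hSupp (evalRe v).continuous hξ)

theorem suppD_smul (A : ConvexBody (W →L[ℂ] ℂ)) {t : ℝ} (ht : 0 < t) (u : W) :
    suppD A (t • u) = t * suppD A u := by
  have h : ∀ {t : ℝ}, 0 < t → ∀ u : W, suppD A (t • u) ≤ t * suppD A u := fun ht u => by
    refine hSupp_le _ fun ξ hξ => ?_
    rw [map_real_smul ξ ξ.continuous, Complex.smul_re]
    exact mul_le_mul_of_nonneg_left (A.le_hSupp (evalRe u).continuous hξ) ht.le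
  refine (h ht u).antisymm ?_
  have h1 := mul_le_mul_of_nonneg_left (h (inv_pos.2 ht) (t • u)) ht.le
  rwa [inv_smul_smul₀ ht.ne', mul_inv_cancel_left₀ ht.ne'] at h1

theorem continuous_suppD (u : W) : Continuous fun A => suppD A u := by
  refine (LipschitzWith.of_le_add_mul ‖evalRe u‖₊ fun A B => ?_).continuous
  refine hSupp_le_add A B (evalRe u).continuous (fun x y => ?_) (norm_nonneg _)
  rw [← map_sub, dist_eq_norm]
  exact (le_abs_self _).trans ((evalRe u).le_opNorm _)

theorem subset_of_suppD_le {A B : ConvexBody (W →L[ℂ] ℂ)} (h : ∀ u, suppD A u ≤ suppD B u) :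
    (A : Set (W →L[ℂ] ℂ)) ⊆ B :=
  subset_of_hSupp_le fun ℓ => by
    obtain ⟨u, rfl⟩ := exists_eq_evalRe ℓ
    exact h u

theorem ext_of_suppD {A B : ConvexBody (W →L[ℂ] ℂ)} (h : ∀ u, suppD A u = suppD B u) : A = B :=
  ConvexBody.ext ((subset_of_suppD_le fun u => (h u).le).antisymm
    (subset_of_suppD_le fun u => (h u).ge))

theorem exists_dist_le_of_suppD_le {A B : ConvexBody (W →L[ℂ] ℂ)} {ε : ℝ} (hε : 0 ≤ ε)
    (h : ∀ u, suppD A u ≤ suppD B u + ε * ‖u‖) {ξ : W →L[ℂ] ℂ} (hξ : ξ ∈ A) :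
    ∃ η ∈ B, dist ξ η ≤ ε := by
  have : ProperSpace (W →L[ℂ] ℂ) := FiniteDimensional.proper ℂ _
  let D : ConvexBody (W →L[ℂ] ℂ) := ⟨Metric.closedBall 0 ε, convex_closedBall _ _,
    isCompact_closedBall _ _, Metric.nonempty_closedBall.2 hε⟩
  have hD : ∀ u, ε * ‖u‖ ≤ suppD D u := fun u => by
    obtain ⟨g, hg, hu⟩ := exists_dual_vector'' ℂ u
    have h1 : ε • g ∈ D := by
      change ε • g ∈ Metric.closedBall 0 ε
      rw [mem_closedBall_zero_iff, norm_smul, Real.norm_of_nonneg hε]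
      exact mul_le_of_le_one_right hε hg
    have h2 := D.le_hSupp (evalRe u).continuous h1
    have h3 : evalRe u (ε • g) = ε * ‖u‖ := by
      rw [map_smul, evalRe_apply, hu]
      simp
    rw [h3] at h2
    exact h2
  have hs := subset_of_suppD_le (A := A) (B := B + D) (fun u => by
    rw [suppD_add]
    linarith [h u, hD u]) hξ
  rw [coe_add] at hs
  obtain ⟨η, hη, ζ, hζ, rfl⟩ := hs
  refine ⟨η, hη, ?_⟩
  rw [dist_eq_norm]
  simpa using mem_closedBall_zero_iff.1 hζ

theorem dist_le_of_suppD {A B : ConvexBody (W →L[ℂ] ℂ)} {ε : ℝ} (hε : 0 ≤ ε)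
    (h : ∀ u, ‖u‖ = 1 → |suppD A u - suppD B u| ≤ ε) : dist A B ≤ ε := by
  have h1 : ∀ u, |suppD A u - suppD B u| ≤ ε * ‖u‖ := fun u => by
    rcases eq_or_ne u 0 with rfl | hu
    · simp [suppD_zero]
    · have hn := norm_pos_iff.2 hu
      have h2 := h (‖u‖⁻¹ • u) (by rw [norm_smul, norm_inv, norm_norm, inv_mul_cancel₀ hn.ne'])
      rw [suppD_smul _ (inv_pos.2 hn), suppD_smul _ (inv_pos.2 hn), ← mul_sub, abs_mul,
        abs_of_pos (inv_pos.2 hn), inv_mul_le_iff₀ hn] at h2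
      linarith
  refine dist_le hε (fun x hx => exists_dist_le_of_suppD_le hε (fun u => ?_) hx)
    fun x hx => exists_dist_le_of_suppD_le hε (fun u => ?_) hx
  · linarith [(abs_le.1 (h1 u)).2]
  · linarith [(abs_le.1 (h1 u)).1]

theorem continuous_of_suppD {X : Type*} [TopologicalSpace X] {Z : X → ConvexBody (W →L[ℂ] ℂ)}
    (h : Continuous fun p : X × W => suppD (Z p.1) p.2) : Continuous Z := by
  have : ProperSpace W := FiniteDimensional.proper ℂ _
  rw [Metric.continuous_iff']
  intro a ε hε
  obtain ⟨v, hv, hv'⟩ := (isCompact_sphere (0 : W) 1).mem_uniformity_of_prod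
    (f := fun K u => suppD (Z K) u) (s := Set.univ) (q := a) h.continuousOn (Set.mem_univ _)
    (Metric.dist_mem_uniformity (half_pos hε))
  rw [nhdsWithin_univ] at hv
  filter_upwards [hv] with K hK
  refine (dist_le_of_suppD (half_pos hε).le fun u hu => ?_).trans_lt (half_lt_self hε)
  exact (hv' K hK u (mem_sphere_zero_iff_norm.2 hu)).le

theorem sublinFam_suppD {Z : ConvexBody W → ConvexBody (W →L[ℂ] ℂ)} (hc : Continuous Z)
    (ht : IsTranslationInvariant Z) (hv : IsMinkowskiValuation Z) (hs : IsSLContravariant Z) :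
    SublinFam fun K u => suppD (Z K) u where
  ctv u :=
    { cont := (continuous_suppD u).comp hc
      val := fun K L hU hI => by
        beta_reduce
        rw [← suppD_add, ← suppD_add, hv]
      ti := fun K x => by
        beta_reduce
        rw [ht] }
  pos _ ht _ u := suppD_smul _ ht u
  equiv g hg K u := by
    let g' : W ≃L[ℂ] W :=
      (g.equivOfDetNeZero (by rw [hg]; exact one_ne_zero)).toContinuousLinearEquiv
    have h1 : ∀ x, g' x = g x := fun _ => rfl
    have h2 : ((g' : W →L[ℂ] W) : W →ₗ[ℂ] W) = g := LinearMap.ext h1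
    have h3 := hs g' (by rw [h2, hg]) K
    have h4 : (g' : W →ₗ[ℂ] W) = g := LinearMap.ext h1
    rw [h4] at h3
    rw [h3, suppD_mapCLM_precompDual, ← h1]
    simp
  sub _ u v := suppD_add_le _ u v

theorem SublinFam.properties {Z : ConvexBody W → ConvexBody (W →L[ℂ] ℂ)}
    (h : SublinFam fun K u => suppD (Z K) u)
    (hc : Continuous fun p : ConvexBody W × W => suppD (Z p.1) p.2) :
    Continuous Z ∧ IsTranslationInvariant Z ∧ IsMinkowskiValuation Z ∧ IsSLContravariant Z := by
  refine ⟨continuous_of_suppD hc, fun K x => ext_of_suppD fun u => (h.ctv u).ti K x,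
    fun K L hU hI => ext_of_suppD fun u => ?_, fun g hg K => ext_of_suppD fun u => ?_⟩
  · rw [suppD_add, suppD_add]
    exact (h.ctv u).val K L hU hI
  · rw [suppD_mapCLM_precompDual]
    have h1 := h.equiv (g : W →ₗ[ℂ] W) hg K (g.symm u)
    have h2 : (g : W →ₗ[ℂ] W) (g.symm u) = u := g.apply_symm_apply u
    rw [h2] at h1
    exact h1

end Dual

section Classification

variable {W : Type*} [NormedAddCommGroup W] [NormedSpace ℂ W] [FiniteDimensional ℂ W]
  [MeasurableSpace W] [BorelSpace W] (μ : Measure W) [μ.IsAddHaarMeasure]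

theorem exists_basis_three (h3 : 3 ≤ finrank ℂ W) :
    Nonempty (Basis (Fin 3 ⊕ Fin (finrank ℂ W - 3)) ℂ W) :=
  ⟨(finBasis ℂ W).reindex ((finCongr (by omega)).trans finSumFinEquiv.symm)⟩

theorem SublinFam.exists_piFam {F : ConvexBody W → W → ℝ} (hF : SublinFam F)
    (h3 : 3 ≤ finrank ℂ W) : ∃ N, ∀ K u, F K u = piFam μ N K u := by
  obtain ⟨e⟩ := exists_basis_three h3
  have hi := hF.homog h3
  obtain ⟨G, hG, hGa, hθ⟩ := ((hF.redFam e).thetaData (redFam_homog e hF.ctv hi)).exists_generator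
  have hC := thetaConst_pos e μ
  obtain ⟨N, hN⟩ := exists_body_of_sublinear (G := fun a => (thetaConst e μ)⁻¹ * G a)
    (fun t ht a => by rw [hG t ht]; ring)
    (fun a b => by
      rw [← mul_add]
      exact mul_le_mul_of_nonneg_left (hGa a b) (inv_nonneg.2 hC.le))
  have hN' : ∀ a, G a = thetaConst e μ * suppC N a := fun a => by
    rw [suppC, ← hN, mul_inv_cancel_left₀ hC.ne']
  refine ⟨N, fun K u => hF.eq_of_theta_eq (piFam_sublinFam μ (finrank_pos_of_basis e) N) hi
    (piFam_homog μ N) e (fun a b => ?_) K u⟩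
  rw [hθ, theta_piFam, hN', hN', hN']
  ring

theorem eq_translate_of_piFam_eq (h3 : 3 ≤ finrank ℂ W) {N₁ N₂ : ConvexBody ℂ}
    (h : ∀ K u, piFam μ N₁ K u = piFam μ N₂ K u) : ∃ x, N₂ = N₁.translate x := by
  obtain ⟨e⟩ := exists_basis_three h3
  have hf : piFam μ N₁ = piFam μ N₂ := funext fun K => funext (h K)
  simp only [translate_eq_add]
  refine eq_add_point_of_suppC fun a b => ?_
  have h1 := theta_piFam e μ N₁ a b
  rw [hf, theta_piFam] at h1
  exact (mul_left_cancel₀ (thetaConst_pos e μ).ne' h1).symm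

end Classification

end

/-- Theorem 1 of the paper; Abardia–Bernig. Let `W` be a complex vector
space of complex dimension `m ≥ 3` (with a fixed Lebesgue measure `μ`). A map
`Z : 𝒦(W) → 𝒦(W*)` is a continuous, translation invariant and `SL(W,ℂ)`-contravariant
Minkowski valuation if and only if there is a convex body `N ⊆ ℂ` such that `Z = Π_N`,
i.e. `h(Z K, u) = V(K, …, K, N·u)` (with `2m - 1` copies of `K`) for all `K ∈ 𝒦(W)`,
`u ∈ W`.  Moreover, `N` is unique up to translations. -/
theorem contravariant_classification_dim_ge_three
    {W : Type*} [NormedAddCommGroup W] [NormedSpace ℂ W] [FiniteDimensional ℂ W]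
    (m : ℕ) (hm : 3 ≤ m) (hW : Module.finrank ℂ W = m)
    [MeasurableSpace W] [BorelSpace W] (μ : Measure W) [μ.IsAddHaarMeasure]
    (Z : ConvexBody W → ConvexBody (W →L[ℂ] ℂ)) :
    ((Continuous Z ∧ IsTranslationInvariant Z ∧ IsMinkowskiValuation Z ∧
        IsSLContravariant Z) ↔
      (∃ N : ConvexBody ℂ, ∀ (K : ConvexBody W) (u : W),
        hSupp (Z K) (fun ξ => (ξ u).re) =
          mixedVol μ (fun i : Fin (2 * m) =>
            if (i : ℕ) < 2 * m - 1 then K else dotBody N u))) ∧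
    (∀ N₁ N₂ : ConvexBody ℂ,
      (∀ (K : ConvexBody W) (u : W),
        hSupp (Z K) (fun ξ => (ξ u).re) =
          mixedVol μ (fun i : Fin (2 * m) =>
            if (i : ℕ) < 2 * m - 1 then K else dotBody N₁ u)) →
      (∀ (K : ConvexBody W) (u : W),
        hSupp (Z K) (fun ξ => (ξ u).re) =
          mixedVol μ (fun i : Fin (2 * m) =>
            if (i : ℕ) < 2 * m - 1 then K else dotBody N₂ u)) →
      ∃ x : ℂ, N₂ = N₁.translate x) := by
  subst hW
  have hpos : 0 < finrank ℂ W := by omega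
  simp only [mixedVol_eq_piFam μ hpos]
  refine ⟨⟨fun ⟨hc, ht, hv, hs⟩ => ?_, fun ⟨N, hN⟩ => ?_⟩, fun N₁ N₂ h₁ h₂ => ?_⟩
  · exact (sublinFam_suppD hc ht hv hs).exists_piFam μ hm
  · have hN' : (fun K u => suppD (Z K) u) = piFam μ N := funext fun K => funext (hN K)
    refine SublinFam.properties (by rw [hN']; exact piFam_sublinFam μ hpos N) ?_
    have : (fun p : ConvexBody W × W => suppD (Z p.1) p.2) = fun p => piFam μ N p.1 p.2 :=
      funext fun p => hN p.1 p.2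
    rw [this]
    exact continuous_piFam μ N
  · exact eq_translate_of_piFam_eq μ hm fun K u => (h₁ K u).symm.trans (h₂ K u)
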